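/- Let D_k^full(x) = #{ d_k^full(N) : N ∈ ℕ, d_k^full(N) ≤ ((k−1)/12)·x }. There exists an absolute constant A > 0 such that for every even integer k ≥ 2 and every real x ≥ 16, (x/log x)·exp( C·log²( (log log x)/(log log log x) ) − A·log log log x ) ≤ D_k^full(x) ≤ (x/log x)·exp( C·log²( (log log x)/(log log log x) ) + A·log log log x ). -/

import Mathlib

noncomputable section

/-- Value at `N` of the multiplicative function determined by local values `f p e`
on prime powers `p^e` (`e ≥ 1`). -/
def mval (f : ℕ → ℕ → ℝ) (N : ℕ) : ℝ := ∏ p ∈ N.primeFactors, f p (N.factorization p)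

def psiFull : ℕ → ℝ := mval fun p e => (p:ℝ)^e + (p:ℝ)^(e-1)

def nuInfFull : ℕ → ℝ := mval fun p e =>
  if Odd e then 2*(p:ℝ)^((e-1)/2) else (p:ℝ)^(e/2) + (p:ℝ)^(e/2-1)

def nu2Full : ℕ → ℝ := mval fun p e =>
  if p^e = 2 then 1 else if p % 4 = 1 then 2 else 0

def nu3Full : ℕ → ℝ := mval fun p e =>
  if p^e = 3 then 1 else if p % 3 = 1 then 2 else 0

def psiNew : ℕ → ℝ := mval fun p e =>
  if e = 1 then (p:ℝ)-1
  else if e = 2 then (p:ℝ)^2-(p:ℝ)-1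
  else (p:ℝ)^(e-3)*((p:ℝ)-1)^2*((p:ℝ)+1)

def nuInfNew : ℕ → ℝ := mval fun p e =>
  if e = 2 then (p:ℝ)-2
  else if Even e ∧ 2 < e then (p:ℝ)^(e/2-2)*((p:ℝ)-1)^2
  else 0

def nu2New : ℕ → ℝ := mval fun p e =>
  if p % 4 = 3 ∧ e = 1 then -2
  else if (p % 4 = 3 ∧ e = 2) ∨ p^e = 8 then 1
  else if (p % 4 = 1 ∧ e = 2) ∨ p^e = 2 ∨ p^e = 4 then -1
  else 0

def nu3New : ℕ → ℝ := mval fun p e =>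
  if p % 3 = 2 ∧ e = 1 then -2
  else if (p % 3 = 2 ∧ e = 2) ∨ p^e = 27 then 1
  else if (p % 3 = 1 ∧ e = 2) ∨ p^e = 3 ∨ p^e = 9 then -1
  else 0

def psiMin : ℕ → ℝ := mval fun p e =>
  ((p:ℝ)-1)/((Nat.gcd (Nat.gcd 2 (p-1)) e : ℕ) : ℝ)
    * (if e = 1 then 1 else if e = 2 then (p:ℝ)-1 else (p:ℝ)^(e-3)*((p:ℝ)^2-1))

def nuInfMin : ℕ → ℝ := mval fun p e =>
  if p = 2 ∧ Even e ∧ 2 < e then (2:ℝ)^(e/2-2) else 0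

def nu2Min : ℕ → ℝ := mval fun p e =>
  if p % 4 = 3 then -2*((ArithmeticFunction.moebius (p^(e-1)) : ℤ) : ℝ)
  else if p^e = 2 ∨ p^e = 4 then -1
  else if p^e = 8 then 1
  else 0

def nu3Min : ℕ → ℝ := mval fun p e =>
  if p % 3 = 2 ∧ p^e ≠ 4 then -2*((ArithmeticFunction.moebius (p^(e-1)) : ℤ) : ℝ)
  else if p^e = 3 ∨ p^e = 9 then -1
  else if p^e = 4 ∨ p^e = 27 then 1
  else 0

/-- The Kronecker symbol `(−4|n)`, i.e. the nontrivial character mod 4. -/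
def chi4 (n : ℕ) : ℝ := if n % 4 = 1 then 1 else if n % 4 = 3 then -1 else 0

/-- The Kronecker symbol `(−3|n)`, i.e. the nontrivial character mod 3. -/
def chi3 (n : ℕ) : ℝ := if n % 3 = 1 then 1 else if n % 3 = 2 then -1 else 0

def c2 (k : ℕ) : ℝ := -(1/4) * chi4 (k-1)

def c3 (k : ℕ) : ℝ := -(1/3) * chi3 (k-1)

def delta2 (k : ℕ) : ℝ := if k = 2 then 1 else 0

def dFull (k N : ℕ) : ℝ :=
  ((k:ℝ)-1)/12 * psiFull N - 1/2 * nuInfFull N + c2 k * nu2Full N + c3 k * nu3Full N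
    + delta2 k

def dNew (k N : ℕ) : ℝ :=
  ((k:ℝ)-1)/12 * psiNew N - 1/2 * nuInfNew N + c2 k * nu2New N + c3 k * nu3New N
    + delta2 k * ((ArithmeticFunction.moebius N : ℤ) : ℝ)

def dMin (k N : ℕ) : ℝ :=
  ((k:ℝ)-1)/12 * psiMin N - 1/2 * nuInfMin N + c2 k * nu2Min N + c3 k * nu3Min N
    + delta2 k * ((ArithmeticFunction.moebius N : ℤ) : ℝ)

/-- `ω(N)`: the number of distinct prime divisors of `N`. -/
def omega (N : ℕ) : ℕ := N.primeFactors.card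

/-- A positive integer is squarefull if `p² ∣ N` for every prime `p ∣ N`. -/
def Squarefull (n : ℕ) : Prop := ∀ p : ℕ, p.Prime → p ∣ n → p^2 ∣ n

/-- `H(N)`: the largest squarefull divisor of `N`. -/
def squarefullPart (N : ℕ) : ℕ := sSup {d : ℕ | d ∣ N ∧ Squarefull d}

/-- `η = ζ(3/2)/ζ(3)`. -/
def eta : ℝ := (riemannZeta (3/2) / riemannZeta 3).re

/-- Ford's coefficients `a_n = (n+1)log(n+1) − n log n − 1`. -/
def fordA (n : ℕ) : ℝ := ((n:ℝ)+1)*Real.log ((n:ℝ)+1) - (n:ℝ)*Real.log n - 1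


def loglog (x : ℝ) : ℝ := Real.log (Real.log x)

def logloglog (x : ℝ) : ℝ := Real.log (Real.log (Real.log x))

def loglogloglog (x : ℝ) : ℝ := Real.log (Real.log (Real.log (Real.log x)))

end

namespace FT
open Finset Real
set_option linter.all false
notation:max "§" x:max => (x : ℝ)
notation:max "¢" x:max => ((Finset.card x : ℕ) : ℝ)
notation:max x:max "°" => x+1
theorem li {p : Prop} (h : p := by linarith) : p := h
theorem po {p : Prop} (h : p := by positivity) : p := h
theorem nu {p : Prop} (h : p := by norm_num) : p := h
theorem om {p : Prop} (h : p := by omega) : p := h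
theorem si {p : Prop} (h : p := by simp) : p := h
theorem exq {α : Sort*} (a : α) : ∃ x, x = a := ⟨a, rfl⟩
abbrev PR (N : ℕ) : Finset ℕ := (range N°).filter Nat.Prime
lemma log_fact (N : ℕ) : log (N.factorial : ℝ) = ∑ p ∈ PR N, (N.factorial.factorization p : ℝ) * log p := by
  rw [log_nat_eq_sum_factorization, Finsupp.sum]
  apply sum_subset
  · intro p hp
    have h := Nat.prime_of_mem_primeFactors hp
    simp only [mem_filter, mem_range]
    exact ⟨Nat.lt_succ_of_le ((h.dvd_factorial).1 (Nat.dvd_of_mem_primeFactors hp)), h⟩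
  · intro p _ hp
    simp [Finsupp.notMem_support_iff.1 hp]
noncomputable def AA (N : ℕ) : ℝ := ∑ p ∈ PR N, log p / p
noncomputable def RR (N : ℕ) : ℝ := ∑ p ∈ PR N, 1 / §p
lemma fact_ge {N p : ℕ} (hp : p.Prime) (hN : p ≤ N) : §N/p - 1 ≤ N.factorial.factorization p := by
  have h1 : N / p ≤ N.factorial.factorization p := by
    rw [Nat.factorization_factorial hp (Nat.lt_succ_self _)]
    have hm : 1 ∈ Ico 1 (Nat.log p N).succ := by
      simp only [mem_Ico, le_refl, true_and]
      exact Nat.succ_lt_succ (Nat.log_pos hp.one_lt hN)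
    calc N / p = N / p^1 := si
      _ ≤ _ := single_le_sum (f := fun i => N / p^i) (fun _ _ => Nat.zero_le _) hm
  have h2 : §N/p < (N/p : ℕ) + 1 := by
    rw [div_lt_iff₀ (mod_cast hp.pos)]
    exact_mod_cast by rw [mul_comm]; exact Nat.lt_mul_div_succ N hp.pos
  have h3 : ((N/p:ℕ):ℝ) ≤ (N.factorial.factorization p : ℝ) := mod_cast h1
  linarith
lemma AA_le {N : ℕ} (hN : 1 ≤ N) : AA N ≤ log N + log 4 := by
  have hN0 : §0 < N := mod_cast hN
  have h1 : §N * AA N - ∑ p ∈ PR N, log §p ≤ log (N.factorial : ℝ) := by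
    rw [log_fact, AA, mul_sum, ← sum_sub_distrib]
    refine sum_le_sum fun p hp => ?_
    simp only [mem_filter, mem_range] at hp
    have := fact_ge hp.2 (Nat.lt_succ_iff.1 hp.1)
    have hl : 0 ≤ log §p := log_natCast_nonneg p
    calc §N * (log p / p) - log p = (§N/p - 1) * log p := by ring
      _ ≤ _ := by gcongr
  have h2 : log (N.factorial : ℝ) ≤ N * log N := by
    rw [← log_pow]
    exact log_le_log (mod_cast N.factorial_pos) (mod_cast Nat.factorial_le_pow N)
  have h3 : ∑ p ∈ PR N, log §p ≤ log 4 * N := by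
    have := Chebyshev.theta_le_log4_mul_x (x := §N) hN0.le
    rw [Chebyshev.theta_eq_sum_Icc] at this
    refine le_trans (le_of_eq ?_) this
    rw [Nat.floor_natCast]
    apply sum_congr _ fun _ _ => rfl
    ext p; simp
  have : §N * AA N ≤ N * (log N + log 4) := li
  exact le_of_mul_le_mul_left this hN0
lemma log_le_two_sqrt {n : ℝ} (hn : 0 < n) : log n ≤ 2 * n^(1/2:ℝ) := by
  have := log_le_rpow_div hn.le (show §0 < 1/2 by norm_num)
  linarith [this]
lemma AA_ge : ∃ C : ℝ, 0 < C ∧ ∀ N : ℕ, 1 ≤ N → log N - C ≤ AA N := by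
  have hs : Summable (fun n : ℕ => 4 * (1/§n^(3/2:ℝ))) :=
    (Real.summable_one_div_nat_rpow.2 nu).mul_left 4
  have h0 : ∀ n : ℕ, 0 ≤ 4 * (1/§n^(3/2:ℝ)) := fun n => po
  refine ⟨1 + ∑' n : ℕ, 4 * (1/§n^(3/2:ℝ)), add_pos_of_pos_of_nonneg one_pos (tsum_nonneg h0), fun N hN => ?_⟩
  have hN0 : §0 < N := mod_cast hN
  have h1 : log (N.factorial : ℝ) ≤ N * AA N + N * ∑ p ∈ PR N, 4 * (1/§p^(3/2:ℝ)) := by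
    rw [log_fact, AA, mul_sum, mul_sum, ← sum_add_distrib]
    refine sum_le_sum fun p hp => ?_
    simp only [mem_filter, mem_range] at hp
    have hp2 : §2 ≤ p := mod_cast hp.2.two_le
    have hv : (N.factorial.factorization p : ℝ) ≤ N / (p - 1) := by
      have := Nat.factorization_factorial_le_div_pred hp.2 N
      rw [← Nat.cast_pred hp.2.pos]
      exact le_trans (mod_cast this) Nat.cast_div_le
    have hl : 0 ≤ log §p := log_natCast_nonneg p
    have h4 : log §p / (p * (p-1)) ≤ 4 * (1/§p^(3/2:ℝ)) := by
      have e : §p^(3/2:ℝ) * §p^(1/2:ℝ) = p^2 := by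
        rw [← rpow_add li]; norm_num
      have e1 := log_le_two_sqrt (show §0 < p by linarith)
      have p3 : 0 < §p^(3/2:ℝ) := po
      rw [mul_one_div, div_le_div_iff₀ (by nlinarith only [hp2]) p3]
      calc log p * §p^(3/2:ℝ) ≤ 2 * §p^(1/2:ℝ) * §p^(3/2:ℝ) := by gcongr
        _ = 2 * p^2 := by rw [← e]; ring
        _ ≤ 4 * (p * (p-1)) := by nlinarith only [hp2]
    calc _ ≤ §N/(p-1) * log p := by gcongr
      _ = N * (log p / p) + N * (log §p / (p * (p-1))) := by
        have : §p - 1 ≠ 0 := li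
        have : §p ≠ 0 := li
        field_simp; ring
      _ ≤ _ := by gcongr
  have h2 : ∑ p ∈ PR N, 4 * (1/§p^(3/2:ℝ)) ≤ ∑' n : ℕ, 4 * (1/§n^(3/2:ℝ)) :=
    hs.sum_le_tsum _ fun i _ => h0 i
  have h3 := Stirling.le_log_factorial_stirling (n := N) om
  have h4 : 0 ≤ log §N := log_natCast_nonneg N
  have h5 : 0 ≤ log (2*π) := log_nonneg (by linarith [pi_gt_three])
  have : §N * (log N - (1 + ∑' n : ℕ, 4 * (1/§n^(3/2:ℝ)))) ≤ N * AA N := by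
    have := mul_le_mul_of_nonneg_left h2 hN0.le
    nlinarith only [h1, h3, h4, h5, this]
  exact le_of_mul_le_mul_left this hN0
lemma PR_succ (f : ℕ → ℝ) (N : ℕ) : ∑ p ∈ PR N°, f p = ∑ p ∈ PR N, f p + if N°.Prime then f N° else 0 := by
  simp only [PR]; rw [range_add_one (n := N+1), filter_insert]
  split_ifs with h
  · rw [sum_insert si, add_comm]
  · simp
lemma FF_succ {N : ℕ} (hN : 2 ≤ N) : RR N° - AA N° / log §N° =
    RR N - AA N / log N + AA N * (1/log N - 1/log §N°) := by
  have h : 0 < log §N° := log_pos (by have : §2 ≤ N := mod_cast hN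
                                      linarith)
  rw [RR, AA, PR_succ, PR_succ]
  change RR N + _ - (AA N + _) / _ = _
  split_ifs
  · push_cast; field_simp; ring
  · ring
theorem mertens_abs : ∃ C : ℝ, 0 < C ∧ ∀ N : ℕ, 2 ≤ N → |RR N - log (log N)| ≤ C := by
  obtain ⟨c, hc, hA⟩ := AA_ge
  have hu : ∀ N : ℕ, 2 ≤ N → 0 < log §N := fun N h => log_pos (mod_cast h)
  have hl2 : (1/2:ℝ) < log 2 := by linarith [log_two_gt_d9]
  have l4 : 0 < log §4 := log_pos nu
  have key : ∀ N : ℕ, 2 ≤ N → RR N - AA N / log N ≤ log (log N) - log 4 / log N +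
        (|RR 2 - AA 2 / log 2| + |log (log 2)| + log 4 / log 2) ∧
      log (log N) + c / log N + 4/(§N-1) - (|RR 2 - AA 2 / log 2| + |log (log 2)| + c / log 2 + 4) ≤ RR N - AA N / log N := by
    intro N hN
    induction N, hN using Nat.le_induction with
    | base =>
      push_cast
      have a1 := le_abs_self (RR 2 - AA 2 / log 2)
      have a2 := neg_abs_le (RR 2 - AA 2 / log 2)
      have b1 := le_abs_self (log (log 2))
      have b2 := neg_abs_le (log (log 2))
      constructor <;> norm_num <;> linarith
    | succ N hN ih =>
      rw [Nat.cast_add_one, FF_succ hN]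
      have hN2 : §2 ≤ N := mod_cast hN
      have u0 := hu N hN
      have u1 : log §N < log §N° := log_lt_log li li
      have hu2 : log 2 ≤ log §N := log_le_log nu hN2
      set u := log §N
      set v := log §N°
      have hv : 0 < v := u0.trans u1
      have d0 : 0 ≤ 1/u - 1/v := by
        rw [sub_nonneg]; exact one_div_le_one_div_of_le u0 u1.le
      have hlog : log (v/u) = log v - log u := log_div hv.ne' u0.ne'
      constructor
      · have h1 : AA N * (1/u - 1/v) ≤ (u + log 4) * (1/u - 1/v) :=
          mul_le_mul_of_nonneg_right (AA_le om) d0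
        have h2 : (u + log 4) * (1/u - 1/v) = (1 - (v/u)⁻¹) + (log 4 / u - log 4 / v) := by field_simp
        have h3 : 1 - (v/u)⁻¹ ≤ log (v/u) := one_sub_inv_le_log_of_pos po
        linarith [ih.1]
      · have h1 : (u - c) * (1/u - 1/v) ≤ AA N * (1/u - 1/v) :=
          mul_le_mul_of_nonneg_right (hA N om) d0
        have h2 : (u - c) * (1/u - 1/v) = (1 - (v/u)⁻¹) - (c / u - c / v) := by field_simp
        set t := v/u - 1 with ht
        have t0 : 0 ≤ t := by rw [ht, sub_nonneg, one_le_div u0]; exact u1.le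
        have t1 : t ≤ 2/N := by
          have : v - u ≤ 1/N := by
            have e : v - u = log (1 + 1/§N) := by
              rw [← log_div li li]; congr 1; field_simp
            rw [e]
            have := log_le_sub_one_of_pos (show 0 < 1 + 1/§N by positivity)
            linarith
          have e : t = (v-u)/u := by rw [ht]; field_simp
          rw [e, div_le_div_iff₀ u0 li]
          have : (v-u) * N ≤ 1 := by rwa [le_div_iff₀ li] at this
          linarith
        have h3 : log (v/u) ≤ t := by have := log_le_sub_one_of_pos (show 0 < v/u by positivity); linarith
        have h4 : t - t^2 ≤ 1 - (v/u)⁻¹ := by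
          have : v/u = 1 + t := by rw [ht]; ring
          rw [this]
          have : 1 - (1+t)⁻¹ - (t - t^2) = t^3/(1+t) := by field_simp; ring
          have : 0 ≤ t^3/(1+t) := po
          linarith
        have h5 : t^2 ≤ 4/(§N-1) - 4/(§N+1-1) := by
          calc t^2 ≤ (2/N)^2 := by gcongr
            _ ≤ _ := by
              have n1 : 0 < §N - 1 := li
              have : 4/(§N-1) - 4/(§N+1-1) = 4/((§N-1)*N) := by
                rw [add_sub_cancel_right]; field_simp; ring
              rw [this, div_pow]
              norm_num
              gcongr; nlinarith only [hN2]
        linarith [ih.2]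
  refine ⟨|RR 2 - AA 2 / log 2| + |log (log 2)| + log 4 / log 2 + c / log 2 + 5 + log 4/log 2 + c/log 2, po, fun N hN => ?_⟩
  obtain ⟨k1, k2⟩ := key N hN
  have u0 := hu N hN
  have hN2 : §2 ≤ N := mod_cast hN
  have hu2 : log 2 ≤ log §N := log_le_log nu hN2
  have e1 : AA N / log N ≤ 1 + log 4/log N := by
    rw [div_le_iff₀ u0, add_mul, div_mul_cancel₀ _ u0.ne']; linarith [AA_le (N := N) om]
  have e2 : 1 - c/log N ≤ AA N / log N := by
    rw [le_div_iff₀ u0, sub_mul, div_mul_cancel₀ _ u0.ne']; linarith [hA N om]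
  have e3 : c/log N ≤ c/log 2 := by gcongr
  have e4 : log 4/log N ≤ log 4/log 2 := by gcongr
  have e5 : 0 ≤ 4/(§N-1) := div_nonneg nu li
  have e6 : 0 ≤ c/log N := po
  have e7 : 0 ≤ c/log 2 := po
  have e8 : 0 ≤ log 4/log 2 := po
  have e9 : 0 ≤ log 4/log N := po
  rw [abs_le]; constructor <;> linarith
noncomputable abbrev LL (p : ℕ) : ℝ := log (log p)
noncomputable abbrev ee (a : ℝ) : ℝ := exp (exp a)
lemma LL_le_iff {p : ℕ} (hp : 2 ≤ p) (b : ℝ) : LL p ≤ b ↔ §p ≤ ee b := by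
  have h : 0 < log §p := log_pos (mod_cast hp)
  rw [log_le_iff_le_exp h, log_le_iff_le_exp po]
lemma LL_mono {p q : ℕ} (hp : 2 ≤ p) (h : p ≤ q) : LL p ≤ LL q :=
  log_le_log (log_pos (mod_cast hp)) (log_le_log po (mod_cast h))
lemma LL_floor {a : ℝ} (h : 2 ≤ ⌊ee a⌋₊) : LL ⌊ee a⌋₊ ≤ a ∧ a - 1 ≤ LL ⌊ee a⌋₊ := by
  refine ⟨(LL_le_iff h a).2 (Nat.floor_le po), ?_⟩
  have h1 := Nat.lt_floor_add_one (ee a)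
  set M := ⌊ee a⌋₊
  have h2 : §2 ≤ M := mod_cast h
  have h3 : exp a < 2 * log M := by
    have : ee a < §M^2 := by nlinarith
    have := log_lt_log po this
    rwa [log_exp, log_pow] at this
  have h4 := log_lt_log po h3
  rw [log_exp, log_mul nu (log_pos li).ne'] at h4
  have : log 2 < 1 := by linarith [log_two_lt_d9]
  linarith
lemma RR_nonneg (N : ℕ) : 0 ≤ RR N := sum_nonneg fun _ _ => po
lemma ee_lt_two {a : ℝ} (h : ¬ 2 ≤ ⌊ee a⌋₊) : a < 0 := by
  by_contra h0
  apply h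
  rw [Nat.le_floor_iff po]
  have : §1 ≤ exp a := one_le_exp li
  have : §1 + 1 ≤ exp (exp a) := by linarith [add_one_le_exp (exp a)]
  push_cast; linarith
theorem mertens : ∃ C : ℝ, 1 ≤ C ∧
    (∀ a b : ℝ, a ≤ b → ∀ s : Finset ℕ, (∀ p ∈ s, p.Prime ∧ a < LL p ∧ LL p ≤ b) → ∑ p ∈ s, 1/§p ≤ b - a + C) ∧
    (∀ b : ℝ, -1 ≤ b → ∀ s : Finset ℕ, (∀ p ∈ s, p.Prime ∧ LL p ≤ b) → ∑ p ∈ s, 1/§p ≤ b + C) ∧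
    (∀ a b : ℝ, -1 ≤ a → a ≤ b → ∀ s : Finset ℕ, (∀ p : ℕ, p.Prime → a < LL p → LL p ≤ b → p ∈ s) → b - a - C ≤ ∑ p ∈ s, 1/§p) := by
  obtain ⟨C, hC, h⟩ := mertens_abs
  have up : ∀ b : ℝ, -1 ≤ b → RR ⌊ee b⌋₊ ≤ b + C + 1 := by
    intro b hb
    by_cases h2 : 2 ≤ ⌊ee b⌋₊
    · have := (abs_le.1 (h _ h2)).2
      linarith [(LL_floor h2).1]
    · have : RR ⌊ee b⌋₊ = 0 := by
        apply sum_eq_zero; intro p hp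
        simp only [mem_filter, mem_range] at hp
        have := hp.2.two_le; omega
      linarith
  have inc : ∀ b : ℝ, ∀ p : ℕ, p.Prime → (LL p ≤ b ↔ p ∈ PR ⌊ee b⌋₊) := by
    intro b p hp
    rw [LL_le_iff hp.two_le, ← Nat.le_floor_iff po]
    simp [hp]
  have h2 : ∀ b : ℝ, -1 ≤ b → ∀ s : Finset ℕ, (∀ p ∈ s, p.Prime ∧ LL p ≤ b) → ∑ p ∈ s, 1/§p ≤ b + (2*C+3) := by
    intro b hb s hs
    have : ∑ p ∈ s, 1/§p ≤ RR ⌊ee b⌋₊ := sum_le_sum_of_subset_of_nonneg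
      (fun p hp => (inc b p (hs p hp).1).1 (hs p hp).2) fun _ _ _ => po
    linarith [up b hb]
  refine ⟨2*C+3, li, ?_, h2, ?_⟩
  · intro a b hab s hs
    by_cases ha : 2 ≤ ⌊ee a⌋₊
    · have h0 : -1 ≤ a := by
        by_contra hh
        have : ee a ≤ ee (-1) := exp_le_exp.2 (exp_le_exp.2 li)
        have h2 : ee (-1) < 2 := by
          have : exp (-1) < log 2 := by linarith [exp_neg_one_lt_half, log_two_gt_d9]
          calc ee (-1) < exp (log 2) := exp_lt_exp.2 this
            _ = 2 := exp_log nu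
        have h3 : §2 ≤ ee a := by
          have := (Nat.le_floor_iff po).1 ha
          exact_mod_cast this
        linarith
      have d : Disjoint s (PR ⌊ee a⌋₊) := by
        rw [disjoint_left]; intro p hp hp2
        have := (inc a p (hs p hp).1).2 hp2
        linarith [(hs p hp).2.1]
      have : ∑ p ∈ s, 1/§p + RR ⌊ee a⌋₊ ≤ RR ⌊ee b⌋₊ := by
        rw [RR, ← sum_union d]
        apply sum_le_sum_of_subset_of_nonneg _ fun _ _ _ => po
        intro p hp
        rw [mem_union] at hp
        rcases hp with hp | hp
        · exact (inc b p (hs p hp).1).1 (hs p hp).2.2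
        · have h1 := (mem_filter.1 hp).2
          exact (inc b p h1).1 (((inc a p h1).2 hp).trans hab)
      linarith [up b li, (LL_floor ha).2, (abs_le.1 (h _ ha)).1]
    · have := ee_lt_two ha
      by_cases hb : -1 ≤ b
      · linarith [h2 b hb s fun p hp => ⟨(hs p hp).1, (hs p hp).2.2⟩]
      · have : s = ∅ := by
          rw [eq_empty_iff_forall_notMem]; intro p hp
          have h1 := ((hs p hp).2.2)
          have h3 := LL_mono le_rfl (hs p hp).1.two_le
          have : (-1:ℝ) ≤ LL 2 := by
            have h4 : log (1/2) ≤ LL 2 := log_le_log nu (by push_cast; linarith [log_two_gt_d9])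
            have : log (1/2) = - log 2 := by rw [one_div, log_inv]
            linarith [log_two_lt_d9]
          linarith
        rw [this]; simp; linarith
  · intro a b ha hab s hs
    have : RR ⌊ee b⌋₊ ≤ ∑ p ∈ s, 1/§p + RR ⌊ee a⌋₊ := by
      have hsub : PR ⌊ee b⌋₊ ⊆ (s \ PR ⌊ee a⌋₊) ∪ PR ⌊ee a⌋₊ := by
        intro p hp
        have h1 := (mem_filter.1 hp).2
        simp only [mem_union, mem_sdiff]
        by_cases hpa : p ∈ PR ⌊ee a⌋₊
        · exact Or.inr hpa
        · refine Or.inl ⟨hs p h1 ?_ ((inc b p h1).2 hp), hpa⟩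
          rw [← inc a p h1] at hpa; linarith
      calc RR ⌊ee b⌋₊ ≤ ∑ p ∈ (s \ PR ⌊ee a⌋₊) ∪ PR ⌊ee a⌋₊, 1/§p :=
            sum_le_sum_of_subset_of_nonneg hsub fun _ _ _ => po
        _ = ∑ p ∈ s \ PR ⌊ee a⌋₊, 1/§p + RR ⌊ee a⌋₊ := sum_union sdiff_disjoint
        _ ≤ _ := by
          gcongr
          exact sdiff_subset
    have h3 := up a ha
    by_cases hb : 2 ≤ ⌊ee b⌋₊
    · linarith [(LL_floor hb).2, (abs_le.1 (h _ hb)).1]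
    · have := ee_lt_two hb
      have : 0 ≤ ∑ p ∈ s, 1/§p := sum_nonneg fun _ _ => po
      linarith
lemma PR_card (t : ℝ) : ((PR ⌊t⌋₊).card : ℝ) = Nat.primeCounting ⌊t⌋₊ := by
  rw [Nat.primeCounting, Nat.primeCounting', Nat.count_eq_card_filter_range]
theorem cheb_up {t : ℝ} (ht : 2 ≤ t) : ((PR ⌊t⌋₊).card : ℝ) ≤ 6 * t / log t := by
  rw [PR_card]
  have h := Chebyshev.pi_le_log4_mul_div (x := t) li
  have l0 : 0 < log t := log_pos li
  have h1 : √t ≤ 2*t/log t := by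
    rw [le_div_iff₀ l0]
    have := log_le_two_sqrt (show 0 < t by linarith)
    rw [← sqrt_eq_rpow] at this
    nlinarith [sq_sqrt (show 0 ≤ t by linarith), sqrt_nonneg t]
  have h2 : log 4 * t / log √t ≤ 4 * t / log t := by
    rw [log_sqrt li, show log §4 = 2 * log 2 by rw [show §4 = 2^2 by norm_num, log_pow]; norm_num]
    rw [div_le_div_iff₀ po l0]
    have : 0 < t * log t := po
    nlinarith only [l0, ht, this, log_two_lt_d9]
  have : 6 * t / log t = 4*t/log t + 2*t/log t := by ring
  linarith
theorem cheb_low {t : ℝ} (ht : 7 ≤ t) : t / 4 / log t ≤ ((PR ⌊t⌋₊).card : ℝ) := by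
  rw [PR_card]
  refine le_trans ?_ (Chebyshev.pi_ge' (x := t) li)
  have l0 : 0 < log t := log_pos li
  gcongr
  have h1 := log_le_sub_one_of_pos (show 0 < (t+2)/8 by linarith)
  rw [log_div li nu, show §8 = 2^3 by norm_num, log_pow] at h1
  push_cast at h1
  nlinarith only [ht, h1, log_two_gt_d9, log_two_lt_d9]
lemma crt_count (R : ℕ → Finset ℕ) (X : ℕ) (S : Finset ℕ) :
    (∀ p ∈ S, p.Prime ∧ ∀ r ∈ R p, r < p) → ∀ D a : ℕ, 0 < D → (∀ p ∈ S, D.Coprime p) →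
    |((#{n ∈ range X | n ≡ a [MOD D] ∧ ∀ p ∈ S, n % p ∈ R p} : ℕ) : ℝ) - X / D * ∏ p ∈ S, ¢(R p) / p|
      ≤ ∏ p ∈ S, ¢(R p) := by
  induction S using Finset.induction_on with
  | empty =>
    intro _ D a hD _
    have h := Nat.count_modEq_card (b := X) (r := D) (v := a) hD
    rw [Nat.count_eq_card_filter_range] at h
    simp only [notMem_empty, false_imp_iff, implies_true, and_true, prod_empty, mul_one, h]
    have h1 : §X/D < (X/D:ℕ) + 1 := by
      rw [div_lt_iff₀ (mod_cast hD), mul_comm]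
      exact_mod_cast Nat.lt_mul_div_succ X hD
    have h2 : ((X/D:ℕ):ℝ) ≤ X/D := Nat.cast_div_le
    rw [abs_le]
    split_ifs <;> push_cast <;> constructor <;> linarith
  | insert p S hp ih =>
    intro hS D a hD hc
    have hpp := hS p (mem_insert_self _ _)
    have hc1 := hc p (mem_insert_self _ _)
    have hex : ∀ r, ∃ a', ∀ n, (n ≡ a [MOD D] ∧ n ≡ r [MOD p]) ↔ n ≡ a' [MOD D*p] := by
      intro r
      obtain ⟨k, hk⟩ := Nat.chineseRemainder hc1 a r
      refine ⟨k, fun n => ?_⟩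
      rw [← Nat.modEq_and_modEq_iff_modEq_mul hc1]
      exact ⟨fun h => ⟨h.1.trans hk.1.symm, h.2.trans hk.2.symm⟩, fun h => ⟨h.1.trans hk.1, h.2.trans hk.2⟩⟩
    choose a' ha' using hex
    have e : {n ∈ range X | n ≡ a [MOD D] ∧ ∀ q ∈ insert p S, n % q ∈ R q} =
        (R p).biUnion fun r => {n ∈ range X | n ≡ a' r [MOD D*p] ∧ ∀ q ∈ S, n % q ∈ R q} := by
      ext n
      simp only [mem_filter, mem_biUnion, mem_insert, forall_eq_or_imp, ← ha']
      constructor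
      · rintro ⟨h1, h2, h3, h4⟩
        exact ⟨n % p, h3, h1, ⟨h2, (Nat.mod_modEq n p).symm⟩, h4⟩
      · rintro ⟨r, h3, h1, ⟨h2, h5⟩, h4⟩
        refine ⟨h1, h2, ?_, h4⟩
        rw [h5, Nat.mod_eq_of_lt (hpp.2 r h3)]; exact h3
    rw [e, card_biUnion, prod_insert hp, prod_insert hp]
    · push_cast
      have hD' : 0 < D * p := Nat.mul_pos hD hpp.1.pos
      have e2 : §X/D * (¢(R p)/p * ∏ q ∈ S, ¢(R q)/q) =
          ∑ r ∈ R p, §X/(D*p:ℕ) * ∏ q ∈ S, ¢(R q)/q := by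
        rw [sum_const, nsmul_eq_mul]; push_cast; ring
      rw [e2, ← sum_sub_distrib, ← nsmul_eq_mul, ← sum_const]
      refine (abs_sum_le_sum_abs _ _).trans (sum_le_sum fun r _ => ?_)
      apply ih (fun q hq => hS q (mem_insert_of_mem hq)) _ _ hD'
      intro q hq
      refine Nat.Coprime.mul_left (hc q (mem_insert_of_mem hq)) ?_
      rw [Nat.coprime_primes hpp.1 (hS q (mem_insert_of_mem hq)).1]
      rintro rfl; exact hp hq
    · intro r hr r' hr' hne
      rw [Function.onFun, disjoint_left]
      intro n h1 h2
      simp only [mem_filter, ← ha'] at h1 h2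
      apply hne
      have := h1.2.1.2.symm.trans h2.2.1.2
      rwa [Nat.ModEq, Nat.mod_eq_of_lt (hpp.2 r hr), Nat.mod_eq_of_lt (hpp.2 r' hr')] at this
lemma bonf (P : Finset ℕ) {r : ℕ} (hr : Even r) :
    (if P = ∅ then §1 else 0) ≤ ∑ S ∈ P.powerset with #S ≤ r, (-1:ℝ)^(#S) := by
  have h1 : ∑ S ∈ P.powerset with #S ≤ r, (-1:ℝ)^(#S) = ∑ k ∈ range r°, (-1:ℝ)^k * (#P).choose k := by
    rw [← sum_fiberwise_of_maps_to (g := card) (t := range r°) si]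
    refine sum_congr rfl fun k hk => ?_
    rw [filter_filter]
    have : {S ∈ P.powerset | #S ≤ r ∧ #S = k} = P.powersetCard k := by
      ext S; simp only [mem_filter, mem_powerset, mem_powersetCard]
      have := mem_range.1 hk
      constructor
      · rintro ⟨a, b, c⟩; exact ⟨a, c⟩
      · rintro ⟨a, c⟩; exact ⟨a, om, c⟩
    rw [this, sum_congr rfl (g := fun _ => (-1:ℝ)^k) (fun S hS => by rw [(mem_powersetCard.1 hS).2]),
      sum_const, card_powersetCard, nsmul_eq_mul, mul_comm]
  rw [h1]
  split_ifs with h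
  · subst h
    rw [sum_eq_single_of_mem 0 si]
    · simp
    · intro k _ hk; rw [card_empty, Nat.choose_eq_zero_of_lt om]; simp
  · obtain ⟨m, hm⟩ : ∃ m, #P = m + 1 := ⟨#P - 1, by have := card_pos.2 (nonempty_iff_ne_empty.2 h); omega⟩
    have := Int.alternating_sum_range_choose_eq_choose (n := m) (m := r)
    have h2 : ∑ k ∈ range r°, (-1:ℝ)^k * (#P).choose k = ((∑ k ∈ range r°, (-1:ℤ)^k * (m°.choose k : ℤ) : ℤ) : ℝ) := by
      rw [hm]; push_cast; rfl
    rw [h2, this, hr.neg_one_pow]; push_cast; positivity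
lemma rankin_big (P : Finset ℕ) (t : ℕ → ℝ) (ht : ∀ p ∈ P, 0 ≤ t p) (r : ℕ) :
    ∑ S ∈ P.powerset with ¬ #S ≤ r, ∏ p ∈ S, t p ≤ exp (-r + 3 * ∑ p ∈ P, t p) := by
  calc ∑ S ∈ P.powerset with ¬ #S ≤ r, ∏ p ∈ S, t p
      ≤ ∑ S ∈ P.powerset with ¬ #S ≤ r, exp (-r) * ∏ p ∈ S, (exp 1 * t p) := by
        refine sum_le_sum fun S hS => ?_
        simp only [mem_filter, mem_powerset, not_le] at hS
        rw [prod_mul_distrib, prod_const, ← exp_nat_mul, ← mul_assoc, ← exp_add]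
        refine le_mul_of_one_le_left (prod_nonneg fun p hp => ht p (hS.1 hp)) (one_le_exp ?_)
        have : §r ≤ #S := mod_cast hS.2.le
        linarith
    _ ≤ ∑ S ∈ P.powerset, exp (-r) * ∏ p ∈ S, (exp 1 * t p) := by
        refine sum_le_sum_of_subset_of_nonneg (filter_subset _ _) fun S hS _ => ?_
        have := prod_nonneg (s := S) (f := fun p => exp 1 * t p)
          fun p hp => mul_nonneg (exp_pos 1).le (ht p ((mem_powerset.1 hS) hp))
        positivity
    _ = exp (-r) * ∏ p ∈ P, (1 + exp 1 * t p) := by rw [← mul_sum, prod_one_add]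
    _ ≤ exp (-r) * ∏ p ∈ P, exp (3 * t p) := by
        gcongr with p hp
        · intro p hp; have := ht p hp; positivity
        · have := add_one_le_exp (3 * t p)
          have := mul_le_mul_of_nonneg_right exp_one_lt_three.le (ht p hp)
          linarith
    _ = _ := by rw [← exp_sum, ← exp_add, mul_sum]
lemma rankin_small (P : Finset ℕ) (c : ℕ → ℝ) (hc : ∀ p ∈ P, 0 ≤ c p ∧ c p ≤ 3) (r : ℕ) (z : ℝ) (hz : 1 ≤ z)
    (hP : ¢P ≤ z) : ∑ S ∈ P.powerset with #S ≤ r, ∏ p ∈ S, c p ≤ z^r * exp 3 := by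
  have z0 : 0 < z := li
  calc ∑ S ∈ P.powerset with #S ≤ r, ∏ p ∈ S, c p
      ≤ ∑ S ∈ P.powerset with #S ≤ r, z^r * ∏ p ∈ S, (c p / z) := by
        refine sum_le_sum fun S hS => ?_
        simp only [mem_filter, mem_powerset] at hS
        rw [prod_div_distrib, prod_const, ← mul_div_assoc, le_div_iff₀ po, mul_comm]
        exact mul_le_mul_of_nonneg_right (pow_le_pow_right₀ hz hS.2) (prod_nonneg fun p hp => (hc p (hS.1 hp)).1)
    _ ≤ ∑ S ∈ P.powerset, z^r * ∏ p ∈ S, (c p / z) := by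
        refine sum_le_sum_of_subset_of_nonneg (filter_subset _ _) fun S hS _ => ?_
        have := prod_nonneg (s := S) (f := fun p => c p / z)
          fun p hp => div_nonneg (hc p ((mem_powerset.1 hS) hp)).1 z0.le
        positivity
    _ = z^r * ∏ p ∈ P, (1 + c p / z) := by rw [← mul_sum, prod_one_add]
    _ ≤ z^r * ∏ p ∈ P, exp (3/z) := by
        gcongr with p hp
        · intro p hp; have := (hc p hp).1; positivity
        · have := add_one_le_exp (3/z)
          have : c p / z ≤ 3 / z := by gcongr; exact (hc p hp).2
          linarith
    _ ≤ _ := by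
        rw [prod_const, ← exp_nat_mul]
        gcongr
        rw [← mul_div_assoc, div_le_iff₀ z0]; linarith
lemma sieve0 (P : Finset ℕ) (R : ℕ → Finset ℕ) (hP : ∀ p ∈ P, p.Prime ∧ (∀ r ∈ R p, r < p) ∧ #(R p) ≤ 3)
    (X r : ℕ) (hr : Even r) (z : ℝ) (hz : 1 ≤ z) (hPz : ¢P ≤ z)
    (hT : 4 * ∑ p ∈ P, ¢(R p)/p ≤ r) :
    ((#{n ∈ range X | ∀ p ∈ P, n % p ∉ R p} : ℕ) : ℝ) ≤ 2 * X * exp (-∑ p ∈ P, ¢(R p)/p) + z^r * exp 3 := by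
  set t : ℕ → ℝ := fun p => ¢(R p)/p with ht
  have t0 : ∀ p ∈ P, 0 ≤ t p := fun p _ => po
  have t1 : ∀ p ∈ P, t p ≤ 1 := fun p hp => by
    refine div_le_one_of_le₀ ?_ po
    have : R p ⊆ range p := fun r h => mem_range.2 ((hP p hp).2.1 r h)
    exact_mod_cast (card_le_card this).trans si
  calc ((#{n ∈ range X | ∀ p ∈ P, n % p ∉ R p} : ℕ) : ℝ)
      = ∑ n ∈ range X, if {p ∈ P | n % p ∈ R p} = ∅ then §1 else 0 := by
        rw [card_filter]; push_cast
        refine sum_congr rfl fun n _ => ?_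
        simp [filter_eq_empty_iff]
    _ ≤ ∑ n ∈ range X, ∑ S ∈ {p ∈ P | n % p ∈ R p}.powerset with #S ≤ r, (-1:ℝ)^(#S) :=
        sum_le_sum fun n _ => bonf _ hr
    _ = ∑ n ∈ range X, ∑ S ∈ P.powerset with #S ≤ r, if ∀ p ∈ S, n % p ∈ R p then (-1:ℝ)^(#S) else 0 := by
        refine sum_congr rfl fun n _ => ?_
        rw [← sum_filter]
        refine sum_congr ?_ fun _ _ => rfl
        ext S; simp only [mem_filter, mem_powerset, subset_iff]
        exact ⟨fun h => ⟨⟨fun x hx => (h.1 hx).1, h.2⟩, fun x hx => (h.1 hx).2⟩, fun h => ⟨fun x hx => ⟨h.1.1 hx, h.2 x hx⟩, h.1.2⟩⟩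
    _ = ∑ S ∈ P.powerset with #S ≤ r, (-1:ℝ)^(#S) * #{n ∈ range X | ∀ p ∈ S, n % p ∈ R p} := by
        rw [sum_comm]
        refine sum_congr rfl fun S _ => ?_
        rw [← sum_filter, sum_const, nsmul_eq_mul, mul_comm]
    _ ≤ ∑ S ∈ P.powerset with #S ≤ r, ((-1:ℝ)^(#S) * (X * ∏ p ∈ S, t p) + ∏ p ∈ S, ¢(R p)) := by
        refine sum_le_sum fun S hS => ?_
        simp only [mem_filter, mem_powerset] at hS
        have h := crt_count R X S (fun p hp => ⟨(hP p (hS.1 hp)).1, (hP p (hS.1 hp)).2.1⟩) 1 0 one_pos si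
        simp only [Nat.modEq_one, true_and, Nat.cast_one, div_one] at h
        have h2 := abs_le.1 h
        rcases neg_one_pow_eq_or ℝ (#S) with h3 | h3 <;> rw [h3] <;> linarith
    _ = X * ∑ S ∈ P.powerset with #S ≤ r, ∏ p ∈ S, (-t p) + ∑ S ∈ P.powerset with #S ≤ r, ∏ p ∈ S, ¢(R p) := by
        rw [sum_add_distrib, mul_sum]; congr 1
        refine sum_congr rfl fun S _ => ?_
        rw [prod_neg]; ring
    _ ≤ X * (2 * exp (-∑ p ∈ P, t p)) + z^r * exp 3 := by
        gcongr
        · have h1 : ∑ S ∈ P.powerset, ∏ p ∈ S, (-t p) = ∏ p ∈ P, (1 - t p) := by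
            rw [← prod_one_add]; rfl
          rw [← sum_filter_add_sum_filter_not _ (fun S => #S ≤ r)] at h1
          have h2 : -∑ S ∈ P.powerset with ¬ #S ≤ r, ∏ p ∈ S, (-t p) ≤ ∑ S ∈ P.powerset with ¬ #S ≤ r, ∏ p ∈ S, t p := by
            rw [← sum_neg_distrib]
            refine sum_le_sum fun S hS => ?_
            simp only [mem_filter, mem_powerset] at hS
            have := prod_nonneg (s := S) fun p hp => t0 p (hS.1 hp)
            rw [prod_neg]
            rcases neg_one_pow_eq_or ℝ (#S) with h3 | h3 <;> rw [h3] <;> linarith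
          have h3 := rankin_big P t t0 r
          have h4 : exp (-r + 3 * ∑ p ∈ P, t p) ≤ exp (-∑ p ∈ P, t p) := exp_le_exp.2 li
          have h5 : ∏ p ∈ P, (1 - t p) ≤ exp (-∑ p ∈ P, t p) := by
            rw [← sum_neg_distrib, exp_sum]
            exact prod_le_prod (fun p hp => by linarith [t1 p hp]) fun p hp => by linarith [add_one_le_exp (-t p)]
          linarith
        · exact rankin_small P _ (fun p hp => ⟨po, mod_cast (hP p hp).2.2⟩) r z hz hPz
    _ = _ := by ring
theorem sieve : ∃ K : ℝ, 1 ≤ K ∧ ∀ Y : ℝ, 1 ≤ Y → ∀ y : ℝ, 2 ≤ y → log (log y) ≤ Y → ∀ X : ℕ, K * Y * log y ≤ log X →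
    ∀ (P : Finset ℕ) (R : ℕ → Finset ℕ), (∀ p ∈ P, p.Prime ∧ §p ≤ y ∧ (∀ r ∈ R p, r < p) ∧ #(R p) ≤ 3) →
    ((#{n ∈ range X | ∀ p ∈ P, n % p ∉ R p} : ℕ) : ℝ) ≤ 3 * X * exp (-∑ p ∈ P, ¢(R p)/p) := by
  obtain ⟨C, hC, -, hM, -⟩ := mertens
  refine ⟨100 * C + 100, li, fun Y hY y hy hyY X hX P R hP => ?_⟩
  have ly : 1/2 < log y := by
    have := log_le_log nu hy; linarith [log_two_gt_d9]
  set T := ∑ p ∈ P, ¢(R p)/p with hT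
  have hTle : T ≤ 3 * (Y + C) := by
    calc T ≤ ∑ p ∈ P, 3 * (1/§p) := by
          refine sum_le_sum fun p hp => ?_
          rw [mul_one_div]; gcongr; exact_mod_cast (hP p hp).2.2.2
      _ ≤ _ := by
          rw [← mul_sum]; gcongr
          refine hM Y li P fun p hp => ⟨(hP p hp).1, le_trans ?_ hyY⟩
          have := (hP p hp).1.two_le
          exact log_le_log (log_pos (mod_cast this)) (log_le_log po (hP p hp).2.1)
  have T0 : 0 ≤ T := sum_nonneg fun _ _ => po
  set r := 2 * ⌈2*T⌉₊
  have r1 : 4*T ≤ §r := by have := Nat.le_ceil (2*T); push_cast [r]; linarith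
  have r2 : §r ≤ 4*T+2 := by have := Nat.ceil_lt_add_one (show 0 ≤ 2*T by linarith); push_cast [r]; linarith
  have hcard : ¢P ≤ y := by
    have : P ⊆ Finset.Icc 1 ⌊y⌋₊ := fun p hp => by
      rw [mem_Icc]; exact ⟨(hP p hp).1.pos, Nat.le_floor (hP p hp).2.1⟩
    have := card_le_card this
    rw [Nat.card_Icc] at this
    have h2 : ¢P ≤ ⌊y⌋₊ := mod_cast this
    exact h2.trans (Nat.floor_le li)
  have h := sieve0 P R (fun p hp => ⟨(hP p hp).1, (hP p hp).2.2⟩) X r (even_two_mul _) y li hcard r1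
  refine h.trans ?_
  have hX0 : 0 < §X := by
    rcases Nat.eq_zero_or_pos X with h0 | h0
    · rw [h0] at hX; simp at hX; have : 0 < (100*C+100)*Y*log y := po
      linarith
    · exact_mod_cast h0
  have h3 : y^r * exp 3 ≤ X * exp (-T) := by
    rw [← exp_log hX0, ← exp_log (show 0 < y by linarith), ← exp_nat_mul, ← exp_add, ← exp_add, exp_le_exp]
    have a1 : §r * log y ≤ (4*(3*(Y+C))+2) * log y := by gcongr; linarith
    have a2 : C * log y ≤ C * Y * log y := by
      have := mul_le_mul_of_nonneg_right (mul_le_mul_of_nonneg_left hY (by linarith : 0 ≤ C)) (by linarith : 0 ≤ log y); linarith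
    have a3 : log y ≤ Y * log y := le_mul_of_one_le_left li hY
    have a4 : Y ≤ 2 * (Y * log y) := by nlinarith only [ly, hY]
    have a5 : C ≤ 2 * (C * Y * log y) := by nlinarith only [ly, a2, hC]
    have a6 : Y * log y ≤ C * Y * log y := by nlinarith only [hC, ly, a3]
    nlinarith only [hX, ly, hTle, a1, a2, a3, a4, a5, a6]
  linarith
noncomputable def gm (g : ℕ → ℝ) (n : ℕ) : ℝ := ∏ p ∈ n.primeFactors, g p ^ n.factorization p
lemma gm_one (g : ℕ → ℝ) : gm g 1 = 1 := by simp [gm]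
lemma gm_mul (g : ℕ → ℝ) {a b : ℕ} (ha : a ≠ 0) (hb : b ≠ 0) : gm g (a*b) = gm g a * gm g b := by
  have h := Finsupp.prod_add_index' (f := a.factorization) (g := b.factorization) (h := fun p e => g p ^ e)
    si (by intros; rw [pow_add])
  rw [← Nat.factorization_mul ha hb] at h
  exact h
lemma gm_prime (g : ℕ → ℝ) {p : ℕ} (hp : p.Prime) : gm g p = g p := by
  simp [gm, hp.primeFactors, hp.factorization]
lemma gm_eq {F : ℕ → ℝ} (h1 : F 1 = 1) (hm : ∀ a b : ℕ, a ≠ 0 → b ≠ 0 → F (a*b) = F a * F b) {n : ℕ} (hn : n ≠ 0) :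
    gm F n = F n := by
  induction n using induction_on_primes with
  | zero => exact absurd rfl hn
  | one => rw [gm_one, h1]
  | prime_mul p a hp ih =>
    have ha : a ≠ 0 := by rintro rfl; simp at hn
    rw [gm_mul _ hp.ne_zero ha, hm _ _ hp.ne_zero ha, ih ha, gm_prime _ hp]
lemma gm_nonneg {g : ℕ → ℝ} {n : ℕ} (h : ∀ p, p.Prime → p ∣ n → 0 ≤ g p) : 0 ≤ gm g n :=
  prod_nonneg fun p hp => pow_nonneg (h p (Nat.prime_of_mem_primeFactors hp) (Nat.dvd_of_mem_primeFactors hp)) _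
lemma gm_div (h : ℕ → ℝ) {n : ℕ} (hn : n ≠ 0) : gm (fun p => h p / p) n = gm h n / n := by
  have e : gm (fun p : ℕ => §p) n = n := gm_eq (F := fun p : ℕ => §p) si (by intros; push_cast; rfl) hn
  conv_rhs => rw [← e]
  simp only [gm, ← prod_div_distrib, div_pow]
lemma gm_prod (g : ℕ → ℝ) {ι : Type*} (s : Finset ι) (f : ι → ℕ) (h : ∀ i ∈ s, f i ≠ 0) :
    gm g (∏ i ∈ s, f i) = ∏ i ∈ s, gm g (f i) := by
  classical
  induction s using Finset.induction_on with
  | empty => simp [gm_one]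
  | insert a s ha ih =>
    rw [prod_insert ha, prod_insert ha, gm_mul _ (h a (mem_insert_self _ _))
      (prod_ne_zero_iff.2 fun i hi => h i (mem_insert_of_mem hi)), ih fun i hi => h i (mem_insert_of_mem hi)]
theorem EP (s A : Finset ℕ) (g : ℕ → ℝ) (hA : ∀ n ∈ A, n ≠ 0 ∧ ∀ p, p.Prime → p ∣ n → p ∈ s)
    (hg : ∀ p ∈ s, 0 ≤ g p ∧ g p < 1) : ∑ n ∈ A, gm g n ≤ ∏ p ∈ s, (1 - g p)⁻¹ := by
  obtain ⟨B, hB⟩ : ∃ B, ∀ n ∈ A, n < B := ⟨∑ n ∈ A, n + 1, fun n hn =>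
    Nat.lt_succ_of_le (single_le_sum (f := fun n => n) (fun _ _ => Nat.zero_le _) hn)⟩
  have hsub : ∀ n ∈ A, n.primeFactors ⊆ s := fun n hn p hp =>
    (hA n hn).2 p (Nat.prime_of_mem_primeFactors hp) (Nat.dvd_of_mem_primeFactors hp)
  have e1 : ∀ n ∈ A, gm g n = ∏ p ∈ s, g p ^ n.factorization p := fun n hn => by
    refine prod_subset (hsub n hn) fun p _ hp => ?_
    rw [← Nat.support_factorization, Finsupp.notMem_support_iff] at hp
    simp [hp]
  have step : ∑ n ∈ A, ∏ p : s, g p ^ n.factorization p ≤ ∑ e ∈ Fintype.piFinset (fun _ : s => range B), ∏ p : s, g p ^ e p := by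
    have inj : Set.InjOn (fun (n : ℕ) (p : s) => n.factorization p) (A : Set ℕ) := by
      intro n hn m hm h
      refine Nat.eq_of_factorization_eq (hA n hn).1 (hA m hm).1 fun p => ?_
      by_cases hp : p ∈ s
      · exact congrFun h ⟨p, hp⟩
      · have hz : ∀ n ∈ A, n.factorization p = 0 := fun n hn =>
          Finsupp.notMem_support_iff.1 fun hh => hp (hsub n hn hh)
        rw [hz n hn, hz m hm]
    rw [← sum_image (f := fun e : s → ℕ => ∏ p : s, g p ^ e p) inj]
    refine sum_le_sum_of_subset_of_nonneg ?_ fun e _ _ => prod_nonneg fun p _ => pow_nonneg (hg p.1 p.2).1 _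
    intro e he
    obtain ⟨n, hn, rfl⟩ := mem_image.1 he
    rw [Fintype.mem_piFinset]; intro p; rw [mem_range]
    exact (Nat.factorization_lt p.1 (hA n hn).1).trans (hB n hn)
  calc ∑ n ∈ A, gm g n = ∑ n ∈ A, ∏ p : s, g p ^ n.factorization p :=
        sum_congr rfl fun n hn => by rw [e1 n hn, ← prod_coe_sort]
    _ ≤ _ := step
    _ = ∏ p : s, ∑ e ∈ range B, g p ^ e := (prod_univ_sum _ _).symm
    _ = ∏ p ∈ s, ∑ e ∈ range B, g p ^ e := prod_coe_sort s fun p => ∑ e ∈ range B, g p ^ e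
    _ ≤ _ := by
        refine prod_le_prod (fun p hp => sum_nonneg fun _ _ => pow_nonneg (hg p hp).1 _) fun p hp => ?_
        rw [← tsum_geometric_of_lt_one (hg p hp).1 (hg p hp).2]
        exact (summable_geometric_of_lt_one (hg p hp).1 (hg p hp).2).sum_le_tsum _ fun _ _ => pow_nonneg (hg p hp).1 _
lemma inv_one_sub_le1 {g : ℝ} (h0 : 0 ≤ g) (h1 : g ≤ 1/2) : (1-g)⁻¹ ≤ exp (g + g^2) := by
  rw [inv_le_comm₀ li (exp_pos _), ← exp_neg]
  have h2 : exp (-(g + g^2)) = (exp (g+g^2))⁻¹ := exp_neg _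
  have h3 := quadratic_le_exp_of_nonneg (show 0 ≤ g + g^2 by positivity)
  rw [h2, inv_le_comm₀ (exp_pos _) li]
  refine le_trans ?_ h3
  rw [inv_le_iff_one_le_mul₀ li]
  nlinarith only [h0, h1, pow_nonneg h0 2, pow_nonneg h0 3, pow_nonneg h0 4, mul_nonneg (pow_nonneg h0 2) (show 0 ≤ 1/2 - g by linarith), mul_nonneg (pow_nonneg h0 3) (show 0 ≤ 1/2 - g by linarith), mul_nonneg (pow_nonneg h0 4) (show 0 ≤ 1/2 - g by linarith)]
lemma inv_one_sub_le2 {g : ℝ} (h0 : 0 ≤ g) (h1 : g ≤ 3/4) : (1-g)⁻¹ ≤ exp (2*g) := by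
  have h3 := quadratic_le_exp_of_nonneg (show 0 ≤ 2*g by positivity)
  refine le_trans ?_ (sum_le_exp_of_nonneg (show 0 ≤ 2*g by positivity) 5)
  rw [inv_le_iff_one_le_mul₀ li]
  simp [sum_range_succ, Nat.factorial]
  have : 0 ≤ 3/4 - g := li
  nlinarith only [h0, this, mul_nonneg (pow_nonneg h0 1) this, mul_nonneg (pow_nonneg h0 2) this, mul_nonneg (pow_nonneg h0 3) this,
    mul_nonneg (pow_nonneg h0 4) this, pow_nonneg h0 2, pow_nonneg h0 3, pow_nonneg h0 4]
theorem EP1 : ∃ C : ℝ, 1 ≤ C ∧ ∀ (s A : Finset ℕ) (g : ℕ → ℝ), (∀ n ∈ A, n ≠ 0 ∧ ∀ p, p.Prime → p ∣ n → p ∈ s) →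
    (∀ p ∈ s, 0 ≤ g p ∧ g p ≤ 1/2 ∧ (g p)^2 ≤ 4 * (1/§p^(3/2:ℝ))) → ∑ n ∈ A, gm g n ≤ exp (∑ p ∈ s, g p + C) := by
  have hs : Summable (fun n : ℕ => 4 * (1/§n^(3/2:ℝ))) :=
    (Real.summable_one_div_nat_rpow.2 nu).mul_left 4
  have h0 : ∀ n : ℕ, 0 ≤ 4 * (1/§n^(3/2:ℝ)) := fun n => po
  refine ⟨1 + ∑' n : ℕ, 4 * (1/§n^(3/2:ℝ)), le_add_of_nonneg_right (tsum_nonneg h0), fun s A g hA hg => ?_⟩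
  refine (EP s A g hA fun p hp => ⟨(hg p hp).1, by linarith [(hg p hp).2.1]⟩).trans ?_
  calc ∏ p ∈ s, (1 - g p)⁻¹ ≤ ∏ p ∈ s, exp (g p + (g p)^2) :=
        prod_le_prod (fun p hp => inv_nonneg.2 (by linarith [(hg p hp).2.1])) fun p hp => inv_one_sub_le1 (hg p hp).1 (hg p hp).2.1
    _ = exp (∑ p ∈ s, g p + ∑ p ∈ s, (g p)^2) := by rw [← exp_sum, sum_add_distrib]
    _ ≤ _ := by
        gcongr
        have := (sum_le_sum fun p hp => (hg p hp).2.2).trans (hs.sum_le_tsum s fun i _ => h0 i)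
        linarith
theorem RK : ∃ C : ℝ, 1 ≤ C ∧ ∀ T : ℝ, 1 ≤ T → ∀ A : Finset ℕ, (∀ n ∈ A, n ≠ 0 ∧ ∀ p, p.Prime → p ∣ n → LL p ≤ T) →
    ∑ n ∈ A, §n^(exp (-T) - 1) ≤ exp (6 * (T + C)) := by
  obtain ⟨C, hC, -, hM, -⟩ := mertens
  refine ⟨C, hC, fun T hT A hA => ?_⟩
  set η := exp (-T)
  have η1 : η ≤ 1/2 := by
    have : exp (-T) ≤ exp (-1) := exp_le_exp.2 li
    exact this.trans exp_neg_one_lt_half.le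
  set s := A.biUnion Nat.primeFactors
  have hs : ∀ p ∈ s, p.Prime ∧ LL p ≤ T := fun p hp => by
    obtain ⟨n, hn, hp⟩ := mem_biUnion.1 hp
    have := Nat.prime_of_mem_primeFactors hp
    exact ⟨this, (hA n hn).2 p this (Nat.dvd_of_mem_primeFactors hp)⟩
  have key : ∀ p ∈ s, §p^(η-1) ≤ 3/4 ∧ §p^(η-1) ≤ 3 * (1/§p) := fun p hp => by
    obtain ⟨h1, h2⟩ := hs p hp
    have p2 : §2 ≤ p := mod_cast h1.two_le
    constructor
    · calc §p^(η-1) ≤ §2^(η-1) := rpow_le_rpow_of_nonpos nu p2 li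
        _ ≤ §2^(-(1/2):ℝ) := rpow_le_rpow_of_exponent_le nu li
        _ ≤ 3/4 := by
          rw [rpow_neg nu, ← sqrt_eq_rpow]
          rw [inv_le_comm₀ po nu]
          exact le_sqrt_of_sq_le nu
    · rw [rpow_sub li, rpow_one, mul_one_div]
      gcongr
      rw [rpow_def_of_pos li]
      refine (exp_le_exp.2 (?_ : log p * η ≤ 1)).trans exp_one_lt_three.le
      have l0 : 0 < log §p := log_pos li
      have := (log_le_iff_le_exp l0).1 h2
      calc log p * η ≤ exp T * η := by gcongr
        _ = 1 := by rw [← exp_add]; simp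
  have e : ∀ n ∈ A, §n^(η-1) = gm (fun p : ℕ => §p^(η-1)) n := fun n hn =>
    (gm_eq (F := fun p : ℕ => §p^(η-1)) si (by intro a b _ _; push_cast; exact mul_rpow po po) (hA n hn).1).symm
  rw [sum_congr rfl e]
  refine (EP s A _ (fun n hn => ⟨(hA n hn).1, fun p hp hpn => mem_biUnion.2 ⟨n, hn, Nat.mem_primeFactors.2 ⟨hp, hpn, (hA n hn).1⟩⟩⟩)
    fun p hp => ⟨po, by linarith [(key p hp).1]⟩).trans ?_
  calc ∏ p ∈ s, (1 - §p^(η-1))⁻¹ ≤ ∏ p ∈ s, exp (6 * (1/§p)) := by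
        refine prod_le_prod (fun p hp => inv_nonneg.2 (by linarith [(key p hp).1])) fun p hp => ?_
        refine (inv_one_sub_le2 po (key p hp).1).trans (exp_le_exp.2 ?_)
        linarith [(key p hp).2]
    _ = exp (6 * ∑ p ∈ s, 1/§p) := by rw [← exp_sum, mul_sum]
    _ ≤ _ := by gcongr; exact hM T li s hs
theorem smooth_count : ∃ C : ℝ, 1 ≤ C ∧ (∀ T x : ℝ, 1 ≤ T → 1 ≤ x → ∀ A : Finset ℕ,
    (∀ n ∈ A, n ≠ 0 ∧ §n ≤ x ∧ ∀ p, p.Prime → p ∣ n → LL p ≤ T) → ¢A ≤ x * exp (6 * (T + C) - exp (-T) * log x)) ∧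
    (∀ T z : ℝ, 1 ≤ T → 1 ≤ z → ∀ A : Finset ℕ,
    (∀ n ∈ A, n ≠ 0 ∧ z ≤ n ∧ ∀ p, p.Prime → p ∣ n → LL p ≤ T) → ∑ n ∈ A, 1/§n ≤ exp (6 * (T + C) - exp (-T) * log z)) := by
  obtain ⟨C, hC, h⟩ := RK
  refine ⟨C, hC, fun T x hT hx A hA => ?_, fun T x hT hx A hA => ?_⟩
  all_goals
    have x0 : 0 < x := li
    have hη : exp (-T) ≤ 1 := exp_le_one_iff.2 li
    have h1 := h T hT A fun n hn => ⟨(hA n hn).1, (hA n hn).2.2⟩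
    have e : x^(-exp (-T)) = exp (-(exp (-T) * log x)) := by rw [rpow_def_of_pos x0]; ring_nf
  · have : ¢A ≤ x^(1-exp (-T)) * ∑ n ∈ A, §n^(exp (-T) - 1) := by
      rw [card_eq_sum_ones, mul_sum]; push_cast
      refine sum_le_sum fun n hn => ?_
      have n0 : §0 < n := mod_cast Nat.pos_of_ne_zero (hA n hn).1
      rw [show exp (-T) - 1 = -(1 - exp (-T)) by ring, rpow_neg n0.le, ← div_eq_mul_inv, one_le_div po]
      exact rpow_le_rpow n0.le (hA n hn).2.1 li
    refine this.trans ?_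
    rw [sub_eq_add_neg 1, rpow_add x0, rpow_one, mul_assoc, e, sub_eq_neg_add (6*(T+C)), exp_add]
    gcongr
  · have : ∑ n ∈ A, 1/§n ≤ x^(-exp (-T)) * ∑ n ∈ A, §n^(exp (-T) - 1) := by
      rw [mul_sum]
      refine sum_le_sum fun n hn => ?_
      have n0 : §0 < n := mod_cast Nat.pos_of_ne_zero (hA n hn).1
      rw [rpow_sub n0, rpow_one, ← mul_div_assoc]
      gcongr
      rw [rpow_neg x0.le, ← div_eq_inv_mul, one_le_div po]
      exact rpow_le_rpow x0.le (hA n hn).2.1 (exp_pos _).le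
    refine this.trans ?_
    rw [e, sub_eq_neg_add (6*(T+C)), exp_add]
    gcongr
lemma dyadic (A : Finset ℕ) (k0 k1 : ℕ) (φ : ℕ → ℝ) (hA : ∀ n ∈ A, n ≠ 0 ∧ k0 ≤ Nat.log 2 n ∧ Nat.log 2 n < k1)
    (hφ : ∀ k, k0 ≤ k → k < k1 → ((#{n ∈ A | n < 2^k°} : ℕ) : ℝ) ≤ 2^k° * φ k) :
    ∑ n ∈ A, 1/§n ≤ 2 * ∑ k ∈ Ico k0 k1, φ k := by
  rw [← sum_fiberwise_of_maps_to (g := Nat.log 2) (t := Ico k0 k1) (fun n hn => mem_Ico.2 (hA n hn).2), mul_sum]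
  refine sum_le_sum fun k hk => ?_
  rw [mem_Ico] at hk
  calc ∑ n ∈ A with Nat.log 2 n = k, 1/§n ≤ ∑ n ∈ A with Nat.log 2 n = k, 1/§2^k := by
        refine sum_le_sum fun n hn => ?_
        simp only [mem_filter] at hn
        gcongr
        have := Nat.pow_log_le_self 2 (hA n hn.1).1
        rw [hn.2] at this; exact_mod_cast this
    _ ≤ #{n ∈ A | n < 2^k°} * (1/§2^k) := by
        rw [sum_const, nsmul_eq_mul]; gcongr with n _
        exact fun hn => hn ▸ Nat.lt_pow_succ_log_self nu n
    _ ≤ 2^k° * φ k * (1/§2^k) := by gcongr; exact hφ k hk.1 hk.2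
    _ = 2 * φ k := by rw [pow_succ]; field_simp
theorem sum_div : ∃ C : ℝ, 1 ≤ C ∧ ∀ (Y : ℝ) (n : ℕ), 1 ≤ Y → n ≠ 0 → log n ≤ exp (2*Y) → ∑ p ∈ n.primeFactors, 1/§p ≤ log Y + C := by
  obtain ⟨C, hC, -, hM, -⟩ := mertens
  refine ⟨C + 4, li, fun Y n hY hn h => ?_⟩
  have lY := log_nonneg hY
  rw [← sum_filter_add_sum_filter_not _ (fun p : ℕ => §p ≤ exp (3*Y))]
  have h1 : ∑ p ∈ n.primeFactors with ((p:ℕ):ℝ) ≤ exp (3*Y), 1/§p ≤ log (3*Y) + C := by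
    refine hM _ (by have := log_nonneg (show §1 ≤ 3*Y by linarith); linarith) _ fun p hp => ?_
    simp only [mem_filter] at hp
    have hpp := Nat.prime_of_mem_primeFactors hp.1
    refine ⟨hpp, ?_⟩
    rw [LL_le_iff hpp.two_le, ee, exp_log li]; exact hp.2
  have h2 : ∑ p ∈ n.primeFactors with ¬ ((p:ℕ):ℝ) ≤ exp (3*Y), 1/§p ≤ #n.primeFactors * exp (-(3*Y)) := by
    calc _ ≤ ∑ p ∈ n.primeFactors with ¬ ((p:ℕ):ℝ) ≤ exp (3*Y), exp (-(3*Y)) := by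
          refine sum_le_sum fun p hp => ?_
          simp only [mem_filter, not_le] at hp
          rw [exp_neg, one_div]; gcongr; exact hp.2.le
      _ ≤ _ := by rw [sum_const, nsmul_eq_mul]; gcongr; exact filter_subset _ _
  have h3 : (#n.primeFactors : ℝ) * log 2 ≤ log n := by
    rw [← log_pow]
    refine log_le_log po ?_
    have : 2^(#n.primeFactors) ≤ n := (Finset.pow_card_le_prod _ _ _ fun p hp => (Nat.prime_of_mem_primeFactors hp).two_le).trans
      (Nat.le_of_dvd (Nat.pos_of_ne_zero hn) (Nat.prod_primeFactors_dvd n))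
    exact_mod_cast this
  have h4 : (#n.primeFactors : ℝ) ≤ 2 * exp (2*Y) := by nlinarith only [h, h3, log_two_gt_d9]
  have h5 : (#n.primeFactors : ℝ) * exp (-(3*Y)) ≤ 2 := by
    calc _ ≤ 2 * exp (2*Y) * exp (-(3*Y)) := by gcongr
      _ = 2 * exp (-Y) := by rw [mul_assoc, ← exp_add]; ring_nf
      _ ≤ 2 := by have := exp_le_one_iff.2 (show -Y ≤ 0 by linarith); linarith
  have h6 : log (3*Y) ≤ 2 + log Y := by
    rw [log_mul nu li]
    have := log_le_sub_one_of_pos (show §0 < 3 by norm_num); linarith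
  linarith
theorem shifted : ∃ K C T0 : ℝ, 400 ≤ K ∧ 1 ≤ C ∧ 1 ≤ T0 ∧ ∀ t T : ℝ, T0 ≤ T → 1 < t → log (log t) = T → ∀ d : ℕ, d ≠ 0 → §d ≤ 2 * √t →
    ∀ I : Finset ℕ, (∀ p ∈ I, p.Prime ∧ LL p ≤ T - log (K * T)) → ∀ Q : Finset ℕ,
    (∀ q ∈ Q, q.Prime ∧ √t < q ∧ §q ≤ t ∧ d ∣ q + 1 ∧ ∀ p ∈ I, ¬ p ∣ q°/d) →
    ¢Q ≤ C * T^2 * (t * exp (-T)) * exp (-∑ p ∈ I, 1/§p) / d := by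
  obtain ⟨Ks, hKs, hS⟩ := sieve
  obtain ⟨C, hC, -, -, hM⟩ := mertens
  obtain ⟨C', hC', hD⟩ := sum_div
  set K := 4 * (Ks + 100) with hK
  refine ⟨K, 9 * exp (C + C') * K, max 10 (3*K), li, ?_, le_max_of_le_left nu, ?_⟩
  · have := one_le_exp (show 0 ≤ C + C' by linarith); nlinarith
  intro t T hT0 ht hT d hd hdt I hI Q hQ
  have hT10 : 10 ≤ T := (le_max_left _ _).trans hT0
  have hT3 : 3*K ≤ T := (le_max_right _ _).trans hT0
  have K4 : 400 ≤ K := li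
  have hlog : log t = exp T := by rw [← hT, exp_log (log_pos ht)]
  have KT : 0 < K * T := po
  set ly := exp T / (K * T) with hly
  set y := exp ly
  have e3 : T^3/6 ≤ exp T := by
    have := pow_div_factorial_le_exp T li 3; simpa [Nat.factorial] using this
  have hly1 : 2 ≤ ly := by
    rw [le_div_iff₀ KT]
    have : K*T ≤ T*T/3 := by nlinarith only [hT3, hT10]
    have : T^2*10 ≤ T^3 := by nlinarith only [hT10, sq_nonneg T]
    nlinarith
  have llly : log ly = T - log (K*T) := by rw [hly, log_div (exp_pos _).ne' KT.ne', log_exp]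
  have hy2 : 2 ≤ y := by have := add_one_le_exp ly; linarith
  have lKT : 0 ≤ log (K*T) := log_nonneg (by nlinarith only [hKs, hT3, KT, hT10])
  have t0 : 0 < t := li
  have st : y ≤ √t := by
    apply le_sqrt_of_sq_le
    rw [← exp_log t0, hlog, ← exp_nat_mul, exp_le_exp]
    push_cast
    rw [hly, ← mul_div_assoc, div_le_iff₀ KT]
    have : 2 ≤ K*T := by nlinarith only [hKs, hT3, hT10]
    nlinarith only [this, exp_pos T]
  have sq := sq_sqrt t0.le
  have st4 : 4 ≤ √t := by have := add_one_le_exp ly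
                          have h3 : 1 + ly + ly^2/2 ≤ exp ly := quadratic_le_exp_of_nonneg li
                          nlinarith only [hly1, st, h3]
  have d0 : §0 < d := mod_cast Nat.pos_of_ne_zero hd
  set X := ⌊t°/d⌋₊ + 1
  have X1 : √t/2 ≤ X := by
    have h1 := Nat.lt_floor_add_one (t°/d)
    have : √t/2 ≤ t°/d := by rw [le_div_iff₀ d0]; nlinarith only [sq, hdt]
    push_cast [X]; linarith
  have X2 : §X ≤ 3*t/d := by
    have h1 := Nat.floor_le (show 0 ≤ t°/d by positivity)
    push_cast [X]
    have : t°/d + 1 ≤ 3*t/d := by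
      rw [div_add_one d0.ne']; gcongr; nlinarith only [ht, sq, hdt, st4]
    linarith
  have Xlog : log t / 4 ≤ log X := by
    have h1 : log (√t/2) ≤ log X := log_le_log po X1
    have h2 : log (√t) / 2 ≤ log (√t/2) := by
      rw [log_div po nu]
      have : log 4 ≤ log √t := log_le_log nu st4
      have : log §4 = 2 * log 2 := by rw [show §4 = 2^2 by norm_num, log_pow]; norm_num
      linarith
    rw [log_sqrt t0.le] at h2; linarith
  have hex : ∀ p : ℕ, ∃ c : ℕ, p.Prime → ¬ p ∣ d → c < p ∧ c ≠ 0 ∧ ∀ b : ℕ, 1 ≤ d * b → b % p = c → p ∣ d * b - 1 := by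
    intro p
    by_cases h : p.Prime ∧ ¬ p ∣ d
    · obtain ⟨hp, hpd⟩ := h
      have hc : Nat.Coprime d p := ((Nat.Prime.coprime_iff_not_dvd hp).2 hpd).symm
      obtain ⟨c, hc1, hc2⟩ := Nat.exists_mul_mod_eq_one_of_coprime hc hp.one_lt
      refine ⟨c, fun _ _ => ⟨hc1, ?_, fun b hb hbc => ?_⟩⟩
      · rintro rfl; simp at hc2
      · have : d * b ≡ 1 [MOD p] := by
          rw [Nat.ModEq, Nat.mul_mod, hbc, Nat.mod_mul_mod, hc2, Nat.mod_eq_of_lt hp.one_lt]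
        exact (Nat.modEq_iff_dvd' hb).1 this.symm
    · exact ⟨0, fun h1 h2 => absurd ⟨h1, h2⟩ h⟩
  choose c hc using hex
  let R : ℕ → Finset ℕ := fun p => (if p ∣ d then ∅ else {c p}) ∪ (if p ∈ I then {0} else ∅)
  set P := PR ⌊y⌋₊
  have hPy : ∀ p ∈ P, p.Prime ∧ §p ≤ y := fun p hp => by
    simp only [P, mem_filter, mem_range, Nat.lt_succ_iff] at hp
    exact ⟨hp.2, (Nat.le_floor_iff po).1 hp.1⟩
  have hIP : I ⊆ P := fun p hp => by
    simp only [P, mem_filter, mem_range, Nat.lt_succ_iff]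
    refine ⟨Nat.le_floor ?_, (hI p hp).1⟩
    have := (hI p hp).2
    rw [← llly, LL_le_iff (hI p hp).1.two_le, ee, exp_log li] at this
    exact this
  have hcard : ∀ p ∈ P, ¢(R p) = 1 - (if p ∣ d then 1 else 0) + (if p ∈ I then 1 else 0) := fun p hp => by
    have hp1 := (hPy p hp).1
    simp only [R]
    split_ifs with h1 h2 h2
    · simp
    · simp
    · have := (hc p hp1 h1).2.1
      rw [card_union_of_disjoint (by simpa using this)]; simp; norm_num
    · simp
  have h := hS T li y hy2 (by rw [log_exp, llly]; linarith) X (by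
    refine le_trans ?_ Xlog
    rw [log_exp, hly, hlog, ← mul_div_assoc, div_le_iff₀ KT]
    have : 0 < T * exp T := po
    nlinarith only [this]) P R (fun p hp => ⟨(hPy p hp).1, (hPy p hp).2, fun r hr => by
      simp only [R, mem_union] at hr
      rcases hr with hr | hr
      · split_ifs at hr with h1
        · simp at hr
        · rw [mem_singleton.1 hr]; exact (hc p (hPy p hp).1 h1).1
      · split_ifs at hr with h1
        · rw [mem_singleton.1 hr]; exact (hPy p hp).1.pos
        · simp at hr, by
      have := hcard p hp
      have h2 : ¢(R p) ≤ 3 := by rw [this]; split_ifs <;> norm_num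
      exact_mod_cast h2⟩)
  have hQle : #Q ≤ #{n ∈ range X | ∀ p ∈ P, n % p ∉ R p} := by
    refine card_le_card_of_injOn (fun q => q°/d) (fun q hq => ?_) (fun q hq q' hq' he => ?_)
    · obtain ⟨h1, h2, h3, h4, h5⟩ := hQ q hq
      obtain ⟨b, hb⟩ := h4
      have e : q°/d = b := by rw [hb]; exact Nat.mul_div_cancel_left b (Nat.pos_of_ne_zero hd)
      simp only [coe_filter, Set.mem_ofPred_eq, mem_range, e] at h5 ⊢
      constructor
      · refine Nat.lt_succ_of_le (Nat.le_floor ?_)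
        rw [le_div_iff₀ d0]
        have : ((q+1:ℕ):ℝ) = (d*b:ℕ) := by rw [hb]
        push_cast at this; linarith only [h3, this]
      · intro p hp hm
        obtain ⟨hp1, hp2⟩ := hPy p hp
        simp only [R, mem_union] at hm
        rcases hm with hm | hm
        · split_ifs at hm with h6
          · simp at hm
          · have := (hc p hp1 h6).2.2 b om (mem_singleton.1 hm)
            rw [← hb, Nat.add_sub_cancel, Nat.prime_dvd_prime_iff_eq hp1 h1] at this
            rw [this] at hp2; linarith only [st, h2, hp2]
        · split_ifs at hm with h6
          · exact h5 p h6 (Nat.dvd_of_mod_eq_zero (mem_singleton.1 hm))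
          · simp at hm
    · have h1 := Nat.div_mul_cancel (hQ q hq).2.2.2.1
      have h2 := Nat.div_mul_cancel (hQ q' hq').2.2.2.1
      simp only at he
      rw [he] at h1; omega
  have hsum : T - log (K*T) - C - (log T + C') + ∑ p ∈ I, 1/§p ≤ ∑ p ∈ P, ¢(R p)/p := by
    have e1 : ∑ p ∈ P, ¢(R p)/p = ∑ p ∈ P, 1/§p - (∑ p ∈ P with p ∣ d, 1/§p) + ∑ p ∈ I, 1/§p := by
      have : ∑ p ∈ I, 1/§p = ∑ p ∈ P, if p ∈ I then 1/§p else 0 := by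
        rw [← sum_filter]; congr 1; ext p; simp only [mem_filter]
        exact ⟨fun h => ⟨hIP h, h⟩, fun h => h.2⟩
      rw [this, sum_filter (s := P) (p := fun p => p ∣ d), ← sum_sub_distrib, ← sum_add_distrib]
      refine sum_congr rfl fun p hp => ?_
      rw [hcard p hp]; split_ifs <;> ring
    have h2 : ∑ p ∈ P with p ∣ d, 1/§p ≤ log T + C' := by
      refine le_trans (sum_le_sum_of_subset_of_nonneg ?_ fun _ _ _ => po) (hD T d (by linarith only [hKs, hT3]) hd ?_)
      · intro p hp
        simp only [mem_filter] at hp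
        exact Nat.mem_primeFactors.2 ⟨(hPy p hp.1).1, hp.2, hd⟩
      · have h3 : §d ≤ t := by nlinarith only [sq, hdt, st4]
        calc log d ≤ log t := log_le_log d0 h3
          _ = exp T := hlog
          _ ≤ _ := exp_le_exp.2 li
    have h3 := hM 0 (T - log (K*T)) nu (by rw [← llly]; exact log_nonneg (by linarith only [hly1])) P (fun p hp h4 h5 => by
      rw [← llly, LL_le_iff hp.two_le, ee, exp_log li] at h5
      simp only [P, mem_filter, mem_range, Nat.lt_succ_iff]
      exact ⟨Nat.le_floor h5, hp⟩)
    linarith only [e1, h2, h3]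
  calc ¢Q ≤ _ := mod_cast hQle
    _ ≤ _ := h
    _ ≤ 3 * (3*t/d) * exp (-(T - log (K*T) - C - (log T + C') + ∑ p ∈ I, 1/§p)) := by gcongr
    _ = _ := by
      rw [show -(T - log (K*T) - C - (log T + C') + ∑ p ∈ I, 1/§p) = -T + log (K*T) + (C + C') + log T + -∑ p ∈ I, 1/§p by ring,
        exp_add, exp_add, exp_add, exp_add, exp_log KT, exp_log (by linarith only [hKs, hT3])]
      ring
def Om (I : Finset ℕ) (n : ℕ) : ℕ := ∑ p ∈ I, n.factorization p
lemma Om_mul (I : Finset ℕ) {a b : ℕ} (ha : a ≠ 0) (hb : b ≠ 0) : Om I (a*b) = Om I a + Om I b := by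
  simp [Om, Nat.factorization_mul ha hb, sum_add_distrib]
lemma Om_prime {I : Finset ℕ} {p : ℕ} (hp : p.Prime) : Om I p = if p ∈ I then 1 else 0 := by
  simp [Om, hp.factorization, Finsupp.single_apply]
lemma Om_mono {I J : Finset ℕ} (h : I ⊆ J) (n : ℕ) : Om I n ≤ Om J n := sum_le_sum_of_subset h
lemma ipart (I : Finset ℕ) (n : ℕ) : ∃ d b : ℕ, n ≠ 0 → n = d * b ∧ (∀ p, p.Prime → p ∣ d → p ∈ I) ∧ (∀ p ∈ I, p.Prime → ¬ p ∣ b) := by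
  induction n using induction_on_primes with
  | zero => exact ⟨0, 0, fun h => absurd rfl h⟩
  | one => exact ⟨1, 1, fun _ => ⟨rfl, fun p hp h => absurd (Nat.dvd_one.1 h) hp.one_lt.ne', fun p _ hp h => hp.one_lt.ne' (Nat.dvd_one.1 h)⟩⟩
  | prime_mul r n hr ih =>
    obtain ⟨d, b, h⟩ := ih
    by_cases hI : r ∈ I
    · refine ⟨r*d, b, fun hn => ?_⟩
      obtain ⟨h1, h2, h3⟩ := h (right_ne_zero_of_mul hn)
      refine ⟨by rw [h1, mul_assoc], fun p hp hd => ?_, h3⟩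
      rcases hp.dvd_mul.1 hd with h | h
      · rwa [(Nat.prime_dvd_prime_iff_eq hp hr).1 h]
      · exact h2 p hp h
    · refine ⟨d, r*b, fun hn => ?_⟩
      obtain ⟨h1, h2, h3⟩ := h (right_ne_zero_of_mul hn)
      refine ⟨by rw [h1, mul_left_comm], h2, fun p hpI hp hd => ?_⟩
      rcases hp.dvd_mul.1 hd with h | h
      · rw [(Nat.prime_dvd_prime_iff_eq hp hr).1 h] at hpI; exact hI hpI
      · exact h3 p hpI hp h
lemma Om_zero {I : Finset ℕ} {b : ℕ} (h : ∀ p ∈ I, p.Prime → ¬ p ∣ b) : Om I b = 0 :=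
  sum_eq_zero fun p hp => by
    by_cases h1 : p.Prime
    · exact Nat.factorization_eq_zero_of_not_dvd (h p hp h1)
    · exact Nat.factorization_eq_zero_of_not_prime b h1
lemma gm_Om {I : Finset ℕ} (ρ : ℝ) {d : ℕ} (hd : d ≠ 0) (h : ∀ p, p.Prime → p ∣ d → p ∈ I) : gm (fun _ => ρ) d = ρ ^ Om I d := by
  rw [gm, prod_pow_eq_pow_sum, Om]; congr 1
  refine sum_subset (fun p hp => h p (Nat.prime_of_mem_primeFactors hp) (Nat.dvd_of_mem_primeFactors hp)) fun p _ hp => ?_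
  exact Finsupp.notMem_support_iff.1 hp
lemma exists_dvd (I : Finset ℕ) {n : ℕ} (hn : n ≠ 0) (k : ℕ) (hk : k ≤ Om I n) :
    ∃ d, d ∣ n ∧ (∀ p, p.Prime → p ∣ d → p ∈ I) ∧ Om I d = k := by
  induction k with
  | zero => exact ⟨1, one_dvd _, fun p hp h => absurd (Nat.dvd_one.1 h) hp.one_lt.ne', by simp [Om]⟩
  | succ k ih =>
    obtain ⟨d, ⟨e, rfl⟩, h1, h2⟩ := ih om
    have hd := left_ne_zero_of_mul hn
    have he := right_ne_zero_of_mul hn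
    rw [Om_mul I hd he] at hk
    by_cases h : ∀ p ∈ I, p.Prime → ¬ p ∣ e
    · rw [Om_zero h] at hk; omega
    push Not at h
    obtain ⟨p, hpI, hp, hpe⟩ := h
    refine ⟨d*p, Nat.mul_dvd_mul_left d hpe, fun q hq hqd => ?_, ?_⟩
    · rcases hq.dvd_mul.1 hqd with h | h
      · exact h1 q hq h
      · rwa [(Nat.prime_dvd_prime_iff_eq hq hp).1 h]
    · rw [Om_mul I hd hp.ne_zero, h2, Om_prime hp, if_pos hpI]
theorem shifted2 : ∃ K C T0 : ℝ, 400 ≤ K ∧ 1 ≤ C ∧ 1 ≤ T0 ∧ ∀ t T : ℝ, T0 ≤ T → 1 < t → log (log t) = T → ∀ I Q : Finset ℕ,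
    (∀ p ∈ I, p.Prime) → (∀ q ∈ Q, q.Prime ∧ √t < q ∧ §q ≤ t) →
    (∀ ρ : ℝ, 0 ≤ ρ → ρ ≤ 2 → (∀ p ∈ I, 4 ≤ p ∧ LL p ≤ T - log (K * T)) →
      (∀ q ∈ Q, ∀ d, d ∣ q + 1 → (∀ p, p.Prime → p ∣ d → p ∈ I) → §d ≤ 2 * √t) →
      ∑ q ∈ Q, ρ ^ Om I q° ≤ C * T^2 * (t * exp (-T)) * exp ((ρ - 1) * ∑ p ∈ I, 1/§p)) ∧
    (∀ k : ℕ, (∀ q ∈ Q, 2 * k ≤ Om I q°) → ¢Q ≤ C * T^2 * (t * exp (-T)) * ((2/3:ℝ)^k * exp (3 * ∑ p ∈ I, 1/§p))) := by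
  obtain ⟨K, C, T0, hK, hC, hT0, hS⟩ := shifted
  obtain ⟨C1, hC1, hE⟩ := EP1
  refine ⟨K, C * exp C1, T0, hK, by nlinarith [one_le_exp (show 0 ≤ C1 by linarith)], hT0, fun t T hT ht htT I Q hI hQ => ⟨?_, ?_⟩⟩
  · intro ρ hρ hρ2 hI2 hd
    choose d b hdb using ipart I
    have hq0 : ∀ q : ℕ, q + 1 ≠ 0 := fun q => om
    have hd0 : ∀ q : ℕ, d q° ≠ 0 := fun q h => by have := (hdb q° (hq0 q)).1; rw [h] at this; omega
    have hb0 : ∀ q : ℕ, b q° ≠ 0 := fun q h => by have := (hdb q° (hq0 q)).1; rw [h] at this; omega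
    have hdd : ∀ q : ℕ, d q° ∣ q + 1 := fun q => ⟨_, (hdb q° (hq0 q)).1⟩
    set D := Q.image fun q => d q° with hD
    have e1 : ∀ q : ℕ, ρ ^ Om I q° = ρ ^ Om I (d q°) := fun q => by
      conv_lhs => rw [(hdb q° (hq0 q)).1, Om_mul I (hd0 q) (hb0 q), Om_zero (hdb q° (hq0 q)).2.2]
      simp
    set B := C * T^2 * (t * exp (-T)) * exp (-∑ p ∈ I, 1/§p) with hB
    have B0 : 0 ≤ B := po
    calc ∑ q ∈ Q, ρ ^ Om I q° = ∑ e ∈ D, ∑ q ∈ Q with d q° = e, ρ ^ Om I q° :=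
          (sum_fiberwise_of_maps_to (fun q hq => mem_image_of_mem _ hq) _).symm
      _ ≤ ∑ e ∈ D, B * gm (fun p => ρ / p) e := by
        refine sum_le_sum fun e he => ?_
        obtain ⟨q0, hq0Q, rfl⟩ := mem_image.1 he
        rw [gm_div (fun _ => ρ) (hd0 q0), gm_Om ρ (hd0 q0) (hdb _ (hq0 q0)).2.1]
        have h1 := hS t T hT ht htT (d q0°) (hd0 q0) (hd q0 hq0Q _ (hdd q0) (hdb _ (hq0 q0)).2.1) I
          (fun p hp => ⟨hI p hp, (hI2 p hp).2⟩) (Q.filter fun q => d q° = d q0°) (fun q hq => by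
            obtain ⟨h1, h2⟩ := mem_filter.1 hq
            refine ⟨(hQ q h1).1, (hQ q h1).2.1, (hQ q h1).2.2, h2 ▸ hdd q, fun p hp => ?_⟩
            rw [← h2, Nat.div_eq_of_eq_mul_right (Nat.pos_of_ne_zero (hd0 q)) (hdb _ (hq0 q)).1]
            exact (hdb _ (hq0 q)).2.2 p hp (hI p hp))
        calc ∑ q ∈ Q with d q° = d q0°, ρ ^ Om I q° = ∑ q ∈ Q with d q° = d q0°, ρ ^ Om I (d q0°) :=
              sum_congr rfl fun q hq => by rw [e1, (mem_filter.1 hq).2]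
          _ = ρ ^ Om I (d q0°) * #{q ∈ Q | d q° = d q0°} := by rw [sum_const, nsmul_eq_mul, mul_comm]
          _ ≤ ρ ^ Om I (d q0°) * (B / d q0°) := by gcongr
          _ = _ := by ring
      _ = B * ∑ e ∈ D, gm (fun p => ρ / p) e := by rw [mul_sum]
      _ ≤ B * exp (∑ p ∈ I, ρ / p + C1) := by
        refine mul_le_mul_of_nonneg_left (hE I D _ (fun e he => ?_) fun p hp => ?_) B0
        · obtain ⟨q0, hq0Q, rfl⟩ := mem_image.1 he
          exact ⟨hd0 q0, (hdb _ (hq0 q0)).2.1⟩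
        · have p4 : §4 ≤ p := mod_cast (hI2 p hp).1
          have p0 : §0 < p := li
          refine ⟨po, by rw [div_le_iff₀ p0]; linarith, ?_⟩
          have h1 : §p^(3/2:ℝ) ≤ §p^(2:ℕ) := by
            rw [← rpow_natCast]; exact rpow_le_rpow_of_exponent_le li nu
          have h2 : ρ^2 ≤ 4 := by nlinarith
          rw [div_pow, mul_one_div]; gcongr
      _ = _ := by
        rw [hB, show (ρ-1) * ∑ p ∈ I, 1/§p = -∑ p ∈ I, 1/§p + ∑ p ∈ I, ρ / p by rw [sub_mul, mul_sum]; simp only [mul_one_div]; ring, exp_add, exp_add]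
        ring
  · intro k hk
    have t0 : 0 < t := li
    have hex : ∀ q : ℕ, ∃ d, q ∈ Q → d ∣ q+1 ∧ (∀ p, p.Prime → p ∣ d → p ∈ I) ∧ Om I d = k ∧ §d ≤ 2 * √t := by
      intro q
      by_cases hq : q ∈ Q
      · obtain ⟨d1, ⟨e, he⟩, h1, h2⟩ := exists_dvd I (show q+1 ≠ 0 by omega) k (by have := hk q hq; omega)
        have hd0 : d1 ≠ 0 := by rintro rfl; simp at he
        have he0 : e ≠ 0 := by rintro rfl; simp at he
        have h3 : k ≤ Om I e := by have := hk q hq; rw [he, Om_mul I hd0 he0] at this; omega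
        obtain ⟨d2, h4, h5, h6⟩ := exists_dvd I he0 k h3
        have h7 := Nat.le_of_dvd (Nat.pos_of_ne_zero he0) h4
        have hle : d1 * d2 ≤ q + 1 := he ▸ Nat.mul_le_mul_left d1 h7
        have hqt : §q + 1 ≤ 4 * t := by linarith [(hQ q hq).2.2]
        have hm : ∀ d : ℕ, d * d ≤ q+1 → §d ≤ 2 * √t := fun d h => by
          refine abs_le_of_sq_le_sq' ?_ po |>.2
          rw [mul_pow, sq_sqrt t0.le]
          have : ((d*d:ℕ):ℝ) ≤ (q+1:ℕ) := mod_cast h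
          push_cast at this; nlinarith
        rcases le_total d1 d2 with h | h
        · exact ⟨d1, fun _ => ⟨⟨e, he⟩, h1, h2, hm d1 (by nlinarith)⟩⟩
        · exact ⟨d2, fun _ => ⟨h4.trans ⟨d1, by rw [he, mul_comm]⟩, h5, h6, hm d2 (by nlinarith)⟩⟩
      · exact ⟨0, fun h => absurd h hq⟩
    choose d hd using hex
    have hd0 : ∀ q ∈ Q, d q ≠ 0 := fun q hq h => by have := (hd q hq).1; rw [h] at this; simp at this
    set D := Q.image d with hD
    set B := C * T^2 * (t * exp (-T)) with hB
    have B0 : 0 ≤ B := po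
    have hs := EP I D (fun p => (3/2:ℝ)/p) (fun e he => by
      obtain ⟨q, hq, rfl⟩ := mem_image.1 he
      exact ⟨hd0 q hq, (hd q hq).2.1⟩) (fun p hp => by
        have : §2 ≤ p := mod_cast (hI p hp).two_le
        exact ⟨po, by rw [div_lt_iff₀ li]; linarith⟩)
    have hs2 : ∏ p ∈ I, (1 - (3/2:ℝ)/p)⁻¹ ≤ exp (3 * ∑ p ∈ I, 1/§p) := by
      rw [mul_sum, exp_sum]
      refine prod_le_prod (fun p hp => ?_) fun p hp => ?_
      all_goals
        have : §2 ≤ p := mod_cast (hI p hp).two_le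
        have h34 : (3/2:ℝ)/p ≤ 3/4 := by rw [div_le_iff₀ li]; linarith
      · exact inv_nonneg.2 li
      · refine (inv_one_sub_le2 po h34).trans (exp_le_exp.2 (le_of_eq (by ring)))
    calc ¢Q = ∑ e ∈ D, (#{q ∈ Q | d q = e} : ℝ) := by
          exact_mod_cast card_eq_sum_card_image d Q
      _ ≤ ∑ e ∈ D, B * (2/3:ℝ)^k * gm (fun p => (3/2:ℝ)/p) e := by
        refine sum_le_sum fun e he => ?_
        obtain ⟨q0, hq, rfl⟩ := mem_image.1 he
        rw [gm_div (fun _ => (3/2:ℝ)) (hd0 q0 hq), gm_Om _ (hd0 q0 hq) (hd q0 hq).2.1, (hd q0 hq).2.2.1]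
        have h1 := hS t T hT ht htT (d q0) (hd0 q0 hq) (hd q0 hq).2.2.2 ∅ si (Q.filter fun q => d q = d q0) (fun q hq' => by
            obtain ⟨h1, h2⟩ := mem_filter.1 hq'
            exact ⟨(hQ q h1).1, (hQ q h1).2.1, (hQ q h1).2.2, h2 ▸ (hd q h1).1, si⟩)
        refine h1.trans (le_of_eq ?_)
        have : (2/3:ℝ)^k * (3/2)^k = 1 := by rw [← mul_pow]; norm_num
        simp only [sum_empty, neg_zero, exp_zero, mul_one]
        rw [mul_div_assoc', mul_assoc B, this, mul_one]
      _ = B * (2/3:ℝ)^k * ∑ e ∈ D, gm (fun p => (3/2:ℝ)/p) e := by rw [mul_sum]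
      _ ≤ B * (2/3:ℝ)^k * exp (3 * ∑ p ∈ I, 1/§p) := by gcongr; exact hs.trans hs2
      _ ≤ exp C1 * (B * (2/3:ℝ)^k * exp (3 * ∑ p ∈ I, 1/§p)) := le_mul_of_one_le_left po (one_le_exp li)
      _ = _ := by rw [hB]; ring
lemma mk_up (J : Finset ℕ) (o : ℕ → ℕ) {B η ℓ s : ℝ} (h0 : 0 ≤ η) (hs : 0 ≤ s) (h : ∑ q ∈ J, (1+η)^(o q) ≤ B * exp (η * ℓ)) (ho : ∀ q ∈ J, s ≤ o q) :
    ¢J ≤ B * exp (η*ℓ - s*(η - η^2/2)) := by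
  have h1 : ∀ q ∈ J, exp (s*(η - η^2/2)) ≤ (1+η)^(o q) := fun q hq => by
    rw [← exp_log (show 0 < 1+η by linarith), ← exp_nat_mul, exp_le_exp]
    have h2 := Real.le_log_one_add_of_nonneg h0
    have h3 : η - η^2/2 ≤ 2*η/(η+2) := by rw [le_div_iff₀ li]; nlinarith [mul_nonneg h0 (sq_nonneg η)]
    have h4 : 0 ≤ log (1+η) := log_nonneg li
    calc _ ≤ s * log (1+η) := by gcongr; linarith
      _ ≤ _ := by gcongr; exact ho q hq
  have h2 := (card_nsmul_le_sum J _ _ h1).trans h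
  rw [nsmul_eq_mul] at h2
  rw [exp_sub, ← mul_div_assoc, le_div_iff₀ (exp_pos _)]; exact h2
lemma mk_lo (J : Finset ℕ) (o : ℕ → ℕ) {B η ℓ s : ℝ} (h0 : 0 ≤ η) (hη : η ≤ 1/2) (h : ∑ q ∈ J, (1-η)^(o q) ≤ B * exp (-η * ℓ)) (ho : ∀ q ∈ J, o q ≤ s) :
    ¢J ≤ B * exp (-η*ℓ + s*(η + η^2)) := by
  have h1 : ∀ q ∈ J, exp (-(s*(η + η^2))) ≤ (1-η)^(o q) := fun q hq => by
    have h2 := inv_one_sub_le1 h0 hη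
    rw [inv_le_comm₀ li (exp_pos _), ← exp_neg] at h2
    calc _ ≤ exp (o q * -(η + η^2)) := by rw [exp_le_exp, mul_neg]; have := ho q hq; gcongr
      _ = exp (-(η + η^2)) ^ o q := by rw [exp_nat_mul]
      _ ≤ _ := by gcongr
  have h2 := (card_nsmul_le_sum J _ _ h1).trans h
  rw [nsmul_eq_mul, exp_neg, ← div_eq_mul_inv, div_le_iff₀ (exp_pos _)] at h2
  rw [exp_add]; linarith
noncomputable def II (a b : ℝ) : Finset ℕ := {p ∈ PR ⌊ee b⌋₊ | a < LL p ∧ LL p ≤ b}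
lemma mem_II {a b : ℝ} {p : ℕ} : p ∈ II a b ↔ p.Prime ∧ a < LL p ∧ LL p ≤ b := by
  simp only [II, mem_filter, mem_range, Nat.lt_succ_iff]
  refine ⟨fun h => ⟨h.1.2, h.2⟩, fun h => ⟨⟨Nat.le_floor ((LL_le_iff h.1.two_le b).1 h.2.2), h.1⟩, h.2⟩⟩
lemma LL_gt {p : ℕ} (hp : 2 ≤ p) : -1 < LL p := by
  have h2 : log 2 ≤ log p := log_le_log nu (mod_cast hp)
  rw [LL, lt_log_iff_exp_lt (by linarith [log_two_gt_d9])]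
  have : exp (-1) < 0.5 := by
    rw [exp_neg, inv_lt_comm₀ (exp_pos _) nu]; linarith [exp_one_gt_d9]
  linarith [log_two_gt_d9]
lemma ee1 : 4 ≤ ee 1 := by
  have h5 := quadratic_le_exp_of_nonneg (exp_pos 1).le
  rw [ee]; nlinarith [exp_one_gt_d9]
def Nrm (Y : ℝ) (q : ℕ) : Prop := (∀ a : ℕ, log Y ≤ a → §a ≤ Y + 2 →
    (§a ≤ LL q → a - log Y - LL q / log Y ^ 4 ≤ Om (II (log Y) a) q°) ∧
    (Om (II (log Y) a) q° ≤ min §a (LL q) - log Y + LL q / log Y ^ 4)) ∧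
  ∃ p : ℕ, p.Prime ∧ p ∣ q + 1 ∧ log q ≤ Y^2 * log p
lemma log_le_Om {I : Finset ℕ} {d : ℕ} {l : ℝ} (hd0 : d ≠ 0) (h : ∀ p, p.Prime → p ∣ d → p ∈ I) (hl : ∀ p ∈ I, p ∣ d → log p ≤ l) :
    log d ≤ Om I d * l := by
  have : §d = ∏ p ∈ d.primeFactors, §p^d.factorization p := by
    conv_lhs => rw [← Nat.factorization_prod_pow_eq_self hd0]
    rw [Finsupp.prod, Nat.support_factorization]; push_cast; rfl
  rw [this, log_prod (fun p hp => pow_ne_zero _ (mod_cast (Nat.prime_of_mem_primeFactors hp).ne_zero)), Om, Nat.cast_sum, sum_mul]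
  calc _ ≤ ∑ p ∈ d.primeFactors, (d.factorization p:ℝ) * l := sum_le_sum fun p hp => by
        rw [log_pow]; gcongr
        exact hl p (h p (Nat.prime_of_mem_primeFactors hp) (Nat.dvd_of_mem_primeFactors hp)) (Nat.dvd_of_mem_primeFactors hp)
    _ = _ := sum_subset (fun p hp => h p (Nat.prime_of_mem_primeFactors hp) (Nat.dvd_of_mem_primeFactors hp)) fun p _ hp => by
      rw [← Nat.support_factorization, Finsupp.notMem_support_iff] at hp; simp [hp]
set_option maxHeartbeats 2000000 in
theorem abn : ∃ Y0 : ℝ, 10 ≤ Y0 ∧ ∀ Y t : ℝ, Y0 ≤ Y → 1 < t → log Y ^ 20 - 1 ≤ log (log t) → log (log t) ≤ Y + 1 →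
    ∀ A : Finset ℕ, (∀ q ∈ A, q.Prime ∧ §q ≤ t ∧ ¬ Nrm Y q) → ¢A ≤ t / log t / Y^10 := by
  obtain ⟨K, C, T0, hK, hC, hT0, hS⟩ := shifted2
  obtain ⟨M, hM, hM1, hM2, hM3⟩ := mertens
  set D := 1000 + C + K + M + T0 with hD
  refine ⟨exp D, by linarith [add_one_le_exp D], fun Y t hY ht hT1 hT2 A hA => ?_⟩
  have Y0 : 0 < Y := (exp_pos _).trans_le hY
  set Λ := log Y with hΛ
  have hDΛ : D ≤ Λ := (le_log_iff_exp_le Y0).2 hY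
  have Ye : Y = exp Λ := (exp_log Y0).symm
  set T := log (log t) with hT
  have Λ1 : 1000 ≤ Λ := li
  have hlt : log t = exp T := by rw [hT, exp_log (log_pos ht)]
  have hp : ∀ n : ℕ, 1 ≤ Λ^n := fun n => one_le_pow₀ li
  set P := Λ^4 with hP
  have P1 : 10^9 * Λ ≤ P := by have := pow_le_pow_left₀ nu Λ1 3; rw [hP, pow_succ]; nlinarith only [this, hK, hC, hT0, hM, hDΛ]
  have P0 : 0 < P := li
  set u := T / P with hu
  have TuP : T = u * P := by rw [hu]; field_simp
  have hu2 : 10^9*Λ*P ≤ u := by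
    have h19 : 10^9 ≤ Λ^10 := le_trans nu (pow_le_pow_left₀ nu Λ1 10)
    have : 2 ≤ Λ := li
    rw [hu, le_div_iff₀ P0, hP]
    have : Λ^20 = Λ^10*Λ*Λ^9 := by ring
    have h8 := hp 9
    have : 10^9*2*Λ^9 ≤ Λ^10*Λ*Λ^9 := by gcongr
    rw [show 10^9*Λ*Λ^4*Λ^4 = 10^9*Λ^9 by ring]; linarith
  have hu1 : 10^9*P ≤ u := le_trans (by gcongr; linarith) hu2
  have hTu : 10^9*u ≤ T := by rw [TuP, mul_comm u]; gcongr <;> linarith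
  have uP : u ≤ T := li
  have hTY : T ≤ exp (2*Λ) := by
    have h2 : 2 ≤ Y := by rw [Ye]; linarith [add_one_le_exp Λ]
    rw [show 2*Λ = Λ + Λ by ring, exp_add, ← Ye]; linarith [mul_le_mul_of_nonneg_right h2 Y0.le]
  have Tpos : 0 < T := li
  have KT0 : 0 < K*T := po
  have KT4 : 400*T ≤ K*T := by gcongr
  have hlT : log T ≤ 2*Λ := by rw [← log_exp (2*Λ)]; exact log_le_log Tpos hTY
  have hlK : log (K*T) ≤ 3*Λ := by
    rw [log_mul li Tpos.ne']; have := log_le_sub_one_of_pos (show 0 < K by linarith); linarith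
  have hlK1 : 1 ≤ log (K*T) := by
    rw [le_log_iff_exp_le li]; linarith [exp_one_lt_d9]
  set A1 := ⌊T - log (K*T)⌋₊ with hA1
  have hA1' : §A1 ≤ T - log (K*T) := Nat.floor_le li
  have hA1'' : T - log (K*T) < A1 + 1 := Nat.lt_floor_add_one _
  have t0 : 0 < t := li
  set B := t * exp (-T) with hB
  have hBt : t / log t = B := by rw [hlt, hB, exp_neg]; rfl
  have B0 : 0 < B := po
  have hCT : C * T^2 ≤ exp (5*Λ) := by
    rw [show 5*Λ = Λ + 2*Λ + 2*Λ by ring, exp_add, exp_add]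
    have : C ≤ exp Λ := by linarith [add_one_le_exp Λ]
    rw [mul_assoc, pow_two]; gcongr
  set k1 := ⌊K*T/4⌋₊
  have hk1 : §k1 ≤ K*T/4 := Nat.floor_le po
  have hk1' : K*T/4 < k1 + 1 := Nat.lt_floor_add_one _
  set k2 := ⌊u/10⌋₊
  have hk2 : §k2 ≤ u/10 := Nat.floor_le po
  have hk2' : u/10 < k2 + 1 := Nat.lt_floor_add_one _
  have h23 : ∀ k : ℕ, (2/3:ℝ)^k ≤ exp (-(k/3)) := fun k => by
    have : (2/3:ℝ) ≤ exp (-(1/3)) := by linarith [add_one_le_exp (-(1/3:ℝ))]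
    calc (2/3:ℝ)^k ≤ exp (-(1/3))^k := by gcongr
      _ = _ := by rw [← exp_nat_mul]; congr 1; ring
  have I1 : ∀ p : ℕ, p.Prime → §p ≤ t + 1 → LL p ≤ T + 1 := fun p hp h => by
    have h2 : §2 ≤ p := mod_cast hp.two_le
    have e1 : exp 1 ≤ log t := by rw [hlt]; exact exp_le_exp.2 li
    have : log p ≤ 2 * log t := by
      rw [← log_rpow t0]; refine log_le_log li (h.trans ?_)
      have : 2 ≤ t := by linarith [log_le_sub_one_of_pos t0, exp_one_gt_d9]
      norm_cast; rw [pow_two]; linarith [mul_le_mul_of_nonneg_right this t0.le]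
    calc LL p ≤ log (2 * log t) := log_le_log (log_pos li) this
      _ = log 2 + T := log_mul nu (by linarith [exp_pos 1])
      _ ≤ _ := by linarith [log_two_lt_d9]
  set Q := A.filter fun q : ℕ => √t < q with hQ
  have hQ1 : ∀ q ∈ Q, q.Prime ∧ √t < q ∧ §q ≤ t := fun q hq =>
    ⟨(hA q (mem_filter.1 hq).1).1, (mem_filter.1 hq).2, (hA q (mem_filter.1 hq).1).2.1⟩
  have hQT : ∀ q ∈ Q, T - 1 ≤ LL q ∧ LL q ≤ T := fun q hq => by
    obtain ⟨h1, h2, h3⟩ := hQ1 q hq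
    have q2 : §2 ≤ q := mod_cast h1.two_le
    have ht1 := log_pos ht
    constructor
    · have : log t / 2 ≤ log q := by rw [← log_sqrt t0.le]; exact log_le_log (sqrt_pos.2 t0) h2.le
      calc T - 1 ≤ log (log t / 2) := by rw [log_div ht1.ne' nu]; linarith [log_two_lt_d9]
        _ ≤ _ := log_le_log li this
    · exact log_le_log (log_pos li) (log_le_log li h3)
  set E1 := Q.filter fun q => 2*k1 ≤ Om (II (-1) T°) q°
  set E2 := Q.filter fun q => 2*k2 ≤ Om (II A1 T°) q°
  set Q' := Q.filter fun q => ¬ 2*k1 ≤ Om (II (-1) T°) q°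
  set R := (range A1°).filter fun a : ℕ => Λ ≤ a
  set Up := fun a : ℕ => Q'.filter fun q => §a - Λ + u/2 ≤ Om (II Λ a) q°
  set Lo := fun a : ℕ => Q'.filter fun q => Om (II Λ a) q° ≤ §a - Λ - u/2
  have Iall : ∀ q ∈ Q, ∀ p, p.Prime → p ∣ q+1 → p ∈ II (-1) T° := fun q hq p hp hpd => by
    refine mem_II.2 ⟨hp, LL_gt hp.two_le, I1 p hp ?_⟩
    have := Nat.le_of_dvd om hpd
    have : §p ≤ (q+1:ℕ) := mod_cast this
    push_cast at this; linarith [(hQ1 q hq).2.2]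
  have hOm : ∀ q ∈ Q', (Om (II (-1) T°) q°:ℝ) ≤ K*T/2 := fun q hq => by
    have h := (mem_filter.1 hq).2
    push Not at h
    have : (Om (II (-1) T°) q°:ℝ) ≤ ((2*k1:ℕ):ℝ) := mod_cast h.le
    push_cast at this; linarith only [hk1, this]
  have cov : A ⊆ (A.filter fun q : ℕ => ¬ √t < q) ∪ (E1 ∪ E2 ∪ R.biUnion fun a => Up a ∪ Lo a) := by
    intro q hq
    by_contra hc
    simp only [mem_union, not_or, mem_biUnion, not_exists, not_and, mem_filter, hq, true_and, not_not] at hc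
    obtain ⟨hc1, ⟨hc2, hc3⟩, hc4⟩ := hc
    have hqQ : q ∈ Q := mem_filter.2 ⟨hq, hc1⟩
    have hqQ' : q ∈ Q' := mem_filter.2 ⟨hqQ, fun h => hc2 (mem_filter.2 ⟨hqQ, h⟩)⟩
    have hE2 : (Om (II A1 T°) q°:ℝ) ≤ u/5 := by
      have h : ¬ _ := fun h => hc3 (mem_filter.2 ⟨hqQ, h⟩)
      push Not at h
      have : (Om (II A1 T°) q°:ℝ) ≤ ((2*k2:ℕ):ℝ) := mod_cast h.le
      push_cast at this; linarith
    obtain ⟨hL1, hL2⟩ := hQT q hqQ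
    have hUL : ∀ a : ℕ, Λ ≤ a → a ≤ A1 → (Om (II Λ a) q°:ℝ) ≤ a - Λ + u/2 ∧ §a - Λ - u/2 ≤ Om (II Λ a) q° := fun a ha1 ha2 => by
      obtain ⟨h1, h2⟩ := hc4 a (mem_filter.2 ⟨mem_range.2 om, ha1⟩)
      exact ⟨le_of_not_ge fun h => h1 (mem_filter.2 ⟨hqQ', h⟩), le_of_not_ge fun h => h2 (mem_filter.2 ⟨hqQ', h⟩)⟩
    have hLu : u - 1 ≤ LL q / P := by
      rw [le_div_iff₀ P0, sub_mul, one_mul, ← TuP]; linarith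
    refine (hA q hq).2.2 ⟨fun a ha1 ha2 => ?_, ?_⟩
    · rw [← hΛ, ← hP]
      rcases le_total a A1 with ha | ha
      · obtain ⟨h1, h2⟩ := hUL a ha1 ha
        have : §a ≤ A1 := mod_cast ha
        rw [min_eq_left li]
        exact ⟨fun _ => li, li⟩
      · obtain ⟨h1, h2⟩ := hUL A1 li le_rfl
        have ha' : §A1 ≤ a := mod_cast ha
        have hm : §A1 ≤ min §a (LL q) := le_min ha' li
        refine ⟨fun h => ?_, ?_⟩
        · have h3 : (Om (II Λ A1) q°:ℝ) ≤ Om (II Λ a) q° := by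
            exact_mod_cast Om_mono (fun p hp => by
              rw [mem_II] at hp ⊢; exact ⟨hp.1, hp.2.1, hp.2.2.trans ha'⟩) _
          linarith
        · have h3 : Om (II Λ a) q° ≤ Om (II Λ A1) q° + Om (II A1 T°) q° := by
            unfold Om
            rw [← sum_union (disjoint_left.2 fun p h1 h2 => by rw [mem_II] at h1 h2; linarith [h1.2.2, h2.2.1])]
            refine sum_le_sum_of_ne_zero fun p hp h0 => ?_
            have hpp := mem_II.1 hp
            have := mem_II.1 (Iall q hqQ p hpp.1 (Nat.dvd_of_factorization_pos h0))
            rw [mem_union, mem_II, mem_II]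
            rcases le_or_gt (LL p) A1 with h | h
            · exact Or.inl ⟨hpp.1, hpp.2.1, h⟩
            · exact Or.inr ⟨hpp.1, h, this.2.2⟩
          have h4 : (Om (II Λ a) q°:ℝ) ≤ Om (II Λ A1) q° + Om (II A1 T°) q° := mod_cast h3
          linarith
    · have hne : q°.primeFactors.Nonempty := Nat.nonempty_primeFactors.2 (by have := (hQ1 q hqQ).1.pos; omega)
      obtain ⟨p, hp, hmax⟩ := exists_max_image _ (fun p : ℕ => p) hne
      have hpp := Nat.prime_of_mem_primeFactors hp
      refine ⟨p, hpp, Nat.dvd_of_mem_primeFactors hp, ?_⟩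
      have h1 := log_le_Om (d := q+1) (l := log p) om (Iall q hqQ) (fun r hr hrd => by
        have := mem_II.1 hr
        exact log_le_log (mod_cast this.1.pos) (mod_cast hmax r (Nat.mem_primeFactors.2 ⟨this.1, hrd, om⟩)))
      have h2 : log q ≤ log (q+1:ℕ) := log_le_log (mod_cast (hQ1 q hqQ).1.pos) (by push_cast; linarith only)
      have h3 : 0 ≤ log p := log_nonneg (mod_cast hpp.one_lt.le)
      have h4 : K*T/2 ≤ Y^2 := by
        have : K ≤ Y := by linarith [add_one_le_exp Λ]
        have : T ≤ 2 * Y := by linarith [add_one_le_exp Λ]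
        calc K*T/2 ≤ Y*(2*Y)/2 := by gcongr
          _ = Y^2 := by ring
      calc log q ≤ _ := h2
        _ ≤ _ := h1
        _ ≤ _ := by gcongr; exact (hOm q hqQ').trans h4
  have b0 : ¢(A.filter fun q : ℕ => ¬ √t < q) ≤ B * exp (-(12*Λ)) := by
    have h1 : #(A.filter fun q : ℕ => ¬ √t < q) ≤ ⌊√t⌋₊ := by
      rw [show ⌊√t⌋₊ = #(Icc 1 ⌊√t⌋₊) by simp]
      refine card_le_card fun q hq => ?_
      rw [mem_filter, not_lt] at hq
      exact mem_Icc.2 ⟨(hA q hq.1).1.pos, Nat.le_floor hq.2⟩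
    calc ¢(A.filter fun q : ℕ => ¬ √t < q) ≤ ⌊√t⌋₊ := mod_cast h1
      _ ≤ √t := Nat.floor_le (sqrt_nonneg _)
      _ = exp (exp T / 2) := by rw [← hlt, ← log_sqrt t0.le, exp_log (sqrt_pos.2 t0)]
      _ ≤ _ := by
        have hBe : B = exp (exp T + -T) := by rw [exp_add, ← hlt, exp_log t0]
        rw [hBe, ← exp_add, exp_le_exp]
        have h1 := quadratic_le_exp_of_nonneg Tpos.le
        have h2 : 100 * T ≤ T^2 := by rw [pow_two]; gcongr; linarith
        linarith
  have b1 : ¢E1 ≤ B * exp (-(12*Λ)) := by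
    have h := (hS t T li ht rfl (II (-1) T°) E1 (fun p hp => (mem_II.1 hp).1) (fun q hq => hQ1 q (mem_filter.1 hq).1)).2 k1 (fun q hq => (mem_filter.1 hq).2)
    have h1 := hM2 T° li (II (-1) T°) (fun p hp => ⟨(mem_II.1 hp).1, (mem_II.1 hp).2.2⟩)
    calc ¢E1 ≤ _ := h
      _ ≤ exp (5*Λ) * B * (exp (-(k1/3)) * exp (3 * (T+1+M))) := by gcongr; exact h23 k1
      _ = B * exp (5*Λ + (-(k1/3) + 3 * (T+1+M))) := by rw [exp_add, exp_add]; ring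
      _ ≤ _ := by gcongr; linarith
  have b2 : ¢E2 ≤ B * exp (-(12*Λ)) := by
    have h := (hS t T li ht rfl (II A1 T°) E2 (fun p hp => (mem_II.1 hp).1) (fun q hq => hQ1 q (mem_filter.1 hq).1)).2 k2 (fun q hq => (mem_filter.1 hq).2)
    have h1 := hM1 A1 T° li (II A1 T°) (fun p hp => mem_II.1 hp)
    calc ¢E2 ≤ _ := h
      _ ≤ exp (5*Λ) * B * (exp (-(k2/3)) * exp (3 * (T+1-A1+M))) := by gcongr; exact h23 k2
      _ = B * exp (5*Λ + (-(k2/3) + 3 * (T+1-A1+M))) := by rw [exp_add, exp_add]; ring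
      _ ≤ _ := by gcongr; linarith
  set η := 1/(16*P) with hη
  have η0 : 0 < η := po
  have η1 : η ≤ 1/2 := by rw [hη, div_le_iff₀ po]; linarith
  have eu : η * P = 1/16 := by rw [hη]; field_simp
  have eT : η * T = u/16 := by rw [TuP]; linear_combination u * eu
  have eu2 : 16*16*Λ ≤ η * u := by
    have : η * P * (16*16*16*Λ) ≤ η * u := by rw [mul_assoc]; gcongr; linarith
    rw [eu] at this; linarith
  have b3 : ∀ a ∈ R, ¢(Up a ∪ Lo a) ≤ B * exp (-(20*Λ)) * 2 * exp (5*Λ) := fun a ha => by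
    obtain ⟨ha1, ha2⟩ := mem_filter.1 ha
    have ha3 : §a ≤ A1 := by have := mem_range.1 ha1; exact_mod_cast (by omega : a ≤ A1)
    have hI1 : ∀ p ∈ II Λ a, 4 ≤ p ∧ LL p ≤ T - log (K*T) := fun p hp => by
      have h := mem_II.1 hp
      refine ⟨?_, li⟩
      by_contra hc
      have h4 : §p ≤ ee 1 := by
        have : §p ≤ 4 := mod_cast (by omega : p ≤ 4)
        exact this.trans ee1
      have := (LL_le_iff h.1.two_le 1).2 h4
      linarith [h.2.1]
    have hd : ∀ J, J ⊆ Q' → ∀ q ∈ J, ∀ d, d ∣ q + 1 → (∀ p, p.Prime → p ∣ d → p ∈ II Λ a) → §d ≤ 2 * √t := fun J hJ q hq d hdq hdI => by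
      have hd0 : d ≠ 0 := by rintro rfl; simp at hdq
      have h1 := log_le_Om (l := exp (T - log (K*T))) hd0 hdI (fun p hp _ => by
        have h := mem_II.1 hp
        rw [← log_le_iff_le_exp (log_pos (mod_cast h.1.one_lt))]; linarith [(hI1 p hp).2])
      have h2 : (Om (II Λ a) d : ℝ) ≤ K*T/2 := by
        refine le_trans ?_ (hOm q (hJ hq))
        have : Om (II Λ a) d ≤ Om (II Λ a) q° := sum_le_sum fun p _ => (Nat.factorization_le_iff_dvd hd0 om).2 hdq p
        have h' : II Λ a ⊆ II (-1) T° := fun p hp => by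
          have h := mem_II.1 hp
          exact mem_II.2 ⟨h.1, LL_gt h.1.two_le, li⟩
        exact_mod_cast this.trans (Om_mono h' _)
      have h3 : log d ≤ log √t := by
        rw [log_sqrt t0.le, hlt]
        calc log d ≤ _ := h1
          _ ≤ K*T/2 * exp (T - log (K*T)) := by gcongr
          _ = exp T/2 := by rw [exp_sub, exp_log KT0]; field_simp
      have := (log_le_log_iff (mod_cast Nat.pos_of_ne_zero hd0) (sqrt_pos.2 t0)).1 h3
      linarith [sqrt_nonneg t]
    set ℓ := ∑ p ∈ II Λ a, 1/§p with hℓ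
    have l1 : ℓ ≤ a - Λ + M := hM1 Λ a ha2 _ (fun p hp => mem_II.1 hp)
    have l2 : a - Λ - M ≤ ℓ := hM3 Λ a li ha2 _ (fun p h1 h2 h3 => mem_II.2 ⟨h1, h2, h3⟩)
    have l0 : 0 ≤ ℓ := sum_nonneg fun _ _ => po
    have c1 : ¢(Up a) ≤ B * exp (-(20*Λ)) * exp (5*Λ) := by
      have h := (hS t T li ht rfl (II Λ a) (Up a) (fun p hp => (mem_II.1 hp).1) (fun q hq => hQ1 q (mem_filter.1 (mem_filter.1 hq).1).1)).1
        (1+η) li li hI1 (hd _ (filter_subset _ _))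
      rw [add_sub_cancel_left] at h
      have h2 := mk_up _ _ η0.le (show 0 ≤ §a - Λ + u/2 by linarith) h (fun q hq => (mem_filter.1 hq).2)
      calc ¢(Up a) ≤ _ := h2
        _ ≤ exp (5*Λ) * B * exp (-(20*Λ)) := by
          gcongr
          have h3 : η * ℓ ≤ η * (a - Λ + M) := by gcongr
          have h4 : (a - Λ + u/2) * (η^2/2) ≤ 2*T * (η^2/2) := by gcongr; linarith
          have h5 : T * η^2 = η*u/16 := by linear_combination η * eT
          have h6 : η * M ≤ M := mul_le_of_le_one_left (by linarith only [hM, η0, η1]) (by linarith only [η0, η1])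
          linarith
        _ = _ := by ring
    have c2 : ¢(Lo a) ≤ B * exp (-(20*Λ)) * exp (5*Λ) := by
      have h := (hS t T li ht rfl (II Λ a) (Lo a) (fun p hp => (mem_II.1 hp).1) (fun q hq => hQ1 q (mem_filter.1 (mem_filter.1 hq).1).1)).1
        (1-η) li li hI1 (hd _ (filter_subset _ _))
      rw [show 1 - η - 1 = -η by ring] at h
      have h2 := mk_lo _ _ η0.le η1 h (fun q hq => (mem_filter.1 hq).2)
      calc ¢(Lo a) ≤ _ := h2
        _ ≤ exp (5*Λ) * B * exp (-(20*Λ)) := by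
          gcongr
          have h3 : η * (a - Λ - M) ≤ η * ℓ := by gcongr
          have h4 : (a - Λ - u/2) * (η^2) ≤ T * (η^2) := by gcongr; linarith
          have h5 : T * η^2 = η*u/16 := by linear_combination η * eT
          have h6 : η * M ≤ M := mul_le_of_le_one_left (by linarith only [hM, η0, η1]) (by linarith only [η0, η1])
          linarith
        _ = _ := by ring
    have : ¢(Up a ∪ Lo a) ≤ #(Up a) + #(Lo a) := mod_cast card_union_le _ _
    linarith
  have hRc : ¢R ≤ exp (3*Λ) := by
    have h1 : #R ≤ A1 + 1 := (card_filter_le _ _).trans si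
    have h1' : ¢R ≤ A1 + 1 := mod_cast h1
    have h2 : exp (2*Λ) ≤ exp (3*Λ) := exp_le_exp.2 li
    linarith
  have hb : ¢(R.biUnion fun a => Up a ∪ Lo a) ≤ exp (3*Λ) * (B * exp (-(20*Λ)) * 2 * exp (5*Λ)) := by
    calc ¢(R.biUnion fun a => Up a ∪ Lo a) ≤ ∑ a ∈ R, ¢(Up a ∪ Lo a) := mod_cast card_biUnion_le
      _ ≤ #R • _ := sum_le_card_nsmul _ _ _ b3
      _ ≤ _ := by rw [nsmul_eq_mul]; gcongr
  have hfin : ¢A ≤ #(A.filter fun q : ℕ => ¬ √t < q) + (#E1 + #E2 + #(R.biUnion fun a => Up a ∪ Lo a)) := by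
    have := (card_le_card cov).trans ((card_union_le _ _).trans (Nat.add_le_add_left ((card_union_le _ _).trans (Nat.add_le_add_right (card_union_le _ _) _)) _))
    exact_mod_cast this
  have e1 : exp (3*Λ) * (B * exp (-(20*Λ)) * 2 * exp (5*Λ)) = B * (2 * exp (-(12*Λ))) := by
    rw [show -(12*Λ) = 3*Λ + -(20*Λ) + 5*Λ by ring, exp_add, exp_add]; ring
  rw [hBt, Ye, ← exp_nat_mul, div_eq_mul_inv, ← exp_neg]
  have e2 : 5 * exp (-(12*Λ)) ≤ exp (-((10:ℕ)*Λ)) := by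
    rw [show -(((10:ℕ):ℝ)*Λ) = 2*Λ + -(12*Λ) by push_cast; ring, exp_add]
    gcongr; linarith [add_one_le_exp (2*Λ)]
  calc ¢A ≤ B * (5 * exp (-(12*Λ))) := by rw [e1] at hb; linarith
    _ ≤ _ := by gcongr
theorem fA_pos {n : ℕ} (hn : 1 ≤ n) : 0 < fordA n := by
  have hn' : §1 ≤ n := mod_cast hn
  have h1 : Real.log §n° = log n + log (1 + 1/§n) := by
    rw [← log_mul po po]; congr 1; field_simp
  have h2 : 1 - (1 + 1/§n)⁻¹ ≤ log (1 + 1/§n) := one_sub_inv_le_log_of_pos po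
  have h3 : 1 - (1 + 1/§n)⁻¹ = 1/§n° := by field_simp; ring
  have h4 : log 2 ≤ log §n° := log_le_log nu li
  have h5 : 1/§n° ≤ 1/2 := one_div_le_one_div_of_le nu li
  have h6 : §n * (1/§n°) = 1 - 1/§n° := by field_simp; ring
  have h7 := mul_le_mul_of_nonneg_left (h3 ▸ h2) (by linarith : §0 ≤ n)
  have h8 : fordA n = log §n° + n * log (1 + 1/§n) - 1 := by
    unfold fordA; rw [show §n * log n = n * (log §n° - log (1 + 1/§n)) by rw [h1]; ring]; ring
  have := log_two_gt_d9
  rw [h8]; linarith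
theorem fA_le {n : ℕ} (hn : 1 ≤ n) : fordA n ≤ n := by
  have hn' : §1 ≤ n := mod_cast hn
  have h1 : Real.log §n° = log n + log (1 + 1/§n) := by
    rw [← log_mul po po]; congr 1; field_simp
  have h2 : log (1 + 1/§n) ≤ 1/§n := by
    have := log_le_sub_one_of_pos (show 0 < 1 + 1/§n by positivity); linarith
  have h7 := mul_le_mul_of_nonneg_left h2 (by linarith : §0 ≤ n)
  have h9 : §n * (1/n) = 1 := by field_simp
  have h10 := log_le_sub_one_of_pos (show 0 < §n+1 by positivity)
  have h8 : fordA n = log §n° + n * log (1 + 1/§n) - 1 := by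
    unfold fordA; rw [show §n * log n = n * (log §n° - log (1 + 1/§n)) by rw [h1]; ring]; ring
  rw [h8]; linarith
theorem gG (ϱ : ℝ) (h0 : 0 < ϱ) (h1 : ϱ < 1) (hs : ∑' n : ℕ, fordA n° * ϱ^n° = 1) :
    ∃ c : ℝ, 0 < c ∧ ∀ ξ : ℝ, 0 < ξ → ∃ G : ℕ → ℝ, G 0 = 1 ∧
      (∀ m : ℕ, c * exp (-(ξ*m)) * (1/ϱ)^m ≤ G m) ∧
      ∀ m : ℕ, (1+ξ) * G m° ≤ ∑ i ∈ range m°, fordA i° * G (m-i) := by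
  obtain ⟨p, hp⟩ := exq (fun n => fordA n° * ϱ^n° : ℕ → ℝ)
  have hpos : ∀ n, 0 < p n := fun n => by
    rw [hp]; exact mul_pos (fA_pos om) po
  have hsum : HasSum p 1 := by
    have : Summable p := by
      by_contra h
      rw [← hp, tsum_eq_zero_of_not_summable h] at hs; norm_num at hs
    rw [← hs, ← hp]; exact this.hasSum
  obtain ⟨t, ht⟩ := exq (fun m => 1 - ∑ i ∈ range m, p i : ℕ → ℝ)
  have ht0 : ∀ m, 0 ≤ t m := fun m => by
    rw [ht]; simpa using sum_le_hasSum (range m) (fun i _ => (hpos i).le) hsum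
  have ht1 : ∀ m, t m° ≤ 1 - p 0 := fun m => by
    rw [ht]; dsimp only
    have := Finset.single_le_sum (fun i _ => (hpos i).le) (show 0 ∈ range m° by simp)
    linarith
  have hpsum : Summable fun i : ℕ => §i° * p i := by
    have h := summable_pow_mul_geometric_of_norm_lt_one 2 (show ‖ϱ‖ < 1 by
      rw [norm_of_nonneg h0.le]; exact h1)
    have h' := (summable_nat_add_iff 1).mpr h
    refine Summable.of_nonneg_of_le (fun i => by have := hpos i; positivity) (fun i => ?_) h'
    rw [hp]; push_cast
    have := fA_le (show 1 ≤ i+1 by omega)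
    push_cast at this
    calc §i° * (fordA i° * ϱ^i°) ≤ §i° * (§i° * ϱ^i°) := by gcongr
      _ = _ := by ring
  obtain ⟨C, hC⟩ := exq (∑' i : ℕ, §i° * p i : ℝ)
  have htail : ∀ M : ℕ, ∑ m ∈ range M, t m ≤ C := by
    intro M
    have e1 : ∑ m ∈ range M, t m = M * t M + ∑ i ∈ range M, §i° * p i := by
      induction M with
      | zero => simp
      | succ M ih =>
        rw [sum_range_succ, ih, sum_range_succ]
        have : t M° = t M - p M := by rw [ht]; simp only [sum_range_succ]; ring
        rw [this]; push_cast; ring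
    have e2 : HasSum (fun i => p (i+M)) (t M) := by
      rw [ht]; exact (hasSum_nat_add_iff' M).mpr hsum
    have e3 := (hasSum_nat_add_iff' M).mpr hpsum.hasSum
    have e4 : §M * t M ≤ C - ∑ i ∈ range M, §i° * p i := by
      rw [hC]
      refine hasSum_le (fun i => ?_) (e2.mul_left §M) e3
      have := hpos (i+M)
      gcongr; push_cast; have : §0 ≤ i := po
      linarith
    linarith
  have hp0 := hpos 0
  refine ⟨exp (-(C/p 0)), exp_pos _, fun ξ hξ => ?_⟩
  obtain ⟨h, hh⟩ := exq (fun m : ℕ => exp (-(m*ξ + ∑ l ∈ range m, t l°/p 0)) : ℕ → ℝ)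
  have hpos' : ∀ m, 0 < h m := fun m => by rw [hh]; exact exp_pos _
  have hstep : ∀ m, (1+ξ) * h m° ≤ h m * (1 - t m°) := by
    intro m
    have e : h m° = h m * exp (-ξ) * exp (-(t m°/p 0)) := by
      rw [hh]; dsimp only; rw [← exp_add, ← exp_add, sum_range_succ]; congr 1; push_cast; ring
    have e1 : (1+ξ) * exp (-ξ) ≤ 1 := by
      rw [exp_neg, ← div_eq_mul_inv, div_le_one (exp_pos _)]; linarith [add_one_le_exp ξ]
    have e2 : exp (-(t m°/p 0)) ≤ 1 - t m° := by
      have a1 := add_one_le_exp (t m°/p 0)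
      have a2 := ht0 m°
      have a3 := ht1 m
      have a4 : 0 ≤ t m°/p 0 := po
      rw [exp_neg, inv_le_iff_one_le_mul₀ (exp_pos _)]
      have a5 : (1 - t m°) * (t m°/p 0 + 1) = 1 + (t m°/p 0) * (1 - p 0 - t m°) := by
        field_simp; ring
      have a6 : 0 ≤ (t m°/p 0) * (1 - p 0 - t m°) := mul_nonneg a4 li
      calc 1 ≤ (1 - t m°) * (t m°/p 0 + 1) := li
        _ ≤ _ := by gcongr; linarith
    rw [e]
    calc (1+ξ) * (h m * exp (-ξ) * exp (-(t m°/p 0))) = h m * ((1+ξ) * exp (-ξ)) * exp (-(t m°/p 0)) := by ring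
      _ ≤ h m * 1 * (1 - t m°) := by have := hpos' m; gcongr
      _ = _ := by ring
  have hmono : Antitone h := antitone_nat_of_succ_le fun m => by
    have a := hstep m
    have b := ht0 m°
    have := hpos' m; have := hpos' m°
    nlinarith
  refine ⟨fun m => h m * (1/ϱ)^m, by simp [hh], fun m => ?_, fun m => ?_⟩
  · have : exp (-(C/p 0)) * exp (-(ξ*m)) ≤ h m := by
      rw [hh, ← exp_add]; dsimp only
      refine exp_le_exp.mpr ?_
      have a := htail m°
      rw [sum_range_succ'] at a
      rw [← Finset.sum_div]
      have b := ht0 0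
      have : (∑ l ∈ range m, t l°)/p 0 ≤ C/p 0 := by gcongr; linarith
      linarith
    exact mul_le_mul_of_nonneg_right this po
  · have a : ∀ i ∈ range m°, ϱ^m° * (fordA i° * (h (m-i) * (1/ϱ)^(m-i))) = p i * h (m-i) := by
      intro i hi
      have hi' : i ≤ m := by simp at hi; omega
      rw [hp]; dsimp only
      have e : ϱ^m° = ϱ^i° * ϱ^(m-i) := by rw [← pow_add]; congr 1; omega
      rw [e, one_div, inv_pow]; field_simp
    have b : h m * (1 - t m°) ≤ ∑ i ∈ range m°, p i * h (m-i) := by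
      have : 1 - t m° = ∑ i ∈ range m°, p i := by rw [ht]; ring
      rw [this, mul_sum]
      refine sum_le_sum fun i _ => ?_
      rw [mul_comm]
      exact mul_le_mul_of_nonneg_left (hmono (Nat.sub_le m i)) (hpos i).le
    have c := (hstep m).trans b
    rw [← sum_congr rfl a, ← mul_sum] at c
    have d : (1+ξ) * h m° = ϱ^m° * ((1+ξ) * (h m° * (1/ϱ)^m°)) := by
      rw [one_div, inv_pow]; field_simp
    rw [d] at c
    exact le_of_mul_le_mul_left c po
theorem slack (W : ℕ) (ξ : ℝ) (G : ℕ → ℝ) (hG0 : G 0 = 1) (hG : ∀ m, 0 ≤ G m)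
    (hG1 : ∀ m : ℕ, (1+ξ) * G m° ≤ ∑ i ∈ range m°, fordA i° * G (m-i))
    (n : ℕ → ℕ) (hn : ∀ j, W < j → n j = 0) :
    ∑ j ∈ range W°, G j * ((1+ξ) * n j - ∑ i ∈ range W, fordA i° * n (j+i+1)) ≤ (1+ξ) * n 0 := by
  have hA : ∀ i, 0 ≤ fordA i° := fun i => (fA_pos om).le
  have e1 : ∑ j ∈ range W°, G j * ((1+ξ) * n j) ≤ (1+ξ) * n 0 +
      ∑ m ∈ range W, ∑ i ∈ range m°, fordA i° * G (m-i) * n (i+(m-i)+1) := by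
    rw [sum_range_succ', hG0, add_comm]
    simp only [one_mul]
    gcongr with m hm
    calc G m° * ((1+ξ) * n m°) = ((1+ξ) * G m°) * n m° := by ring
      _ ≤ (∑ i ∈ range m°, fordA i° * G (m-i)) * n m° := by gcongr; exact hG1 m
      _ = _ := by
        rw [sum_mul]; refine sum_congr rfl fun i hi => ?_
        rw [Nat.add_sub_cancel' (by simp at hi; omega)]
  have e2 := sum_range_diag_flip W (fun i j => fordA i° * G j * n (i+j+1))
  have e3 : ∑ i ∈ range W, ∑ j ∈ range (W-i), fordA i° * G j * (n (i+j+1) : ℝ) ≤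
      ∑ j ∈ range W°, G j * ∑ i ∈ range W, fordA i° * (n (j+i+1) : ℝ) := by
    simp only [mul_sum]; rw [sum_comm]
    refine sum_le_sum fun i hi => ?_
    calc _ ≤ ∑ j ∈ range W°, fordA i° * G j * (n (i+j+1) : ℝ) :=
          sum_le_sum_of_subset_of_nonneg (fun j hj => by simp at hj ⊢; omega)
            (fun j _ _ => by have := hA i; have := hG j; positivity)
      _ = _ := sum_congr rfl fun j _ => by rw [add_comm i j]; ring
  simp only [mul_sub, sum_sub_distrib]
  linarith
theorem sum_max (β : ℝ) (hβ : 0 < β) (W : ℕ) : ∀ l : ℝ, 0 ≤ l →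
    ∑ j ∈ range W, max 0 (l - β*j) ≤ l^2/(2*β) + l/2 + β/8 := by
  have key : ∀ l : ℝ, 0 ≤ l^2/(2*β) - l/2 + β/8 := fun l => by
    have : l^2/(2*β) - l/2 + β/8 = (l - β/2)^2/(2*β) := by field_simp; ring
    rw [this]; positivity
  induction W with
  | zero => intro l hl; simp; positivity
  | succ W ih =>
    intro l hl
    rw [sum_range_succ']
    have e : ∀ j ∈ range W, max 0 (l - β*((j+1:ℕ):ℝ)) = max 0 (l - β - β*§j) := fun j _ => by
      push_cast; congr 1; ring
    rw [sum_congr rfl e]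
    simp only [Nat.cast_zero, mul_zero, sub_zero, max_eq_right hl]
    by_cases h : β ≤ l
    · have a := ih (l-β) li
      have : (l-β)^2/(2*β) = l^2/(2*β) - l + β/2 := by field_simp; ring
      linarith
    · have : ∑ j ∈ range W, max 0 (l - β - β*§j) = 0 := sum_eq_zero fun j _ => by
        apply max_eq_left; have : 0 ≤ β*§j := po
        linarith
      rw [this]; linarith [key l]
theorem boxcount (W : ℕ) (ξ s R : ℝ) (hξ : 0 < ξ) (hs : 0 < s) (G : ℕ → ℝ) (hG : ∀ m, 0 < G m)
    (P : Finset (ℕ → ℕ)) (hP : ∀ n ∈ P, (∀ j, W < j → n j = 0) ∧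
      (∀ j ≤ W, ∑ i ∈ range W, fordA i° * n (j+i+1) ≤ (1+ξ) * n j) ∧
      ∑ j ∈ range W°, G j * ((1+ξ) * n j - ∑ i ∈ range W, fordA i° * n (j+i+1)) ≤ R) :
    ¢P ≤ exp (s*R) * ∏ j ∈ range W°, (1 + 1/(s * G j)) := by
  obtain ⟨y, hy⟩ := exq (fun n j => (1+ξ) * n j - ∑ i ∈ range W, fordA i° * n (j+i+1) : (ℕ → ℕ) → ℕ → ℝ)
  obtain ⟨F, hF⟩ := exq (fun n (j : Fin W°) => ⌊y n j⌋₊ : (ℕ → ℕ) → (Fin W° → ℕ))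
  have hy0 : ∀ n ∈ P, ∀ j ≤ W, 0 ≤ y n j := fun n hn j hj => by
    rw [hy]; dsimp only; linarith [(hP n hn).2.1 j hj]
  have hinj : Set.InjOn F P := by
    intro n hn n' hn' h
    have key : ∀ d, ∀ j, W < j + d → n j = n' j := by
      intro d
      induction d with
      | zero => intro j hj; rw [(hP n hn).1 j hj, (hP n' hn').1 j hj]
      | succ d ih =>
        intro j hj
        by_cases hj' : W < j
        · rw [(hP n hn).1 j hj', (hP n' hn').1 j hj']
        have h2 : ⌊y n j⌋₊ = ⌊y n' j⌋₊ := by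
          have := congrFun h ⟨j, om⟩; rw [hF] at this; simpa using this
        have h3 : ∑ i ∈ range W, fordA i° * (n (j+i+1):ℝ) = ∑ i ∈ range W, fordA i° * (n' (j+i+1):ℝ) :=
          sum_congr rfl fun i _ => by rw [ih (j+i+1) om]
        have b1 := Nat.floor_le (hy0 n hn j om)
        have b2 := Nat.lt_floor_add_one (y n j)
        have b3 := Nat.floor_le (hy0 n' hn' j om)
        have b4 := Nat.lt_floor_add_one (y n' j)
        rw [h2] at b1 b2
        rw [hy] at b1 b2 b3 b4; dsimp only at b1 b2 b3 b4
        rw [h3] at b1 b2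
        by_contra hne
        rcases Nat.lt_or_gt_of_ne hne with hlt | hlt
        · have : (n j:ℝ) + 1 ≤ n' j := mod_cast hlt
          nlinarith only [hξ, b1, b4, this]
        · have : (n' j:ℝ) + 1 ≤ n j := mod_cast hlt
          nlinarith only [hξ, b2, b3, this]
    funext j; exact key W° j om
  obtain ⟨M, hM⟩ : ∃ M : ℕ, ∀ z ∈ P.image F, ∀ j, z j < M := by
    refine ⟨(P.image F).sup (fun z => Finset.univ.sup z) + 1, fun z hz j => Nat.lt_succ_of_le ?_⟩
    exact (Finset.le_sup (f := z) (mem_univ j)).trans (Finset.le_sup (f := fun z => Finset.univ.sup z) hz)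
  calc ¢P = #(P.image F) := by rw [card_image_of_injOn hinj]
    _ = ∑ z ∈ P.image F, §1 := si
    _ ≤ ∑ z ∈ P.image F, exp (s*R) * ∏ j : Fin W°, exp (-(s*G j)) ^ z j := by
      refine sum_le_sum fun z hz => ?_
      obtain ⟨n, hn, rfl⟩ := mem_image.mp hz
      have a := (hP n hn).2.2
      have b : ∑ j ∈ range W°, G j * (⌊y n j⌋₊:ℝ) ≤ R := by
        refine le_trans (sum_le_sum fun j hj => ?_) a
        have := Nat.floor_le (hy0 n hn j (by simp at hj; omega))
        rw [hy] at this ⊢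
        exact mul_le_mul_of_nonneg_left this (hG j).le
      have e : ∏ j : Fin W°, exp (-(s*G j)) ^ (F n j) = exp (-(s * ∑ j ∈ range W°, G j * (⌊y n j⌋₊:ℝ))) := by
        rw [hF]; dsimp only
        rw [Fin.prod_univ_eq_prod_range (fun j => exp (-(s*G j)) ^ ⌊y n j⌋₊) W°, mul_sum, ← sum_neg_distrib, exp_sum]
        refine prod_congr rfl fun j _ => ?_
        rw [← exp_nat_mul]; congr 1; ring
      rw [e, ← exp_add]
      refine one_le_exp ?_
      nlinarith
    _ ≤ ∑ z ∈ Fintype.piFinset (fun _ : Fin W° => range M), exp (s*R) * ∏ j : Fin W°, exp (-(s*G j)) ^ z j :=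
      sum_le_sum_of_subset_of_nonneg (fun z hz => by simpa using hM z hz) (fun _ _ _ => po)
    _ = exp (s*R) * ∏ j : Fin W°, ∑ z ∈ range M, exp (-(s*G j)) ^ z := by
      rw [← mul_sum, prod_univ_sum]
    _ ≤ exp (s*R) * ∏ j : Fin W°, (1 + 1/(s * G j)) := by
      gcongr with j
      have hu : 0 < s * G j := mul_pos hs (hG _)
      have h1 : exp (-(s*G j)) < 1 := by rw [exp_lt_one_iff]; linarith
      refine ((summable_geometric_of_lt_one (exp_pos _).le h1).sum_le_tsum _ (fun _ _ => po)).trans ?_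
      rw [tsum_geometric_of_lt_one (exp_pos _).le h1]
      have h2 : exp (-(s*G j)) ≤ 1/(1+s*G j) := by
        rw [exp_neg, ← one_div]; exact one_div_le_one_div_of_le li (by linarith [add_one_le_exp (s*G j)])
      have h3 : (1 - 1/(1+s*G j))⁻¹ = 1 + 1/(s*G j) := by
        generalize s * G j = u at hu
        have : 1 - 1/(1+u) = u/(1+u) := by field_simp; ring
        rw [this, inv_div]; field_simp; ring
      rw [← h3]
      refine inv_anti₀ ?_ li
      rw [sub_pos, div_lt_one po]; linarith
    _ = _ := by rw [Fin.prod_univ_eq_prod_range (fun j => 1 + 1/(s * G j)) W°]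
theorem profiles (ϱ : ℝ) (h0 : 0 < ϱ) (h1 : ϱ < 1) (hs : ∑' n : ℕ, fordA n° * ϱ^n° = 1) :
    ∃ A K Y0 : ℝ, 1 ≤ A ∧ 1 ≤ K ∧ 10 ≤ Y0 ∧ ∀ Y : ℝ, Y0 ≤ Y → ∀ W : ℕ, K * log Y ≤ W → W ≤ 2*K*log Y →
    ∀ P : Finset (ℕ → ℕ), (∀ n ∈ P, (∀ j, W < j → n j = 0) ∧ (n 0:ℝ) ≤ Y ∧
      ∀ j ≤ W, ∑ i ∈ range W, fordA i° * n (j+i+1) ≤ (1+1/log Y) * n j) →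
    ¢P ≤ exp (1/(2*log (1/ϱ)) * log (Y/log Y)^2 + A * log Y) ∧ ∀ n ∈ P, n W = 0 := by
  obtain ⟨c, hc, hG⟩ := gG ϱ h0 h1 hs
  obtain ⟨β, hβ⟩ := exq (log (1/ϱ) : ℝ)
  have hβ0 : 0 < β := by rw [hβ]; exact log_pos (by rw [lt_div_iff₀ h0]; linarith)
  have hpow : ∀ m : ℕ, (1/ϱ)^m = exp (β*m) := fun m => by
    rw [mul_comm, exp_nat_mul, hβ, exp_log po]
  obtain ⟨K, hK⟩ := exq (2/β + 1 : ℝ)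
  have hK1 : 1 ≤ K := by rw [hK]; have : 0 < 2/β := po
                         linarith
  have hKβ : 2 ≤ β * K := by rw [hK, mul_add, mul_div_cancel₀ _ hβ0.ne']; linarith
  obtain ⟨c', hc'⟩ := exq (min (c * exp (-(2*K))) 1 : ℝ)
  have hc0 : 0 < c' := by rw [hc']; positivity
  have hcm : c' ≤ c * exp (-(2*K)) := by rw [hc']; exact min_le_left _ _
  have hc1 : c' ≤ 1 := by rw [hc']; exact min_le_right _ _
  obtain ⟨d, hd⟩ := exq (log (1/c') : ℝ)
  have hd0 : 0 ≤ d := by rw [hd]; exact log_nonneg (by rw [le_div_iff₀ hc0]; linarith)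
  have hA0 : 0 ≤ (2*d+d^2)/(2*β) + (1+d)/2 + β/8 := po
  refine ⟨3 + 2*K + ((2*d+d^2)/(2*β) + (1+d)/2 + β/8) + 2, K, 10 + 3/c', li, hK1,
    by have : 0 < 3/c' := po
       linarith, ?_⟩
  intro Y hY W hW1 hW2 P hP
  have hY10 : 10 ≤ Y := by have : 0 < 3/c' := po
                           linarith
  obtain ⟨l, hl⟩ := exq (log Y : ℝ)
  rw [← hl] at hW1 hW2 hP ⊢
  have hl1 : 1 ≤ l := by
    rw [hl, le_log_iff_exp_le li]; linarith [exp_one_lt_d9]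
  have hlY : l ≤ Y := by rw [hl]; linarith [log_le_sub_one_of_pos (show 0 < Y by linarith)]
  have hξ : 0 < 1/l := po
  have hξ1 : 1/l ≤ 1 := by rw [div_le_one li]; exact hl1
  obtain ⟨G, hG0, hG1, hG2⟩ := hG (1/l) hξ
  have hGpos : ∀ m, 0 < G m := fun m => lt_of_lt_of_le po (hG1 m)
  have hGlow : ∀ m ≤ W, c' * exp (β*m) ≤ G m := fun m hm => by
    refine le_trans ?_ (hG1 m)
    rw [hpow]
    gcongr
    refine hcm.trans (mul_le_mul_of_nonneg_left (exp_le_exp.mpr (neg_le_neg ?_)) hc.le)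
    have : §m ≤ 2*K*l := le_trans (mod_cast hm) hW2
    rw [one_div, inv_mul_le_iff₀ li]; linarith
  have hP' : ∀ n ∈ P, (∀ j, W < j → n j = 0) ∧
      (∀ j ≤ W, ∑ i ∈ range W, fordA i° * n (j+i+1) ≤ (1+1/l) * n j) ∧
      ∑ j ∈ range W°, G j * ((1+1/l) * n j - ∑ i ∈ range W, fordA i° * n (j+i+1)) ≤ 2*Y := by
    intro n hn
    obtain ⟨a1, a2, a3⟩ := hP n hn
    refine ⟨a1, a3, (slack W (1/l) G hG0 (fun m => (hGpos m).le) hG2 n a1).trans ?_⟩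
    have : §0 ≤ n 0 := po
    nlinarith only [a2, hξ1]
  refine ⟨?_, ?_⟩
  · refine (boxcount W (1/l) (l/Y) (2*Y) hξ po G hGpos P hP').trans ?_
    obtain ⟨L, hL⟩ := exq (log (Y/l) : ℝ)
    rw [← hL, ← hβ]
    have hL0 : 0 ≤ L := by rw [hL]; exact log_nonneg (by rw [le_div_iff₀ li]; linarith)
    have hLl : L ≤ l := by
      rw [hL]; conv_rhs => rw [hl]
      exact log_le_log po (div_le_self li hl1)
    have hexp : exp (L + d) = Y/(l*c') := by
      rw [exp_add, hL, hd, exp_log po, exp_log po]; field_simp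
    have e1 : ∀ j ∈ range W°, 1 + 1/(l/Y * G j) ≤ exp (1 + max 0 (L + d - β*j)) := by
      intro j hj
      have a : l/Y * (c' * exp (β*j)) ≤ l/Y * G j := by
        have := hGlow j (by simp at hj; omega)
        gcongr
      have b : 1/(l/Y * G j) ≤ exp (L + d - β*j) := by
        refine (one_div_le_one_div_of_le po a).trans (le_of_eq ?_)
        rw [exp_sub, hexp]; field_simp
      have c1 : exp (L + d - β*j) ≤ exp (max 0 (L + d - β*j)) := exp_le_exp.mpr (le_max_right _ _)
      have c2 : 1 ≤ exp (max 0 (L + d - β*j)) := one_le_exp (le_max_left _ _)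
      rw [exp_add]
      have := exp_one_gt_d9
      nlinarith only [b, c1, c2, h0, h1, this]
    have e2 : ∏ j ∈ range W°, (1 + 1/(l/Y * G j)) ≤ exp (∑ j ∈ range W°, (1 + max 0 (L + d - β*j))) := by
      rw [exp_sum]
      exact prod_le_prod (fun j _ => by have := hGpos j; positivity) e1
    have e3 := sum_max β hβ0 W° (L+d) li
    refine (mul_le_mul_of_nonneg_left e2 (exp_pos _).le).trans ?_
    rw [← exp_add, exp_le_exp, sum_add_distrib]
    simp only [sum_const, card_range, nsmul_eq_mul, mul_one]
    have e4 : l/Y*(2*Y) = 2*l := by field_simp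
    have e5 : (L+d)^2/(2*β) = 1/(2*β)*L^2 + (2*L*d+d^2)/(2*β) := by field_simp; ring
    have e6 : (2*L*d+d^2)/(2*β) ≤ (2*d+d^2)/(2*β)*l := by
      rw [div_mul_eq_mul_div]; gcongr
      have := mul_le_mul_of_nonneg_right hLl hd0
      have : d^2*1 ≤ d^2*l := by gcongr
      linarith
    have e7 : d ≤ d*l := le_mul_of_one_le_right hd0 hl1
    have e8 : β ≤ β*l := le_mul_of_one_le_right hβ0.le hl1
    push_cast
    linarith
  · intro n hn
    by_contra hne
    have hne1 : §1 ≤ n W := mod_cast Nat.one_le_iff_ne_zero.mpr hne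
    obtain ⟨a1, a2, a3⟩ := hP' n hn
    have b := Finset.single_le_sum (f := fun j => G j * ((1+1/l) * n j - ∑ i ∈ range W, fordA i° * (n (j+i+1):ℝ)))
      (fun j hj => mul_nonneg (hGpos j).le (by linarith [a2 j (by simp at hj; omega)])) (show W ∈ range W° by simp)
    have z : ∑ i ∈ range W, fordA i° * (n (W+i+1):ℝ) = 0 := sum_eq_zero fun i _ => by
      rw [a1 _ om]; simp
    rw [z, sub_zero] at b
    have e : Y^2 ≤ exp (β*W) := by
      rw [show Y^2 = exp (2*l) by rw [two_mul, exp_add, hl, exp_log li]; ring]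
      refine exp_le_exp.mpr ?_
      calc 2*l ≤ β*K*l := by gcongr
        _ = β*(K*l) := by ring
        _ ≤ _ := by gcongr
    have g := hGlow W le_rfl
    have f1 : 1 ≤ (1+1/l) * (n W:ℝ) := by nlinarith only [hne1, hξ]
    have f2 : c' * Y^2 ≤ G W := (mul_le_mul_of_nonneg_left e hc0.le).trans g
    have f3 : c' * Y^2 ≤ 2*Y := by
      have := mul_le_mul f2 f1 zero_le_one (hGpos W).le
      linarith
    have f4 : c' * Y ≤ 2 := by nlinarith only [f3, h0, h1, hY10]
    have f5 : 3/c' ≤ Y := li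
    rw [div_le_iff₀ hc0] at f5
    linarith
def Val (v : ℕ) : Prop := ∃ S : Finset ℕ, (∀ q ∈ S, q.Prime) ∧ ∏ q ∈ S, q° = v
open Classical in
noncomputable def VS (x : ℝ) : Finset ℕ := (range (⌊x⌋₊+1)).filter Val
theorem mem_VS {x : ℝ} (hx : 0 ≤ x) {v : ℕ} : v ∈ VS x ↔ Val v ∧ §v ≤ x := by
  classical
  unfold VS; rw [mem_filter, mem_range, Nat.lt_succ_iff, Nat.le_floor_iff hx, and_comm]
theorem Val_ne {v : ℕ} (h : Val v) : v ≠ 0 := by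
  obtain ⟨S, _, rfl⟩ := h; exact prod_ne_zero_iff.mpr fun q _ => om
theorem dy2 (T c z : ℝ) (hT : 1 ≤ T) (hc : 0 ≤ c) (hz : 1 ≤ z) (hzT : log z ≤ exp T) (A : Finset ℕ)
    (hA : ∀ n ∈ A, n ≠ 0 ∧ §n ≤ z)
    (h : ∀ t : ℝ, 2 ≤ t → t ≤ 2*z → ¢(A.filter fun n : ℕ => §n ≤ t) ≤ c*(t/log t)) :
    ∑ n ∈ A, 1/§n ≤ 9*c*T := by
  have hl2 := log_two_gt_d9
  have hlog : 0 ≤ log z := log_nonneg hz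
  obtain ⟨k1, hk1⟩ := exq (Nat.log 2 ⌊z⌋₊ + 1)
  have hfl : ⌊z⌋₊ ≠ 0 := by rw [Nat.ne_zero_iff_zero_lt, Nat.floor_pos]; exact hz
  have h2 : §2^(Nat.log 2 ⌊z⌋₊) ≤ z :=
    le_trans (mod_cast Nat.pow_log_le_self 2 hfl) (Nat.floor_le li)
  have h1 := dyadic A 0 k1 (fun k => c/((k+1:ℕ) * log 2)) (fun n hn => ⟨(hA n hn).1, Nat.zero_le _, by
      rw [hk1, Nat.lt_succ_iff]; exact Nat.log_mono_right (Nat.le_floor (hA n hn).2)⟩)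
    (fun k _ hk => by
      have hk' : §2^k ≤ z := le_trans (pow_le_pow_right₀ nu om) h2
      have := h (2^k°) (by rw [pow_succ]; nlinarith [one_le_pow₀ (show §1 ≤ 2 by norm_num) (n := k)]) (by rw [pow_succ]; linarith)
      rw [log_pow] at this
      calc (#{n ∈ A | n < 2^k°}:ℝ) ≤ #(A.filter fun n : ℕ => §n ≤ 2^k°) := by
            refine Nat.cast_le.mpr (card_le_card (monotone_filter_right A fun n _ hn => ?_))
            exact_mod_cast (le_of_lt hn)
        _ ≤ _ := this
        _ = _ := by ring)
  refine h1.trans ?_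
  have h3 : ∑ k ∈ Ico 0 k1, c/((k+1:ℕ) * log 2) = c/log 2 * (harmonic k1 : ℝ) := by
    rw [harmonic, Nat.Ico_zero_eq_range, mul_comm]; push_cast; rw [sum_mul]
    refine sum_congr rfl fun k _ => ?_
    field_simp
  have h4 := harmonic_le_one_add_log k1
  have h5 : log k1 ≤ T + 1 := by
    have hk : §k1 ≤ exp T° := by
      have a : (Nat.log 2 ⌊z⌋₊:ℝ) * log 2 ≤ log z := by
        rw [← log_pow]; exact log_le_log po h2
      have b := exp_one_gt_d9
      have c1 : exp 1 ≤ exp T := exp_le_exp.mpr hT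
      rw [hk1, exp_add]; push_cast
      nlinarith [exp_pos T]
    calc log k1 ≤ log (exp T°) := log_le_log (by rw [hk1]; positivity) hk
      _ = _ := log_exp _
  rw [h3]
  have h6 : c/log 2 ≤ 3/2*c := by
    rw [div_le_iff₀ li]; nlinarith
  have h7 : §0 ≤ harmonic k1 := by
    unfold harmonic; push_cast; positivity
  calc 2*(c/log 2 * (harmonic k1:ℝ)) ≤ 2*(3/2*c*(3*T)) := by gcongr; linarith
    _ = _ := by ring
theorem count_big (x Y : ℝ) (hx : 1 < x) (hY : 0 < Y) (V : Finset ℕ) (c u : ℕ → ℕ)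
    (h : ∀ v ∈ V, v = c v * u v ∧ v ≠ 0 ∧ §v ≤ x ∧ ((c v).Prime ∨ (c v - 1).Prime) ∧
      log x ≤ Y * log (c v)) :
    ¢V ≤ 12*Y*(x/log x) * ∑ w ∈ V.image u, 1/§w := by
  have hlx : 0 < log x := log_pos hx
  rw [card_eq_sum_card_image u V]
  push_cast
  rw [mul_sum]
  refine sum_le_sum fun w hw => ?_
  obtain ⟨v0, hv0, rfl⟩ := mem_image.mp hw
  obtain ⟨e1, e2, e3, e4, e5⟩ := h v0 hv0
  have hw0 : u v0 ≠ 0 := by intro h0; rw [h0, mul_zero] at e1; exact e2 e1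
  have hwp : §0 < u v0 := po
  have hcle : ∀ v ∈ V, u v = u v0 → (c v:ℝ) ≤ x/u v0 := fun v hv hu => by
    obtain ⟨f1, f2, f3, f4, f5⟩ := h v hv
    rw [le_div_iff₀ hwp, ← hu]; rw [f1] at f3; exact_mod_cast f3
  have hc2 : 2 ≤ c v0 := by rcases e4 with h | h <;> have := h.two_le <;> omega
  obtain ⟨t, ht⟩ := exq (x/u v0 : ℝ)
  have hct := hcle v0 hv0 rfl
  rw [← ht] at hct hcle
  have hc2' : §2 ≤ c v0 := mod_cast hc2
  have hlt : log x ≤ Y * log t := e5.trans (by gcongr)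
  have hltp : 0 < log t := log_pos li
  have hsub : #{v ∈ V | u v = u v0} ≤ #(PR ⌊t⌋₊ ∪ (PR ⌊t⌋₊).image (·+1)) := by
    refine card_le_card_of_injOn c (fun v hv => ?_) (fun v hv v' hv' hh => ?_)
    · obtain ⟨hv, hu⟩ := mem_filter.mp hv
      have a := Nat.le_floor (hcle v hv hu)
      simp only [coe_union, Set.mem_union, mem_coe, mem_image, mem_filter, mem_range]
      rcases (h v hv).2.2.2.1 with g | g
      · left; exact ⟨om, g⟩
      · right; exact ⟨c v - 1, ⟨om, g⟩, by have := g.two_le; omega⟩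
    · obtain ⟨hv, hu⟩ := mem_filter.mp hv
      obtain ⟨hv', hu'⟩ := mem_filter.mp hv'
      rw [(h v hv).1, (h v' hv').1, hh, hu, hu']
  have hcard : (#{v ∈ V | u v = u v0}:ℝ) ≤ 2 * (6*t/log t) := by
    have a : #{v ∈ V | u v = u v0} ≤ 2 * #(PR ⌊t⌋₊) := by
      refine hsub.trans ((card_union_le _ _).trans ?_)
      have := card_image_le (s := PR ⌊t⌋₊) (f := (·+1)); omega
    calc (#{v ∈ V | u v = u v0}:ℝ) ≤ 2 * ¢(PR ⌊t⌋₊) := mod_cast a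
      _ ≤ _ := by gcongr; exact cheb_up li
  refine hcard.trans ?_
  calc 2*(6*t/log t) = 12*t*(1/log t) := by ring
    _ ≤ 12*t*(Y/log x) := by
      have : 0 < t := li
      refine mul_le_mul_of_nonneg_left ?_ po
      rw [div_le_div_iff₀ hltp hlx]; linarith
    _ = _ := by rw [ht]; field_simp
theorem mulset (I : ℕ → Finset ℕ) (s : Finset ℕ) (hI : ∀ i ∈ s, ∀ q ∈ I i, q ≠ 0) : ∀ U W : Finset ℕ,
    (∀ u ∈ U, ∃ f : ℕ → ℕ, ∃ w ∈ W, (∀ i ∈ s, f i ∈ I i) ∧ u = (∏ i ∈ s, (f i + 1)) * w) →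
    ∑ u ∈ U, 1/§u ≤ (∏ i ∈ s, ∑ q ∈ I i, 1/§q) * ∑ w ∈ W, 1/§w := by
  classical
  induction s using Finset.induction with
  | empty =>
    intro U W h
    simp only [prod_empty, one_mul]
    refine sum_le_sum_of_subset_of_nonneg (fun u hu => ?_) (fun _ _ _ => po)
    obtain ⟨f, w, hw, _, e⟩ := h u hu
    rw [e]; simpa using hw
  | insert a s ha ih =>
    intro U W h
    have ih' := ih (fun i hi => hI i (mem_insert_of_mem hi))
    choose! f w hw hf e using h
    have h1 := ih' (U.image fun u => (∏ i ∈ s, (f u i + 1)) * w u) W (fun z hz => by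
      obtain ⟨u, hu, rfl⟩ := mem_image.mp hz
      exact ⟨f u, w u, hw u hu, fun i hi => hf u hu i (mem_insert_of_mem hi), rfl⟩)
    rw [prod_insert ha, mul_assoc]
    have h2 : ∑ u ∈ U, 1/§u ≤ ∑ p ∈ (I a) ×ˢ (U.image fun u => (∏ i ∈ s, (f u i + 1)) * w u), 1/((p.1:ℝ)*p.2) := by
      calc ∑ u ∈ U, 1/§u ≤ ∑ u ∈ U, 1/((f u a:ℝ) * ((∏ i ∈ s, (f u i + 1)) * w u : ℕ)) := by
            refine sum_le_sum fun u hu => ?_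
            conv_lhs => rw [e u hu, prod_insert ha, mul_assoc]
            rcases Nat.eq_zero_or_pos ((∏ i ∈ s, (f u i + 1)) * w u) with h0 | h0
            · simp [h0]
            have : 0 < f u a := Nat.pos_of_ne_zero (hI a (mem_insert_self _ _) _ (hf u hu a (mem_insert_self _ _)))
            have h0' : §0 < ((∏ i ∈ s, (f u i + 1)) * w u : ℕ) := mod_cast h0
            rw [Nat.cast_mul (f u a + 1)]
            gcongr
            push_cast; linarith
        _ = ∑ p ∈ U.image (fun u => (f u a, (∏ i ∈ s, (f u i + 1)) * w u)), 1/((p.1:ℝ)*p.2) := by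
            rw [sum_image]
            intro u hu u' hu' hh
            simp only [Prod.mk.injEq] at hh
            rw [e u hu, e u' hu', prod_insert ha, prod_insert ha, mul_assoc, mul_assoc, hh.1, hh.2]
        _ ≤ _ := by
            refine sum_le_sum_of_subset_of_nonneg (fun p hp => ?_) (fun _ _ _ => po)
            obtain ⟨u, hu, rfl⟩ := mem_image.mp hp
            exact mem_product.mpr ⟨hf u hu a (mem_insert_self _ _), mem_image_of_mem _ hu⟩
    refine h2.trans ?_
    rw [sum_product]
    calc _ = (∑ q ∈ I a, 1/§q) * ∑ z ∈ U.image (fun u => (∏ i ∈ s, (f u i + 1)) * w u), 1/§z := by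
          rw [sum_mul_sum]; refine sum_congr rfl fun i _ => sum_congr rfl fun j _ => by
            rw [one_div_mul_one_div]
      _ ≤ _ := mul_le_mul_of_nonneg_left h1 (sum_nonneg fun _ _ => po)
theorem sum_logr (M : ℕ) : ∑ r ∈ range M, log ((§r+2)/§r°) = log §M° := by
  induction M with
  | zero => simp
  | succ M ih => rw [sum_range_succ, ih, ← log_mul po po]; congr 1; push_cast; field_simp; ring
theorem ident (n : ℕ → ℝ) (M : ℕ) : ∑ i ∈ range M°, ∑ r ∈ range M, log ((§r+2)/§r°) * n (max i r°) =
    ∑ k ∈ range M, (fordA k° + 1) * n k° := by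
  induction M with
  | zero => simp
  | succ M ih =>
    rw [sum_range_succ, sum_range_succ (fun k => (fordA k° + 1) * n k°), ← ih]
    have e1 : ∑ r ∈ range M°, log ((§r+2)/§r°) * n (max M° r°) = log (§M+2) * n M° := by
      rw [sum_congr rfl (g := fun r : ℕ => log ((§r+2)/§r°) * n M°) (fun r hr => by
        rw [max_eq_left (by simp at hr; omega)]), ← sum_mul, sum_logr]; push_cast; ring_nf
    have e2 : ∑ i ∈ range M°, ∑ r ∈ range M°, log ((§r+2)/§r°) * n (max i r°) =
        ∑ i ∈ range M°, ∑ r ∈ range M, log ((§r+2)/§r°) * n (max i r°) +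
          M° * (log ((§M+2)/§M°) * n M°) := by
      have : ∀ i ∈ range M°, ∑ r ∈ range M°, log ((§r+2)/§r°) * n (max i r°) =
          ∑ r ∈ range M, log ((§r+2)/§r°) * n (max i r°) + log ((§M+2)/§M°) * n M° := fun i hi => by
        rw [sum_range_succ, max_eq_right (by simp at hi; omega)]
      rw [sum_congr rfl this, sum_add_distrib]; simp
    rw [e1, e2, log_div po po]
    have : fordA M° = (§M+2) * log (§M+2) - §M° * log §M° - 1 := by
      unfold fordA; push_cast; ring_nf
    rw [this]; ring
noncomputable def lam (lo : ℝ) (n : ℕ → ℕ) (M p : ℕ) : ℝ :=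
  exp (∑ r ∈ range M, if p ∈ II lo (n r°) then log ((§r+2)/§r°) else 0)
lemma logr_nonneg (r : ℕ) : 0 ≤ log ((§r+2)/§r°) :=
  log_nonneg (by rw [le_div_iff₀ po]; linarith)
lemma one_le_lam (lo : ℝ) (n : ℕ → ℕ) (M p : ℕ) : 1 ≤ lam lo n M p :=
  one_le_exp (sum_nonneg fun r _ => by split_ifs; exacts [logr_nonneg r, le_rfl])
lemma lam_le (lo : ℝ) (n : ℕ → ℕ) (M p : ℕ) :
    lam lo n M p ≤ 1 + ∑ r ∈ range M, if p ∈ II lo (n r°) then §1 else 0 := by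
  unfold lam
  induction M with
  | zero => simp
  | succ M ih =>
    rw [sum_range_succ, sum_range_succ, exp_add]
    split_ifs with h
    · have hc : ∑ r ∈ range M, (if p ∈ II lo (n r°) then §1 else 0) ≤ M := by
        calc _ ≤ ∑ r ∈ range M, §1 := sum_le_sum fun r _ => by split_ifs <;> norm_num
          _ = M := si
      generalize ∑ r ∈ range M, (if p ∈ II lo (n r°) then §1 else 0) = c at ih hc
      rw [exp_log po]
      refine (mul_le_mul_of_nonneg_right ih po).trans ?_
      rw [mul_div_assoc', div_le_iff₀ po]
      nlinarith
    · simpa using ih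
lemma lam_le' (lo : ℝ) (n : ℕ → ℕ) (M p : ℕ) : lam lo n M p ≤ 1 + M := by
  refine (lam_le lo n M p).trans ?_
  gcongr
  calc _ ≤ ∑ r ∈ range M, §1 := sum_le_sum fun r _ => by split_ifs <;> norm_num
    _ = M := si
lemma gm_lam (lo : ℝ) (n : ℕ → ℕ) (M w : ℕ) : gm (lam lo n M) w =
    exp (∑ r ∈ range M, log ((§r+2)/§r°) * Om (II lo (n r°)) w) := by
  unfold gm lam
  simp_rw [← exp_nat_mul]
  rw [← exp_sum]
  congr 1
  simp_rw [mul_sum]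
  rw [sum_comm]
  refine sum_congr rfl fun r _ => ?_
  unfold Om; push_cast; rw [mul_sum]
  simp only [mul_ite, mul_zero, ← sum_filter]
  rw [sum_congr rfl (g := fun p => log ((§r+2)/§r°) * (w.factorization p:ℝ)) (fun p hp => mul_comm _ _)]
  refine sum_subset (fun p hp => (mem_filter.mp hp).2) (fun p hp hnp => ?_)
  have : w.factorization p = 0 := by
    by_contra h0
    exact hnp (mem_filter.mpr ⟨by rw [← Nat.support_factorization]; exact Finsupp.mem_support_iff.mpr h0, hp⟩)
  rw [this]; simp
lemma LL_succ {q : ℕ} (hq : 2 ≤ q) : LL q° ≤ LL q + 1 := by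
  have hq' : §2 ≤ q := mod_cast hq
  have h0 : 0 < log q := log_pos li
  have h1 : log ((q+1:ℕ):ℝ) ≤ log q * exp 1 := by
    calc log ((q+1:ℕ):ℝ) ≤ log (§q^2) := log_le_log po (by push_cast; nlinarith)
      _ = 2 * log q := by rw [log_pow]; norm_num
      _ ≤ _ := by nlinarith [exp_one_gt_d9]
  calc LL q° ≤ log (log q * exp 1) := log_le_log (log_pos (by push_cast; linarith)) h1
    _ = _ := by rw [log_mul h0.ne' (exp_pos 1).ne', log_exp]
def HB (Y : ℝ) (M : ℕ) (n : ℕ → ℕ) (w : ℕ) : Prop := w ≠ 0 ∧ ∃ b : ℕ, (b = 1 ∨ b.Prime) ∧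
  ∃ T : Finset ℕ, (∀ q ∈ T, q.Prime ∧ LL q ≤ n 0 + 1) ∧ w * b = ∏ q ∈ T, q° ∧
  ∃ f : ℕ → ℕ, (∀ i, i ≤ M → n i ≠ 0 → f i ∈ T ∧ (n i:ℝ) ≤ LL (f i) ∧ Nrm Y (f i)) ∧
    Set.InjOn f {i | i ≤ M ∧ n i ≠ 0}
theorem HB_gm {Y : ℝ} {M : ℕ} {n : ℕ → ℕ} {w : ℕ} (hY : 10 ≤ Y) (hn : Antitone n) (hn0 : (n 0:ℝ) ≤ Y)
    (h : HB Y M n w) : exp (∑ k ∈ range M, (fordA k° + 1) * n k° -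
      M° * log M° * (log Y + (n 0+1)/log Y^4) - log M°) ≤ gm (lam (log Y) n M) w := by
  obtain ⟨hw, b, hb, T, hT, hwb, f, hf, hinj⟩ := h
  have hb0 : b ≠ 0 := by rcases hb with rfl | h; exacts [one_ne_zero, h.ne_zero]
  have hl : 1 ≤ log Y := by
    rw [le_log_iff_exp_le li]; linarith [exp_one_lt_d9]
  have hn0p : §0 ≤ n 0 := po
  obtain ⟨err, herr⟩ := exq (log Y + (n 0+1)/log Y^4 : ℝ)
  have herr0 : 0 ≤ err := by rw [herr]; positivity
  have g1 : ∀ m : ℕ, 1 ≤ gm (lam (log Y) n M) m := fun m => by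
    rw [gm_lam]; exact one_le_exp (sum_nonneg fun r _ => mul_nonneg (logr_nonneg r) po)
  have gb : gm (lam (log Y) n M) b ≤ M + 1 := by
    rcases hb with rfl | h
    · rw [gm_one]; have : §0 ≤ M := po
      linarith
    · rw [gm_prime _ h]; linarith [lam_le' (log Y) n M b]
  obtain ⟨s, hs⟩ := exq ((range M°).filter (fun i => n i ≠ 0))
  have hsm : ∀ i, i ∈ s ↔ i ≤ M ∧ n i ≠ 0 := fun i => by rw [hs, mem_filter, mem_range, Nat.lt_succ_iff]
  have key : exp (∑ i ∈ range M°, ∑ r ∈ range M, log ((§r+2)/§r°) * (n (max i r°) - err)) ≤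
      gm (lam (log Y) n M) (w*b) := by
    rw [hwb, gm_prod _ _ _ (fun q _ => om)]
    calc _ ≤ ∏ i ∈ s, gm (lam (log Y) n M) (f i + 1) := by
          rw [exp_sum, ← prod_filter_mul_prod_filter_not (range M°) (fun i => n i ≠ 0), ← hs]
          rw [← mul_one (∏ i ∈ s, gm (lam (log Y) n M) (f i + 1))]
          refine mul_le_mul (prod_le_prod (fun _ _ => (exp_pos _).le) fun i hi => ?_)
            (prod_le_one (fun _ _ => (exp_pos _).le) fun i hi => ?_) (prod_nonneg fun _ _ => (exp_pos _).le)
            (prod_nonneg fun i _ => zero_le_one.trans (g1 _))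
          · rw [gm_lam]
            refine exp_le_exp.mpr (sum_le_sum fun r _ => mul_le_mul_of_nonneg_left ?_ (logr_nonneg r))
            obtain ⟨i1, i2⟩ := (hsm i).mp hi
            obtain ⟨f1, f2, f3⟩ := hf i i1 i2
            obtain ⟨t1, t2⟩ := hT _ f1
            have hm1 : n (max i r°) ≤ n r° := hn (le_max_right _ _)
            have hm2 : n (max i r°) ≤ n i := hn (le_max_left _ _)
            have hm3 : n i ≤ n 0 := hn (Nat.zero_le _)
            rcases lt_or_ge (n (max i r°):ℝ) (log Y) with hlt | hge
            · have : log Y ≤ err := by rw [herr]; have : §0 ≤ (n 0+1)/log Y^4 := po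
                                       linarith
              have : §0 ≤ Om (II (log Y) (n r°)) (f i + 1) := po
              linarith
            · have hm2' : (n (max i r°):ℝ) ≤ n i := mod_cast hm2
              have hm3' : (n i:ℝ) ≤ n 0 := mod_cast hm3
              have a := ((f3.1 _ hge li).1 li)
              have a2 : Om (II (log Y) (n (max i r°))) (f i + 1) ≤ Om (II (log Y) (n r°)) (f i + 1) :=
                Om_mono (fun p hp => by
                  rw [mem_II] at hp ⊢
                  exact ⟨hp.1, hp.2.1, hp.2.2.trans (mod_cast hm1)⟩) _
              have a3 : (Om (II (log Y) (n (max i r°))) (f i + 1):ℝ) ≤ Om (II (log Y) (n r°)) (f i + 1) := by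
                exact_mod_cast a2
              have a4 : LL (f i)/log Y^4 ≤ (n 0+1)/log Y^4 := by gcongr
              rw [herr]; linarith
          · refine exp_le_one_iff.mpr (sum_nonpos fun r _ => mul_nonpos_of_nonneg_of_nonpos (logr_nonneg r) ?_)
            have : n i = 0 := by simpa using (mem_filter.mp hi).2
            have : n (max i r°) = 0 := Nat.le_zero.mp (this ▸ hn (le_max_left i r°))
            rw [this]; simpa using herr0
      _ = ∏ q ∈ s.image f, gm (lam (log Y) n M) q° := by
          rw [prod_image]; intro i hi j hj hij
          exact hinj ((hsm i).mp hi) ((hsm j).mp hj) hij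
      _ ≤ _ := by
          have hsub : s.image f ⊆ T := fun q hq => by
            obtain ⟨i, hi, rfl⟩ := mem_image.mp hq
            exact (hf i ((hsm i).mp hi).1 ((hsm i).mp hi).2).1
          rw [← prod_sdiff hsub]
          refine le_mul_of_one_le_left (prod_nonneg fun i _ => zero_le_one.trans (g1 _)) ?_
          exact prod_const_one.symm.le.trans (prod_le_prod (fun _ _ => zero_le_one) fun q _ => g1 _)
  rw [gm_mul _ hw hb0] at key
  have e1 : ∑ i ∈ range M°, ∑ r ∈ range M, log ((§r+2)/§r°) * (n (max i r°) - err) =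
      ∑ k ∈ range M, (fordA k° + 1) * n k° - M° * log M° * err := by
    rw [← ident (fun k => (n k:ℝ))]
    simp only [mul_sub, sum_sub_distrib, ← sum_mul, sum_logr]
    simp
  rw [e1] at key
  rw [← herr, exp_sub _ (log _), exp_log po, div_le_iff₀ po]
  exact key.trans (mul_le_mul_of_nonneg_left gb (zero_le_one.trans (g1 _)))
theorem finB (K l N C C' M g : ℝ) (hK : 1 ≤ K) (hC : 1 ≤ C) (hC' : 1 ≤ C')
    (hlD : 4*(2+C+C'+2*K*C+3*K+18*K^2) + 36*K^2 + 16 ≤ l) (hM0 : 0 ≤ M) (hM : M ≤ 2*K*l)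
    (hg0 : 0 ≤ g) (hg : g ≤ M+1) (hnT : l^20 - 1 ≤ N) :
    2 + C + M*C + C' + M°*g*(l + N°/l^4) + g ≤ N/l - N/(2*l) := by
  have hKC : 0 ≤ K*C := mul_nonneg (zero_le_one.trans hK) (zero_le_one.trans hC)
  have hK2 : 0 ≤ K^2 := sq_nonneg K
  have hl0 : 16 ≤ l := li
  have hKl0 : l ≤ K*l := le_mul_of_one_le_left li hK
  have hM1 : M+1 ≤ 3*K*l := li
  have hKl : 36*K^2 ≤ l := li
  have f4 : l^5 ≤ N := by
    have : l^20 = l^5*l^15 := by ring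
    have h2 : §2 ≤ l^15 := (by linarith : §2 ≤ l).trans (le_self_pow₀ li nu)
    have h3 : 1 ≤ l^5 := one_le_pow₀ li
    have h4 : l^5*2 ≤ l^5*l^15 := by gcongr
    linarith
  have hN0 : 0 ≤ N := le_trans po f4
  have f1 : M°*g*(l + N°/l^4) ≤ 9*K^2*l^3 + 9*K^2*N°/l^2 := by
    calc M°*g*(l + N°/l^4) ≤ (3*K*l)*(3*K*l)*(l + N°/l^4) := by gcongr; linarith
      _ = _ := by field_simp; ring
  have f3 : 9*K^2*N°/l^2 ≤ N°/(4*l) := by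
    rw [div_le_div_iff₀ po po]
    have : 36*K^2*(N°*l) ≤ l*(N°*l) := by gcongr
    linarith
  have f5 : M*C ≤ 2*K*C*l := by
    calc M*C ≤ 2*K*l*C := by gcongr
      _ = _ := by ring
  obtain ⟨E, hE'⟩ := exq (2+C+C'+2*K*C+3*K+18*K^2 : ℝ)
  have hEl : 4*E ≤ l := by rw [hE']; linarith
  have hl3 : l ≤ l^3 := le_self_pow₀ li nu
  have f6 : 2 + C + C' + 2*K*C*l + 3*K*l + 9*K^2*l^3 + 1/(4*l) ≤ E*l^3 := by
    have g1 : 1/(4*l) ≤ l^3 := by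
      have : 1/(4*l) ≤ 1 := by rw [div_le_one li]; linarith
      linarith
    have g2 : 2*K*C*l ≤ 2*K*C*l^3 := by gcongr
    have g3 : 3*K*l ≤ 3*K*l^3 := by gcongr
    have g4 : (2+C+C')*1 ≤ (2+C+C')*l^3 := by gcongr; linarith
    have g5 : 1*l^3 ≤ 9*K^2*l^3 := by gcongr; linarith [one_le_pow₀ hK (n := 2)]
    rw [hE']; linarith
  have f7 : E*l^3 ≤ N/(4*l) := by
    rw [le_div_iff₀ po]
    calc E*l^3*(4*l) = 4*E*l^4 := by ring
      _ ≤ l*l^4 := by gcongr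
      _ ≤ N := by linarith [f4]
  have f9 : N°/(4*l) = N/l/4 + 1/(4*l) := by field_simp
  have f10 : N/(4*l) = N/l/4 := by field_simp
  have f11 : N/(2*l) = N/l/2 := by field_simp
  rw [f11]; linarith
theorem caseB (K : ℝ) (hK : 1 ≤ K) : ∃ Y0 : ℝ, 10 ≤ Y0 ∧ ∀ Y : ℝ, Y0 ≤ Y → ∀ M : ℕ, M ≤ 2*K*log Y →
    ∀ n : ℕ → ℕ, Antitone n → (n 0:ℝ) ≤ Y → log Y^20 - 1 ≤ n 0 →
    (1+1/log Y) * n 0 < ∑ i ∈ range M, fordA i° * n i° →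
    ∀ A : Finset ℕ, (∀ w ∈ A, HB Y M n w) → ∑ w ∈ A, 1/§w ≤ exp (-(n 0/(2*log Y))) := by
  obtain ⟨C, hC, -, hC2, -⟩ := mertens
  obtain ⟨C', hC', hE⟩ := EP1
  obtain ⟨D, hD⟩ := exq (4*(2+C+C'+2*K*C+3*K+18*K^2) + 36*K^2 + 16 + 81*K^4 : ℝ)
  have hD16 : 16 ≤ D := by rw [hD]; nlinarith [sq_nonneg K, sq_nonneg (K^2), mul_nonneg (zero_le_one.trans hK) (zero_le_one.trans hC)]
  refine ⟨exp D, by linarith [add_one_le_exp D], fun Y hY M hM n hn hn0 hnT hviol A hA => ?_⟩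
  obtain ⟨l, hl⟩ := exq (log Y : ℝ)
  have hY0 : 0 < Y := (exp_pos D).trans_le hY
  have hlD : D ≤ l := by rw [hl, le_log_iff_exp_le hY0]; exact hY
  have hYl : Y = exp l := by rw [hl, exp_log hY0]
  have hY10 : 10 ≤ Y := by linarith [add_one_le_exp D]
  have hM0 : §0 ≤ M := po
  have hM1 : §M + 1 ≤ 3*K*l := by rw [← hl] at hM; nlinarith only [hK, hC, hC', hD, hM, hlD, hD16]
  have hlogM1 : log §M° ≤ M+1 := by linarith [log_le_sub_one_of_pos (show 0 < §M+1 by linarith)]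
  have hlogM0 : 0 ≤ log §M° := log_nonneg li
  have hM4 : §M°^4 ≤ exp Y := by
    have h1 : §M°^4 ≤ (3*K*l)^4 := by gcongr
    have h2 : (3*K*l)^4 ≤ l^5 := by
      have : 81*K^4 ≤ l := by
        rw [hD] at hlD; nlinarith only [hK, hC, hC', hlD, sq_nonneg K, mul_nonneg (zero_le_one.trans hK) (zero_le_one.trans hC)]
      calc (3*K*l)^4 = 81*K^4*l^4 := by ring
        _ ≤ l*l^4 := by gcongr
        _ = l^5 := by ring
    have h3 : l^5 ≤ exp (5*l) := by
      rw [show §5*l = ((5:ℕ):ℝ)*l by norm_num, exp_nat_mul]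
      exact pow_le_pow_left₀ li (by linarith [add_one_le_exp l]) 5
    refine h1.trans (h2.trans (h3.trans (exp_le_exp.mpr ?_)))
    have := quadratic_le_exp_of_nonneg (show 0 ≤ l by linarith)
    rw [hYl]; nlinarith only [hK, hC, hC', hD, hl, hlD, this, hD16, hM, hM1]
  obtain ⟨s, hs⟩ := exq (II (-1) (n 0 + 2))
  obtain ⟨H, hH⟩ : ∃ H : ℝ, H = ∑ k ∈ range M, (fordA k° + 1) * n k° -
      M° * log M° * (log Y + (n 0+1)/log Y^4) - log M° := ⟨_, rfl⟩
  have hgm : ∀ w ∈ A, exp H ≤ gm (lam (log Y) n M) w := fun w hw => by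
    rw [hH]; exact HB_gm hY10 hn hn0 (hA w hw)
  have hEP := hE s A (fun p => lam (log Y) n M p / p) (fun w hw => by
    obtain ⟨h1, b, hb, T, hT, hwb, -⟩ := hA w hw
    refine ⟨h1, fun p hp hpw => ?_⟩
    have hd : p ∣ ∏ q ∈ T, q° := hwb ▸ dvd_mul_of_dvd_left hpw b
    obtain ⟨q, hq, hpq⟩ := (hp.prime.dvd_finset_prod_iff _).mp hd
    rw [hs, mem_II]
    refine ⟨hp, LL_gt hp.two_le, ?_⟩
    have h2 := LL_mono hp.two_le (Nat.le_of_dvd om hpq)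
    have h3 := LL_succ (hT q hq).1.two_le
    linarith [(hT q hq).2]) (fun p hp => by
    rw [hs, mem_II] at hp
    have hp2 : §2 ≤ p := mod_cast hp.1.two_le
    have g0 := one_le_lam (log Y) n M p
    have hcases : lam (log Y) n M p = 1 ∨ (lam (log Y) n M p ^ 4 ≤ p ∧ §16 ≤ p) := by
      by_cases hex : ∃ r ∈ range M, p ∈ II (log Y) (n r°)
      · right
        obtain ⟨r, -, hr⟩ := hex
        have h1 := (mem_II.mp hr).2.1
        have h2 : exp Y ≤ p := by
          by_contra hlt
          push Not at hlt
          have : LL p ≤ log Y := (LL_le_iff hp.1.two_le _).mpr (by unfold ee; rw [exp_log hY0]; exact hlt.le)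
          linarith
        have h3 : lam (log Y) n M p ^ 4 ≤ §M°^4 :=
          pow_le_pow_left₀ li (by linarith [lam_le' (log Y) n M p]) 4
        exact ⟨li, by linarith [quadratic_le_exp_of_nonneg hY0.le, mul_self_nonneg (Y-10)]⟩
      · left
        push Not at hex
        unfold lam
        rw [sum_eq_zero (fun r hr => if_neg (hex r hr)), exp_zero]
    have h4 : lam (log Y) n M p ^ 4 ≤ p := by
      rcases hcases with h | h
      · rw [h]; linarith
      · exact h.1
    generalize lam (log Y) n M p = L at g0 hcases h4
    refine ⟨po, ?_, ?_⟩
    · rw [div_le_iff₀ li]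
      rcases hcases with h | h
      · rw [h]; linarith
      · rcases le_or_gt L 8 with h8 | h8
        · linarith [h.2]
        · have : 8*L ≤ L^4 := by
            calc 8*L ≤ 8^3*L := li
              _ ≤ L^3*L := by gcongr
              _ = L^4 := by ring
          linarith
    · have h5 : §p^(3/2:ℝ) ≤ 4 * §p^2 / L^2 := by
        have h6 : L^2 ≤ §p^(1/2:ℝ) := by
          rw [← sqrt_eq_rpow]; exact le_sqrt_of_sq_le (by rw [← pow_mul]; exact h4)
        rw [le_div_iff₀ po]
        calc §p^(3/2:ℝ) * L^2 ≤ §p^(3/2:ℝ) * §p^(1/2:ℝ) := by gcongr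
          _ = §p^2 := by rw [← rpow_add li]; norm_num
          _ ≤ _ := by nlinarith only
      have hpp : 0 < §p^(3/2:ℝ) := po
      rw [div_pow, mul_one_div, div_le_div_iff₀ po hpp]
      rw [le_div_iff₀ po] at h5
      linarith)
  have hsum : ∑ p ∈ s, lam (log Y) n M p / p ≤ n 0 + 2 + C + (∑ r ∈ range M, (n r°:ℝ) + M*C) := by
    calc ∑ p ∈ s, lam (log Y) n M p / p ≤ ∑ p ∈ s, (1/§p + ∑ r ∈ range M, if p ∈ II (log Y) (n r°) then 1/§p else 0) := by
          refine sum_le_sum fun p _ => ?_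
          calc lam (log Y) n M p / p ≤ (1 + ∑ r ∈ range M, if p ∈ II (log Y) (n r°) then §1 else 0)/p := by
                gcongr; exact lam_le _ _ _ _
            _ = _ := by rw [add_div, Finset.sum_div]; congr 1; exact sum_congr rfl fun r _ => by split_ifs <;> simp
      _ = ∑ p ∈ s, 1/§p + ∑ r ∈ range M, ∑ p ∈ s, if p ∈ II (log Y) (n r°) then 1/§p else 0 := by
          rw [sum_add_distrib, sum_comm]
      _ ≤ (n 0 + 2 + C) + ∑ r ∈ range M, ((n r°:ℝ) + C) := by
          gcongr with r hr
          · rw [hs]; exact hC2 _ (by have : §0 ≤ n 0 := po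
                                     linarith) _ (fun p hp => ⟨(mem_II.mp hp).1, (mem_II.mp hp).2.2⟩)
          · rw [← sum_filter]
            exact hC2 _ (by have : §0 ≤ n r° := po
                            linarith) _ (fun p hp => by
              have := mem_II.mp (mem_filter.mp hp).2; exact ⟨this.1, this.2.2⟩)
      _ = _ := by rw [sum_add_distrib]; simp
  calc ∑ w ∈ A, 1/§w ≤ ∑ w ∈ A, exp (-H) * gm (fun p => lam (log Y) n M p / p) w := by
        refine sum_le_sum fun w hw => ?_
        have hw0 := (hA w hw).1
        have : §0 < w := po
        rw [gm_div _ hw0, exp_neg, mul_div_assoc']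
        gcongr
        rw [inv_mul_eq_div, one_le_div (exp_pos _)]; exact hgm w hw
    _ ≤ exp (-H) * exp (n 0 + 2 + C + (∑ r ∈ range M, (n r°:ℝ) + M*C) + C') := by
        rw [← mul_sum]; gcongr
        exact hEP.trans (exp_le_exp.mpr li)
    _ ≤ _ := by
        rw [← exp_add, exp_le_exp, hH, ← hl]
        rw [← hl] at hviol hnT hM
        have e1 : ∑ k ∈ range M, (fordA k° + 1) * (n k°:ℝ) = ∑ k ∈ range M, fordA k° * n k° + ∑ k ∈ range M, (n k°:ℝ) := by
          rw [← sum_add_distrib]; exact sum_congr rfl fun k _ => by ring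
        rw [e1]
        have := finB K l (n 0) C C' M (log M°) hK hC hC' (by rw [hD] at hlD; linarith [sq_nonneg (K^2)]) hM0 hM hlogM0 hlogM1 hnT
        have f8 : (1+1/l)*(n 0:ℝ) = n 0 + n 0/l := by ring
        linarith
theorem decr (S : Finset ℕ) : ∃ q : ℕ → ℕ, (∀ i j, i < j → j < #S → q j < q i) ∧ S = (range #S).image q := by
  refine ⟨fun i => if h : i < #S then S.orderEmbOfFin rfl (Fin.rev ⟨i, h⟩) else 0, fun i j hij hj => ?_, ?_⟩
  · have hi : i < #S := hij.trans hj
    simp only [hi, hj, dif_pos]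
    refine (S.orderEmbOfFin rfl).strictMono ?_
    rw [Fin.rev_lt_rev]; exact hij
  · ext a
    rw [mem_image]
    constructor
    · intro ha
      have : a ∈ Set.range (S.orderEmbOfFin rfl) := by rw [range_orderEmbOfFin]; exact ha
      obtain ⟨k, hk⟩ := this
      refine ⟨(Fin.rev k).1, mem_range.mpr (Fin.rev k).2, ?_⟩
      rw [dif_pos (Fin.rev k).2, Fin.eta, Fin.rev_rev]; exact hk
    · rintro ⟨i, hi, rfl⟩
      rw [dif_pos (mem_range.mp hi)]
      exact orderEmbOfFin_mem S rfl _
theorem c0 : ∃ Y0 : ℝ, 10 ≤ Y0 ∧ ∀ Y, Y0 ≤ Y → ∀ A : Finset ℕ, (∀ v ∈ A, v ≠ 0 ∧ §v ≤ ee Y ∧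
    ∀ p, p.Prime → p ∣ v → LL p ≤ Y - log (8*Y)) → ¢A ≤ ee Y/log (ee Y) := by
  obtain ⟨C, hC, h, -⟩ := smooth_count
  refine ⟨6*C+1000, li, fun Y hY A hA => ?_⟩
  have hl : log (8*Y) ≤ Y/2 := by
    have := quadratic_le_exp_of_nonneg (x := Y/2) li
    rw [log_le_iff_le_exp li]; nlinarith
  have hl0 : 0 ≤ log (8*Y) := log_nonneg li
  have := h (Y - log (8*Y)) (ee Y) li (by unfold ee; exact one_le_exp (exp_pos _).le) A hA
  refine this.trans ?_
  have e1 : exp (-(Y-log (8*Y))) * log (ee Y) = 8*Y := by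
    unfold ee
    rw [log_exp, neg_sub, exp_sub, exp_log li]; field_simp
  rw [e1, div_eq_mul_inv]
  have e2 : (log (ee Y))⁻¹ = exp (-Y) := by unfold ee; rw [log_exp, exp_neg]
  rw [e2]
  have : 0 < ee Y := exp_pos _
  refine mul_le_mul_of_nonneg_left (exp_le_exp.mpr li) this.le
theorem c1 : ∃ Y0 : ℝ, 10 ≤ Y0 ∧ ∀ Y, Y0 ≤ Y → ∀ x, x = ee Y → ∀ Z : ℝ, 1 ≤ Z →
    (∀ y : ℝ, 2 ≤ y → y ≤ x - 1 → ¢(VS y) ≤ Z*(y/log y)) → ∀ V : Finset ℕ,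
    (∀ v ∈ V, §v ≤ x ∧ ∃ q w, q.Prime ∧ log Y^20 ≤ LL q ∧ ¬ Nrm Y q ∧ Val w ∧ v = q°*w) →
    ¢V ≤ Z/4*(x/log x) := by
  classical
  obtain ⟨Y0, hY0, hab⟩ := abn
  refine ⟨Y0, hY0, fun Y hY x hx Z hZ hV V h => ?_⟩
  have hY10 : 10 ≤ Y := hY0.trans hY
  obtain ⟨r, hr⟩ := exq (√x)
  have hx0 : 0 < x := hx ▸ exp_pos _
  have hlx : log x = exp Y := by rw [hx]; exact log_exp _
  have hlx10 : 10 ≤ log x := by rw [hlx]; linarith [add_one_le_exp Y]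
  have hlr : log r = log x/2 := by rw [hr, log_sqrt hx0.le]
  have hr5 : 5 ≤ r := by
    have : log r + 1 ≤ exp (log r) := add_one_le_exp _
    rw [exp_log (by rw [hr]; positivity)] at this; linarith
  have hrr : r*r = x := by rw [hr]; exact mul_self_sqrt hx0.le
  have hrx : 2*r ≤ x - 1 := by nlinarith only [hr5, hrr]
  have hL20 : 1 ≤ log Y^20 := by
    refine one_le_pow₀ ?_
    rw [le_log_iff_exp_le li]; linarith [exp_one_lt_d9]
  have hab' : ∀ t : ℝ, 2 ≤ t → t ≤ x → ∀ A : Finset ℕ, (∀ q ∈ A, q.Prime ∧ log Y^20 ≤ LL q ∧ ¬ Nrm Y q ∧ §q ≤ t) →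
      ¢A ≤ t/log t/Y^10 := fun t ht htx A hA => by
    have hlt : 0 < log t := log_pos li
    by_cases hc : log Y^20 - 1 ≤ log (log t)
    · refine hab Y t hY li hc ?_ A fun q hq => ⟨(hA q hq).1, (hA q hq).2.2.2, (hA q hq).2.2.1⟩
      calc log (log t) ≤ log (log x) := log_le_log hlt (log_le_log li htx)
        _ = Y := by rw [hlx, log_exp]
        _ ≤ _ := li
    · have : A = ∅ := by
        rw [eq_empty_iff_forall_notMem]; intro q hq
        obtain ⟨q1, q2, -, q4⟩ := hA q hq
        have q5 : §2 ≤ q := mod_cast q1.two_le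
        have : LL q ≤ log (log t) := log_le_log (log_pos li) (log_le_log li q4)
        linarith
      rw [this]; simp only [card_empty, Nat.cast_zero]; positivity
  choose! hvx q w hq hqL hqN hw hv using h
  have hq2 : ∀ v ∈ V, §2 ≤ q v := fun v hv' => mod_cast (hq v hv').two_le
  have hw1 : ∀ v ∈ V, §1 ≤ w v := fun v hv' => mod_cast Nat.pos_of_ne_zero (Val_ne (hw v hv'))
  have hprod : ∀ v ∈ V, ((q v:ℝ)+1)*w v ≤ x := fun v hv' => by
    have := hvx v hv'; rw [hv v hv'] at this; exact_mod_cast this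
  have b1 : ¢(V.filter fun v => (q v:ℝ) ≤ r) ≤ 27*Z/Y^9*(x/log x) := by
    obtain ⟨V1, hV1⟩ := exq (V.filter fun v => (q v:ℝ) ≤ r)
    rw [← hV1]
    have m1 : ∀ v ∈ V1, v ∈ V ∧ (q v:ℝ) ≤ r := fun v hv => by rw [hV1] at hv; exact mem_filter.mp hv
    have i1 : V1 ⊆ (V1.image q).biUnion fun p => (VS (x/§p°)).image fun w => p°*w := fun v hv' => by
      obtain ⟨a, b⟩ := m1 v hv'
      rw [mem_biUnion]
      refine ⟨q v, mem_image_of_mem _ hv', mem_image.mpr ⟨w v, ?_, (hv v a).symm⟩⟩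
      rw [mem_VS po]
      refine ⟨hw v a, ?_⟩
      rw [le_div_iff₀ po, mul_comm]; exact hprod v a
    have i2 : ¢V1 ≤ ∑ p ∈ V1.image q, ¢(VS (x/§p°)) := by
      calc ¢V1 ≤ (∑ p ∈ V1.image q, #((VS (x/§p°)).image fun w => p°*w) : ℕ) := by
            exact_mod_cast (card_le_card i1).trans card_biUnion_le
        _ ≤ _ := by push_cast; exact sum_le_sum fun p _ => mod_cast card_image_le
    have i3 : ∀ p ∈ V1.image q, ¢(VS (x/§p°)) ≤ 3*Z*(x/log x)*(1/§p) := fun p hp => by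
      obtain ⟨v, hv', rfl⟩ := mem_image.mp hp
      obtain ⟨a, b⟩ := m1 v hv'
      have h2 := hq2 v a
      obtain ⟨y, hy⟩ := exq (x/((q v:ℝ)+1))
      have hyr : r ≤ y * (6/5) := by
        rw [hy, ← hrr]
        have : (q v:ℝ)+1 ≤ 6/5*r := li
        rw [div_mul_eq_mul_div, le_div_iff₀ po]; nlinarith only [hr5, b]
      have hyx : y ≤ x/2 := by
        rw [hy]; exact div_le_div_of_nonneg_left hx0.le nu li
      have := hV y li (by nlinarith only [hr5, hrx, hyx])
      rw [← hy]
      refine this.trans ?_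
      have hly : log x/3 ≤ log y := by
        have e1 : log r ≤ log y + log (6/5) := by
          rw [← log_mul li nu]; exact log_le_log li hyr
        have e2 := log_le_sub_one_of_pos (show §0 < 6/5 by norm_num)
        linarith
      calc Z*(y/log y) ≤ Z*((x/q v)/(log x/3)) := by
            have : y ≤ x/q v := by rw [hy]; exact div_le_div_of_nonneg_left hx0.le li li
            gcongr
        _ = _ := by field_simp
    have i4 := dy2 Y (1/Y^10) r li po li (by rw [hlr, ← hlx]; linarith) (V1.image q)
      (fun p hp => by
        obtain ⟨v, hv', rfl⟩ := mem_image.mp hp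
        exact ⟨(hq v (m1 v hv').1).ne_zero, (m1 v hv').2⟩)
      (fun t ht ht' => by
        have := hab' t ht li ((V1.image q).filter fun n : ℕ => §n ≤ t) fun p hp => by
          obtain ⟨hp, hpt⟩ := mem_filter.mp hp
          obtain ⟨v, hv', rfl⟩ := mem_image.mp hp
          have a := (m1 v hv').1
          exact ⟨hq v a, hqL v a, hqN v a, hpt⟩
        refine this.trans (le_of_eq (by ring)))
    calc ¢V1 ≤ ∑ p ∈ V1.image q, 3*Z*(x/log x)*(1/§p) := i2.trans (sum_le_sum i3)
      _ = 3*Z*(x/log x) * ∑ p ∈ V1.image q, 1/§p := by rw [mul_sum]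
      _ ≤ 3*Z*(x/log x) * (9*(1/Y^10)*Y) := by gcongr
      _ = _ := by field_simp; ring
  have b2 : ¢(V.filter fun v => ¬ (q v:ℝ) ≤ r) ≤ 18*Z/Y^9*(x/log x) := by
    obtain ⟨V1, hV1⟩ := exq (V.filter fun v => ¬ (q v:ℝ) ≤ r)
    rw [← hV1]
    have m1 : ∀ v ∈ V1, v ∈ V ∧ r ≤ (q v:ℝ) := fun v hv => by
      rw [hV1] at hv; exact ⟨(mem_filter.mp hv).1, (not_le.mp (mem_filter.mp hv).2).le⟩
    have hwr : ∀ v ∈ V1, (w v:ℝ) ≤ r := fun v hv' => by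
      obtain ⟨a, b⟩ := m1 v hv'
      have := hprod v a
      rw [← hrr] at this; have := hw1 v a; nlinarith
    have i2 : ¢V1 ≤ ∑ u ∈ V1.image w, ¢(V1.filter fun v => w v = u) := by
      exact_mod_cast (card_eq_sum_card_image w V1).le
    have i3 : ∀ u ∈ V1.image w, ¢(V1.filter fun v => w v = u) ≤ 2/Y^10*(x/log x)*(1/§u) := fun u hu => by
      obtain ⟨v0, hv0, rfl⟩ := mem_image.mp hu
      have a0 := (m1 v0 hv0).1
      have w1 := hw1 v0 a0
      have wr := hwr v0 hv0
      obtain ⟨t, ht⟩ := exq (x/(w v0:ℝ))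
      have htr : r ≤ t := by rw [ht, le_div_iff₀ li, ← hrr]; nlinarith only [wr, hr5]
      have htx : t ≤ x := by rw [ht]; exact div_le_self hx0.le w1
      have e1 := hab' t li htx ((V1.filter fun v => w v = w v0).image q) fun p hp => by
        obtain ⟨v, hv', rfl⟩ := mem_image.mp hp
        obtain ⟨hv', hw'⟩ := mem_filter.mp hv'
        have a := (m1 v hv').1
        refine ⟨hq v a, hqL v a, hqN v a, ?_⟩
        have := hprod v a
        rw [hw'] at this
        rw [ht, le_div_iff₀ li]; nlinarith only [w1, this]
      rw [card_image_of_injOn] at e1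
      · refine e1.trans ?_
        have : log x/2 ≤ log t := by rw [← hlr]; exact log_le_log li htr
        have t0 : 0 ≤ t := li
        calc t/log t/Y^10 ≤ t/(log x/2)/Y^10 := by gcongr
          _ = _ := by rw [ht]; field_simp
      · intro v hv' v' hv'' hh
        obtain ⟨a1, a2⟩ := mem_filter.mp hv'
        obtain ⟨a3, a4⟩ := mem_filter.mp hv''
        rw [hv v (m1 v a1).1, hv v' (m1 v' a3).1, hh, a2, a4]
    have i4 := dy2 Y Z r li li li (by rw [hlr, ← hlx]; linarith) (V1.image w)
      (fun p hp => by
        obtain ⟨v, hv', rfl⟩ := mem_image.mp hp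
        exact ⟨Val_ne (hw v (m1 v hv').1), hwr v hv'⟩)
      (fun t ht ht' => by
        refine le_trans ?_ (hV t ht li)
        refine Nat.cast_le.mpr (card_le_card fun p hp => ?_)
        obtain ⟨hp, hpt⟩ := mem_filter.mp hp
        obtain ⟨v, hv', rfl⟩ := mem_image.mp hp
        rw [mem_VS li]
        exact ⟨hw v (m1 v hv').1, hpt⟩)
    calc ¢V1 ≤ ∑ p ∈ V1.image w, 2/Y^10*(x/log x)*(1/§p) := i2.trans (sum_le_sum i3)
      _ = 2/Y^10*(x/log x) * ∑ p ∈ V1.image w, 1/§p := by rw [mul_sum]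
      _ ≤ 2/Y^10*(x/log x) * (9*Z*Y) := by gcongr
      _ = _ := by field_simp; ring
  have b3 : ¢V = ¢(V.filter fun v => (q v:ℝ) ≤ r) + ¢(V.filter fun v => ¬ (q v:ℝ) ≤ r) := by
    exact_mod_cast (card_filter_add_card_filter_not _).symm
  rw [b3]
  refine (add_le_add b1 b2).trans ?_
  rw [← add_mul]
  have hY9 : §10^9 ≤ Y^9 := pow_le_pow_left₀ nu hY10 9
  refine mul_le_mul_of_nonneg_right ?_ po
  rw [← add_div, div_le_div_iff₀ po nu]
  nlinarith only [hZ, hY9]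
theorem usum : ∃ T0 : ℝ, 1 ≤ T0 ∧ ∀ T Z : ℝ, T0 ≤ T → 1 ≤ Z →
    (∀ y : ℝ, 2 ≤ y → y ≤ ee (3*T) → ¢(VS y) ≤ Z*(y/log y)) → ∀ A : Finset ℕ,
    (∀ w ∈ A, Val w ∧ ∀ p, p.Prime → p ∣ w → LL p ≤ T) → ∑ w ∈ A, 1/§w ≤ 19*T*Z := by
  obtain ⟨C, hC, -, h⟩ := smooth_count
  refine ⟨12 + C, li, fun T Z hT hZ hV A hA => ?_⟩
  have hz1 : 1 ≤ ee (2*T) := one_le_exp (exp_pos _).le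
  have hlz : log (ee (2*T)) = exp (2*T) := log_exp _
  rw [← sum_filter_add_sum_filter_not A fun w : ℕ => §w ≤ ee (2*T)]
  have h1 := dy2 (2*T) Z (ee (2*T)) li li hz1 hlz.le (A.filter fun w : ℕ => §w ≤ ee (2*T))
    (fun w hw => ⟨Val_ne (hA w (mem_filter.mp hw).1).1, (mem_filter.mp hw).2⟩) (fun t ht ht' => by
      refine le_trans ?_ (hV t ht (ht'.trans ?_))
      · refine Nat.cast_le.mpr (card_le_card fun w hw => ?_)
        obtain ⟨hw, hwt⟩ := mem_filter.mp hw
        rw [mem_VS li]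
        exact ⟨(hA w (mem_filter.mp hw).1).1, hwt⟩
      · have e2 : §2 ≤ exp 1 := by linarith [add_one_le_exp §1]
        calc 2*ee (2*T) ≤ exp 1 * exp (exp (2*T)) := by unfold ee; gcongr
          _ = exp (1 + exp (2*T)) := by rw [exp_add]
          _ ≤ ee (3*T) := by
            refine exp_le_exp.mpr ?_
            have e3 : exp (3*T) = exp T * exp (2*T) := by rw [← exp_add]; ring_nf
            have e4 := add_one_le_exp T
            have e5 := add_one_le_exp (2*T)
            rw [e3]; nlinarith)
  have h2 := h T (ee (2*T)) li hz1 (A.filter fun w : ℕ => ¬ §w ≤ ee (2*T)) (fun w hw => by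
    obtain ⟨hw, hwt⟩ := mem_filter.mp hw
    exact ⟨Val_ne (hA w hw).1, (not_le.mp hwt).le, (hA w hw).2⟩)
  have h3 : exp (6*(T+C) - exp (-T) * log (ee (2*T))) ≤ 1 := by
    rw [hlz, ← exp_add, exp_le_one_iff]
    have : -T + 2*T = T := by ring
    rw [this]
    have := quadratic_le_exp_of_nonneg (x := T) li
    nlinarith
  nlinarith
theorem peel : ∃ C : ℝ, 1 ≤ C ∧ ∀ x Y : ℝ, 1 < x → 1 ≤ Y → ∀ (V s : Finset ℕ) (n : ℕ → ℕ) (Pw : ℕ → Prop) (U : ℝ),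
    (∀ A : Finset ℕ, (∀ w ∈ A, Pw w) → ∑ w ∈ A, 1/§w ≤ U) →
    (∀ v ∈ V, v ≠ 0 ∧ §v ≤ x ∧ ∃ q : ℕ → ℕ, ∃ w, Pw w ∧ (q 0).Prime ∧ log x ≤ 8*Y*log (q 0 + 1) ∧
      (∀ i ∈ s, (q i).Prime ∧ (n i:ℝ) ≤ LL (q i) ∧ LL (q i) ≤ n i + 1) ∧
      v = (q 0 + 1)*((∏ i ∈ s, (q i + 1))*w)) →
    ¢V ≤ 96*Y*(x/log x)*(C^(#s) * U) := by
  classical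
  obtain ⟨C, hC, h1, -, -⟩ := mertens
  refine ⟨2 + C, li, fun x Y hx hY V s n Pw U hU h => ?_⟩
  choose! hv0 hvx q w hw hq hql hqs hv using h
  have e1 := count_big x (8*Y) hx li V (fun v => q v 0 + 1) (fun v => (∏ i ∈ s, (q v i + 1))*w v)
    (fun v hv' => ⟨hv v hv', hv0 v hv', hvx v hv', Or.inr (by simpa using hq v hv'), by
      have := hql v hv'; exact_mod_cast this⟩)
  have e2 := mulset (fun i => II (n i - 1) (n i + 1)) s (fun i _ p hp => (mem_II.mp hp).1.ne_zero)
    (V.image fun v => (∏ i ∈ s, (q v i + 1))*w v) (V.image w) (fun u hu => by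
      obtain ⟨v, hv', rfl⟩ := mem_image.mp hu
      exact ⟨q v, w v, mem_image_of_mem _ hv', fun i hi => mem_II.mpr ⟨(hqs v hv' i hi).1, by linarith [(hqs v hv' i hi).2.1], (hqs v hv' i hi).2.2⟩, rfl⟩)
  have e3 : ∏ i ∈ s, ∑ p ∈ II (n i - 1) (n i + 1), 1/§p ≤ (2+C)^(#s) := by
    rw [← prod_const]
    refine prod_le_prod (fun i _ => sum_nonneg fun _ _ => po) fun i _ => ?_
    have := h1 (n i - 1) (n i + 1) li (II (n i - 1) (n i + 1)) fun p hp => mem_II.mp hp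
    linarith
  have hlx : 0 < log x := log_pos hx
  refine e1.trans ?_
  calc 12*(8*Y)*(x/log x) * _ ≤ 12*(8*Y)*(x/log x) * ((2+C)^(#s) * U) := by
        refine mul_le_mul_of_nonneg_left (e2.trans ?_) po
        refine mul_le_mul e3 (hU _ fun w' hw' => ?_) (sum_nonneg fun _ _ => po) po
        obtain ⟨v, hv', rfl⟩ := mem_image.mp hw'
        exact hw v hv'
    _ = _ := by ring
theorem profcount (W m : ℕ) (P : Finset (ℕ → ℕ)) (h : ∀ n ∈ P, (∀ j, W < j → n j = 0) ∧ ∀ j, n j ≤ m) :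
    #P ≤ m°^W° := by
  have : #P ≤ #(Fintype.piFinset fun _ : Fin W° => range m°) := by
    refine card_le_card_of_injOn (fun n i => n i.1) (fun n hn => ?_) (fun n hn n' hn' hh => ?_)
    · rw [mem_coe, Fintype.mem_piFinset]; intro i; rw [mem_range]; exact Nat.lt_succ_of_le ((h n hn).2 i)
    · funext j
      by_cases hj : W < j
      · rw [(h n hn).1 j hj, (h n' hn').1 j hj]
      · exact congrFun hh ⟨j, om⟩
  simpa using this
def Rp (x Y : ℝ) (W : ℕ) (n q : ℕ → ℕ) (m v : ℕ) : Prop :=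
  (∀ i < m, (q i).Prime) ∧ (∀ i j, i < j → j < m → q j < q i) ∧ v = ∏ i ∈ range m, (q i + 1) ∧
  (∀ i < m, log Y^20 ≤ LL (q i) → Nrm Y (q i)) ∧
  (∀ i, n i = if i ≤ W ∧ i < m ∧ log Y^20 ≤ LL (q i) then ⌊LL (q i)⌋₊ else 0) ∧
  (∃ p, p.Prime ∧ p ∣ v ∧ log x ≤ 8*Y*log p) ∧ §v ≤ x
theorem Rp_facts {x Y : ℝ} {W : ℕ} {n q : ℕ → ℕ} {m v : ℕ} (h : Rp x Y W n q m v) (hY : 10 ≤ Y) (hx : x = ee Y) :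
    Antitone n ∧ (∀ i, n i ≠ 0 → i ≤ W ∧ i < m ∧ (n i:ℝ) ≤ LL (q i) ∧ LL (q i) ≤ n i + 1 ∧ log Y^20 ≤ LL (q i)) ∧
    (∀ i, i ≤ W → i < m → n i = 0 → LL (q i) < log Y^20) ∧ 0 < m ∧ log x ≤ 8*Y*log (q 0 + 1) ∧ (n 0:ℝ) ≤ Y ∧ v ≠ 0 ∧
    (∀ i j, i ≤ j → j < m → LL (q j) ≤ LL (q i)) ∧ 1 ≤ log Y^20 := by
  obtain ⟨h1, h2, h3, h4, h5, ⟨p, hp, hpv, hpx⟩, hvx⟩ := h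
  have hL20 : 1 ≤ log Y^20 := by
    refine one_le_pow₀ ?_
    rw [le_log_iff_exp_le li]; linarith [exp_one_lt_d9]
  have hq : ∀ i j, i ≤ j → j < m → q j ≤ q i := fun i j hij hj => by
    rcases hij.eq_or_lt with rfl | hij
    · exact le_rfl
    · exact (h2 i j hij hj).le
  have hLq : ∀ i j, i ≤ j → j < m → LL (q j) ≤ LL (q i) := fun i j hij hj =>
    LL_mono (h1 j hj).two_le (hq i j hij hj)
  have hv0 : v ≠ 0 := by rw [h3]; exact prod_ne_zero_iff.mpr fun i _ => om
  have hdiv := hpv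
  rw [h3, hp.prime.dvd_finset_prod_iff] at hdiv
  obtain ⟨i, hi, hpi⟩ := hdiv
  rw [mem_range] at hi
  have hm : 0 < m := om
  have hpos : ∀ i, n i ≠ 0 → i ≤ W ∧ i < m ∧ (n i:ℝ) ≤ LL (q i) ∧ LL (q i) ≤ n i + 1 ∧ log Y^20 ≤ LL (q i) := fun i hi => by
    rw [h5 i] at hi ⊢
    by_cases hc : i ≤ W ∧ i < m ∧ log Y^20 ≤ LL (q i)
    · rw [if_pos hc]; exact ⟨hc.1, hc.2.1, Nat.floor_le (by linarith [hc.2.2]), (Nat.lt_floor_add_one _).le, hc.2.2⟩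
    · rw [if_neg hc] at hi; exact absurd rfl hi
  have hv' : (q 0 + 1) ∣ v := by rw [h3]; exact dvd_prod_of_mem (fun i => q i + 1) (mem_range.mpr hm)
  refine ⟨fun i j hij => ?_, hpos, fun i hi him hn => ?_, hm, hpx.trans ?_, ?_, hv0, hLq, hL20⟩
  · rw [h5 i, h5 j]
    by_cases hc : j ≤ W ∧ j < m ∧ log Y^20 ≤ LL (q j)
    · have := hLq i j hij hc.2.1
      rw [if_pos hc, if_pos ⟨om, om, hc.2.2.trans this⟩]
      exact Nat.floor_mono this
    · rw [if_neg hc]; exact Nat.zero_le _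
  · by_contra hc
    rw [h5 i, if_pos ⟨hi, him, not_lt.mp hc⟩, Nat.floor_eq_zero] at hn
    linarith
  · have a : p ≤ q 0 + 1 := (Nat.le_of_dvd om hpi).trans (by have := hq 0 i om hi; omega)
    have b : §p ≤ q 0 + 1 := mod_cast a
    have c : §0 < p := mod_cast hp.pos
    gcongr
  · by_cases h0 : n 0 = 0
    · rw [h0]; push_cast; linarith
    · refine (hpos 0 h0).2.2.1.trans ?_
      rw [LL_le_iff (h1 0 hm).two_le, ← hx]
      refine le_trans ?_ hvx
      have := Nat.le_of_dvd (Nat.pos_of_ne_zero hv0) hv'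
      exact_mod_cast (by omega : q 0 ≤ v)
theorem Rp_HB {x Y : ℝ} {W : ℕ} {n q : ℕ → ℕ} {m v : ℕ} (h : Rp x Y W n q m v) (hY : 10 ≤ Y) (hx : x = ee Y)
    (j w b : ℕ) (hj : n j ≠ 0) (hb : b = 1 ∨ b.Prime) (hw : w*b = ∏ i ∈ Ico j m, (q i + 1)) :
    HB Y W (fun i => n (j+i)) w := by
  classical
  obtain ⟨f1, f2, f3, f4, f5, f6, f7, f8, f9⟩ := Rp_facts h hY hx
  obtain ⟨h1, h2, h3, h4, h5, -, hvx⟩ := h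
  have hinj : Set.InjOn q {i | i < m} := fun a ha c hc hh => by
    rcases lt_trichotomy a c with g | g | g
    · have := h2 a c g hc; omega
    · exact g
    · have := h2 c a g ha; omega
  refine ⟨?_, b, hb, (Ico j m).image q, fun p hp => ?_, ?_, fun i => q (j+i), fun i hi hni => ?_, fun a ha c hc hh => ?_⟩
  · intro h0
    rw [h0, zero_mul] at hw
    exact prod_ne_zero_iff.mpr (fun i _ => om) hw.symm
  · obtain ⟨i, hi, rfl⟩ := mem_image.mp hp
    rw [mem_Ico] at hi
    exact ⟨h1 i hi.2, (f8 j i hi.1 hi.2).trans (by simpa using (f2 j hj).2.2.2.1)⟩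
  · rw [hw, prod_image]
    intro a ha c hc hh
    exact hinj (mem_Ico.mp ha).2 (mem_Ico.mp hc).2 hh
  · obtain ⟨a1, a2, a3, a4, a5⟩ := f2 (j+i) hni
    exact ⟨mem_image_of_mem _ (mem_Ico.mpr ⟨om, a2⟩), a3, h4 _ a2 a5⟩
  · have := hinj (f2 _ ha.2).2.1 (f2 _ hc.2).2.1 hh
    omega
theorem caseA : ∃ Y0 C : ℝ, 10 ≤ Y0 ∧ 1 ≤ C ∧ ∀ x Y Z : ℝ, Y0 ≤ Y → x = ee Y → 1 ≤ Z →
    (∀ y : ℝ, 2 ≤ y → y ≤ ee (3*(log Y^20+1)) → ¢(VS y) ≤ Z*(y/log y)) → ∀ (W : ℕ) (n : ℕ → ℕ), n W = 0 →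
    ∀ V : Finset ℕ, (∀ v ∈ V, ∃ q m, Rp x Y W n q m v) →
    ¢V ≤ 96*Y*(x/log x)*(C^W*(19*(log Y^20+1)*Z)) := by
  classical
  obtain ⟨C, hC, hP⟩ := peel
  obtain ⟨T0, hT0, hU⟩ := usum
  refine ⟨10 + exp T0, C, by linarith [exp_pos T0], hC, fun x Y Z hY hx hZ hV W n hn V h => ?_⟩
  have hY10 : 10 ≤ Y := by linarith [exp_pos T0]
  have hT : T0 ≤ log Y := by rw [le_log_iff_exp_le li]; linarith
  have hT' : T0 ≤ log Y^20 + 1 := by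
    have : log Y ≤ log Y^20 := le_self_pow₀ li nu
    linarith
  have hx1 : 1 < x := by rw [hx]; exact one_lt_exp_iff.mpr (exp_pos _)
  have hlx : 0 < log x := log_pos hx1
  have e := hP x Y hx1 li V ((Ico 1 W).filter fun i => n i ≠ 0) n
    (fun w => Val w ∧ ∀ p, p.Prime → p ∣ w → LL p ≤ log Y^20+1) _ (hU _ Z hT' hZ hV) (fun v hv => by
      obtain ⟨q, m, hR⟩ := h v hv
      obtain ⟨f1, f2, f3, f4, f5, f6, f7, f8, f9⟩ := Rp_facts hR hY10 hx
      obtain ⟨h1, h2, h3, h4, h5, -, hvx⟩ := hR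
      obtain ⟨s, hs⟩ := exq ((Ico 1 W).filter fun i => n i ≠ 0)
      have ms : ∀ i, i ∈ s ↔ (1 ≤ i ∧ i < W) ∧ n i ≠ 0 := fun i => by rw [hs, mem_filter, mem_Ico]
      have h0s : 0 ∉ s := fun h0 => by have := ((ms 0).mp h0).1; omega
      have hsub : insert 0 s ⊆ range m := fun i hi => by
        rw [mem_range]
        rcases mem_insert.mp hi with rfl | hi
        · exact f4
        · exact (f2 i ((ms i).mp hi).2).2.1
      rw [← hs]
      have hr : ∀ i ∈ range m \ insert 0 s, i < m ∧ LL (q i) ≤ log Y^20 := fun i hi => by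
        rw [mem_sdiff, mem_insert, not_or, mem_range] at hi
        obtain ⟨him, hi0, his⟩ := hi
        refine ⟨him, ?_⟩
        rcases lt_or_ge i W with g | g
        · refine (f3 i g.le him ?_).le
          by_contra hc
          exact his ((ms i).mpr ⟨⟨om, g⟩, hc⟩)
        · exact (f8 W i g him).trans (f3 W le_rfl om hn).le
      refine ⟨f7, hvx, q, ∏ i ∈ range m \ insert 0 s, (q i + 1), ⟨⟨(range m \ insert 0 s).image q, fun p hp => ?_, ?_⟩, fun p hp hpd => ?_⟩,
        h1 0 f4, f5, fun i hi => ?_, ?_⟩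
      · obtain ⟨i, hi, rfl⟩ := mem_image.mp hp
        exact h1 i (hr i hi).1
      · rw [prod_image]
        intro a ha c hc hh
        have ha := (hr a ha).1; have hc := (hr c hc).1
        rcases lt_trichotomy a c with g | g | g
        · have := h2 a c g hc; omega
        · exact g
        · have := h2 c a g ha; omega
      · rw [hp.prime.dvd_finset_prod_iff] at hpd
        obtain ⟨i, hi, hd⟩ := hpd
        obtain ⟨g1, g2⟩ := hr i hi
        have := LL_mono hp.two_le (Nat.le_of_dvd om hd)
        have := LL_succ (h1 i g1).two_le
        linarith
      · obtain ⟨a1, a2, a3, a4, a5⟩ := f2 i ((ms i).mp hi).2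
        exact ⟨h1 i a2, a3, a4⟩
      · rw [h3, ← prod_sdiff hsub, prod_insert h0s]; ring)
  refine e.trans ?_
  have hcard : #((Ico 1 W).filter fun i => n i ≠ 0) ≤ W := (card_filter_le _ _).trans si
  have hb : 0 ≤ 19*(log Y^20+1)*Z := by nlinarith
  have hx0 : 0 < x := li
  have hY0 : 0 < Y := li
  refine mul_le_mul_of_nonneg_left (mul_le_mul_of_nonneg_right (pow_le_pow_right₀ hC hcard) hb) po
theorem caseB' (K : ℝ) (hK : 1 ≤ K) : ∃ Y0 C : ℝ, 10 ≤ Y0 ∧ 1 ≤ C ∧ ∀ x Y : ℝ, Y0 ≤ Y → x = ee Y →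
    ∀ W : ℕ, W ≤ 2*K*log Y → ∀ (n : ℕ → ℕ) (j : ℕ), (1+1/log Y)*n j < ∑ i ∈ range W, fordA i°*n (j+i+1) →
    ∀ V : Finset ℕ, (∀ v ∈ V, ∃ q m, Rp x Y W n q m v) →
    ¢V ≤ 96*Y*(x/log x)*(C^W*exp (-((log Y^20-1)/(2*log Y)))) := by
  classical
  obtain ⟨C, hC, hP⟩ := peel
  obtain ⟨Y0, hY0, hB⟩ := caseB K hK
  refine ⟨Y0, C, hY0, hC, fun x Y hY hx W hW n j hviol V h => ?_⟩
  have hY10 : 10 ≤ Y := hY0.trans hY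
  have hx1 : 1 < x := by rw [hx]; exact one_lt_exp_iff.mpr (exp_pos _)
  have hx0 : 0 < x := li
  have hlx : 0 < log x := log_pos hx1
  have hlY : 0 < log Y := log_pos li
  rcases V.eq_empty_or_nonempty with rfl | ⟨v0, hv0⟩
  · simp only [card_empty, Nat.cast_zero]; positivity
  obtain ⟨q0, m0, hR0⟩ := h v0 hv0
  obtain ⟨f1, f2, f3, f4, f5, f6, f7, f8, f9⟩ := Rp_facts hR0 hY10 hx
  have hnj : n j ≠ 0 := fun h0 => by
    refine absurd hviol (not_lt.mpr (le_of_eq ?_))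
    rw [h0, Nat.cast_zero, mul_zero]
    refine sum_eq_zero fun i _ => ?_
    have : n (j+i+1) = 0 := Nat.le_zero.mp (h0 ▸ f1 (by omega : j ≤ j+i+1))
    rw [this, Nat.cast_zero, mul_zero]
  obtain ⟨g1, g2, g3, g4, g5⟩ := f2 j hnj
  have hL : log Y^20 - 1 ≤ n j := li
  have hU : ∀ A : Finset ℕ, (∀ w ∈ A, HB Y W (fun i => n (j+i)) w) → ∑ w ∈ A, 1/§w ≤ exp (-((log Y^20-1)/(2*log Y))) := by
    intro A hA
    have hnjY : ((fun i => n (j+i)) 0 : ℝ) ≤ Y := by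
      have : (n j:ℝ) ≤ n 0 := mod_cast f1 (Nat.zero_le j)
      simpa using this.trans f6
    refine (hB Y hY W hW (fun i => n (j+i)) (fun a b hab => f1 om) hnjY (by simpa using hL)
      (by simpa [add_assoc] using hviol) A hA).trans (exp_le_exp.mpr (neg_le_neg ?_))
    simp only [add_zero]
    gcongr
  rcases Nat.eq_zero_or_pos j with rfl | hj
  · have h' : ∀ v ∈ V, ∃ p, p.Prime ∧ p ∣ v ∧ log x ≤ 8*Y*log p ∧ v ≠ 0 ∧ §v ≤ x ∧ HB Y W (fun i => n (0+i)) (v/p) := fun v hv => by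
      obtain ⟨q, m, hR⟩ := h v hv
      obtain ⟨p, hp, hpd, hpl⟩ := hR.2.2.2.2.2.1
      refine ⟨p, hp, hpd, hpl, (Rp_facts hR hY10 hx).2.2.2.2.2.2.1, hR.2.2.2.2.2.2, Rp_HB hR hY10 hx 0 _ p hnj (Or.inr hp) ?_⟩
      rw [Nat.div_mul_cancel hpd, Nat.Ico_zero_eq_range, hR.2.2.1]
    choose! p hp hpd hpl hv0 hvx hH using h'
    have e := count_big x (8*Y) hx1 li V p (fun v => v/p v) (fun v hv =>
      ⟨(Nat.mul_div_cancel' (hpd v hv)).symm, hv0 v hv, hvx v hv, Or.inl (hp v hv), hpl v hv⟩)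
    refine e.trans ?_
    have e2 := hU (V.image fun v => v/p v) (fun w hw => by
      obtain ⟨v, hv, rfl⟩ := mem_image.mp hw
      exact hH v hv)
    have : 1 ≤ C^W := one_le_pow₀ hC
    calc 12*(8*Y)*(x/log x)*_ ≤ 12*(8*Y)*(x/log x)*(1*exp (-((log Y^20-1)/(2*log Y)))) := by
          rw [one_mul]; exact mul_le_mul_of_nonneg_left e2 po
      _ ≤ 12*(8*Y)*(x/log x)*(C^W*exp (-((log Y^20-1)/(2*log Y)))) := by gcongr
      _ = _ := by ring
  · have e := hP x Y hx1 li V (Ico 1 j) n _ _ hU (fun v hv => by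
      obtain ⟨q, m, hR⟩ := h v hv
      have hH := fun w b => Rp_HB hR hY10 hx j w b hnj
      obtain ⟨f1, f2, f3, f4, f5, f6, f7, f8, f9⟩ := Rp_facts hR hY10 hx
      obtain ⟨h1, h2, h3, h4, h5, -, hvx⟩ := hR
      refine ⟨f7, hvx, q, _, hH _ 1 (Or.inl rfl) (mul_one _), h1 0 f4, f5, fun i hi => ?_, ?_⟩
      · have hni : n i ≠ 0 := fun h0 => hnj (Nat.le_zero.mp (h0 ▸ f1 (mem_Ico.mp hi).2.le))
        obtain ⟨a1, a2, a3, a4, a5⟩ := f2 i hni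
        exact ⟨h1 i a2, a3, a4⟩
      · rw [prod_Ico_consecutive _ hj (f2 j hnj).2.1.le, h3, range_eq_Ico, prod_eq_prod_Ico_succ_bot f4])
    refine e.trans ?_
    have hcard : #(Ico 1 j) ≤ W := by simp; omega
    refine mul_le_mul_of_nonneg_left (mul_le_mul_of_nonneg_right (pow_le_pow_right₀ hC hcard) (exp_pos _).le) po
theorem pow_le_exp_ev (c : ℝ) (k : ℕ) : ∃ L0 : ℝ, 1 ≤ L0 ∧ ∀ L, L0 ≤ L → c*L^k ≤ exp L := by
  have h := (isLittleO_pow_exp_atTop (n := k)).bound (show §0 < 1/(|c|+1) by positivity)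
  obtain ⟨L0, h0⟩ := Filter.eventually_atTop.mp h
  refine ⟨max 1 L0, le_max_left _ _, fun L hL => ?_⟩
  have h1 := h0 L ((le_max_right _ _).trans hL)
  have hL0 : 0 ≤ L := le_trans (by linarith [le_max_left 1 L0]) hL
  rw [norm_of_nonneg po, norm_of_nonneg (exp_pos _).le, div_mul_eq_mul_div, le_div_iff₀ po, one_mul] at h1
  have : c * L^k ≤ |c| * L^k := by gcongr; exact le_abs_self c
  nlinarith [pow_nonneg hL0 k]
theorem numB (K C L W : ℝ) (hK : 1 ≤ K) (hC : 0 ≤ C) (hL : 100*K*(1+C) ≤ L) (hW : W ≤ 2*K*L) :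
    2*L*W° + 5 + L + W*C + -((L^20-1)/(2*L)) ≤ 0 := by
  have hL1 : 100 ≤ L := by nlinarith
  have h1 : L^4 ≤ (L^20-1)/(2*L) := by
    rw [le_div_iff₀ li]
    have : L^6 ≤ L^20 := pow_le_pow_right₀ li nu
    have h5 : 1 ≤ L^5 := one_le_pow₀ li
    nlinarith
  have hKL : K ≤ L := by nlinarith
  have hCL : C ≤ L := by nlinarith
  have h2 : W ≤ L^2 := by nlinarith
  have h3 : W*C ≤ L^2*L := by
    have : 0 ≤ L^2 := po
    nlinarith
  have h4 : 2*L*W° ≤ 2*L*(L^2+1) := by gcongr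
  nlinarith only [hK, hC, hL, hW, h1, h2, hL1, h3, h4, pow_pos (show §0 < L by linarith) 3, pow_pos (show §0 < L by linarith) 2]
theorem step (ϱ : ℝ) (h0 : 0 < ϱ) (h1 : ϱ < 1) (hs : ∑' n, fordA n° * ϱ^n° = 1) :
    ∃ Y0 A : ℝ, 10 ≤ Y0 ∧ 1 ≤ A ∧ ∀ x Y Z Z' : ℝ, Y0 ≤ Y → x = ee Y → 1 ≤ Z → 1 ≤ Z' →
    (∀ y : ℝ, 2 ≤ y → y ≤ x - 1 → ¢(VS y) ≤ Z*(y/log y)) →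
    (∀ y : ℝ, 2 ≤ y → y ≤ ee (3*(log Y^20+1)) → ¢(VS y) ≤ Z'*(y/log y)) →
    ¢(VS x) ≤ (2 + Z/4 + exp (1/(2*log (1/ϱ))*log (Y/log Y)^2 + A*log Y)*Z')*(x/log x) := by
  classical
  obtain ⟨A0, K, Y1, hA0, hK, hY1, hprof⟩ := profiles ϱ h0 h1 hs
  obtain ⟨Y2, hY2, hc0⟩ := c0
  obtain ⟨Y3, hY3, hc1⟩ := c1
  obtain ⟨Y4, C4, hY4, hC4, hcA⟩ := caseA
  obtain ⟨Y5, C5, hY5, hC5, hcB⟩ := caseB' K hK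
  obtain ⟨L0, hL0, hexp⟩ := pow_le_exp_ev 3648 20
  have hlC4 : 0 ≤ log C4 := log_nonneg hC4
  have hlC5 : 0 ≤ log C5 := log_nonneg hC5
  obtain ⟨L1, hL1⟩ := exq (L0 + 100*K*(1+log C5))
  have hKC : 0 ≤ 100*K*(1+log C5) := po
  refine ⟨Y1+Y2+Y3+Y4+Y5+exp L1, A0+2+2*K*log C4, by linarith [exp_pos L1], by nlinarith only [hA0, hlC4, h0, h1, hK], fun x Y Z Z' hY hx hZ hZ' hV hV' => ?_⟩
  have hL : L1 ≤ log Y := by rw [le_log_iff_exp_le (by linarith [exp_pos L1])]; linarith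
  have e0 := exp_pos L1
  have hY10 : 10 ≤ Y := li
  have hΛ : 0 < log Y := log_pos li
  have hexpL : exp (log Y) = Y := exp_log li
  have hlx : log x = exp Y := by rw [hx]; exact log_exp _
  have hx0 : 0 < x := hx ▸ exp_pos _
  have hlx0 : 0 < log x := hlx ▸ exp_pos _
  obtain ⟨W, hWd⟩ := exq (⌈K*log Y⌉₊)
  have hW1 : K*log Y ≤ W := hWd ▸ Nat.le_ceil _
  have hLam1 : 1 ≤ log Y := li
  have hW2 : §W ≤ 2*K*log Y := by
    have := Nat.ceil_lt_add_one (show 0 ≤ K*log Y by positivity)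
    rw [← hWd] at this; nlinarith only [hK, hL0, hlC5, hL1, hL, this, h0, h1, hKC]
  obtain ⟨V0, hV0⟩ := exq ((VS x).filter fun v => ∀ p, p.Prime → p ∣ v → LL p ≤ Y - log (8*Y))
  obtain ⟨V1, hV1⟩ := exq ((VS x).filter fun v => ∃ q w, q.Prime ∧ log Y^20 ≤ LL q ∧ ¬ Nrm Y q ∧ Val w ∧ v = q°*w)
  obtain ⟨V2, hV2⟩ := exq ((VS x).filter fun v => ∃ n q m, Rp x Y W n q m v)
  have hcover : VS x ⊆ V0 ∪ (V1 ∪ V2) := fun v hv => by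
    rw [mem_union, mem_union]
    by_contra hcon
    push Not at hcon
    obtain ⟨n0, n1, n2⟩ := hcon
    rw [hV0, mem_filter, not_and] at n0
    rw [hV1, mem_filter, not_and] at n1
    rw [hV2, mem_filter, not_and] at n2
    have n0 := n0 hv; have n1 := n1 hv
    refine n2 hv ?_
    push Not at n0
    obtain ⟨p, hp, hpd, hpl⟩ := n0
    obtain ⟨⟨S, hS, hSv⟩, hvx⟩ := (mem_VS hx0.le).mp hv
    obtain ⟨q, hq, hSq⟩ := decr S
    have hinj : Set.InjOn q (range #S) := fun a ha c hc hh => by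
      rw [mem_coe, mem_range] at ha hc
      rcases lt_trichotomy a c with g | g | g
      · have := hq a c g hc; omega
      · exact g
      · have := hq c a g ha; omega
    have hqS : ∀ i < #S, q i ∈ S := fun i hi => by
      have := mem_image_of_mem q (mem_range.mpr hi); rwa [← hSq] at this
    refine ⟨fun i => if i ≤ W ∧ i < #S ∧ log Y^20 ≤ LL (q i) then ⌊LL (q i)⌋₊ else 0, q, #S,
      fun i hi => hS _ (hqS i hi), hq, ?_, fun i hi hiL => ?_, fun i => rfl, ⟨p, hp, hpd, ?_⟩, hvx⟩
    · rw [← hSv]; conv_lhs => rw [hSq]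
      rw [prod_image hinj]
    · by_contra hN
      refine n1 ⟨q i, ∏ q ∈ S.erase (q i), q°, hS _ (hqS i hi), hiL, hN, ⟨S.erase (q i), fun r hr => hS r (mem_of_mem_erase hr), rfl⟩, ?_⟩
      rw [mul_prod_erase S (fun q => q+1) (hqS i hi), hSv]
    · have p2 : §2 ≤ p := mod_cast hp.two_le
      have hlp : 0 < log p := log_pos li
      have : exp (Y - log (8*Y)) ≤ log p := by
        rw [← exp_log hlp]; exact exp_le_exp.mpr hpl.le
      rw [exp_sub, exp_log li, div_le_iff₀ li] at this
      rw [hlx]; linarith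
  have hmem : ∀ v ∈ VS x, v ≠ 0 ∧ §v ≤ x := fun v hv => ⟨Val_ne ((mem_VS hx0.le).mp hv).1, ((mem_VS hx0.le).mp hv).2⟩
  have b0 : ¢V0 ≤ x/log x := by
    rw [hx]
    refine hc0 Y li V0 fun v hv => ?_
    rw [hV0] at hv
    obtain ⟨hv, hv2⟩ := mem_filter.mp hv
    exact ⟨(hmem v hv).1, hx ▸ (hmem v hv).2, hv2⟩
  have b1 : ¢V1 ≤ Z/4*(x/log x) := hc1 Y li x hx Z hZ hV V1 fun v hv => by
    rw [hV1] at hv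
    obtain ⟨hv, hv2⟩ := mem_filter.mp hv
    exact ⟨(hmem v hv).2, hv2⟩
  have hR : ∀ v ∈ V2, ∃ n q m, Rp x Y W n q m v := fun v hv => by rw [hV2] at hv; exact (mem_filter.mp hv).2
  choose! n hn using hR
  have hfib : ∀ g, ∀ v ∈ V2.filter (fun v => n v = g), ∃ q m, Rp x Y W g q m v := fun g v hv => by
    obtain ⟨hv, hg⟩ := mem_filter.mp hv
    rw [← hg]; exact hn v hv
  have hnP : ∀ g ∈ V2.image n, (∀ j, W < j → g j = 0) ∧ (g 0:ℝ) ≤ Y ∧ ∀ j, g j ≤ ⌊Y⌋₊ := fun g hg => by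
    obtain ⟨v, hv, rfl⟩ := mem_image.mp hg
    obtain ⟨q, m, hr⟩ := hn v hv
    obtain ⟨f1, f2, f3, f4, f5, f6, -⟩ := Rp_facts hr hY10 hx
    refine ⟨fun j hj => ?_, f6, fun j => (f1 (Nat.zero_le j)).trans (Nat.le_floor f6)⟩
    by_contra hc
    have := (f2 j hc).1; omega
  obtain ⟨PA, hPA⟩ := exq ((V2.image n).filter fun g => ∀ j ≤ W, ∑ i ∈ range W, fordA i°*g (j+i+1) ≤ (1+1/log Y)*g j)
  obtain ⟨PB, hPB⟩ := exq ((V2.image n).filter fun g => ¬ ∀ j ≤ W, ∑ i ∈ range W, fordA i°*g (j+i+1) ≤ (1+1/log Y)*g j)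
  have hsplit : ¢V2 = ∑ g ∈ PA, ¢(V2.filter fun v => n v = g) + ∑ g ∈ PB, ¢(V2.filter fun v => n v = g) := by
    rw [hPA, hPB, sum_filter_add_sum_filter_not]
    exact_mod_cast card_eq_sum_card_image n V2
  obtain ⟨hp1, hp2⟩ := hprof Y li W hW1 hW2 PA (fun g hg => by
    rw [hPA] at hg
    obtain ⟨hg, hg2⟩ := mem_filter.mp hg
    exact ⟨(hnP g hg).1, (hnP g hg).2.1, hg2⟩)
  have bA : ∑ g ∈ PA, ¢(V2.filter fun v => n v = g) ≤ exp (1/(2*log (1/ϱ))*log (Y/log Y)^2 + (A0+2+2*K*log C4)*log Y)*Z'*(x/log x) := by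
    have s1 : ∀ g ∈ PA, ¢(V2.filter fun v => n v = g) ≤ 96*Y*(x/log x)*(C4^W*(19*(log Y^20+1)*Z')) := fun g hg =>
      hcA x Y Z' li hx hZ' hV' W g (hp2 g hg) _ (hfib g)
    refine (sum_le_sum s1).trans ?_
    rw [sum_const, nsmul_eq_mul]
    have s2 : §96*19*(log Y^20+1) ≤ Y := by
      have := hexp (log Y) li
      rw [hexpL] at this
      have : 1 ≤ log Y^20 := one_le_pow₀ hLam1
      linarith
    have s3 : C4^W ≤ exp (2*K*log C4*log Y) := by
      rw [← exp_log (pow_pos (show 0 < C4 by linarith) W), log_pow]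
      refine exp_le_exp.mpr ?_
      nlinarith only [h0, h1, hlC4, hW2]
    calc ¢PA*(96*Y*(x/log x)*(C4^W*(19*(log Y^20+1)*Z')))
        = #PA*Y*(96*19*(log Y^20+1))*C4^W*(Z'*(x/log x)) := by ring
      _ ≤ exp (1/(2*log (1/ϱ))*log (Y/log Y)^2 + A0*log Y)*exp (log Y)*exp (log Y)*exp (2*K*log C4*log Y)*(Z'*(x/log x)) := by
          rw [hexpL]; gcongr
      _ = _ := by rw [← exp_add, ← exp_add, ← exp_add]; ring_nf
  have bB : ∑ g ∈ PB, ¢(V2.filter fun v => n v = g) ≤ x/log x := by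
    have s1 : ∀ g ∈ PB, ¢(V2.filter fun v => n v = g) ≤ 96*Y*(x/log x)*(C5^W*exp (-((log Y^20-1)/(2*log Y)))) := fun g hg => by
      rw [hPB] at hg
      have hg2 := (mem_filter.mp hg).2
      push Not at hg2
      obtain ⟨j, -, hj⟩ := hg2
      exact hcB x Y li hx W hW2 g j hj _ (hfib g)
    refine (sum_le_sum s1).trans ?_
    rw [sum_const, nsmul_eq_mul]
    have s2 : ¢PB ≤ exp (2*log Y*W°) := by
      have c1 := profcount W ⌊Y⌋₊ PB (fun g hg => by
        rw [hPB] at hg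
        exact ⟨(hnP g (mem_filter.mp hg).1).1, (hnP g (mem_filter.mp hg).1).2.2⟩)
      have c2 : ((⌊Y⌋₊+1:ℕ):ℝ) ≤ exp (2*log Y) := by
        have := Nat.floor_le (show 0 ≤ Y by linarith)
        rw [two_mul, exp_add, hexpL]; push_cast; nlinarith only [hY1, hY2, hY3, hY4, hY5, hY, this, h0, h1, e0]
      calc ¢PB ≤ ((⌊Y⌋₊+1:ℕ):ℝ)^W° := mod_cast c1
        _ ≤ exp (2*log Y)^W° := by gcongr
        _ = _ := by rw [← exp_nat_mul]; push_cast; ring_nf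
    have s3 : C5^W = exp (W*log C5) := by
      rw [← log_pow, exp_log (pow_pos (show 0 < C5 by linarith) W)]
    have s4 : §96 ≤ exp 5 := by
      have : exp 5 = exp 1^5 := by rw [← exp_nat_mul]; norm_num
      rw [this]
      calc §96 ≤ 2.7^5 := nu
        _ ≤ _ := by gcongr; linarith only [h0, h1, exp_one_gt_d9]
    have s5 := numB K (log C5) (log Y) W hK hlC5 li hW2
    calc ¢PB*(96*Y*(x/log x)*(C5^W*exp (-((log Y^20-1)/(2*log Y)))))
        = #PB*96*Y*C5^W*exp (-((log Y^20-1)/(2*log Y)))*(x/log x) := by ring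
      _ ≤ exp (2*log Y*W°)*exp 5*exp (log Y)*exp (W*log C5)*exp (-((log Y^20-1)/(2*log Y)))*(x/log x) := by
          rw [s3, hexpL]; gcongr
      _ ≤ 1*(x/log x) := by
          rw [← exp_add, ← exp_add, ← exp_add, ← exp_add]
          refine mul_le_mul_of_nonneg_right (exp_le_one_iff.mpr s5) po
      _ = _ := one_mul _
  have hfin : ¢(VS x) ≤ #V0 + (#V1 + #V2) := by
    exact_mod_cast (card_le_card hcover).trans ((card_union_le _ _).trans (by gcongr; exact card_union_le _ _))
  rw [hsplit] at hfin
  refine hfin.trans ((add_le_add b0 (add_le_add b1 (add_le_add bA bB))).trans (le_of_eq ?_))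
  ring
theorem div_log_mono {a b : ℝ} (ha : 10 ≤ a) (hab : a ≤ b) : 1 ≤ a/log a ∧ a/log a ≤ b/log b := by
  have hla : 0 < log a := log_pos li
  have hlb : 0 < log b := log_pos li
  have e := exp_one_lt_d9
  have := log_div_self_antitoneOn (show exp 1 ≤ a by linarith) (show exp 1 ≤ b by linarith) hab
  constructor
  · rw [le_div_iff₀ hla]; linarith [log_le_sub_one_of_pos (show 0 < a by linarith)]
  · rw [div_le_div_iff₀ li li] at this
    rw [div_le_div_iff₀ hla hlb]; linarith
theorem Th_mono {C A a b : ℝ} (hC : 0 ≤ C) (hA : 0 ≤ A) (ha : 10 ≤ a) (hab : a ≤ b) :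
    C*log (a/log a)^2 + A*log a ≤ C*log (b/log b)^2 + A*log b := by
  obtain ⟨h1, h2⟩ := div_log_mono ha hab
  have h3 : 0 ≤ log (a/log a) := log_nonneg h1
  have h4 : log (a/log a) ≤ log (b/log b) := log_le_log li h2
  have h5 : log a ≤ log b := log_le_log li hab
  gcongr
theorem Th_small (C A : ℝ) (hC : 0 ≤ C) (hA : 0 ≤ A) : ∃ L0 : ℝ, 3 ≤ L0 ∧ ∀ L u, L0 ≤ L → 10 ≤ u → u ≤ 3*(L^20+1) →
    C*log (u/log u)^2 + A*log u ≤ L := by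
  obtain ⟨M, hM, h⟩ := pow_le_exp_ev (484*C+22*A) 2
  refine ⟨3 + exp M, by linarith [exp_pos M], fun L u hL hu huL => ?_⟩
  have hL3 : 3 ≤ L := by linarith [exp_pos M]
  have h1 : M ≤ log L := by rw [le_log_iff_exp_le li]; linarith
  have h2 := h _ h1
  rw [exp_log li] at h2
  have h3 : log u ≤ 22*log L := by
    rw [show §22*log L = log (L^22) by rw [log_pow]; norm_num]
    refine log_le_log li (huL.trans ?_)
    have : 1 ≤ L^20 := one_le_pow₀ li
    have e : L^22 = L^20*L^2 := by ring
    have h9 : 9 ≤ L^2 := by nlinarith only [hL3]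
    rw [e]; nlinarith only [hu, huL, h9, mul_nonneg (show 0 ≤ L^20 by linarith) (show 0 ≤ L^2-9 by linarith)]
  have hlu : 1 ≤ log u := by rw [le_log_iff_exp_le li]; linarith [exp_one_lt_d9]
  have h4 : 0 ≤ log (u/log u) := log_nonneg (div_log_mono hu le_rfl).1
  have h5 : log (u/log u) ≤ log u := by
    refine log_le_log (div_pos li li) (div_le_self li hlu)
  have h6 : log (u/log u)^2 ≤ (22*log L)^2 := pow_le_pow_left₀ h4 li 2
  have hl1 : 1 ≤ log L := li
  calc C*log (u/log u)^2 + A*log u ≤ C*(22*log L)^2 + A*(22*log L) := by gcongr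
    _ ≤ (484*C+22*A)*log L^2 := by
        have : A*log L ≤ A*log L^2 := mul_le_mul_of_nonneg_left (le_self_pow₀ hl1 nu) hA
        linarith
    _ ≤ L := h2
theorem VS_triv (y : ℝ) (hy : 0 ≤ y) : ¢(VS y) ≤ y := by
  have : VS y ⊆ Icc 1 ⌊y⌋₊ := fun v hv => by
    rw [mem_VS hy] at hv
    exact mem_Icc.mpr ⟨Nat.pos_of_ne_zero (Val_ne hv.1), Nat.le_floor hv.2⟩
  calc ¢(VS y) ≤ ¢(Icc 1 ⌊y⌋₊) := mod_cast card_le_card this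
    _ = ⌊y⌋₊ := si
    _ ≤ y := Nat.floor_le hy
theorem fin_step (E X L Z B A : ℝ) (hB : 0 ≤ B) (hE : E = exp (X + (A+2)*L)) (hX : 0 ≤ X) (hL : 3 ≤ L) (hA : 1 ≤ A)
    (hZ : Z = exp B*E) : 2 + Z/4 + exp (X + A*L)*exp (B+L) ≤ Z := by
  have h1 : exp (X + A*L)*exp (B+L) = exp (-L)*Z := by
    rw [hZ, hE, ← exp_add, ← exp_add, ← exp_add]; ring_nf
  have h2 : exp (-L) ≤ 1/4 := by
    rw [exp_neg, inv_le_comm₀ (exp_pos _) nu]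
    linarith [add_one_le_exp L]
  have h3 : 4 ≤ Z := by
    rw [hZ, hE, ← exp_add]
    have := add_one_le_exp (B + (X + (A+2)*L)); nlinarith only [hB, hX, hL, hA, this]
  rw [h1]; nlinarith only [h2, h3]
theorem upperV (ϱ : ℝ) (h0 : 0 < ϱ) (h1 : ϱ < 1) (hs : ∑' n, fordA n° * ϱ^n° = 1) :
    ∃ Y0 A : ℝ, 10 ≤ Y0 ∧ 1 ≤ A ∧ ∀ Y y : ℝ, Y0 ≤ Y → 2 ≤ y → y ≤ ee Y →
    ¢(VS y) ≤ exp (1/(2*log (1/ϱ))*log (Y/log Y)^2 + A*log Y)*(y/log y) := by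
  obtain ⟨Y1, A, hY1, hA, hstep⟩ := step ϱ h0 h1 hs
  obtain ⟨C, hCd⟩ := exq (1/(2*log (1/ϱ)))
  rw [← hCd] at hstep ⊢
  have hC : 0 ≤ C := by
    have : 0 < log (1/ϱ) := log_pos (by rw [lt_div_iff₀ h0]; linarith)
    rw [hCd]; positivity
  obtain ⟨L0, hL0, hsm⟩ := Th_small C (A+2) hC li
  obtain ⟨L2, hL2, hexp⟩ := pow_le_exp_ev 8 20
  obtain ⟨Y0, hY0⟩ := exq (Y1 + exp (L0+L2))
  have e0 := exp_pos (L0+L2)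
  obtain ⟨Th, hTh⟩ := exq (fun Y => C*log (Y/log Y)^2 + (A+2)*log Y : ℝ → ℝ)
  have hThm : ∀ a b, 10 ≤ a → a ≤ b → Th a ≤ Th b := fun a b ha hab => by
    rw [hTh]; exact Th_mono hC li ha hab
  have hTh0 : ∀ a, 10 ≤ a → 0 ≤ Th a := fun a ha => by
    have : 0 ≤ log a := log_nonneg li
    rw [hTh]; have : 0 ≤ C*log (a/log a)^2 := po
    show 0 ≤ C*log (a/log a)^2 + (A+2)*log a
    positivity
  have triv : ∀ y E, 2 ≤ y → y ≤ ee Y0 → 0 ≤ E → ¢(VS y) ≤ exp (Y0 + E)*(y/log y) := fun y E hy hyY hE => by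
    refine (VS_triv y li).trans ?_
    have hly : 0 < log y := log_pos li
    have : log y ≤ exp (Y0+E) := by
      rw [log_le_iff_le_exp li]
      exact hyY.trans (exp_le_exp.mpr (exp_le_exp.mpr li))
    rw [← mul_div_assoc, le_div_iff₀ hly, mul_comm]
    exact mul_le_mul_of_nonneg_right this li
  have key : ∀ n : ℕ, ∀ Y, Y0 ≤ Y → ee Y ≤ n → ¢(VS (ee Y)) ≤ exp (Y0 + Th Y)*(ee Y/log (ee Y)) := by
    intro n
    induction n with
    | zero => intro Y _ h; have : 0 < ee Y := exp_pos _; push_cast at h; linarith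
    | succ n ih =>
      intro Y hY hn
      push_cast at hn
      have hY10 : 10 ≤ Y := li
      have hL : L0 + L2 ≤ log Y := by rw [le_log_iff_exp_le li]; linarith
      have hT : ∀ y, 2 ≤ y → ∀ Y', Y0 ≤ Y' → y ≤ ee Y' → y ≤ ee Y - 1 → ¢(VS y) ≤ exp (Y0 + Th Y')*(y/log y) := by
        intro y hy Y' hY' hyY' hyY
        rcases le_total y (ee Y0) with g | g
        · exact triv y _ hy g (hTh0 _ li)
        · have hly : 0 < log y := log_pos li
          have hy' : y = ee (log (log y)) := by unfold ee; rw [exp_log hly, exp_log li]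
          have ha : Y0 ≤ log (log y) := by
            rw [le_log_iff_exp_le hly, le_log_iff_exp_le li]; exact g
          have hb : log (log y) ≤ Y' := by
            rw [log_le_iff_le_exp hly, log_le_iff_le_exp li]; exact hyY'
          have := ih (log (log y)) ha (by rw [← hy']; linarith)
          rw [← hy'] at this
          refine this.trans ?_
          have : Th (log (log y)) ≤ Th Y' := hThm _ _ li hb
          gcongr
      obtain ⟨u, hu⟩ := exq (3*(log Y^20+1))
      have hL1 : 1 ≤ log Y^20 := one_le_pow₀ li
      have huY : u + 1 ≤ Y := by
        have := hexp (log Y) li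
        rw [exp_log li] at this; linarith
      have huY' : ee u ≤ ee Y - 1 := by
        have a1 : exp u + 1 ≤ exp Y := by
          have : exp u° ≤ exp Y := exp_le_exp.mpr huY
          rw [exp_add] at this
          have h2 : 2 ≤ exp 1 := by linarith [add_one_le_exp §1]
          have : 1 ≤ exp u := one_le_exp li
          nlinarith
        have a2 : exp (exp u + 1) ≤ exp (exp Y) := exp_le_exp.mpr a1
        rw [exp_add] at a2
        have h2 : 2 ≤ exp 1 := by linarith [add_one_le_exp §1]
        have : 1 ≤ exp (exp u) := one_le_exp (exp_pos _).le
        unfold ee; nlinarith only [a2, h2, this]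
      have hpos : 0 < ee Y/log (ee Y) := by
        unfold ee; rw [log_exp]; positivity
      have hst := hstep (ee Y) Y (exp (Y0 + Th Y)) (exp (Y0 + log Y)) li rfl
        (one_le_exp (by linarith [hTh0 Y hY10])) (one_le_exp li)
        (fun y hy hyY => hT y hy Y hY li hyY)
        (fun y hy hyu => by
          rw [← hu] at hyu
          rcases le_total u Y0 with g | g
          · exact triv y _ hy (hyu.trans (exp_le_exp.mpr (exp_le_exp.mpr g))) li
          · refine (hT y hy u g hyu (hyu.trans huY')).trans ?_
            have : Th u ≤ log Y := by rw [hTh]; exact hsm (log Y) u li li hu.le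
            have hly : 0 < log y := log_pos li
            gcongr)
      refine hst.trans (mul_le_mul_of_nonneg_right ?_ hpos.le)
      refine fin_step (exp (Th Y)) (C*log (Y/log Y)^2) (log Y) _ Y0 A li (by rw [hTh]) po li hA (by rw [exp_add])
  refine ⟨exp Y0, A+3, by linarith [add_one_le_exp Y0], li, fun Y y hY hy hyY => ?_⟩
  have hYY : Y0 ≤ Y := by linarith [add_one_le_exp Y0]
  have hY0l : Y0 ≤ log Y := by rw [le_log_iff_exp_le li]; exact hY
  have hly : 0 < log y := log_pos li
  have : ¢(VS y) ≤ exp (Y0 + Th Y)*(y/log y) := by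
    rcases le_total y (ee Y0) with g | g
    · exact triv y _ hy g (hTh0 _ li)
    · have hy' : y = ee (log (log y)) := by unfold ee; rw [exp_log hly, exp_log li]
      have ha : Y0 ≤ log (log y) := by
        rw [le_log_iff_exp_le hly, le_log_iff_exp_le li]; exact g
      have hb : log (log y) ≤ Y := by
        rw [log_le_iff_le_exp hly, log_le_iff_le_exp li]; exact hyY
      have := key ⌈y⌉₊ (log (log y)) ha (by rw [← hy']; exact Nat.le_ceil y)
      rw [← hy'] at this
      refine this.trans ?_
      have : Th (log (log y)) ≤ Th Y := hThm _ _ li hb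
      gcongr
  refine this.trans (mul_le_mul_of_nonneg_right (exp_le_exp.mpr ?_) po)
  rw [hTh]
  show Y0 + (C*log (Y/log Y)^2 + (A+2)*log Y) ≤ _
  linarith
theorem tupfin (D Y u : ℝ) (hD : 1 ≤ D) (hY : 1000*D^3 ≤ Y) (hu : 0 < u) (h : ℕ) (h2 : h ≤ 2) (t X S ll : ℝ) (ht : 1 ≤ t) (hX : X ≤ 2*t)
    (hll : ll = log u) (hS : (1+h)*(ll - log (D*Y°^2)) ≤ S) :
    3*X*exp (-S) ≤ Y^9*(t/u^(1+h)) := by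
  have hY1 : 1000 ≤ Y := by nlinarith only [hY, hD, one_le_pow₀ hD (n := 3)]
  have p0 : 0 < D*Y°^2 := po
  have e1 : exp (-S) ≤ (D*Y°^2)^3/u^(1+h) := by
    have : exp (-S) ≤ exp (-((1+h)*(ll - log (D*Y°^2)))) := exp_le_exp.mpr (neg_le_neg hS)
    refine this.trans ?_
    have e2 : -((1+h:ℝ)*(ll - log (D*Y°^2))) = ((1+h:ℕ):ℝ)*log (D*Y°^2) - ((1+h:ℕ):ℝ)*log u := by
      rw [hll]; push_cast; ring
    rw [e2, exp_sub, exp_nat_mul, exp_nat_mul, exp_log p0, exp_log hu]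
    have : 1 ≤ D*Y°^2 := by nlinarith only [hY1, p0, hD]
    gcongr
    omega
  have e3 : (D*Y°^2)^3 ≤ 8*Y^7 := by
    have : Y°^2 ≤ 2*Y^2 := by nlinarith only [hY1]
    calc (D*Y°^2)^3 ≤ (D*(2*Y^2))^3 := by gcongr
      _ = 8*D^3*Y^6 := by ring
      _ ≤ 8*Y*Y^6 := by gcongr; nlinarith only [hY, hY1, one_le_pow₀ hD (n := 3)]
      _ = _ := by ring
  calc 3*X*exp (-S) ≤ 3*(2*t)*((8*Y^7)/u^(1+h)) := by
        gcongr
        exact e1.trans (by gcongr)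
    _ = 48*Y^7*(t/u^(1+h)) := by ring
    _ ≤ Y^9*(t/u^(1+h)) := by
      have : 48*Y^7 ≤ Y^9 := by
        rw [show Y^9 = Y^2*Y^7 by ring]; gcongr; nlinarith only [hY1]
      gcongr
theorem res_le (G : Finset ℕ) (p : ℕ) (hp : p.Prime) :
    #((range p).filter fun r => r = 0 ∨ ∃ a ∈ G, (a*r) % p = 1) ≤ 1 + #G := by
  have huniq : ∀ a r s : ℕ, r < p → s < p → (a*r) % p = 1 → (a*s) % p = 1 → r = s := by
    intro a r s hr hs h1 h2
    have hcop : Nat.Coprime p a := by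
      rw [hp.coprime_iff_not_dvd]; rintro ⟨k, rfl⟩
      rw [mul_assoc, Nat.mul_mod_right] at h1; omega
    have : a*r ≡ a*s [MOD p] := by rw [Nat.ModEq, h1, h2]
    have := Nat.ModEq.cancel_left_of_coprime hcop this
    rwa [Nat.ModEq, Nat.mod_eq_of_lt hr, Nat.mod_eq_of_lt hs] at this
  have : ((range p).filter fun r => r = 0 ∨ ∃ a ∈ G, (a*r) % p = 1) ⊆ {0} ∪ G.biUnion fun a => (range p).filter fun r => (a*r) % p = 1 := fun r hr => by
    obtain ⟨h1, h2⟩ := mem_filter.mp hr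
    rw [mem_union, mem_singleton, mem_biUnion]
    rcases h2 with h2 | ⟨a, ha, h2⟩
    · exact Or.inl h2
    · exact Or.inr ⟨a, ha, mem_filter.mpr ⟨h1, h2⟩⟩
  refine (card_le_card this).trans ((card_union_le _ _).trans (Nat.add_le_add le_rfl ?_))
  have := card_biUnion_le_card_mul G (fun a => (range p).filter fun r => (a*r) % p = 1) 1 (fun a _ => card_le_one.mpr fun r hr s hs => by
    obtain ⟨h1, h2⟩ := mem_filter.mp hr
    obtain ⟨h3, h4⟩ := mem_filter.mp hs
    exact huniq a r s (mem_range.mp h1) (mem_range.mp h3) h2 h4)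
  rwa [mul_one] at this
theorem res_ge (G : Finset ℕ) (p : ℕ) (hp : p.Prime) (g1 : ∀ a ∈ G, ¬ p ∣ a) (g2 : ∀ a ∈ G, ∀ b ∈ G, a % p = b % p → a = b) :
    1 + #G ≤ #((range p).filter fun r => r = 0 ∨ ∃ a ∈ G, (a*r) % p = 1) := by
  have : ∀ a ∈ G, ∃ c, c < p ∧ (a*c) % p = 1 := fun a ha => by
    have hc : Nat.Coprime a p := ((Nat.Prime.coprime_iff_not_dvd hp).2 (g1 a ha)).symm
    obtain ⟨c, h1, h2⟩ := Nat.exists_mul_mod_eq_one_of_coprime hc hp.one_lt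
    exact ⟨c, h1, h2⟩
  choose! c hc1 hc2 using this
  have h0 : 0 ∉ G.image c := fun h => by
    obtain ⟨a, ha, h0⟩ := mem_image.mp h
    have := hc2 a ha; rw [h0] at this; simp at this
  have hcard : #(insert 0 (G.image c)) = 1 + #G := by
    rw [card_insert_of_notMem h0, card_image_of_injOn, add_comm]
    intro a ha b hb hab
    have hab : c a = c b := hab
    refine g2 a ha b hb ?_
    have e1 := hc2 a ha
    have e2 := hc2 b hb
    rw [← hab] at e2
    have hcop : Nat.Coprime p (c a) := by
      rw [hp.coprime_iff_not_dvd]; rintro ⟨k, hk⟩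
      rw [hk, mul_left_comm, Nat.mul_mod_right] at e1; omega
    exact Nat.ModEq.cancel_right_of_coprime hcop (show a * c a ≡ b * c a [MOD p] by rw [Nat.ModEq, e1, e2])
  rw [← hcard]
  refine card_le_card fun r hr => ?_
  rcases mem_insert.mp hr with rfl | hr
  · exact mem_filter.mpr ⟨mem_range.mpr hp.pos, Or.inl rfl⟩
  · obtain ⟨a, ha, rfl⟩ := mem_image.mp hr
    exact mem_filter.mpr ⟨mem_range.mpr (hc1 a ha), Or.inr ⟨a, ha, hc2 a ha⟩⟩
theorem tupsmall (t y ly : ℝ) (h : ℕ) (hG : h ≤ 2) (hy : y = exp ly) (hlyt : ly ≤ log t/4) (h6 : 1 ≤ log t) (hy2 : 2 ≤ y) (ht : 1 ≤ t)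
    (a2 : 24*(log t/2)^3 ≤ exp (log t/2)) : y + 2 ≤ t/log t^(1+h) := by
  have a1 : log t^(1+h) ≤ log t^3 := pow_le_pow_right₀ h6 om
  have h3 : 0 < log t^3 := po
  have a3 : 2*log t^3 ≤ exp (log t/2) := by
    have : 24*(log t/2)^3 = 3*log t^3 := by ring
    linarith
  have hp : 0 < log t^(1+h) := po
  rw [le_div_iff₀ hp]
  have hye : y ≤ exp (log t/4) := by rw [hy]; exact exp_le_exp.mpr hlyt
  calc (y+2)*log t^(1+h) ≤ (y+y)*log t^3 := by gcongr
    _ = y*(2*log t^3) := by ring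
    _ ≤ exp (log t/4)*exp (log t/2) := by gcongr
    _ ≤ exp (log t) := by rw [← exp_add]; exact exp_le_exp.mpr li
    _ = t := exp_log li
theorem tuple : ∃ Y0 : ℝ, 10 ≤ Y0 ∧ ∀ Y t : ℝ, Y0 ≤ Y → 1 < t → Y^2 ≤ log t → log (log t) ≤ Y + 1 →
    ∀ (G : Finset ℕ) (Δ : ℕ), #G ≤ 2 → Δ ≠ 0 → log Δ ≤ exp (2*Y°) → (∀ a ∈ G, a ≠ 0) →
    (∀ p : ℕ, p.Prime → ¬ p ∣ Δ → (∀ a ∈ G, ¬ p ∣ a) ∧ ∀ a ∈ G, ∀ b ∈ G, a % p = b % p → a = b) →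
    ∀ B : Finset ℕ, (∀ b ∈ B, b.Prime ∧ §b ≤ t ∧ ∀ a ∈ G, (a*b-1).Prime) →
    ¢B ≤ Y^10*(t/log t^(1+#G)) := by
  classical
  obtain ⟨K, hK, hS⟩ := sieve
  obtain ⟨C, hC, -, -, hM⟩ := mertens
  obtain ⟨C', hC', hD⟩ := sum_div
  obtain ⟨L0, hL0, hexp⟩ := pow_le_exp_ev 24 3
  obtain ⟨D, hDd⟩ := exq ((4*K)*exp (C+C'))
  have hD1 : 1 ≤ D := by rw [hDd]; nlinarith [one_le_exp (show 0 ≤ C+C' by linarith)]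
  refine ⟨1000*D^3 + 100*K + 2*L0 + 10, by have : 0 < D^3 := po
                                           linarith, fun Y t hY ht hlt hllt G Δ hG hΔ hlΔ hG0 hGp B hB => ?_⟩
  have hD3 : 1 ≤ D^3 := one_le_pow₀ hD1
  have hY0 : 1000 ≤ Y := li
  have hYK : 100*K ≤ Y := li
  obtain ⟨ly, hly⟩ := exq (log t/(4*K*Y°))
  obtain ⟨y, hy⟩ := exq (exp ly)
  have hlt0 : 0 < log t := log_pos ht
  have hlog6 : Y ≤ log t := le_trans (by rw [sq]; exact le_mul_of_one_le_left li li) hlt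
  have hKY : 0 < 4*K*Y° := po
  have hly2 : 2 ≤ ly := by
    rw [hly, le_div_iff₀ hKY]
    have : 2*(4*K*Y°) ≤ Y*Y := by
      calc 2*(4*K*Y°) = (8*K)*Y° := by ring
        _ ≤ (Y/2)*(2*Y) := by gcongr <;> linarith
        _ = _ := by ring
    linarith [sq Y]
  have hy2 : 2 ≤ y := by rw [hy]; linarith [add_one_le_exp ly]
  have hlogy : log y = ly := by rw [hy, log_exp]
  have hly3 : log ly = log (log t) - log (4*K*Y°) := by rw [hly, log_div hlt0.ne' hKY.ne']
  have hlyt : ly ≤ log t/4 := by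
    rw [hly]; gcongr; rw [mul_assoc]; exact le_mul_of_one_le_right nu (one_le_mul_of_one_le_of_one_le hK li)
  obtain ⟨X, hX⟩ := exq (⌊t⌋₊+1)
  have hX1 : t ≤ X := by rw [hX]; push_cast; exact (Nat.lt_floor_add_one t).le
  have hX2 : §X ≤ 2*t := by rw [hX]; push_cast; linarith [Nat.floor_le (show 0 ≤ t by linarith)]
  obtain ⟨R, hR⟩ := exq (fun p => (range p).filter fun r => r = 0 ∨ ∃ a ∈ G, (a*r) % p = 1 : ℕ → Finset ℕ)
  have hPy : ∀ p ∈ PR ⌊y⌋₊, p.Prime ∧ §p ≤ y := fun p hp => by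
    simp only [mem_filter, mem_range, Nat.lt_succ_iff] at hp
    exact ⟨hp.2, (Nat.le_floor_iff po).1 hp.1⟩
  have hRle : ∀ p : ℕ, p.Prime → #(R p) ≤ 1 + #G := fun p hp => by rw [hR]; exact res_le G p hp
  have hRge : ∀ p : ℕ, p.Prime → ¬ p ∣ Δ → 1 + #G ≤ #(R p) := fun p hp hpd => by
    rw [hR]; exact res_ge G p hp (hGp p hp hpd).1 (hGp p hp hpd).2
  have hs := hS Y° li y hy2 (by
      rw [hlogy, hly3]
      have : 0 ≤ log (4*K*Y°) := log_nonneg (by rw [mul_assoc]; exact one_le_mul_of_one_le_of_one_le nu (one_le_mul_of_one_le_of_one_le hK li))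
      linarith) X (by
      have : log t ≤ log X := log_le_log li hX1
      refine le_trans ?_ this
      rw [hlogy, hly]
      have : K*Y°*(log t/(4*K*Y°)) = log t/4 := by field_simp
      linarith) (PR ⌊y⌋₊) R (fun p hp => ⟨(hPy p hp).1, (hPy p hp).2, fun r hr => by
        rw [hR] at hr; exact mem_range.mp (mem_filter.mp hr).1, (hRle p (hPy p hp).1).trans om⟩)
  have hsum : (1+#G:ℝ)*(log (log t) - log (D*Y°^2)) ≤ ∑ p ∈ PR ⌊y⌋₊, ¢(R p)/p := by
    have m1 := hM (-1) (log (log y)) le_rfl (by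
      rw [hlogy]; have : 0 ≤ log ly := log_nonneg li
      linarith) (PR ⌊y⌋₊) (fun p hp _ hpy => by
        rw [LL_le_iff hp.two_le, ee, exp_log (by rw [hlogy]; linarith), exp_log li] at hpy
        simp only [mem_filter, mem_range, Nat.lt_succ_iff]
        exact ⟨Nat.le_floor hpy, hp⟩)
    have m2 := hD Y° Δ li hΔ hlΔ
    have m3 : (1+#G:ℝ)*(∑ p ∈ PR ⌊y⌋₊, 1/§p - ∑ p ∈ Δ.primeFactors, 1/§p) ≤ ∑ p ∈ PR ⌊y⌋₊, ¢(R p)/p := by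
      have n1 : ∑ p ∈ PR ⌊y⌋₊, 1/§p - ∑ p ∈ Δ.primeFactors, 1/§p ≤ ∑ p ∈ (PR ⌊y⌋₊).filter (fun p => ¬ p ∣ Δ), 1/§p := by
        rw [sub_le_iff_le_add, ← sum_filter_add_sum_filter_not (PR ⌊y⌋₊) (fun p => ¬ p ∣ Δ)]
        refine add_le_add le_rfl (sum_le_sum_of_subset_of_nonneg (fun p hp => ?_) (fun _ _ _ => po))
        obtain ⟨a, b⟩ := mem_filter.mp hp
        exact Nat.mem_primeFactors.mpr ⟨(hPy p a).1, not_not.mp b, hΔ⟩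
      calc _ ≤ (1+#G:ℝ)*∑ p ∈ (PR ⌊y⌋₊).filter (fun p => ¬ p ∣ Δ), 1/§p := by gcongr
        _ = ∑ p ∈ (PR ⌊y⌋₊).filter (fun p => ¬ p ∣ Δ), (1+#G:ℝ)/§p := by
            rw [mul_sum]; exact sum_congr rfl fun p _ => by ring
        _ ≤ ∑ p ∈ (PR ⌊y⌋₊).filter (fun p => ¬ p ∣ Δ), ¢(R p)/§p := by
            refine sum_le_sum fun p hp => ?_
            obtain ⟨a, b⟩ := mem_filter.mp hp
            have := hRge p (hPy p a).1 b
            gcongr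
            exact_mod_cast this
        _ ≤ _ := sum_le_sum_of_subset_of_nonneg (filter_subset _ _) fun _ _ _ => po
    refine le_trans ?_ m3
    refine mul_le_mul_of_nonneg_left ?_ po
    have e1 : log (D*Y°^2) = log (4*K*Y°) + (C + C') + log Y° := by
      rw [hDd, show 4*K*exp (C+C')*Y°^2 = (4*K*Y°)*exp (C+C')*Y° by ring,
        log_mul po po, log_mul po po, log_exp]
    rw [hlogy, hly3] at m1
    linarith only [m1, m2, e1]
  have hfin := tupfin D Y (log t) hD1 li hlt0 #G hG t X _ _ ht.le hX2 rfl hsum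
  have hsplit : ¢B ≤ (y+2) + (#{n ∈ range X | ∀ p ∈ PR ⌊y⌋₊, n % p ∉ R p}:ℝ) := by
    have i1 : B ⊆ range (⌊y⌋₊+2) ∪ {n ∈ range X | ∀ p ∈ PR ⌊y⌋₊, n % p ∉ R p} := fun b hb => by
      obtain ⟨b1, b2, b3⟩ := hB b hb
      rw [mem_union, mem_range]
      by_cases hby : b < ⌊y⌋₊+2
      · exact Or.inl hby
      refine Or.inr (mem_filter.mpr ⟨mem_range.mpr (by rw [hX]; exact Nat.lt_succ_of_le (Nat.le_floor b2)), fun p hp hpR => ?_⟩)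
      have hp1 := (hPy p hp).1
      have hp2 : p ≤ ⌊y⌋₊ := Nat.le_floor (hPy p hp).2
      rw [hR] at hpR
      rcases (mem_filter.mp hpR).2 with h | ⟨a, ha, h⟩
      · have := (Nat.prime_dvd_prime_iff_eq hp1 b1).mp (Nat.dvd_of_mod_eq_zero h); omega
      · have hb0 := b1.two_le
        have h1 : 1 ≤ a := Nat.pos_of_ne_zero (hG0 a ha)
        have hab : b ≤ a*b := Nat.le_mul_of_pos_left b h1
        have : 1 ≡ a*b [MOD p] := by
          rw [Nat.ModEq, Nat.mod_eq_of_lt hp1.one_lt, ← h, Nat.mul_mod, Nat.mod_mod, ← Nat.mul_mod]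
        have := (Nat.modEq_iff_dvd' om).1 this
        have := (Nat.prime_dvd_prime_iff_eq hp1 (b3 a ha)).mp this
        omega
    calc ¢B ≤ (⌊y⌋₊+2:ℕ) + (#{n ∈ range X | ∀ p ∈ PR ⌊y⌋₊, n % p ∉ R p}:ℝ) := by
          have := (card_le_card i1).trans (card_union_le _ _)
          rw [card_range] at this; exact_mod_cast this
      _ ≤ _ := by
          push_cast; linarith only [hy2, Nat.floor_le (show 0 ≤ y by linarith)]
  have hsmall := tupsmall t y ly #G hG hy hlyt li hy2 ht.le (hexp (log t/2) li)
  have hY10 : 1 + Y^9 ≤ Y^10 := by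
    have : 1 ≤ Y^9 := one_le_pow₀ li
    have h2 : 2*Y^9 ≤ Y*Y^9 := mul_le_mul_of_nonneg_right li li
    rw [show Y^10 = Y*Y^9 by ring]; linarith
  calc ¢B ≤ t/log t^(1+#G) + Y^9*(t/log t^(1+#G)) := li
    _ = (1+Y^9)*(t/log t^(1+#G)) := by ring
    _ ≤ _ := by gcongr
theorem mkDelta (G : Finset ℕ) (hG : #G ≤ 2) (h0 : ∀ a ∈ G, a ≠ 0) (U : ℝ) (hU : 0 ≤ U) (hl : ∀ a ∈ G, log §a ≤ U) :
    ∃ Δ : ℕ, Δ ≠ 0 ∧ log Δ ≤ 4*U ∧ ∀ p : ℕ, p.Prime → ¬ p ∣ Δ → (∀ a ∈ G, ¬ p ∣ a) ∧ ∀ a ∈ G, ∀ b ∈ G, a % p = b % p → a = b := by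
  have d0 : ∀ i ∈ G.offDiag, ((i.1:ℤ)-i.2).natAbs ≠ 0 := fun i hi => by
    have := (mem_offDiag.mp hi).2.2; omega
  refine ⟨(∏ a ∈ G, a) * ∏ i ∈ G.offDiag, ((i.1:ℤ)-i.2).natAbs, mul_ne_zero (prod_ne_zero_iff.mpr h0) (prod_ne_zero_iff.mpr d0), ?_, ?_⟩
  · push_cast
    rw [log_mul (by rw [prod_ne_zero_iff]; intro a ha; exact_mod_cast h0 a ha)
      (by rw [prod_ne_zero_iff]; intro i hi; have := d0 i hi; exact_mod_cast this),
      log_prod (fun a ha => mod_cast h0 a ha), log_prod (fun i hi => by have := d0 i hi; exact_mod_cast this)]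
    have a1 : ∑ a ∈ G, log §a ≤ #G * U := by rw [← nsmul_eq_mul]; exact sum_le_card_nsmul _ _ _ hl
    have a2 : ∑ i ∈ G.offDiag, log ((((i.1:ℤ)-i.2).natAbs:ℕ):ℝ) ≤ #G.offDiag * U := by
      rw [← nsmul_eq_mul]; refine sum_le_card_nsmul _ _ _ fun i hi => ?_
      obtain ⟨h1, h2, -⟩ := mem_offDiag.mp hi
      have hi0 := d0 i hi
      rcases le_total i.1 i.2 with h | h
      · exact (log_le_log (by exact_mod_cast Nat.pos_of_ne_zero hi0) (mod_cast (by omega : ((i.1:ℤ)-i.2).natAbs ≤ i.2))).trans (hl _ h2)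
      · exact (log_le_log (by exact_mod_cast Nat.pos_of_ne_zero hi0) (mod_cast (by omega : ((i.1:ℤ)-i.2).natAbs ≤ i.1))).trans (hl _ h1)
    have a3 : #G + #G.offDiag ≤ 4 := by
      rw [offDiag_card]; interval_cases #G <;> norm_num
    have a4 : ((#G + #G.offDiag : ℕ):ℝ) ≤ 4 := mod_cast a3
    have a5 := mul_le_mul_of_nonneg_right a4 hU
    push_cast at a2 a5 ⊢
    linarith
  · intro p hp hpd
    refine ⟨fun a ha h => hpd ((h.trans (dvd_prod_of_mem _ ha)).mul_right _), fun a ha b hb hab => ?_⟩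
    by_contra hne
    refine hpd (Dvd.dvd.mul_left ?_ _)
    have : (a,b) ∈ G.offDiag := mem_offDiag.mpr ⟨ha, hb, hne⟩
    refine Dvd.dvd.trans ?_ (dvd_prod_of_mem _ this)
    have := (Nat.modEq_iff_dvd.mp (show b ≡ a [MOD p] from hab.symm))
    exact Int.natCast_dvd.mp this
theorem remsum : ∃ Y0 : ℝ, 10 ≤ Y0 ∧ ∀ Y x : ℝ, Y0 ≤ Y → 4*log Y ≤ x → ∀ (G B : Finset ℕ) (h : ℕ) (z : ℝ), #G ≤ 2 → h ≤ 1 →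
    (∀ a ∈ G, a ≠ 0) → (∀ b ∈ B, b.Prime ∧ (∀ a ∈ G, (a*b-1).Prime ∧ x ≤ LL (a*b-1) ∧ LL (a*b-1) ≤ Y) ∧
      (∃ a ∈ G, log ((a*b-1:ℕ):ℝ) ≤ Y^2*log b) ∧ (h = 1 → z/100 < b ∧ §b ≤ z)) →
    ∑ b ∈ B, 1/§b ≤ Y^19*exp (-((#G+h)*x)) := by
  obtain ⟨Y0, hY0, hT⟩ := tuple
  refine ⟨Y0+100, li, fun Y x hY hx G B h z hG hh hG0 hB => ?_⟩
  have hY1 : 100 ≤ Y := li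
  rcases B.eq_empty_or_nonempty with rfl | ⟨b0, hb0⟩
  · simp; positivity
  obtain ⟨u, hu⟩ := exq (exp x/Y^2)
  have hu0 : 0 < u := by rw [hu]; positivity
  have huY : Y^2 ≤ u := by
    rw [hu, le_div_iff₀ po]
    have := exp_le_exp.mpr hx
    rw [show 4*log Y = ((4:ℕ):ℝ)*log Y by norm_num, exp_nat_mul, exp_log li] at this
    linarith [show Y^2*Y^2 = Y^4 by ring]
  have hYY : 100*Y ≤ Y^2 := by rw [sq]; exact mul_le_mul_of_nonneg_right hY1 li
  have hub : ∀ b ∈ B, u ≤ log b := fun b hb => by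
    obtain ⟨h1, h2, ⟨a, ha, h3⟩, -⟩ := hB b hb
    have h4 := (h2 a ha).2.1
    have hq := (h2 a ha).1.two_le
    have : exp x ≤ log ((a*b-1:ℕ):ℝ) := by
      rwa [LL, le_log_iff_exp_le (log_pos (mod_cast hq))] at h4
    rw [hu, div_le_iff₀ po]; linarith
  have habe : ∀ b ∈ B, ∀ a ∈ G, log ((a*b:ℕ):ℝ) ≤ 1 + exp Y := fun b hb a ha => by
    obtain ⟨h1, h2, -, -⟩ := hB b hb
    obtain ⟨h3, -, h4⟩ := h2 a ha
    rw [LL_le_iff h3.two_le, ee] at h4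
    have : ((a*b:ℕ):ℝ) ≤ exp (1+exp Y) := by
      have e1 : ((a*b:ℕ):ℝ) ≤ 2*((a*b-1:ℕ):ℝ) := by
        have := h3.two_le; exact_mod_cast om
      rw [exp_add]; nlinarith only [h4, e1, exp_one_gt_d9]
    have e0 : 0 < a*b := Nat.mul_pos (Nat.pos_of_ne_zero (hG0 a ha)) h1.pos
    rwa [log_le_iff_le_exp (mod_cast e0)]
  have hlb : ∀ b ∈ B, log b ≤ 1 + exp Y := fun b hb => by
    obtain ⟨h1, -, ⟨a, ha, -⟩, -⟩ := hB b hb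
    refine le_trans (log_le_log (mod_cast h1.pos) ?_) (habe b hb a ha)
    exact_mod_cast Nat.le_mul_of_pos_left b (Nat.pos_of_ne_zero (hG0 a ha))
  have heY : 100 ≤ exp Y := by linarith [add_one_le_exp Y]
  obtain ⟨Δ, d1, d2, d3⟩ := mkDelta G hG hG0 (1+exp Y) li (fun a ha => by
    refine le_trans (log_le_log (mod_cast Nat.pos_of_ne_zero (hG0 a ha)) ?_) (habe b0 hb0 a ha)
    exact_mod_cast Nat.le_mul_of_pos_right a (hB b0 hb0).1.pos)
  have hcnt : ∀ t : ℝ, ∀ b ∈ B, §b ≤ t → log t ≤ exp Y° → ∀ B' ⊆ B, (∀ b ∈ B', §b ≤ t) →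
      1 < t ∧ u ≤ log t ∧ ¢B' ≤ Y^10*(t/log t^(1+#G)) := fun t b hb h1 hlt B' hB' h3 => by
    have hb1 : 1 < §b := mod_cast (hB b hb).1.one_lt
    have hut : u ≤ log t := (hub b hb).trans (log_le_log li h1)
    have hlt0 : 0 < log t := hu0.trans_le hut
    refine ⟨li, hut, hT Y t li li (huY.trans hut) ((log_le_iff_le_exp hlt0).mpr hlt) G Δ hG d1
      (d2.trans ?_) hG0 d3 B' fun b hb => ⟨(hB b (hB' hb)).1, h3 b hb, fun a ha => ((hB b (hB' hb)).2.1 a ha).1⟩⟩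
    have : exp (2*Y°) = exp Y*exp Y*exp 2 := by rw [← exp_add, ← exp_add]; ring_nf
    rw [this]; nlinarith only [heY, one_le_exp (show §0 ≤ 2 by norm_num), mul_pos (exp_pos Y) (exp_pos Y)]
  have huinv : 1/u = Y^2*exp (-x) := by rw [hu, exp_neg]; field_simp
  have hexp : ∀ n : ℕ, (1/u)^n = Y^(2*n)*exp (-(n*x)) := fun n => by
    rw [huinv, mul_pow, ← pow_mul, ← exp_nat_mul]; ring_nf
  have hh2 : h = 0 ∨ h = 1 := om
  rcases hh2 with rfl | rfl
  · have := dy2 (Y+2) (Y^10*(1/u)^#G) (exp (1+exp Y)) li po (one_le_exp li) (by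
      rw [log_exp, exp_add]; nlinarith only [heY, add_one_le_exp §2]) B (fun b hb => ⟨(hB b hb).1.ne_zero, by
        have := exp_le_exp.mpr (hlb b hb)
        rwa [exp_log (mod_cast (hB b hb).1.pos)] at this⟩) (fun t ht _ => by
        rcases (B.filter fun n : ℕ => §n ≤ t).eq_empty_or_nonempty with he | ⟨b, hb⟩
        · rw [he]; simp only [card_empty, Nat.cast_zero]
          have := log_nonneg (show 1 ≤ t by linarith); positivity
        obtain ⟨hb1, hb2⟩ := mem_filter.mp hb
        obtain ⟨c1, c2, c3⟩ := hcnt t b hb1 hb2 (by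
          have : log t ≤ log (exp (2+exp Y)) := log_le_log li (by
            rw [show 2+exp Y = 1+(1+exp Y) by ring, exp_add]; nlinarith [exp_one_gt_d9, exp_pos (1+exp Y)])
          rw [log_exp] at this
          rw [exp_add]; nlinarith only [heY, this, exp_one_gt_d9]) _ (filter_subset _ _) (fun b hb => (mem_filter.mp hb).2)
        refine c3.trans ?_
        have h0 := hu0.trans_le c2
        calc Y^10*(t/log t^(1+#G)) = Y^10*(1/log t)^#G*(t/log t) := by rw [div_pow, one_pow, pow_add]; field_simp
          _ ≤ _ := by gcongr)
    calc _ ≤ _ := this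
      _ = (9*(Y+2))*Y^(10+2*#G)*exp (-((#G+(0:ℕ))*x)) := by rw [hexp]; push_cast; ring_nf
      _ ≤ Y^2*Y^17*exp (-((#G+(0:ℕ))*x)) := by gcongr <;> first | linarith | omega
      _ = _ := by ring
  · obtain ⟨c1, c2, c3⟩ := hcnt z b0 hb0 ((hB b0 hb0).2.2.2 rfl).2 (by
        have hb1 : 0 < §b0 := mod_cast (hB b0 hb0).1.pos
        have hz := (hB b0 hb0).2.2.2 rfl
        have : log z ≤ log (exp 5*b0) := log_le_log li (by
          have e2 : §10 ≤ exp (5/2) := by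
            have := exp_one_gt_d9
            rw [show (5/2:ℝ) = 1+1+1/2 by norm_num, exp_add, exp_add]
            nlinarith only [this, add_one_le_exp (1/2:ℝ), exp_pos (1/2:ℝ)]
          have : §100 ≤ exp 5 := by rw [show §5 = 5/2+5/2 by norm_num, exp_add]; nlinarith only [e2]
          nlinarith only [hz, this])
        rw [log_mul po po, log_exp] at this
        rw [exp_add]; nlinarith only [heY, this, hlb, hb0, hlb b0 hb0, exp_one_gt_d9]) B le_rfl (fun b hb => ((hB b hb).2.2.2 rfl).2)
    calc ∑ b ∈ B, 1/§b ≤ ∑ b ∈ B, 100/z := sum_le_sum fun b hb => by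
          have := ((hB b hb).2.2.2 rfl).1
          have hb1 : 0 < §b := mod_cast (hB b hb).1.pos
          rw [div_le_div_iff₀ hb1 li]; linarith
      _ = #B * (100/z) := by rw [sum_const, nsmul_eq_mul]
      _ ≤ Y^10*(z/log z^(1+#G)) * (100/z) := by gcongr
      _ = 100*Y^10*(1/log z)^(1+#G) := by rw [div_pow, one_pow]; field_simp
      _ ≤ 100*Y^10*(1/u)^(1+#G) := by
          have := hu0.trans_le c2
          gcongr
      _ = 100*Y^(10+2*(1+#G))*exp (-((#G+(1:ℕ))*x)) := by rw [hexp]; push_cast; ring_nf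
      _ ≤ Y*Y^18*exp (-((#G+(1:ℕ))*x)) := by gcongr <;> first | linarith | omega
      _ = _ := by ring
noncomputable def wt {κ : Type} [Fintype κ] (g : ℕ → ℝ) (c : κ → ℕ) : ℝ := ∏ e, gm g (c e)
lemma upd_prod {κ : Type} [DecidableEq κ] (c : κ → ℕ) (e : κ) (b : ℕ) (hb : b ∣ c e) (S : Finset κ) (he : e ∈ S) :
    ∏ i ∈ S, c i = (∏ i ∈ S, Function.update c e (c e/b) i) * b := by
  rw [prod_update_of_mem he, ← mul_prod_erase S c he, sdiff_singleton_eq_erase]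
  conv_lhs => rw [← Nat.div_mul_cancel hb]
  ring
lemma upd_prod' {κ : Type} [DecidableEq κ] (c : κ → ℕ) (e : κ) (m : ℕ) (S : Finset κ) (he : e ∉ S) :
    ∏ i ∈ S, Function.update c e m i = ∏ i ∈ S, c i := prod_update_of_notMem he _ _
theorem removal {κ : Type} [Fintype κ] [DecidableEq κ] (g : ℕ → ℝ) (hg : ∀ p : ℕ, 0 ≤ g p ∧ g p ≤ 1/p) (e : κ)
    (𝒞 : Finset (κ → ℕ)) (bf : (κ → ℕ) → ℕ) (D E : ℝ) (hD0 : 0 ≤ D)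
    (h1 : ∀ c ∈ 𝒞, (bf c).Prime ∧ bf c ∣ c e ∧ ∀ i, c i ≠ 0)
    (hD : ∀ d, ∑ b ∈ (𝒞.filter fun c => Function.update c e (c e/bf c) = d).image bf, 1/§b ≤ D)
    (hE : ∑ d ∈ 𝒞.image (fun c => Function.update c e (c e/bf c)), wt g d ≤ E) : ∑ c ∈ 𝒞, wt g c ≤ D*E := by
  rw [← sum_fiberwise_of_maps_to (t := 𝒞.image (fun c => Function.update c e (c e/bf c))) (fun c hc => mem_image_of_mem _ hc)]
  refine le_trans (sum_le_sum (g := fun d => D*wt g d) fun d hd => ?_) (by rw [← mul_sum]; exact mul_le_mul_of_nonneg_left hE hD0)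
  have w0 : 0 ≤ wt g d := prod_nonneg fun i _ => gm_nonneg fun p _ _ => (hg p).1
  refine le_trans ?_ (mul_le_mul_of_nonneg_right (hD d) w0)
  rw [sum_image, sum_mul]
  · refine sum_le_sum fun c hc => ?_
    obtain ⟨hc1, hc2⟩ := mem_filter.mp hc
    obtain ⟨b1, b2, b3⟩ := h1 c hc1
    have e0 : c e/bf c ≠ 0 := (Nat.div_pos (Nat.le_of_dvd (Nat.pos_of_ne_zero (b3 e)) b2) b1.pos).ne'
    have : wt g c = g (bf c)*wt g d := by
      rw [wt, wt, ← mul_prod_erase univ _ (mem_univ e), ← mul_prod_erase univ (fun i => gm g (d i)) (mem_univ e), ← hc2,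
        Function.update_self, ← mul_assoc]
      congr 1
      · conv_lhs => rw [← Nat.mul_div_cancel' b2]
        rw [gm_mul g b1.ne_zero e0, gm_prime g b1]
      · exact prod_congr rfl fun i hi => by rw [Function.update_of_ne (ne_of_mem_erase hi)]
    rw [this]; exact mul_le_mul_of_nonneg_right (hg _).2 w0
  · intro c hc c' hc' hcc
    obtain ⟨hc1, hc2⟩ := mem_filter.mp hc
    obtain ⟨hc3, hc4⟩ := mem_filter.mp hc'
    have hcc : bf c = bf c' := hcc
    have hu := hc2.trans hc4.symm
    funext i
    have hi := congrFun hu i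
    by_cases h : i = e
    · subst h
      rw [Function.update_self, Function.update_self, hcc] at hi
      rw [← Nat.div_mul_cancel (h1 c hc1).2.1, ← Nat.div_mul_cancel (h1 c' hc3).2.1, hcc, hi]
    · rwa [Function.update_of_ne h, Function.update_of_ne h] at hi
theorem rem : ∃ Y0 : ℝ, 10 ≤ Y0 ∧ ∀ Y x : ℝ, Y0 ≤ Y → 4*log Y ≤ x → ∀ (κ : Type) [Fintype κ] [DecidableEq κ] (g : ℕ → ℝ)
    (_ : ∀ p : ℕ, 0 ≤ g p ∧ g p ≤ 1/p) (e : κ) (S : Finset (Finset κ)) (h : ℕ) (z E : ℝ) (𝒞 : Finset (κ → ℕ)),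
    #S ≤ 2 → h ≤ 1 → (∀ s ∈ S, e ∈ s) → (∀ c ∈ 𝒞, (∀ i, c i ≠ 0) ∧
      (∀ s ∈ S, (∏ i ∈ s, c i - 1).Prime ∧ x ≤ LL (∏ i ∈ s, c i - 1) ∧ LL (∏ i ∈ s, c i - 1) ≤ Y) ∧
      (∃ b : ℕ, b.Prime ∧ b ∣ c e ∧ ∃ s ∈ S, log ((∏ i ∈ s, c i - 1 : ℕ):ℝ) ≤ Y^2*log b) ∧
      (∀ s ∈ S, ∀ s' ∈ S, ∏ i ∈ s, c i = ∏ i ∈ s', c i → s = s') ∧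
      (h = 1 → z/100 < (∏ i, c i : ℕ) ∧ ((∏ i, c i : ℕ):ℝ) ≤ z)) →
    (∀ 𝒞' : Finset (κ → ℕ), (∀ d ∈ 𝒞', ∃ c ∈ 𝒞, ∃ b : ℕ, b.Prime ∧ b ∣ c e ∧ d = Function.update c e (c e/b)) →
      ∑ d ∈ 𝒞', wt g d ≤ E) → ∑ c ∈ 𝒞, wt g c ≤ Y^19*exp (-((#S+h)*x))*E := by
  obtain ⟨Y0, hY0, hR⟩ := remsum
  refine ⟨Y0, hY0, fun Y x hY hx κ _ _ g hg e S h z E 𝒞 hS hh heS hc hE => ?_⟩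
  have hY1 : 0 < Y := li
  have hb : ∀ c ∈ 𝒞, ∃ b : ℕ, b.Prime ∧ b ∣ c e ∧ ∃ s ∈ S, log ((∏ i ∈ s, c i - 1 : ℕ):ℝ) ≤ Y^2*log b := fun c hc' => (hc c hc').2.2.1
  choose! bf hb1 hb2 hb3 using hb
  refine removal g hg e 𝒞 bf _ E po (fun c hc' => ⟨hb1 c hc', hb2 c hc', (hc c hc').1⟩) (fun d => ?_)
    (hE _ fun d hd => ?_)
  · obtain ⟨B, hBd⟩ := exq ((𝒞.filter fun c => Function.update c e (c e/bf c) = d).image bf)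
    rw [← hBd]
    have hB : ∀ b ∈ B, ∃ c ∈ 𝒞, bf c = b ∧ (∀ s, e ∈ s → ∏ i ∈ s, c i = (∏ i ∈ s, d i)*b) ∧ ∀ i, d i ≠ 0 := fun b hb => by
      rw [hBd] at hb
      obtain ⟨c, hc', rfl⟩ := mem_image.mp hb
      obtain ⟨c1, c2⟩ := mem_filter.mp hc'
      have key : ∀ s, e ∈ s → ∏ i ∈ s, c i = (∏ i ∈ s, d i)*bf c := fun s hs => by rw [← c2]; exact upd_prod c e _ (hb2 c c1) s hs
      refine ⟨c, c1, rfl, key, fun i hi => ?_⟩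
      by_cases hie : i = e
      · have := key {e} (mem_singleton_self e)
        rw [prod_singleton, prod_singleton, ← hie, hi, zero_mul] at this
        exact (hc c c1).1 i this
      · rw [← c2, Function.update_of_ne hie] at hi; exact (hc c c1).1 i hi
    rcases B.eq_empty_or_nonempty with h0 | ⟨b0, hb0⟩
    · rw [h0, sum_empty]; positivity
    obtain ⟨c0, hc0, -, hk0, hd0⟩ := hB b0 hb0
    have hcard : #(S.image fun s => ∏ i ∈ s, d i) = #S := card_image_of_injOn fun s hs s' hs' hss =>
      (hc c0 hc0).2.2.2.1 s hs s' hs' (by rw [hk0 s (heS s hs), hk0 s' (heS s' hs')]; exact congrArg (· * b0) hss)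
    have hP : 0 < ((∏ i, d i : ℕ):ℝ) := mod_cast Nat.pos_of_ne_zero (prod_ne_zero_iff.mpr fun i _ => hd0 i)
    have := hR Y x hY hx (S.image fun s => ∏ i ∈ s, d i) B h (z/(∏ i, d i : ℕ)) (hcard.trans_le hS) hh (fun a ha => by
      obtain ⟨s, -, rfl⟩ := mem_image.mp ha; exact prod_ne_zero_iff.mpr fun i _ => hd0 i) (fun b hb => by
      obtain ⟨c, h1, h2, h3, -⟩ := hB b hb
      obtain ⟨-, k2, -, -, k5⟩ := hc c h1
      refine ⟨h2 ▸ hb1 c h1, fun a ha => ?_, ?_, fun hh => ?_⟩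
      · obtain ⟨s, hs, rfl⟩ := mem_image.mp ha
        rw [← h3 s (heS s hs)]; exact k2 s hs
      · obtain ⟨s, hs, h4⟩ := hb3 c h1
        exact ⟨_, mem_image_of_mem _ hs, by rw [← h3 s (heS s hs), ← h2]; exact h4⟩
      · have := k5 hh
        rw [h3 univ (mem_univ e)] at this
        push_cast at this hP ⊢
        exact ⟨by rw [div_div, div_lt_iff₀ po]; linarith, by rw [le_div_iff₀ hP]; linarith⟩)
    rwa [hcard] at this
  · obtain ⟨c, c1, rfl⟩ := mem_image.mp hd
    exact ⟨c, c1, bf c, hb1 c c1, hb2 c c1, rfl⟩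
abbrev ln {M : ℕ} (s : Bool) (j : Fin M°) : Finset (Fin M° × Fin M°) := univ.filter fun i => (if s then i.1 else i.2) = j
def LC {M : ℕ} (Y : ℝ) (x : ℕ → ℝ) (c : Fin M° × Fin M° → ℕ) (j : Fin M°) (s : Bool) : Prop :=
  (∏ i ∈ ln s j, c i - 1).Prime ∧ x j ≤ LL (∏ i ∈ ln s j, c i - 1) ∧ LL (∏ i ∈ ln s j, c i - 1) ≤ Y ∧
    ∃ p : ℕ, p.Prime ∧ p ∣ ∏ i ∈ ln s j, c i ∧ log ((∏ i ∈ ln s j, c i - 1 : ℕ):ℝ) ≤ Y^2*log p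
def Gd {M : ℕ} (Y : ℝ) (x ζ : ℕ → ℝ) (n : ℕ) (c : Fin M° × Fin M° → ℕ) : Prop := (∀ i, c i ≠ 0) ∧
  (∀ i p, p.Prime → p ∣ c i → LL p ≤ ζ i.1 + 1 ∧ LL p ≤ ζ i.2 + 1) ∧ ∀ j : Fin M°, n ≤ j →
    (∀ s, LC Y x c j s) ∧ ∏ i ∈ ln true j, c i ≠ ∏ i ∈ ln false j, c i
lemma LC_upd {M : ℕ} {Y : ℝ} {x : ℕ → ℝ} {c : Fin M° × Fin M° → ℕ} {j : Fin M°} {s : Bool} (h : LC Y x c j s)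
    {e} (he : e ∉ ln s j) (m : ℕ) : LC Y x (Function.update c e m) j s := by
  unfold LC; rw [upd_prod' c e m _ he]; exact h
lemma Gd_upd {M : ℕ} {Y : ℝ} {x ζ : ℕ → ℝ} {n : ℕ} {c : Fin M° × Fin M° → ℕ} (h : Gd Y x ζ n c) {e} (he : (e.1:ℕ) < n ∧ (e.2:ℕ) < n)
    {b : ℕ} (hb : b ∣ c e) (hb1 : b.Prime) : Gd Y x ζ n (Function.update c e (c e/b)) := by
  obtain ⟨h1, h2, h3⟩ := h
  have hd : ∀ i, Function.update c e (c e/b) i ∣ c i := fun i => by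
    by_cases hi : i = e
    · rw [hi, Function.update_self]; exact Nat.div_dvd_of_dvd hb
    · rw [Function.update_of_ne hi]
  have hn : ∀ (j : Fin M°) s, n ≤ j → e ∉ ln s j := fun j s hj hm => by
    have := (mem_filter.mp hm).2
    have hj' := congrArg Fin.val this
    cases s <;> simp at hj' <;> omega
  refine ⟨fun i hi => h1 i (Nat.eq_zero_of_zero_dvd (hi ▸ hd i)), fun i p hp hpi => h2 i p hp (hpi.trans (hd i)), fun j hj =>
    ⟨fun s => LC_upd ((h3 j hj).1 s) (hn j s hj) _, ?_⟩⟩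
  rw [upd_prod' c e _ _ (hn j _ hj), upd_prod' c e _ _ (hn j _ hj)]; exact (h3 j hj).2
lemma Gd_succ {M : ℕ} {Y : ℝ} {x ζ : ℕ → ℝ} {n : ℕ} {c : Fin M° × Fin M° → ℕ} (h : Gd Y x ζ n c) : Gd Y x ζ n° c :=
  ⟨h.1, h.2.1, fun j hj => h.2.2 j om⟩
lemma loc {M : ℕ} {Y : ℝ} (hY : 1 ≤ Y) {x ζ : ℕ → ℝ} {n : Fin M°} (hgap : ∀ k : Fin M°, n < k → ζ k + 1 + 2*log Y < x n)
    {c : Fin M° × Fin M° → ℕ} (h : Gd Y x ζ n c) (s : Bool) : ∃ i ∈ ln s n, i.1 ≤ n ∧ i.2 ≤ n ∧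
    ∃ p : ℕ, p.Prime ∧ p ∣ c i ∧ log ((∏ i ∈ ln s n, c i - 1 : ℕ):ℝ) ≤ Y^2*log p := by
  obtain ⟨h0, h1, -, p, hp, hpd, hl⟩ := (h.2.2 n le_rfl).1 s
  obtain ⟨i, hi, hpi⟩ := hp.prime.exists_mem_finset_dvd hpd
  have hL : x n - 2*log Y ≤ LL p := by
    have hl0 : 0 < log ((∏ i ∈ ln s n, c i - 1 : ℕ):ℝ) := log_pos (mod_cast h0.one_lt)
    have hp0 : 0 < log §p := log_pos (mod_cast hp.one_lt)
    have := log_le_log hl0 hl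
    rw [log_mul po hp0.ne', log_pow] at this
    push_cast at this; unfold LL at h1 ⊢; linarith
  have hz := h.2.1 i p hp hpi
  refine ⟨i, hi, not_lt.mp fun hlt => ?_, not_lt.mp fun hlt => ?_, p, hp, hpi, hl⟩
  · linarith [hgap _ hlt]
  · linarith [hgap _ hlt]
theorem stp : ∃ Y0 : ℝ, 10 ≤ Y0 ∧ ∀ (Y : ℝ) (M : ℕ) (x ζ : ℕ → ℝ) (n : Fin M°) (g : ℕ → ℝ) (E : ℝ) (𝒞 : Finset (Fin M° × Fin M° → ℕ)),
    Y0 ≤ Y → 4*log Y ≤ x n → (∀ k : Fin M°, n < k → ζ k + 1 + 2*log Y < x n) → (∀ p : ℕ, 0 ≤ g p ∧ g p ≤ 1/p) →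
    (∀ 𝒞' : Finset (Fin M° × Fin M° → ℕ), (∀ d ∈ 𝒞', Gd Y x ζ n° d) → ∑ d ∈ 𝒞', wt g d ≤ E) → (∀ c ∈ 𝒞, Gd Y x ζ n c) →
    ∑ c ∈ 𝒞, wt g c ≤ (1+§M°^2)*(Y^38*exp (-(2*x n))*E) ∧
    ((n:ℕ) = 0 → ∀ z : ℝ, (∀ c ∈ 𝒞, z/100 < (∏ i, c i : ℕ) ∧ ((∏ i, c i : ℕ):ℝ) ≤ z) → ∑ c ∈ 𝒞, wt g c ≤ Y^19*exp (-(3*x n))*E) := by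
  classical
  obtain ⟨Y0, hY0, hR⟩ := rem
  refine ⟨Y0, hY0, fun Y M x ζ n g E 𝒞 hY hx hgap hg hE hc => ?_⟩
  have hY1 : 1 ≤ Y := li
  have hE0 : 0 ≤ E := by simpa using hE ∅ si
  have hdiag : ∀ (𝒜 : Finset (Fin M° × Fin M° → ℕ)) (h : ℕ) (z : ℝ), 𝒜 ⊆ 𝒞 → h ≤ 1 → (∀ c ∈ 𝒜, ∃ s, ∃ p : ℕ, p.Prime ∧ p ∣ c (n,n) ∧
      log ((∏ i ∈ ln s n, c i - 1 : ℕ):ℝ) ≤ Y^2*log p) → (h = 1 → ∀ c ∈ 𝒜, z/100 < (∏ i, c i : ℕ) ∧ ((∏ i, c i : ℕ):ℝ) ≤ z) →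
      ∑ c ∈ 𝒜, wt g c ≤ Y^19*exp (-((2+h)*x n))*E := fun 𝒜 h z hA hh hb hz => by
    rcases 𝒜.eq_empty_or_nonempty with h0 | ⟨c0, hc0⟩
    · rw [h0, sum_empty]; positivity
    have hne : ln true n ≠ ln false n := fun h => ((hc c0 (hA hc0)).2.2 n le_rfl).2 (by rw [h])
    have := hR Y (x n) hY hx _ g hg (n,n) {ln true n, ln false n} h z E 𝒜 card_le_two hh si (fun c hc' => by
      obtain ⟨k1, k2, k3⟩ := hc c (hA hc')
      obtain ⟨k4, k5⟩ := k3 n le_rfl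
      refine ⟨k1, fun s hs => ?_, ?_, fun s hs s' hs' hss => ?_, fun hh => hz hh c hc'⟩
      · rw [mem_insert, mem_singleton] at hs
        rcases hs with rfl | rfl
        exacts [⟨(k4 true).1, (k4 true).2.1, (k4 true).2.2.1⟩, ⟨(k4 false).1, (k4 false).2.1, (k4 false).2.2.1⟩]
      · obtain ⟨s, p, h1, h2, h3⟩ := hb c hc'
        exact ⟨p, h1, h2, ln s n, by cases s <;> simp, h3⟩
      · rw [mem_insert, mem_singleton] at hs hs'
        rcases hs with rfl | rfl <;> rcases hs' with rfl | rfl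
        exacts [rfl, absurd hss k5, absurd hss.symm k5, rfl]) (fun 𝒞' hd => hE 𝒞' fun d hd' => by
      obtain ⟨c, h1, b, h2, h3, rfl⟩ := hd d hd'
      exact Gd_upd (Gd_succ (hc c (hA h1))) ⟨si, si⟩ h3 h2)
    rwa [card_pair hne] at this
  refine ⟨?_, fun h0 z hz => ?_⟩
  · have hlab : ∀ c ∈ 𝒞, ∃ t : Option (Fin M° × Fin M°), (t = none → ∃ s, ∃ p : ℕ, p.Prime ∧ p ∣ c (n,n) ∧
        log ((∏ i ∈ ln s n, c i - 1 : ℕ):ℝ) ≤ Y^2*log p) ∧ (∀ k k', t = some (k,k') → k < n ∧ k' < n ∧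
        (∃ p : ℕ, p.Prime ∧ p ∣ c (n,k) ∧ log ((∏ i ∈ ln true n, c i - 1 : ℕ):ℝ) ≤ Y^2*log p) ∧
        (∃ p : ℕ, p.Prime ∧ p ∣ c (k',n) ∧ log ((∏ i ∈ ln false n, c i - 1 : ℕ):ℝ) ≤ Y^2*log p)) := fun c hc' => by
      obtain ⟨⟨a, k⟩, i1, i2, i3, i4⟩ := loc hY1 hgap (hc c hc') true
      obtain ⟨⟨k', a'⟩, i1', i2', i3', i4'⟩ := loc hY1 hgap (hc c hc') false
      obtain rfl : a = n := by simpa using i1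
      obtain rfl : a' = a := by simpa using i1'
      by_cases h1 : k = a'
      · subst h1; exact ⟨none, fun _ => ⟨true, i4⟩, si⟩
      by_cases h2 : k' = a'
      · subst h2; exact ⟨none, fun _ => ⟨false, i4'⟩, si⟩
      refine ⟨some (k,k'), si, fun _ _ h => ?_⟩
      cases h
      exact ⟨lt_of_le_of_ne i3 h1, lt_of_le_of_ne i2' h2, i4, i4'⟩
    choose! t ht1 ht2 using hlab
    rw [← sum_fiberwise_of_maps_to (t := univ) (g := t) (fun _ _ => mem_univ _)]
    refine (sum_le_card_nsmul _ _ (Y^38*exp (-(2*x n))*E) fun o _ => ?_).trans (by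
      rw [nsmul_eq_mul]; refine mul_le_mul_of_nonneg_right (le_of_eq ?_) po
      simp [Fintype.card_option]; ring)
    rcases o with _ | ⟨k, k'⟩
    · refine (hdiag _ 0 0 (filter_subset _ _) om (fun c hc' => ?_) si).trans ?_
      · obtain ⟨h1, h2⟩ := mem_filter.mp hc'; exact ht1 c h1 h2
      · rw [Nat.cast_zero, add_zero]; gcongr <;> first | exact hY1 | norm_num
    · by_cases hk : k < n ∧ k' < n
      swap
      · rw [sum_eq_zero]
        · positivity
        · intro c hc'; obtain ⟨h1, h2⟩ := mem_filter.mp hc'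
          exact absurd ⟨(ht2 c h1 k k' h2).1, (ht2 c h1 k k' h2).2.1⟩ hk
      obtain ⟨hk, hk'⟩ := hk
      have hsp : Y^38*exp (-(2*x n))*E = Y^19*exp (-((1+(0:ℕ))*x n))*(Y^19*exp (-((1+(0:ℕ))*x n))*E) := by
        rw [show -(2*x n) = -((1+(0:ℕ))*x n)+ -((1+(0:ℕ))*x n) by push_cast; ring, exp_add]; ring
      rw [hsp]
      have := hR Y (x n) hY hx _ g hg (n,k) {ln true n} 0 0 (Y^19*exp (-((1+(0:ℕ))*x n))*E) (𝒞.filter fun c => t c = some (k,k')) si si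
        si (fun c hc' => by
        obtain ⟨h1, h2⟩ := mem_filter.mp hc'
        have k4 := ((hc c h1).2.2 n le_rfl).1 true
        obtain ⟨-, -, ⟨p, p1, p2, p3⟩, -⟩ := ht2 c h1 k k' h2
        exact ⟨(hc c h1).1, by simpa using ⟨k4.1, k4.2.1, k4.2.2.1⟩, ⟨p, p1, p2, ln true n, si, p3⟩, si, si⟩)
        (fun 𝒟 hD => by
        have := hR Y (x n) hY hx _ g hg (k',n) {ln false n} 0 0 E 𝒟 si si si (fun d hd => by
          obtain ⟨c, h1, b, b1, b2, rfl⟩ := hD d hd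
          obtain ⟨h1, h2⟩ := mem_filter.mp h1
          have he : (n,k) ∉ ln false n := by simpa using hk.ne
          have k4 := LC_upd (((hc c h1).2.2 n le_rfl).1 false) he (c (n,k)/b)
          obtain ⟨-, -, -, p, p1, p2, p3⟩ := ht2 c h1 k k' h2
          refine ⟨(Gd_upd (Gd_succ (hc c h1)) ⟨si, by simp; omega⟩ b2 b1).1, by simpa using ⟨k4.1, k4.2.1, k4.2.2.1⟩, ⟨p, p1, ?_, ln false n, si, ?_⟩, si, si⟩
          · rwa [Function.update_of_ne (by simp [hk'.ne])]
          · rwa [upd_prod' c _ _ _ he]) (fun 𝒟' hD' => hE 𝒟' fun d hd => by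
          obtain ⟨c', h1, b', b1', b2', rfl⟩ := hD' d hd
          obtain ⟨c, h3, b, b1, b2, rfl⟩ := hD c' h1
          have h1 := (mem_filter.mp h3).1
          exact Gd_upd (Gd_upd (Gd_succ (hc c h1)) ⟨si, by simp; omega⟩ b2 b1) ⟨by simp; omega, si⟩ b2' b1')
        simpa using this)
      simpa using this
  · have := hdiag 𝒞 1 z le_rfl le_rfl (fun c hc' => by
      obtain ⟨⟨a, k⟩, i1, i2, i3, i4⟩ := loc hY1 hgap (hc c hc') true
      obtain rfl : a = n := by simpa using i1
      obtain rfl : k = a := by apply Fin.ext; have : (k:ℕ) ≤ a := i3; omega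
      exact ⟨true, i4⟩) (fun _ => hz)
    norm_num at this ⊢; exact this
lemma dvd_split {κ : Type} [DecidableEq κ] (t : Finset κ) : ∀ (b : κ → ℕ) (a : ℕ), a ∣ ∏ k ∈ t, b k →
    ∃ d : κ → ℕ, (∀ k, d k ∣ b k) ∧ ∏ k ∈ t, d k = a := by
  induction t using Finset.induction_on with
  | empty => exact fun b a h => ⟨fun _ => 1, fun _ => one_dvd _, by simpa using (Nat.dvd_one.mp h).symm⟩
  | insert k t hk ih =>
    intro b a h
    rw [prod_insert hk] at h
    obtain ⟨a1, a2, h1, h2, rfl⟩ := exists_dvd_and_dvd_of_dvd_mul h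
    obtain ⟨d, d1, d2⟩ := ih b a2 h2
    refine ⟨Function.update d k a1, fun i => ?_, by rw [prod_insert hk, Function.update_self, prod_update_of_notMem hk, d2]⟩
    by_cases hi : i = k
    · subst hi; simpa using h1
    · rw [Function.update_of_ne hi]; exact d1 i
lemma mat0 {ι κ : Type} [DecidableEq ι] [DecidableEq κ] [Fintype κ] (s : Finset ι) (a : ι → ℕ) : ∀ b : κ → ℕ, (∀ k, b k ≠ 0) →
    ∏ j ∈ s, a j = ∏ k, b k → ∃ c : ι → κ → ℕ, (∀ j ∈ s, ∏ k, c j k = a j) ∧ ∀ k, ∏ j ∈ s, c j k = b k := by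
  induction s using Finset.induction_on with
  | empty =>
    intro b hb h
    refine ⟨fun _ _ => 1, si, fun k => ?_⟩
    have := h ▸ dvd_prod_of_mem b (mem_univ k)
    simpa using (Nat.dvd_one.mp this).symm
  | insert j s hj ih =>
    intro b hb h
    rw [prod_insert hj] at h
    obtain ⟨d, d1, d2⟩ := dvd_split univ b (a j) (h ▸ dvd_mul_right _ _)
    have hd : ∀ k, d k ≠ 0 := fun k h0 => hb k (Nat.eq_zero_of_zero_dvd (h0 ▸ d1 k))
    have hq : ∀ k, b k / d k ≠ 0 := fun k => (Nat.div_pos (Nat.le_of_dvd (Nat.pos_of_ne_zero (hb k)) (d1 k)) (Nat.pos_of_ne_zero (hd k))).ne'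
    obtain ⟨c, c1, c2⟩ := ih (fun k => b k/d k) hq (by
      refine Nat.eq_of_mul_eq_mul_left (Nat.pos_of_ne_zero (d2 ▸ prod_ne_zero_iff.mpr fun k _ => hd k : a j ≠ 0)) ?_
      rw [h, ← d2, ← prod_mul_distrib]
      exact prod_congr rfl fun k _ => (Nat.mul_div_cancel' (d1 k)).symm)
    refine ⟨Function.update c j d, fun i hi => ?_, fun k => ?_⟩
    · by_cases hij : i = j
      · subst hij; simpa using d2
      · rw [Function.update_of_ne hij]; exact c1 i ((mem_insert.mp hi).resolve_left hij)
    · rw [prod_insert hj, Function.update_self, ← Nat.mul_div_cancel' (d1 k), ← c2 k]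
      congr 1; exact prod_congr rfl fun i hi => by rw [Function.update_of_ne (fun hij => hj (by rw [← hij]; exact hi))]
lemma mat {M : ℕ} (a b : Fin M° → ℕ) (hb : ∀ k, b k ≠ 0) (h : ∏ j, a j = ∏ k, b k) : ∃ c : Fin M° × Fin M° → ℕ,
    (∀ j, ∏ i ∈ ln true j, c i = a j) ∧ ∀ j, ∏ i ∈ ln false j, c i = b j := by
  obtain ⟨c, c1, c2⟩ := mat0 univ a b hb h
  refine ⟨fun i => c i.1 i.2, fun j => ?_, fun j => ?_⟩
  · rw [← c1 j (mem_univ j), prod_filter, Fintype.prod_prod_type]; simp [prod_comm (s := univ)]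
  · rw [← c2 j, prod_filter, Fintype.prod_prod_type]; simp
lemma cnt_le (lo : ℝ) (n : ℕ → ℕ) (hn : Antitone n) (p M : ℕ) :
    ∑ k ∈ range M°, (if p ∈ II lo (n k) then §1 else 0) ≤ lam lo n M p := by
  induction M with
  | zero => simp only [zero_add, sum_range_one]; split_ifs; exacts [one_le_lam _ _ _ _, zero_le_one.trans (one_le_lam _ _ _ _)]
  | succ M ih =>
    by_cases h : p ∈ II lo (n M°)
    · have : ∀ k, k ≤ M+1 → p ∈ II lo (n k) := fun k hk => by
        rw [mem_II] at h ⊢; exact ⟨h.1, h.2.1, h.2.2.trans (mod_cast hn hk)⟩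
      rw [lam, sum_congr rfl (g := fun r : ℕ => log ((§r+2)/§r°)) (fun r hr => if_pos (this _ (by have := mem_range.mp hr; omega))),
        sum_logr, exp_log po, sum_congr rfl (g := fun _ => §1) (fun k hk => if_pos (this k (by have := mem_range.mp hk; omega)))]
      simp
    · rw [sum_range_succ, if_neg h, add_zero]
      refine ih.trans (le_of_eq ?_)
      unfold lam; rw [sum_range_succ, if_neg h, add_zero]
theorem Tend : ∃ C : ℝ, 1 ≤ C ∧ ∀ (Y : ℝ) (M : ℕ) (x : ℕ → ℝ) (ζ : ℕ → ℕ) (𝒞 : Finset (Fin M° × Fin M° → ℕ)), 10 ≤ Y →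
    Antitone ζ → (∀ k ≤ M, log Y ≤ ζ k) → (∀ c ∈ 𝒞, Gd Y x (fun j => (ζ j:ℝ)) M° c) →
    ∑ c ∈ 𝒞, wt (fun p => (lam (log Y) ζ M p)⁻¹/p) c ≤ exp (∑ k ∈ range M°, (ζ k:ℝ) + C*M°^2*log Y) := by
  classical
  obtain ⟨C0, hC0, m1, m2, -⟩ := mertens
  obtain ⟨C1, hC1, hEP⟩ := EP1
  refine ⟨4*C0+C1+2, li, fun Y M x ζ 𝒞 hY hζ hζY hc => ?_⟩
  have hl : 1 ≤ log Y := by rw [le_log_iff_exp_le li]; linarith [exp_one_lt_d9]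
  obtain ⟨g, hg⟩ := exq (fun p => (lam (log Y) ζ M p)⁻¹/p : ℕ → ℝ)
  rw [← hg]
  have hg0 : ∀ p, 0 ≤ g p := fun p => by rw [hg]; have := one_le_lam (log Y) ζ M p; positivity
  have hg1 : ∀ p : ℕ, g p ≤ 1/p := fun p => by
    rw [hg]; exact div_le_div_of_nonneg_right (inv_le_one_of_one_le₀ (one_le_lam _ _ _ _)) po
  have hsub : 𝒞 ⊆ Fintype.piFinset fun e => 𝒞.image fun c => c e := fun c hc => Fintype.mem_piFinset.mpr fun e => mem_image_of_mem _ hc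
  refine (sum_le_sum_of_subset_of_nonneg hsub fun c _ _ => prod_nonneg fun i _ => gm_nonneg fun p _ _ => hg0 p).trans ?_
  rw [← prod_univ_sum (fun e => 𝒞.image fun c => c e) (fun _ n => gm g n)]
  obtain ⟨I, hI⟩ := exq (fun k p => if p ∈ II (log Y) (ζ k) then §1 else 0 : ℕ → ℕ → ℝ)
  have hI0 : ∀ k p, 0 ≤ I k p := fun k p => by rw [hI]; dsimp only; split_ifs <;> norm_num
  have hone : ∀ e : Fin M° × Fin M°, ∑ n ∈ 𝒞.image (fun c => c e), gm g n ≤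
      exp (∑ p ∈ II (log Y) (ζ 0), g p*(I e.1 p*I e.2 p) + (2*C0+C1+2)*log Y) := fun e => by
    obtain ⟨m, hm⟩ := exq (min (ζ e.1) (ζ e.2))
    have hmY : log Y ≤ m := by
      have h1 := hζY e.1 om; have h2 := hζY e.2 om
      rw [hm]; push_cast; exact le_min h1 h2
    refine (hEP (II (-1) m°) _ g (fun n hn => ?_) (fun p hp => ?_)).trans (exp_le_exp.mpr ?_)
    · obtain ⟨c, h, rfl⟩ := mem_image.mp hn
      refine ⟨(hc c h).1 e, fun p hp hpd => mem_II.mpr ⟨hp, LL_gt hp.two_le, ?_⟩⟩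
      have := (hc c h).2.1 e p hp hpd
      rw [hm]; push_cast; rw [← min_add_add_right]; exact le_min this.1 this.2
    · have h2 : §2 ≤ p := mod_cast (mem_II.mp hp).1.two_le
      refine ⟨hg0 p, (hg1 p).trans (one_div_le_one_div_of_le nu h2), ?_⟩
      have : (g p)^2 ≤ (1/§p)^2 := pow_le_pow_left₀ (hg0 p) (hg1 p) 2
      have h3 : (1/§p)^2 ≤ 1/§p^(3/2:ℝ) := by
        rw [div_pow, one_pow]
        refine one_div_le_one_div_of_le po ?_
        rw [← rpow_natCast]; exact rpow_le_rpow_of_exponent_le li nu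
      have : 0 ≤ 1/§p^(3/2:ℝ) := po
      linarith
    · have b1 := m2 (log Y) li (II (-1) (log Y)) fun p hp => by
        rw [mem_II] at hp; exact ⟨hp.1, hp.2.2⟩
      have b2 := m1 m m° li (II m m°) fun p hp => mem_II.mp hp
      have hs : II (-1) §m° ⊆ II (-1) (log Y) ∪ (II (log Y) m ∪ II m m°) := fun p hp => by
        simp only [mem_union, mem_II] at hp ⊢
        rcases le_or_gt (LL p) (log Y) with h | h
        · exact Or.inl ⟨hp.1, hp.2.1, h⟩
        rcases le_or_gt (LL p) m with h' | h'
        exacts [Or.inr (Or.inl ⟨hp.1, h, h'⟩), Or.inr (Or.inr ⟨hp.1, h', hp.2.2⟩)]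
      have su : ∀ A B : Finset ℕ, ∑ p ∈ A ∪ B, g p ≤ ∑ p ∈ A, g p + ∑ p ∈ B, g p := fun A B => by
        rw [← sum_union_inter]; linarith [sum_nonneg fun p (_ : p ∈ A ∩ B) => hg0 p]
      have b3 := (sum_le_sum_of_subset_of_nonneg hs fun p _ _ => hg0 p).trans (su _ _)
      have b4 := su (II (log Y) m) (II m m°)
      have b5 : ∑ p ∈ II (-1) (log Y), g p ≤ _ := (sum_le_sum fun p _ => hg1 p).trans b1
      have b6 : ∑ p ∈ II m m°, g p ≤ _ := (sum_le_sum fun p _ => hg1 p).trans b2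
      have b7 : ∑ p ∈ II (log Y) m, g p ≤ ∑ p ∈ II (log Y) (ζ 0), g p*(I e.1 p*I e.2 p) := by
        refine le_trans (sum_le_sum fun p hp => ?_) (sum_le_sum_of_subset_of_nonneg (s := II (log Y) m) (fun p hp => ?_) fun p _ _ =>
          mul_nonneg (hg0 p) (mul_nonneg (hI0 _ _) (hI0 _ _)))
        · have hh : ∀ k : ℕ, m ≤ ζ k → I k p = 1 := fun k hk => by
            rw [hI]; rw [mem_II] at hp
            exact if_pos (mem_II.mpr ⟨hp.1, hp.2.1, hp.2.2.trans (mod_cast hk)⟩)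
          rw [hh _ (hm ▸ min_le_left _ _), hh _ (hm ▸ min_le_right _ _)]; simp
        · rw [mem_II] at hp ⊢
          exact ⟨hp.1, hp.2.1, hp.2.2.trans (mod_cast hm ▸ (min_le_left _ _).trans (hζ (Nat.zero_le _)))⟩
      have : (2*C0+C1+1)*1 ≤ (2*C0+C1+1)*log Y := by gcongr
      linarith
  refine (prod_le_prod (fun e _ => sum_nonneg fun n _ => gm_nonneg fun p _ _ => hg0 p) fun e _ => hone e).trans ?_
  rw [← exp_sum, exp_le_exp, sum_add_distrib, sum_comm]
  have hp : ∀ p ∈ II (log Y) (ζ 0), ∑ e : Fin M° × Fin M°, g p*(I e.1 p*I e.2 p) ≤ ∑ k ∈ range M°, I k p*(1/p) := fun p _ => by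
    have hcn := cnt_le (log Y) ζ hζ p M
    have hS : ∑ k : Fin M°, I k p = ∑ k ∈ range M°, I k p := (sum_range (fun k => I k p)).symm
    rw [← mul_sum, Fintype.sum_prod_type]
    simp only
    rw [← sum_mul_sum, hS, ← sum_mul, hg]
    have h0 : 0 ≤ ∑ k ∈ range M°, I k p := sum_nonneg fun k _ => hI0 k p
    have hcn : ∑ k ∈ range M°, I k p ≤ lam (log Y) ζ M p := by rw [hI]; exact hcn
    have hl0 : 0 < lam (log Y) ζ M p := zero_lt_one.trans_le (one_le_lam _ _ _ _)
    have : (lam (log Y) ζ M p)⁻¹*(∑ k ∈ range M°, I k p) ≤ 1 := by rw [inv_mul_le_iff₀ hl0, mul_one]; exact hcn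
    calc _ = ((lam (log Y) ζ M p)⁻¹*(∑ k ∈ range M°, I k p))*((∑ k ∈ range M°, I k p)*(1/p)) := by ring
      _ ≤ 1*_ := by gcongr
      _ = _ := one_mul _
  have h2 := (sum_le_sum hp).trans_eq sum_comm
  have h3 : ∑ k ∈ range M°, ∑ p ∈ II (log Y) (ζ 0), I k p*(1/p) ≤ ∑ k ∈ range M°, ((ζ k:ℝ) + C0) := sum_le_sum fun k hk => by
    have hk' := hζY k (by have := mem_range.mp hk; omega)
    have := m1 (log Y) (ζ k) hk' (II (log Y) (ζ 0) ∩ II (log Y) (ζ k)) fun p hp => mem_II.mp (mem_inter.mp hp).2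
    rw [← filter_mem_eq_inter, sum_filter] at this
    refine le_trans (le_of_eq (sum_congr rfl fun p _ => ?_)) (this.trans li)
    rw [hI]; dsimp only; split_ifs <;> simp
  rw [sum_add_distrib] at h3
  simp only [sum_const, card_range, card_univ, Fintype.card_prod, Fintype.card_fin, nsmul_eq_mul] at h3 ⊢
  push_cast at h3 ⊢
  have hM : §1 ≤ M+1 := by linarith [show §0 ≤ M from Nat.cast_nonneg M]
  have h5 : §M°*C0 ≤ §M°*M°*(2*C0*log Y) := by
    rw [mul_assoc]; gcongr
    calc C0 ≤ 1*(2*C0*1) := li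
      _ ≤ _ := by gcongr
  refine (add_le_add (h2.trans h3) le_rfl).trans ?_
  nlinarith only [h5]
theorem chain : ∃ Y0 C : ℝ, 10 ≤ Y0 ∧ 1 ≤ C ∧ ∀ (Y : ℝ) (M : ℕ) (x : ℕ → ℝ) (ζ : ℕ → ℕ) (𝒞 : Finset (Fin M° × Fin M° → ℕ)) (h : ℕ) (z : ℝ),
    Y0 ≤ Y → Antitone ζ → (∀ k ≤ M, log Y ≤ ζ k) → (∀ k ≤ M, 4*log Y ≤ x k) → (∀ j k, j < k → k ≤ M → ζ k + 1 + 2*log Y < x j) → h ≤ 1 →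
    (h = 1 → ∀ c ∈ 𝒞, z/100 < (∏ i, c i : ℕ) ∧ ((∏ i, c i : ℕ):ℝ) ≤ z) → (∀ c ∈ 𝒞, Gd Y x (fun j => (ζ j:ℝ)) 0 c) →
    ∑ c ∈ 𝒞, wt (fun p => (lam (log Y) ζ M p)⁻¹/p) c ≤
      exp (∑ k ∈ range M°, (ζ k:ℝ) - 2*∑ k ∈ range M°, x k - h*x 0 + C*M°^3*log Y) := by
  obtain ⟨Y0, hY0, hst⟩ := stp
  obtain ⟨C, hC, hT⟩ := Tend
  refine ⟨Y0, C+39, hY0, li, fun Y M x ζ 𝒞 h z hY hζ h1 h2 h3 hh hz hc => ?_⟩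
  have hY1 : 10 ≤ Y := li
  have hl : 1 ≤ log Y := by rw [le_log_iff_exp_le li]; linarith [exp_one_lt_d9]
  have hYe : exp (log Y) = Y := exp_log li
  have hM : §0 ≤ M := Nat.cast_nonneg M
  obtain ⟨g, hg⟩ := exq (fun p => (lam (log Y) ζ M p)⁻¹/p : ℕ → ℝ)
  have hg1 : ∀ p : ℕ, 0 ≤ g p ∧ g p ≤ 1/p := fun p => by
    have := one_le_lam (log Y) ζ M p
    rw [hg]; exact ⟨po, div_le_div_of_nonneg_right (inv_le_one_of_one_le₀ this) po⟩
  obtain ⟨B, hB⟩ := exq (§M°^2+38*log Y : ℝ)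
  have hY38 : Y^38 = exp (38*log Y) := by rw [← hYe, log_exp, ← exp_nat_mul]; norm_num
  have hD : (1+§M°^2)*Y^38 ≤ exp B := by
    rw [hB, exp_add, ← hY38]; gcongr; linarith [add_one_le_exp (§M°^2)]
  obtain ⟨T, hTT⟩ := exq (∑ k ∈ range M°, (ζ k:ℝ) + C*M°^2*log Y : ℝ)
  have key : ∀ i ≤ M, ∀ 𝒞 : Finset (Fin M° × Fin M° → ℕ), (∀ c ∈ 𝒞, Gd Y x (fun j => (ζ j:ℝ)) (M+1-i) c) →
      ∑ c ∈ 𝒞, wt g c ≤ exp (T - 2*∑ k ∈ Ico (M+1-i) M°, x k + i*B) := by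
    intro i
    induction i with
    | zero => intro _ 𝒞 hc; simpa [hTT, hg] using hT Y M x ζ 𝒞 hY1 hζ h1 hc
    | succ i ih =>
      intro hi 𝒞 hc
      have hn : M+1-i° = M - i := om
      have e1 : M+1-i = M-i+1 := om
      rw [hn] at hc ⊢
      rw [e1] at ih
      have := (hst Y M x (fun j => ζ j) ⟨M-i, om⟩ g _ 𝒞 hY (h2 _ si) (fun k hk => h3 _ _ hk om) hg1 (ih om) hc).1
      refine this.trans ?_
      rw [sum_eq_sum_Ico_succ_bot (show M-i < M+1 by omega), ← mul_assoc, ← mul_assoc, mul_assoc, ← exp_add]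
      refine (mul_le_mul_of_nonneg_right hD (exp_pos _).le).trans (le_of_eq ?_)
      rw [← exp_add]; push_cast; ring_nf
  have hk := key M le_rfl
  rw [show M+1-M = 1 by omega] at hk
  have hf := hst Y M x (fun j => ζ j) 0 g _ 𝒞 hY (h2 _ si) (fun k hk => h3 _ _ hk om) hg1 (by simpa using hk) hc
  rw [← hg]
  have hS : ∑ k ∈ range M°, x k = x 0 + ∑ k ∈ Ico 1 M°, x k := by
    rw [range_eq_Ico, sum_eq_sum_Ico_succ_bot om]
  have hfin : ∑ c ∈ 𝒞, wt g c ≤ exp B*exp (-((2+h)*x 0))*exp (T - 2*∑ k ∈ Ico 1 M°, x k + M*B) := by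
    interval_cases h
    · refine hf.1.trans ?_
      rw [← mul_assoc, ← mul_assoc]; push_cast; rw [add_zero]
      exact mul_le_mul_of_nonneg_right (mul_le_mul_of_nonneg_right hD (exp_pos _).le) (exp_pos _).le
    · refine (hf.2 rfl z (hz rfl)).trans ?_
      have : Y^19 ≤ exp B := by
        refine (pow_le_pow_right₀ li nu).trans ((le_mul_of_one_le_left po ?_).trans hD)
        nlinarith
      push_cast; rw [show §2+1 = 3 by norm_num]
      exact mul_le_mul_of_nonneg_right (mul_le_mul_of_nonneg_right this (exp_pos _).le) (exp_pos _).le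
  refine hfin.trans ?_
  rw [← exp_add, ← exp_add, exp_le_exp, hS, hTT, hB]
  have a1 : C*M°^2*log Y ≤ C*M°^3*log Y := by
    gcongr <;> linarith
  have a2 : §M°*(§M°^2+38*log Y) ≤ 39*M°^3*log Y := by
    have c1 : §M°^3*1 ≤ M°^3*log Y := by gcongr
    have c2 : §M°^1*log Y ≤ M°^3*log Y := by gcongr <;> first | linarith | norm_num
    nlinarith only [c1, c2]
  nlinarith only [a1, a2]
lemma tot {M : ℕ} (c : Fin M° × Fin M° → ℕ) (s : Bool) : ∏ i, c i = ∏ j, ∏ i ∈ ln s j, c i :=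
  (prod_fiberwise univ (fun i : Fin M° × Fin M° => if s then i.1 else i.2) c).symm
theorem pairsum : ∃ Y0 C : ℝ, 10 ≤ Y0 ∧ 1 ≤ C ∧ ∀ (Y : ℝ) (M : ℕ) (x : ℕ → ℝ) (ζ : ℕ → ℕ) (Q0 : Finset ((Fin M° → ℕ) × (Fin M° → ℕ))) (h : ℕ) (z : ℝ),
    Y0 ≤ Y → Antitone ζ → (∀ k ≤ M, log Y ≤ ζ k) → (∀ k, (ζ k:ℝ) ≤ Y+2) → (∀ k ≤ M, 4*log Y ≤ x k) →
    (∀ j k, j < k → k ≤ M → ζ k + 1 + 2*log Y < x j) → h ≤ 1 → (h = 1 → ∀ P ∈ Q0, z/100 < (∏ i, (P.1 i+1) : ℕ) ∧ ((∏ i, (P.1 i+1) : ℕ):ℝ) ≤ z) →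
    (∀ P ∈ Q0, ∏ j, (P.1 j+1) = ∏ j, (P.2 j+1) ∧ (∀ j, P.1 j ≠ P.2 j) ∧ ∀ j q, (q = P.1 j ∨ q = P.2 j) →
      q.Prime ∧ x j ≤ LL q ∧ LL q ≤ ζ j ∧ LL q ≤ Y ∧ Nrm Y q) →
    ∑ P ∈ Q0, 1/((∏ i, (P.1 i+1) : ℕ):ℝ) ≤ exp (∑ k ∈ range M, (fordA k°+1)*ζ k° + log M°*∑ j ∈ range M°, (ζ j:ℝ)/log Y^4 +
      ∑ k ∈ range M°, (ζ k:ℝ) - 2*∑ k ∈ range M°, x k - h*x 0 + C*M°^3*log Y) := by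
  classical
  obtain ⟨Y0, C, hY0, hC, hch⟩ := chain
  refine ⟨Y0, C, hY0, hC, fun Y M x ζ Q0 h z hY hζ h1 h1' h2 h3 hh hz hP => ?_⟩
  have hY1 : 10 ≤ Y := li
  have hl : 1 ≤ log Y := by rw [le_log_iff_exp_le li]; linarith [exp_one_lt_d9]
  have hm : ∀ P : (Fin M° → ℕ) × (Fin M° → ℕ), ∃ c : Fin M° × Fin M° → ℕ, P ∈ Q0 →
      (∀ j, ∏ i ∈ ln true j, c i = P.1 j+1) ∧ ∀ j, ∏ i ∈ ln false j, c i = P.2 j + 1 := fun P => by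
    by_cases hp : P ∈ Q0
    · obtain ⟨c, hc⟩ := mat (fun j => P.1 j+1) (fun j => P.2 j+1) (fun _ => om) (hP P hp).1
      exact ⟨c, fun _ => hc⟩
    · exact ⟨fun _ => 0, fun h => absurd h hp⟩
  choose c hc using hm
  have hinj : Set.InjOn c Q0 := fun P hp Q hq e => by
    have a := hc P hp; have b := hc Q hq
    rw [e] at a
    refine Prod.ext (funext fun j => ?_) (funext fun j => ?_)
    · have := (a.1 j).symm.trans (b.1 j); omega
    · have := (a.2 j).symm.trans (b.2 j); omega
  have hc0 : ∀ P ∈ Q0, ∀ i, c P i ≠ 0 := fun P hp i h0 => by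
    have := (hc P hp).1 i.1
    rw [prod_eq_zero (i := i) si h0] at this; omega
  have htot : ∀ P ∈ Q0, ∏ i, c P i = ∏ j, (P.1 j + 1) := fun P hp => by rw [tot _ true]; exact prod_congr rfl fun j _ => (hc P hp).1 j
  have hlp : ∀ p, 0 < lam (log Y) ζ M p := fun p => zero_lt_one.trans_le (one_le_lam _ _ _ _)
  obtain ⟨g, hg⟩ := exq (fun p => (lam (log Y) ζ M p)⁻¹/p : ℕ → ℝ)
  obtain ⟨W, hW⟩ := exq (∑ k ∈ range M, (fordA k°+1)*ζ k° + log M°*∑ j ∈ range M°, (ζ j:ℝ)/log Y^4 : ℝ)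
  have hterm : ∀ P ∈ Q0, 1/((∏ i, (P.1 i+1) : ℕ):ℝ) ≤ wt g (c P) * exp W := fun P hp => by
    have n0 : ∏ i, (P.1 i+1) ≠ 0 := prod_ne_zero_iff.mpr fun i _ => om
    have e1 : wt g (c P) = (gm (lam (log Y) ζ M) (∏ i, (P.1 i+1)))⁻¹/((∏ i, (P.1 i+1) : ℕ):ℝ) := by
      unfold wt
      rw [← gm_prod g univ (c P) fun i _ => hc0 P hp i, htot P hp, hg, gm_div _ n0]
      congr 1; simp only [gm, inv_pow, prod_inv_distrib]
    have e2 : gm (lam (log Y) ζ M) (∏ i, (P.1 i+1)) ≤ exp W := by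
      rw [gm_prod _ _ _ fun i _ => om]
      simp_rw [gm_lam]
      rw [← exp_sum, exp_le_exp, hW, ← ident (fun k => (ζ k:ℝ)), ← sum_logr, mul_comm (∑ r ∈ range M, log _), sum_mul_sum, ← sum_add_distrib, sum_range (n := M+1)]
      refine sum_le_sum fun j _ => ?_
      rw [← sum_add_distrib]
      refine sum_le_sum fun r hr => ?_
      have hr' := mem_range.mp hr
      rw [mul_comm _ (log _), ← mul_add]
      refine mul_le_mul_of_nonneg_left ?_ (logr_nonneg r)
      obtain ⟨-, -, q3, -, q5⟩ := (hP P hp).2.2 j _ (Or.inl rfl)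
      refine ((q5.1 (ζ r°) (h1 _ om) (h1' _)).2).trans ?_
      have a1 : min ((ζ r°:ℕ):ℝ) (LL (P.1 j)) ≤ ζ (max j r°) := by
        rcases le_total (j:ℕ) r° with hj | hj
        · rw [max_eq_right hj]; exact min_le_left _ _
        · rw [max_eq_left hj]; exact (min_le_right _ _).trans q3
      have a2 : LL (P.1 j)/log Y^4 ≤ (ζ j:ℝ)/log Y^4 := by gcongr
      linarith
    have e3 : 0 < gm (lam (log Y) ζ M) (∏ i, (P.1 i+1)) := by rw [gm_lam]; exact exp_pos _
    rw [e1, div_mul_eq_mul_div]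
    refine div_le_div_of_nonneg_right ?_ po
    rw [inv_mul_eq_div, one_le_div e3]; exact e2
  have hfin := hch Y M x ζ (Q0.image c) h z hY hζ h1 h2 h3 hh (fun e d hd => ?_) (fun d hd => ?_)
  · rw [sum_image hinj, ← hg] at hfin
    refine (sum_le_sum hterm).trans ?_
    rw [← sum_mul]
    refine (mul_le_mul_of_nonneg_right hfin (exp_pos _).le).trans (le_of_eq ?_)
    rw [← exp_add, hW]; congr 1; ring
  · obtain ⟨P, hp, rfl⟩ := mem_image.mp hd
    rw [htot P hp]; exact hz e P hp
  · obtain ⟨P, hp, rfl⟩ := mem_image.mp hd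
    have q := (hP P hp).2.2
    have hsm : ∀ (j : Fin M°) (q p : ℕ), (q = P.1 j ∨ q = P.2 j) → p.Prime → p ∣ q+1 → LL p ≤ ζ j + 1 := fun j q' p hq hp' hd => by
      have := q j q' hq
      linarith [LL_mono hp'.two_le (Nat.le_of_dvd om hd), LL_succ this.1.two_le]
    refine ⟨hc0 P hp, fun i p hp' hd => ⟨hsm i.1 _ p (Or.inl rfl) hp' ?_, hsm i.2 _ p (Or.inr rfl) hp' ?_⟩, fun j _ => ⟨fun s => ?_, ?_⟩⟩
    · rw [← (hc P hp).1]; exact hd.trans (dvd_prod_of_mem _ si)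
    · rw [← (hc P hp).2]; exact hd.trans (dvd_prod_of_mem _ si)
    · unfold LC
      cases s
      · rw [(hc P hp).2, Nat.add_sub_cancel]; obtain ⟨u1, u2, -, u4, -, u6⟩ := q j _ (Or.inr rfl); exact ⟨u1, u2, u4, u6⟩
      · rw [(hc P hp).1, Nat.add_sub_cancel]; obtain ⟨u1, u2, -, u4, -, u6⟩ := q j _ (Or.inl rfl); exact ⟨u1, u2, u4, u6⟩
    · rw [(hc P hp).1, (hc P hp).2]; have := (hP P hp).2.1 j; omega
lemma numL {β κ s L : ℝ} (hβ : 0 < β) (hκ : 0 < κ) (hs : 1 ≤ s) (hL : 0 < L) (h1 : β*L ≤ s^2 - s) (h2 : s^2 - s - β ≤ β*L) :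
    1/(2*β)*(s^2 - log (s^2))^2 - ((1+β^2)/β + (|log (4/(κ*β))|+β/2)/β)*s^2 ≤ L*s^2 - β*(L*L°/2) - L*log (4*L/κ) := by
  have hs0 : 0 < s := li
  have a1 : log (4*L/κ) ≤ log (s^2) + |log (4/(κ*β))| := by
    have : 4*L/κ ≤ s^2*(4/(κ*β)) := by
      rw [div_le_iff₀ hκ, show s^2*(4/(κ*β))*κ = 4*(s^2/β) by field_simp]
      have : L ≤ s^2/β := by rw [le_div_iff₀ hβ]; nlinarith
      linarith
    refine (log_le_log po this).trans ?_
    rw [log_mul po po]; linarith [le_abs_self (log (4/(κ*β)))]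
  obtain ⟨c, hc⟩ := exq (|log (4/(κ*β))|)
  obtain ⟨m, hm⟩ := exq (log (s^2))
  have hc0 : 0 ≤ c := hc ▸ abs_nonneg _
  rw [← hc, ← hm] at a1 ⊢
  have hm0 : 0 ≤ m := hm ▸ log_nonneg (by nlinarith only [hs, h1, hβ, hL])
  have hm1 : m ≤ s := by
    have := add_one_le_exp (s/2-1)
    have h3 : log s ≤ s/2 := by
      rw [log_le_iff_le_exp hs0]
      calc s ≤ 2*exp (s/2-1) := li
        _ ≤ exp 1*exp (s/2-1) := by gcongr; linarith [exp_one_gt_d9]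
        _ = exp (s/2) := by rw [← exp_add]; ring_nf
    rw [hm, log_pow]; push_cast; linarith
  have hq : (s^2-m-β*L)^2 ≤ 2*(1+β^2)*s^2 := by
    have : (s^2-m-β*L)^2 ≤ (s+β)^2 := by apply pow_le_pow_left₀ <;> linarith
    nlinarith only [this, hs, h1, hβ, hL, sq_nonneg (s-β), mul_nonneg (sq_nonneg β) (show 0 ≤ s^2-1 by nlinarith)]
  have hLL : L ≤ s^2/β := by rw [le_div_iff₀ hβ]; nlinarith only [hs, h1]
  have e1 : 1/(2*β)*(s^2-m)^2 = (s^2-m-β*L)^2/(2*β) + L*(s^2-m) - β*L^2/2 := by field_simp; ring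
  have e2 : (s^2-m-β*L)^2/(2*β) ≤ (1+β^2)/β*s^2 := by
    rw [div_le_iff₀ po, show (1+β^2)/β*s^2*(2*β) = 2*(1+β^2)*s^2 by field_simp]; exact hq
  have e3 : L*(c+β/2) ≤ (c+β/2)/β*s^2 := by
    calc L*(c+β/2) ≤ s^2/β*(c+β/2) := by gcongr
      _ = _ := by ring
  have e4 : L*log (4*L/κ) ≤ L*(m+c) := by gcongr
  nlinarith only [e1, e2, e3, e4]
lemma sumA {ϱ : ℝ} (h0 : 0 < ϱ) (hs : ∑' n, fordA n° * ϱ^n° = 1) (M : ℕ) : ∑ r ∈ range M, fordA r° * ϱ^r° ≤ 1 := by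
  have : Summable fun n => fordA n° * ϱ^n° := by
    by_contra h; rw [tsum_eq_zero_of_not_summable h] at hs; norm_num at hs
  rw [← hs]
  exact this.sum_le_tsum _ fun n _ => mul_nonneg (fA_pos om).le po
lemma num5 {L b s C d κ M : ℝ} (hL : 1 ≤ L) (hLb : L ≤ b*s^2) (hb : 1 ≤ b) (hs : 2 ≤ s) (hs3 : 32*b^3 ≤ s) (hC : 1 ≤ C) (hd : 0 < d)
    (hκ : κ ≤ 1) (hκ0 : 0 < κ) (H : 1000*C*b^4*s^50 ≤ κ*d) (hM : 0 ≤ M) (hML : M ≤ L) :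
    -(d/(2*L)) + M*M° + 2*(d/(16*L)+3) + M*(M°*d°/(s^2)^4) + C*M°^3*s^2 ≤ 0 := by
  have hL0 : 0 < L := li
  have hs1 : 1 ≤ s := li
  have hdk : κ*d ≤ d := by nlinarith only [hd, hκ]
  have d1 : 1 ≤ d := by
    have : 1 ≤ 1000*C*b^4*s^50 := by
      have : §1 ≤ C*(b^4*s^50) := one_le_mul_of_one_le_of_one_le hC (one_le_mul_of_one_le_of_one_le (one_le_pow₀ hb) (one_le_pow₀ hs1))
      nlinarith only [this]
    linarith
  have a1 : M*(M°*d°/(s^2)^4) ≤ d/(8*L) := by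
    rw [← mul_div_assoc, div_le_div_iff₀ po po]
    calc M*(M°*d°)*(8*L) ≤ L*((L+L)*(d+d))*(8*L) := by gcongr
      _ = d*(32*L^3) := by ring
      _ ≤ d*(32*(b*s^2)^3) := by gcongr
      _ = d*((32*b^3)*s^6) := by ring
      _ ≤ d*(s*s^6) := by gcongr
      _ = d*(s^7*1) := by ring
      _ ≤ d*(s^7*s) := by gcongr
      _ = d*(s^2)^4 := by ring
  have a2 : M*M°+6+C*M°^3*s^2 ≤ 16*C*L^3*s^2 := by
    have e1 : M*M° ≤ 2*(C*L^3*s^2) := by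
      calc M*M° ≤ L*(L+L) := by gcongr
        _ = 2*(1*L^2*1) := by ring
        _ ≤ 2*(C*L^3*s^2) := by gcongr; norm_num; exact one_le_pow₀ hs1
    have e2 : §1 ≤ C*L^3*s^2 := one_le_mul_of_one_le_of_one_le (one_le_mul_of_one_le_of_one_le hC (one_le_pow₀ hL)) (one_le_pow₀ hs1)
    have e3 : C*M°^3*s^2 ≤ 8*(C*L^3*s^2) := by
      calc C*M°^3*s^2 ≤ C*(L+L)^3*s^2 := by gcongr
        _ = _ := by ring
    nlinarith only [e1, e2, e3]
  have a3 : 16*C*L^3*s^2 ≤ d/(4*L) := by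
    rw [le_div_iff₀ po]
    calc 16*C*L^3*s^2*(4*L) = 64*C*L^4*s^2 := by ring
      _ ≤ 1000*C*(b*s^2)^4*s^2 := by gcongr; norm_num
      _ = 1000*C*b^4*s^10 := by ring
      _ ≤ 1000*C*b^4*s^50 := by gcongr; norm_num
      _ ≤ d := H.trans hdk
  have e : d/(2*L) = 2*(d/(16*L)) + d/(8*L) + d/(4*L) := by field_simp; ring
  linarith
set_option maxHeartbeats 1000000 in
theorem seqs (ϱ : ℝ) (h0 : 0 < ϱ) (h1 : ϱ < 1) (hs : ∑' n, fordA n° * ϱ^n° = 1) (C : ℝ) (hC : 1 ≤ C) :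
    ∃ Y0 A : ℝ, 10 ≤ Y0 ∧ 1 ≤ A ∧ ∀ Y : ℝ, Y0 ≤ Y → ∃ (L : ℕ) (ζ : ℕ → ℕ) (x : ℕ → ℝ), 1 ≤ L ∧ L ≤ A*log Y ∧
    (∀ j k, j ≤ k → k ≤ L → ζ k ≤ ζ j) ∧ Y ≤ ζ 0 ∧ ζ 0 ≤ Y+1 ∧ x 0 = Y-2 ∧ (∀ j, 1 ≤ j → j ≤ L → ζ j ≤ ϱ*Y+1) ∧
    (∀ j, j ≤ L → log Y^20+1 ≤ x j) ∧ (∀ j k, j < k → k ≤ L → ζ k+1+2*log Y < x j) ∧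
    (∀ i M, i+M ≤ L → -(ζ i:ℝ) + ∑ r ∈ range M, fordA r°*ζ (i+r°) + 2*∑ r ∈ range M°, (ζ (i+r) - x (i+r)) +
      log M°*∑ r ∈ range M°, (ζ (i+r):ℝ)/log Y^4 + C*M°^3*log Y ≤ 0) ∧
    (∀ j k, 1 ≤ j → j ≤ k → k ≤ L → C ≤ ζ k - x k ∧ ζ k - x k ≤ ζ j - x j) ∧
    exp (1/(2*log (1/ϱ))*log (Y/log Y)^2 - A*log Y) ≤ ∏ j ∈ range L, ((ζ j° - x j°)/4) := by
  obtain ⟨β, hβ⟩ := exq (log (1/ϱ))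
  have hβ0 : 0 < β := hβ ▸ log_pos (by rw [lt_div_iff₀ h0]; linarith)
  obtain ⟨κ, hκ⟩ := exq ((1-ϱ)/16)
  have hκ0 : 0 < κ := by rw [hκ]; linarith
  obtain ⟨b, hb⟩ := exq (1 + 1/β)
  have hb1 : 1 ≤ b := by rw [hb]; have : 0 < 1/β := po
                         linarith
  obtain ⟨s0, hs0, hexp⟩ := pow_le_exp_ev (1000*C*b^4/κ) 50
  obtain ⟨A, hA⟩ := exq ((1+β^2)/β + (|log (4/(κ*β))|+β/2)/β + b)
  have hA1 : b ≤ A := by rw [hA]; have : 0 ≤ (1+β^2)/β + (|log (4/(κ*β))|+β/2)/β := po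
                         linarith
  obtain ⟨s1, hs1⟩ := exq (s0 + 32*b^3 + 2*β + 2)
  refine ⟨10 + exp (s1^2), A, by linarith [exp_pos (s1^2)], li, fun Y hY => ?_⟩
  have hY0 : 0 < Y := by linarith [exp_pos (s1^2)]
  have hΛ : s1^2 ≤ log Y := by rw [le_log_iff_exp_le hY0]; linarith
  obtain ⟨s, hsd⟩ := exq (√(log Y))
  have hb3 : 0 < b^3 := po
  have hss : s1 ≤ s := by rw [hsd]; exact le_sqrt_of_sq_le hΛ
  have hsl : log Y = s^2 := by rw [hsd, sq_sqrt ((sq_nonneg s1).trans hΛ)]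
  have hYe : Y = exp (s^2) := by rw [← hsl, exp_log hY0]
  have hE := hexp s li
  have hs2 : 2 ≤ s := li
  have hs3 : 32*b^3 ≤ s := li
  have hs2β : 2*β ≤ s := li
  have hsβ : β ≤ s^2 - s := by nlinarith only [hs2, hs2β]
  clear hexp hss hs1 hΛ hY hsd
  obtain ⟨L, hL⟩ := exq (⌊(s^2-s)/β⌋₊ : ℕ)
  have hL0 : 0 ≤ (s^2-s)/β := by apply div_nonneg <;> linarith
  have hL1 : 1 ≤ L := by rw [hL, Nat.one_le_floor_iff, one_le_div hβ0]; exact hsβ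
  have hL1' : §1 ≤ L := mod_cast hL1
  have hLβ : β*L ≤ s^2 - s := by have := Nat.floor_le hL0; rw [← hL, le_div_iff₀ hβ0] at this; linarith
  have hLβ2 : s^2 - s - β ≤ β*L := by have := Nat.lt_floor_add_one ((s^2-s)/β); rw [← hL, div_lt_iff₀ hβ0] at this; linarith
  have hLb : §L ≤ b*s^2 := by
    have : §L ≤ s^2/β := by rw [le_div_iff₀ hβ0]; linarith
    rw [hb]; have h3 : s^2/β = 1/β*s^2 := by ring
    nlinarith only [this, h3, sq_nonneg s]
  clear hL hL0
  obtain ⟨d, hd⟩ := exq (fun j => Y*ϱ^j : ℕ → ℝ)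
  have hρ : ∀ j : ℕ, ϱ^j = exp (-(β*j)) := fun j => by
    rw [hβ, one_div, log_inv, ← exp_log (pow_pos h0 j), log_pow]; ring_nf
  have hd0 : ∀ j, 0 < d j := fun j => by rw [hd]; positivity
  have hdE : ∀ j ≤ L, exp s ≤ d j := fun j hj => by
    rw [hd]; dsimp only; rw [hρ, hYe, ← exp_add, exp_le_exp]
    have := mul_le_mul_of_nonneg_left (show §j ≤ L by exact_mod_cast hj) hβ0.le
    linarith only [this, hLβ]
  have hdd : ∀ i r, d (i+r) = d i*ϱ^r := fun i r => by rw [hd]; dsimp only; rw [pow_add]; ring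
  obtain ⟨y, hy⟩ := exq (fun j => d j*(1-j/(2*L)) : ℕ → ℝ)
  have hfr : ∀ j : ℕ, j ≤ L → §1/2 ≤ 1-j/(2*L) ∧ §1-j/(2*L) ≤ 1 := fun j hj => by
    have : §j ≤ L := mod_cast hj
    have h2 : §j/(2*L) ≤ 1/2 := by rw [div_le_iff₀ li]; linarith
    have h3 : 0 ≤ §j/(2*L) := po
    constructor <;> linarith
  have hy1 : ∀ j ≤ L, d j/2 ≤ y j ∧ y j ≤ d j := fun j hj => by
    have a := hfr j hj
    rw [hy]; exact ⟨by linarith only [mul_le_mul_of_nonneg_left a.1 (hd0 j).le], mul_le_of_le_one_right (hd0 j).le a.2⟩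
  have hys : ∀ i r, i+r° ≤ L → y (i+r°) ≤ d i*(1-i°/(2*L))*ϱ^r° := fun i r h => by
    have hi := hfr (i+r°) h
    rw [hy]; dsimp only; rw [hdd, mul_right_comm]
    have : §1-((i+r°:ℕ):ℝ)/(2*L) ≤ 1-i°/(2*L) := by
      push_cast; gcongr; linarith [show §0 ≤ r from Nat.cast_nonneg r]
    have := hd0 i; gcongr
  obtain ⟨ζ, hζ⟩ := exq (fun j => ⌈y j⌉₊ : ℕ → ℕ)
  have hz1 : ∀ j, y j ≤ ζ j := fun j => hζ ▸ Nat.le_ceil _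
  have hz2 : ∀ j ≤ L, (ζ j:ℝ) ≤ y j + 1 := fun j hj => by
    rw [hζ]; exact (Nat.ceil_lt_add_one (by have := hy1 j hj; have := hd0 j; linarith)).le
  obtain ⟨x, hx⟩ := exq (fun j => if j = 0 then Y-2 else ζ j - κ*d j/L : ℕ → ℝ)
  have hy0 : y 0 = Y := by rw [hy, hd]; simp
  have hw : ∀ j, 1 ≤ j → ζ j - x j = κ*d j/L := fun j hj => by rw [hx]; dsimp only; rw [if_neg om]; ring
  have H : ∀ j ≤ L, 1000*C*b^4*s^50 ≤ κ*d j := fun j hj => by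
    have := hE.trans (hdE j hj); rw [div_mul_eq_mul_div, div_le_iff₀ hκ0] at this; linarith
  have Hp : 1000*s^50 ≤ 1000*C*b^4*s^50 := by
    have : §1 ≤ C*b^4 := one_le_mul_of_one_le_of_one_le hC (one_le_pow₀ hb1)
    have h5 : 0 < s^50 := po
    nlinarith only [this, h5]
  have Hs : s ≤ s^50 ∧ s^2 ≤ s^50 ∧ s^40 ≤ s^50 := ⟨le_self_pow₀ li nu,
    pow_le_pow_right₀ li nu, pow_le_pow_right₀ li nu⟩
  have hκ1 : κ ≤ 1/16 := by rw [hκ]; linarith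
  have hwd : ∀ j ≤ L, κ*d j/L ≤ κ*d j := fun j _ => div_le_self (by have := hd0 j; positivity) hL1'
  have hxy : ∀ j ≤ L, y j - κ*d j - 2 ≤ x j := fun j hj => by
    have h3 : 0 < κ*d j := by have := hd0 j; positivity
    rcases Nat.eq_zero_or_pos j with rfl | hj0
    · rw [hx, hy0]; simp; linarith
    · have := hw j hj0; linarith [hwd j hj, hz1 j]
  have hym : ∀ j k, j < k → k ≤ L → y k ≤ ϱ*y j := fun j k hjk hk => by
    obtain ⟨r, rfl⟩ : ∃ r, k = j+r° := ⟨k-j-1, om⟩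
    refine (hys j r hk).trans ?_
    have h5 : ϱ^r° ≤ ϱ := pow_le_of_le_one h0.le h1.le om
    have h6 : §1-j°/(2*L) ≤ 1-j/(2*L) := by gcongr; linarith
    have h7 := (hfr j° om).1
    push_cast at h7
    calc _ ≤ d j*(1-j/(2*L))*ϱ := by have := hd0 j; have := (hfr j om).1; gcongr
      _ = ϱ*y j := by rw [hy]; ring
  refine ⟨L, ζ, x, hL1, ?_, fun j k hjk hk => ?_, hy0 ▸ hz1 0, hy0 ▸ hz2 0 om, by rw [hx]; simp, fun j hj hjL => ?_, fun j hj => ?_,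
    fun j k hjk hk => ?_, fun i M hi => ?_, fun i j hi hij hjL => ⟨?_, ?_⟩, ?_⟩
  · rw [hsl]; refine hLb.trans ?_; gcongr
  · rcases hjk.eq_or_lt with rfl | hlt
    · rfl
    · rw [hζ]; refine Nat.ceil_mono ((hym j k hlt hk).trans ?_)
      exact mul_le_of_le_one_left (by linarith [hy1 j om, hd0 j]) h1.le
  · have a1 := hym 0 j hj hjL; have a2 := hz2 j hjL; rw [hy0] at a1; linarith only [a1, a2]
  · rw [hsl, ← pow_mul]
    have a1 := hxy j hj; have a2 := (hy1 j hj).1; have a3 := H j hj; have a4 := hd0 j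
    have a5 : κ*d j ≤ 1/16*d j := by gcongr
    norm_num; linarith [Hs.2.2, Hs.1]
  · rw [hsl]
    have a1 := hxy j om; have a2 := (hy1 j om).1; have a3 := H j om; have a4 := hd0 j
    have a5 := hym j k hjk hk; have a6 := hz2 k hk
    have a7 : (1-ϱ)*(d j/2) ≤ (1-ϱ)*y j := by gcongr
    rw [show 1-ϱ = 16*κ by rw [hκ]; ring] at a7
    have a8 : ϱ = 1-16*κ := by rw [hκ]; ring
    rw [a8] at a5
    linarith [Hs.2.1, Hs.1]
  · have hML : §M ≤ L := mod_cast (by omega : M ≤ L)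
    have hM0 : §0 ≤ M := Nat.cast_nonneg M
    have hdi := hd0 i
    have hil : i ≤ L := om
    have hfi : §0 ≤ 1-i°/(2*L) ∨ M = 0 := by
      rcases Nat.eq_zero_or_pos M with h | h
      · exact Or.inr h
      · left; have := (hfr i° om).1; push_cast at this; linarith only [this]
    have b1 : ∑ r ∈ range M, fordA r°*ζ (i+r°) ≤ d i*(1-i°/(2*L)) + M*M° ∨ M = 0 := by
      refine hfi.imp_left fun hfi => ?_
      have : ∀ r ∈ range M, fordA r°*ζ (i+r°) ≤ d i*(1-i°/(2*L))*(fordA r°*ϱ^r°) + M° := fun r hr => by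
        have hr := mem_range.mp hr
        have c1 := hys i r om; have c2 := hz2 (i+r°) om; have c3 := fA_le (n := r+1) om
        have c4 := (fA_pos (n := r+1) om).le
        have c5 : ((r+1:ℕ):ℝ) ≤ M+1 := by push_cast; have : §r ≤ M := mod_cast hr.le
                                          linarith only [this]
        calc _ ≤ fordA r°*(d i*(1-i°/(2*L))*ϱ^r°+1) := by gcongr; linarith only [c1, c2]
          _ = d i*(1-i°/(2*L))*(fordA r°*ϱ^r°) + fordA r° := by ring
          _ ≤ _ := (by linarith only [c3, c5])
      refine (sum_le_sum this).trans ?_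
      rw [sum_add_distrib, ← mul_sum, sum_const, card_range, nsmul_eq_mul]
      have := mul_le_mul_of_nonneg_left (sumA h0 hs M) (mul_nonneg hdi.le hfi)
      linarith only [this]
    have b2 : -(ζ i:ℝ) + ∑ r ∈ range M, fordA r°*ζ (i+r°) ≤ -(d i/(2*L)) + M*M° := by
      have c1 := hz1 i
      have c2 : y i = d i*(1-i/(2*L)) := by rw [hy]
      rcases b1 with b1 | rfl
      · have c3 : d i*(1-i°/(2*L)) = d i*(1-i/(2*L)) - d i/(2*L) := by ring
        linarith
      · simp only [range_zero, sum_empty, Nat.cast_zero, zero_mul, add_zero]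
        have c4 : d i/(2*L) ≤ d i/2 := by gcongr; linarith only [hL1']
        linarith [(hy1 i hil).1]
    have b3 : ∑ r ∈ range M°, ((ζ (i+r):ℝ) - x (i+r)) ≤ d i/(16*L)+3 := by
      have : ∀ r ∈ range M°, (ζ (i+r):ℝ) - x (i+r) ≤ κ*d i/L*ϱ^r + if r = 0 then 3 else 0 := fun r _ => by
        have hnn : 0 ≤ κ*d i/L*ϱ^r := po
        by_cases hir : i+r = 0
        · obtain ⟨rfl, rfl⟩ : i = 0 ∧ r = 0 := om
          rw [if_pos rfl]; have := hz2 0 om; rw [hy0] at this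
          simp only [hx, add_zero, if_true] at hnn ⊢; linarith only [hnn, this]
        · rw [hw _ om, hdd, show κ*(d i*ϱ^r)/L = κ*d i/L*ϱ^r by ring]
          split_ifs <;> linarith only
      refine (sum_le_sum this).trans ?_
      rw [sum_add_distrib, ← mul_sum, sum_ite_eq' (range M°) 0, if_pos si]
      have c1 : ∑ r ∈ range M°, ϱ^r ≤ (1-ϱ)⁻¹ := by
        rw [← tsum_geometric_of_lt_one h0.le h1]
        exact (summable_geometric_of_lt_one h0.le h1).sum_le_tsum _ fun r _ => po
      have c2 : κ*d i/L*∑ r ∈ range M°, ϱ^r ≤ κ*d i/L*(1-ϱ)⁻¹ := by gcongr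
      have c3 : κ*d i/L*(1-ϱ)⁻¹ = d i/(16*L) := by
        have : 1-ϱ ≠ 0 := (by linarith only [h1])
        rw [hκ]; field_simp
      linarith only [c2, c3]
    have b4 : log M°*∑ r ∈ range M°, (ζ (i+r):ℝ)/(s^2)^4 ≤ M*(M°*(d i+1)/(s^2)^4) := by
      have c1 : log §M° ≤ M := by linarith only [log_le_sub_one_of_pos (show §0 < M+1 by linarith)]
      have c2 : ∑ r ∈ range M°, (ζ (i+r):ℝ) ≤ M°*(d i+1) := by
        refine (sum_le_card_nsmul (range M°) _ (d i+1) fun r hr => ?_).trans (le_of_eq (by simp; ring))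
        have hr := mem_range.mp hr
        refine (hz2 _ om).trans ?_
        have := (hy1 (i+r) om).2
        rw [hdd] at this
        have c5 : d i*ϱ^r ≤ d i*1 := by gcongr; exact pow_le_one₀ h0.le h1.le
        linarith only [this, c5]
      rw [← Finset.sum_div]
      have := log_nonneg (show §1 ≤ M+1 by linarith)
      gcongr
    rw [hsl]
    refine le_trans ?_ (num5 hL1' hLb hb1 hs2 hs3 hC hdi (by linarith only [h0, h1, hκ]) hκ0 (H i hil) hM0 hML)
    linarith only [b2, b3, b4]
  · rw [hw j om, le_div_iff₀ li]
    refine le_trans ?_ (H j hjL)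
    calc C*L ≤ C*(b*s^2) := by gcongr
      _ = 1*C*b^1*s^2 := by ring
      _ ≤ 1000*C*b^4*s^50 := by gcongr <;> first | linarith | norm_num
  · rw [hw j om, hw i hi]
    obtain ⟨r, rfl⟩ : ∃ r, j = i+r := ⟨j-i, om⟩
    have := mul_le_of_le_one_right (hd0 i).le (pow_le_one₀ h0.le h1.le : ϱ^r ≤ 1)
    rw [hdd]; gcongr
  · have e1 : ∏ j ∈ range L, ((ζ j° - x j°)/4) = exp (L*s^2 - β*(L*L°/2) - L*log (4*L/κ)) := by
      have c1 : ∀ j ∈ range L, (ζ j° - x j°)/4 = exp (s^2 - log (4*L/κ) - β*§j°) := fun j _ => by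
        rw [hw _ om, sub_sub, exp_sub, exp_add, exp_log po, ← hYe, hd]
        dsimp only; rw [hρ, exp_neg]; push_cast; field_simp
      rw [prod_congr rfl c1, ← exp_sum]
      congr 1
      have c2 : ∑ j ∈ range L, §j° = L*L°/2 := by
        clear * -
        induction L with
        | zero => simp
        | succ n ih => rw [sum_range_succ, ih]; push_cast; ring
      rw [sum_sub_distrib, sum_const, card_range, nsmul_eq_mul, ← mul_sum, c2]; ring
    rw [e1, exp_le_exp, log_div hY0.ne' (by rw [hsl]; positivity), hsl, ← hβ]
    refine le_trans ?_ (numL hβ0 hκ0 li li hLβ hLβ2)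
    rw [hA]; have : 0 ≤ b*s^2 := po
    linarith only [hL1', hLb]
theorem sig : ∃ Y0 C : ℝ, 10 ≤ Y0 ∧ 4 ≤ C ∧ ∀ Y a b : ℝ, Y0 ≤ Y → log Y^20+1 ≤ a → a + C ≤ b → b ≤ Y → ∀ I : Finset ℕ,
    (∀ q, q ∈ II a b → Nrm Y q → q ∈ I) → (b-a)/4 ≤ ∑ q ∈ I, 1/§q° := by
  classical
  obtain ⟨Y0, hY0, hab⟩ := abn
  obtain ⟨C, hC, -, -, m3⟩ := mertens
  refine ⟨Y0, 2*C+2, hY0, li, fun Y a b hY ha hb hbY I hI => ?_⟩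
  have hY1 : 10 ≤ Y := hY0.trans hY
  have hl : 1 ≤ log Y := by rw [le_log_iff_exp_le li]; linarith [exp_one_lt_d9]
  have hl20 : 0 ≤ log Y^20 := po
  have h1 := m3 a b li li (II a b) fun p hp h1 h2 => mem_II.mpr ⟨hp, h1, h2⟩
  have hA : ∑ n ∈ (II a b).filter (fun q => ¬ Nrm Y q), 1/§n ≤ 9*(1/Y^10)*Y := by
    refine dy2 Y _ (ee b) li po (one_le_exp (exp_pos _).le) (by rw [log_exp]; exact exp_le_exp.mpr hbY) _ (fun n hn => ?_) fun t ht htz => ?_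
    · have := mem_II.mp (mem_filter.mp hn).1
      exact ⟨this.1.ne_zero, (LL_le_iff this.1.two_le b).mp this.2.2⟩
    · by_cases hL : log Y^20-1 ≤ log (log t)
      · have hlt : log t ≤ exp b° := by
          refine (log_le_log li htz).trans ?_
          rw [log_mul nu (exp_pos _).ne', log_exp, exp_add]
          have : 1 ≤ exp b := one_le_exp li
          nlinarith only [this, exp_one_gt_d9, log_two_lt_d9]
        have := hab Y t hY li hL ((log_le_iff_le_exp (log_pos li)).mpr (hlt.trans (exp_le_exp.mpr li)))
          (((II a b).filter (fun q => ¬ Nrm Y q)).filter fun n : ℕ => §n ≤ t) fun q hq => by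
            simp only [mem_filter, mem_II] at hq; exact ⟨hq.1.1.1, hq.2, hq.1.2⟩
        refine this.trans (le_of_eq (by ring))
      · have : (((II a b).filter (fun q => ¬ Nrm Y q)).filter fun n : ℕ => §n ≤ t) = ∅ := by
          refine filter_eq_empty_iff.mpr fun q hq hqt => hL ?_
          have := mem_II.mp (mem_filter.mp hq).1
          have h2 : LL q ≤ log (log t) := log_le_log (log_pos (mod_cast this.1.one_lt)) (log_le_log (mod_cast this.1.pos) hqt)
          linarith
        rw [this, card_empty, Nat.cast_zero]
        have := log_pos (show 1 < t by linarith); positivity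
  have hA1 : 9*(1/Y^10)*Y ≤ 1 := by
    rw [mul_one_div, div_mul_eq_mul_div, div_le_one po]
    calc 9*Y ≤ Y*Y := by gcongr; linarith
      _ = Y^2 := by ring
      _ ≤ Y^10 := pow_le_pow_right₀ li nu
  rw [← sum_filter_add_sum_filter_not (II a b) (Nrm Y)] at h1
  have h3 : ∑ q ∈ (II a b).filter (Nrm Y), 1/§q ≤ 2*∑ q ∈ I, 1/§q° := by
    refine le_trans ?_ (mul_le_mul_of_nonneg_left (sum_le_sum_of_subset_of_nonneg (s := (II a b).filter (Nrm Y)) (fun q hq =>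
      hI q (mem_filter.mp hq).1 (mem_filter.mp hq).2) fun q _ _ => po) zero_le_two)
    rw [mul_sum]
    refine sum_le_sum fun q hq => ?_
    have : §1 ≤ q := mod_cast (mem_II.mp (mem_filter.mp hq).1).1.one_le
    rw [mul_one_div, div_le_div_iff₀ li li]; linarith
  linarith
open Classical in
noncomputable def QQ (Y z : ℝ) : Finset ℕ := (range ⌊z⌋₊).filter fun q => q.Prime ∧ Nrm Y q ∧ z/100 < q+1
theorem q0 : ∃ Y0 : ℝ, 10 ≤ Y0 ∧ ∀ Y X z : ℝ, Y0 ≤ Y → log X ≤ exp Y → exp Y ≤ 2*log X → 0 < z → z ≤ X → log X ≤ 2*log z →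
    z/(16*log X) ≤ #(QQ Y z) ∧ ∀ q : ℕ, q.Prime → z/100 < q+1 → §q+1 ≤ z → Y-2 ≤ LL q ∧ LL q ≤ Y := by
  classical
  obtain ⟨Y0, hY0, hab⟩ := abn
  obtain ⟨l0, hl0, hp⟩ := pow_le_exp_ev 3 20
  refine ⟨Y0 + exp l0, by linarith [exp_pos l0], fun Y X z hY hX1 hX2 hzp hzX hz => ?_⟩
  have hYY : Y0 ≤ Y := by linarith [exp_pos l0]
  have hY1 : 10 ≤ Y := hY0.trans hYY
  have hl : l0 ≤ log Y := by rw [le_log_iff_exp_le li]; linarith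
  have hp := hp _ hl
  rw [exp_log li] at hp
  have hp1 : 1 ≤ log Y^20 := one_le_pow₀ li
  have hE : 20000 ≤ exp Y := (exp_le_exp.mpr hY1).trans' (by
    rw [show §10 = (10:ℕ)*1 by norm_num, exp_nat_mul]
    exact (pow_le_pow_left₀ nu exp_one_gt_d9.le 10).trans' nu)
  have he2 : §7 ≤ exp 2 := by
    rw [show §2 = (2:ℕ)*1 by norm_num, exp_nat_mul]
    exact (pow_le_pow_left₀ nu exp_one_gt_d9.le 2).trans' nu
  have hEm : exp (Y-2) ≤ exp Y/7 := by rw [exp_sub]; gcongr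
  have hlz : exp Y/4 ≤ log z := li
  have hl5 : log 200 ≤ 6 := by
    rw [log_le_iff_le_exp nu, show §6 = (6:ℕ)*1 by norm_num, exp_nat_mul]
    exact (pow_le_pow_left₀ nu exp_one_gt_d9.le 6).trans' nu
  have hz5 : exp 5000 ≤ z := by rw [← le_log_iff_exp_le hzp]; linarith
  have hz6 : 5000 ≤ z := by linarith [add_one_le_exp §5000]
  have hlX : log z ≤ log X := log_le_log hzp hzX
  have hlz0 : 0 < log z := li
  refine ⟨?_, fun q hq h1 h2 => ?_⟩
  · have hsub : PR ⌊z-1⌋₊ ⊆ QQ Y z ∪ (PR ⌊z/100⌋₊ ∪ (PR ⌊z⌋₊).filter fun q => ¬ Nrm Y q) := fun q hq => by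
      simp only [QQ, mem_union, mem_filter, mem_range] at hq ⊢
      have hq1 : §q ≤ z-1 := (Nat.le_floor_iff li).mp om
      have hq2 : q+1 ≤ ⌊z⌋₊ := Nat.le_floor (by push_cast; linarith)
      by_cases hn : Nrm Y q
      · by_cases hz : z/100 < q+1
        · exact Or.inl ⟨om, hq.2, hn, hz⟩
        · have : q ≤ ⌊z/100⌋₊ := Nat.le_floor li
          exact Or.inr (Or.inl ⟨om, hq.2⟩)
      · exact Or.inr (Or.inr ⟨⟨om, hq.2⟩, hn⟩)
    have c1 : ¢(PR ⌊z-1⌋₊) ≤ #(QQ Y z) + (#(PR ⌊z/100⌋₊) + #((PR ⌊z⌋₊).filter fun q => ¬ Nrm Y q)) := by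
      exact_mod_cast (card_le_card hsub).trans ((card_union_le _ _).trans (by gcongr; exact card_union_le _ _))
    have c2 := cheb_low (t := z-1) li
    have c3 := cheb_up (t := z/100) li
    have c4 := hab Y z hYY li (by
      rw [le_log_iff_exp_le hlz0]
      exact (exp_le_exp.mpr (by linarith : log Y^20-1 ≤ Y-2)).trans li) (by
      rw [log_le_iff_le_exp hlz0]; exact (hlX.trans hX1).trans (exp_le_exp.mpr li)) ((PR ⌊z⌋₊).filter fun q => ¬ Nrm Y q) fun q hq => by
        simp only [mem_filter, mem_range] at hq
        exact ⟨hq.1.2, (Nat.le_floor_iff hzp.le).mp om, hq.2⟩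
    have d1 : z/log z*(24/100) ≤ (z-1)/4/log (z-1) := by
      have : log (z-1) ≤ log z := log_le_log li li
      have h0 : 0 < log (z-1) := log_pos li
      calc z/log z*(24/100) = z*(24/100)/log z := by ring
        _ ≤ (z-1)/4/log (z-1) := div_le_div₀ li li h0 this
    have d2 : 6*(z/100)/log (z/100) ≤ z/log z*(13/100) := by
      have h1 : log (z/100) = log z - log 100 := log_div hzp.ne' nu
      have h2 : log 100 ≤ log 200 := log_le_log nu nu
      have h3 : log z*(6/13) ≤ log (z/100) := by rw [h1]; linarith
      calc 6*(z/100)/log (z/100) ≤ 6*(z/100)/(log z*(6/13)) := by gcongr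
        _ = _ := by field_simp
    have d3 : z/log z/Y^10 ≤ z/log z/100 := by
      gcongr
      calc §100 ≤ 10^10 := nu
        _ ≤ Y^10 := by gcongr
    have d4 : z/(16*log X) ≤ z/log z/16 := by
      rw [div_div, mul_comm (log z)]; gcongr
    have : 0 < z/log z := po
    linarith
  · have hq0 : §0 < q := mod_cast hq.pos
    have hlq : exp (Y-2) ≤ log q := by
      have : z/200 ≤ q := li
      have := log_le_log po this
      rw [log_div hzp.ne' nu] at this; linarith
    have hlq2 : log q ≤ exp Y := (log_le_log hq0 (by linarith : §q ≤ X)).trans hX1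
    have hq1 : 0 < log §q := (exp_pos _).trans_le hlq
    exact ⟨(le_log_iff_exp_le hq1).mpr hlq, (log_le_iff_le_exp hq1).mpr hlq2⟩
theorem fibK {ι : Type} [Fintype ι] [DecidableEq ι] (K : Finset ι) (I : ι → Finset ℕ) (Q : Finset ((ι → ℕ) × (ι → ℕ))) (E : ℝ)
    (hI : ∀ j, 1 ≤ ∑ q ∈ I j, 1/§q°) (h1 : ∀ P ∈ Q, ∀ j, j ∉ K → P.1 j ∈ I j)
    (h2 : ∀ (u : ι → ℕ) (F : Finset ((ι → ℕ) × (ι → ℕ))), (∀ P ∈ F, P ∈ Q ∧ ∀ j, j ∉ K → P.1 j = u j) → ∑ P ∈ F, 1/∏ j ∈ K, ((P.1 j:ℝ)+1) ≤ E) :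
    ∑ P ∈ Q, 1/∏ j, ((P.1 j:ℝ)+1) ≤ (∏ j, ∑ q ∈ I j, 1/§q°)*E := by
  obtain ⟨r, hr⟩ := exq (fun P j => if j ∈ K then 0 else P.1 j : (ι → ℕ) × (ι → ℕ) → ι → ℕ)
  obtain ⟨J, hJ⟩ := exq (fun j => if j ∈ K then {0} else I j : ι → Finset ℕ)
  have hE : 0 ≤ E := by simpa using h2 0 ∅ si
  have hm : ∀ P ∈ Q, r P ∈ Fintype.piFinset J := fun P hP => Fintype.mem_piFinset.mpr fun j => by
    rw [hr, hJ]; dsimp only; split_ifs with h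
    · simp
    · exact h1 P hP j h
  rw [← sum_fiberwise_of_maps_to hm]
  have h3 : ∀ u ∈ Fintype.piFinset J, ∑ P ∈ Q.filter (fun P => r P = u), 1/∏ j, ((P.1 j:ℝ)+1) ≤ (∏ j, 1/((u j:ℝ)+1))*E := fun u hu => by
    have hu0 : ∀ j ∈ K, u j = 0 := fun j hj => by
      have := Fintype.mem_piFinset.mp hu j; rw [hJ] at this; simpa [hj] using this
    have e : ∀ P ∈ Q.filter (fun P => r P = u), 1/∏ j, ((P.1 j:ℝ)+1) = (∏ j, 1/((u j:ℝ)+1))*(1/∏ j ∈ K, ((P.1 j:ℝ)+1)) := fun P hP => by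
      have hP := (mem_filter.mp hP).2
      have hK1 : ∏ j ∈ K, ((u j:ℝ)+1) = 1 := prod_eq_one fun j hj => by rw [hu0 j hj]; simp
      rw [prod_div_distrib, prod_const_one, div_mul_div_comm, one_mul, ← prod_mul_prod_compl K fun j => ((P.1 j:ℝ)+1),
        ← prod_mul_prod_compl K fun j => ((u j:ℝ)+1), hK1, one_mul, mul_comm]
      congr 2
      refine prod_congr rfl fun j hj => ?_
      rw [← hP, hr]; simp [mem_compl.mp hj]
    rw [sum_congr rfl e, ← mul_sum]
    refine mul_le_mul_of_nonneg_left ?_ (prod_nonneg fun j _ => po)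
    refine h2 u _ fun P hP => ?_
    rw [mem_filter] at hP
    refine ⟨hP.1, fun j hj => ?_⟩
    rw [← hP.2, hr]; simp [hj]
  refine (sum_le_sum h3).trans ?_
  rw [← sum_mul, ← prod_univ_sum J fun _ q => 1/§q°]
  refine mul_le_mul_of_nonneg_right (prod_le_prod (fun j _ => sum_nonneg fun q _ => po) fun j _ => ?_) hE
  rw [hJ]; dsimp only; split_ifs
  · simpa using hI j
  · rfl
def GS (C Y : ℝ) (L : ℕ) (ζ : ℕ → ℕ) (x : ℕ → ℝ) : Prop := (∀ j k, j ≤ k → k ≤ L → ζ k ≤ ζ j) ∧ ζ 0 ≤ Y+1 ∧ (∀ j, j ≤ L → log Y^20+1 ≤ x j) ∧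
    (∀ j k, j < k → k ≤ L → ζ k+1+2*log Y < x j) ∧
    (∀ i M, i+M ≤ L → -(ζ i:ℝ) + ∑ r ∈ range M, fordA r°*ζ (i+r°) + 2*∑ r ∈ range M°, (ζ (i+r) - x (i+r)) +
      log M°*∑ r ∈ range M°, (ζ (i+r):ℝ)/log Y^4 + C*M°^3*log Y ≤ 0) ∧
    (∀ j k, 1 ≤ j → j ≤ k → k ≤ L → C ≤ ζ k - x k ∧ ζ k - x k ≤ ζ j - x j) ∧ ∀ j, j ≤ L → x j ≤ ζ j
def CD (Y : ℝ) (ζ : ℕ → ℕ) (x : ℕ → ℝ) (j q : ℕ) : Prop := q.Prime ∧ x j ≤ LL q ∧ LL q ≤ ζ j ∧ LL q ≤ Y ∧ Nrm Y q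
theorem SK : ∃ Y0 C : ℝ, 10 ≤ Y0 ∧ 1 ≤ C ∧ ∀ (Y : ℝ) (L : ℕ) (ζ : ℕ → ℕ) (x : ℕ → ℝ) (K : Finset (Fin L°)) (Q : Finset ((Fin L° → ℕ) × (Fin L° → ℕ)))
    (u : Fin L° → ℕ) (h : ℕ) (z : ℝ), Y0 ≤ Y → GS C Y L ζ x → K.Nonempty → h ≤ 1 →
    (h = 1 → 0 ∈ K ∧ ∀ P ∈ Q, z/100 < ∏ j ∈ K, ((P.1 j:ℝ)+1) ∧ ∏ j ∈ K, ((P.1 j:ℝ)+1) ≤ z) →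
    (∀ P ∈ Q, (∀ j, j ∉ K → P.1 j = u j ∧ P.2 j = u j) ∧ ∏ j ∈ K, (P.1 j+1) = ∏ j ∈ K, (P.2 j+1) ∧ ∀ j ∈ K, P.1 j ≠ P.2 j ∧
      ∀ q, (q = P.1 j ∨ q = P.2 j) → CD Y ζ x j q) →
    ∑ P ∈ Q, 1/∏ j ∈ K, ((P.1 j:ℝ)+1) ≤ exp (-(h*x 0)) := by
  classical
  obtain ⟨Y0, C, hY0, hC, hps⟩ := pairsum
  refine ⟨Y0, C, hY0, hC, fun Y L ζ x K Q u h z hY ⟨hζ, hζ0, hx, hgap, h5, hw, hxz⟩ hK hh hz hQ => ?_⟩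
  have hl : 1 ≤ log Y := by rw [le_log_iff_exp_le li]; linarith [exp_one_lt_d9]
  have hl2 : 2 ≤ log Y := by
    rw [le_log_iff_exp_le li, show §2 = 1+1 by norm_num, exp_add]
    nlinarith only [exp_one_lt_d9, exp_one_gt_d9, hY, hY0]
  have hl4 : 4*log Y ≤ log Y^20+1 := by
    have h3 := one_add_mul_le_pow (show -2 ≤ log Y-1 by linarith) 20
    rw [add_sub_cancel] at h3; push_cast at h3; linarith only [h3, hl2]
  obtain ⟨M, hM⟩ : ∃ M, #K = M+1 := ⟨#K-1, by have := hK.card_pos; omega⟩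
  obtain ⟨e, he⟩ := exq (K.orderEmbOfFin hM)
  have heK : ∀ i, e i ∈ K := fun i => he ▸ orderEmbOfFin_mem K hM i
  have hmap : univ.map e.toEmbedding = K := he ▸ map_orderEmbOfFin_univ K hM
  obtain ⟨k, hk⟩ := exq (fun r => (e ⟨min r M, om⟩ : ℕ) : ℕ → ℕ)
  have hke : ∀ i : Fin M°, k i = e i := fun i => by
    have : (⟨min (i:ℕ) M, om⟩ : Fin M°) = i := Fin.ext (by simp; omega)
    rw [hk]; dsimp only; rw [this]
  have hkL : ∀ r, k r ≤ L := fun r => by rw [hk]; dsimp only; omega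
  have hkm : ∀ r r', r ≤ r' → k r ≤ k r' := fun r r' hr => by
    rw [hk]; exact e.monotone (Fin.mk_le_mk.mpr om)
  have hks : ∀ r r', r < r' → r' ≤ M → k r < k r' := fun r r' hr hr' => by
    rw [hk]; exact e.strictMono (Fin.mk_lt_mk.mpr om)
  have hkr : ∀ r, r ≤ M → k 0 + r ≤ k r := fun r => by
    induction r with
    | zero => intro _; simp
    | succ r ih => intro hr; have := ih om; have := hks r r° om hr; omega
  have hprod : ∀ f : Fin L° → ℕ, ∏ j ∈ K, f j = ∏ i, f (e i) := fun f => by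
    conv_lhs => rw [← hmap, prod_map]
    rfl
  have hcast : ∀ P : (Fin L° → ℕ) × (Fin L° → ℕ), ∏ j ∈ K, ((P.1 j:ℝ)+1) = ((∏ i, (P.1 (e i)+1) : ℕ):ℝ) := fun P => by
    rw [← hprod fun j => P.1 j+1]; push_cast; rfl
  obtain ⟨g, hg⟩ := exq (fun P => (fun i => P.1 (e i), fun i => P.2 (e i)) : (Fin L° → ℕ) × (Fin L° → ℕ) → (Fin M° → ℕ) × (Fin M° → ℕ))
  have hinj : Set.InjOn g Q := fun P hP P' hP' hPP => by
    rw [hg] at hPP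
    have a1 := congrFun (congrArg Prod.fst hPP); have a2 := congrFun (congrArg Prod.snd hPP)
    have b1 := (hQ P hP).1; have b2 := (hQ P' hP').1
    have hj : ∀ j ∈ K, ∃ i, e i = j := fun j hj => by rw [← hmap] at hj; simpa using hj
    refine Prod.ext (funext fun j => ?_) (funext fun j => ?_)
    · by_cases hjK : j ∈ K
      · obtain ⟨i, rfl⟩ := hj j hjK; exact a1 i
      · rw [(b1 j hjK).1, (b2 j hjK).1]
    · by_cases hjK : j ∈ K
      · obtain ⟨i, rfl⟩ := hj j hjK; exact a2 i
      · rw [(b1 j hjK).2, (b2 j hjK).2]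
  have main := hps Y M (fun r => x (k r)) (fun r => ζ (k r)) (Q.image g) h z hY (fun r r' hr => hζ _ _ (hkm r r' hr) (hkL _))
    (fun r _ => by linarith [hxz _ (hkL r), hx _ (hkL r)])
    (fun r => by have : (ζ (k r):ℝ) ≤ ζ 0 := mod_cast hζ 0 _ (Nat.zero_le _) (hkL r)
                 linarith) (fun r _ => hl4.trans (hx _ (hkL r)))
    (fun r r' hr hr' => hgap _ _ (hks r r' hr hr') (hkL _)) hh (fun h1 P hP => by
      obtain ⟨P', hP', rfl⟩ := mem_image.mp hP
      have := (hz h1).2 P' hP'; rw [hcast] at this; rw [hg]; exact this) (fun P hP => by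
      obtain ⟨P', hP', rfl⟩ := mem_image.mp hP
      obtain ⟨-, c2, c3⟩ := hQ P' hP'
      rw [hprod, hprod] at c2
      rw [hg]; refine ⟨c2, fun i => (c3 _ (heK i)).1, fun i q hq => ?_⟩
      simp only [hke]; exact (c3 _ (heK i)).2 q hq)
  rw [sum_image hinj] at main
  simp only [hcast]
  rw [hg] at main
  refine main.trans (exp_le_exp.mpr ?_)
  have hx0 : §h*x (k 0) = h*x 0 := by
    interval_cases h
    · simp
    · obtain ⟨i, hi⟩ : ∃ i, e i = 0 := by have := (hz rfl).1; rw [← hmap] at this; simpa using this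
      have h0 : k i = 0 := by rw [hke, hi]; rfl
      rw [show k 0 = 0 from Nat.le_zero.mp (h0 ▸ hkm 0 i (Nat.zero_le _))]
  have key := h5 (k 0) M ((hkr M le_rfl).trans (hkL M))
  have s1 : ∑ r ∈ range M, fordA r°*(ζ (k r°):ℝ) ≤ ∑ r ∈ range M, fordA r°*ζ (k 0+r°) := sum_le_sum fun r hr => by
    have := mem_range.mp hr
    refine mul_le_mul_of_nonneg_left ?_ (fA_pos om).le
    exact_mod_cast hζ _ _ (hkr r° om) (hkL _)
  have s2 : ∑ r ∈ range M°, ((ζ (k r):ℝ) - x (k r)) ≤ ∑ r ∈ range M°, (ζ (k 0+r) - x (k 0+r)) := sum_le_sum fun r hr => by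
    have := mem_range.mp hr
    rcases Nat.eq_zero_or_pos r with rfl | h0
    · rfl
    · exact (hw _ _ om (hkr r om) (hkL _)).2
  have s3 : log M°*∑ r ∈ range M°, (ζ (k r):ℝ)/log Y^4 ≤ log M°*∑ r ∈ range M°, (ζ (k 0+r):ℝ)/log Y^4 := by
    have : 0 ≤ log §M° := log_nonneg (by linarith [show §0 ≤ M from Nat.cast_nonneg M])
    gcongr with r hr
    have := mem_range.mp hr
    exact hζ _ _ (hkr r om) (hkL _)
  simp only [add_mul, one_mul, sum_add_distrib, sum_sub_distrib] at s2 key ⊢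
  have s4 := sum_range_succ' (fun r => (ζ (k r):ℝ)) M
  linarith
theorem csl {α : Type} [DecidableEq α] (B : Finset α) (f : α → ℕ) :
    ¢B^2 ≤ #(B.image f)*#((B ×ˢ B).filter fun P => f P.1 = f P.2) := by
  have h1 : ¢B = ∑ v ∈ B.image f, ¢(B.filter fun t => f t = v) := mod_cast card_eq_sum_card_image f B
  have h2 : #((B ×ˢ B).filter fun P => f P.1 = f P.2) = ∑ v ∈ B.image f, #(B.filter fun t => f t = v)^2 := by
    rw [card_eq_sum_card_fiberwise (f := fun P => f P.1) (t := B.image f) fun P hP => mem_coe.mpr (mem_image_of_mem f (mem_product.mp (mem_filter.mp hP).1).1)]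
    refine sum_congr rfl fun v _ => ?_
    rw [sq, ← card_product]
    congr 1; ext P; simp only [mem_filter, mem_product]
    constructor
    · rintro ⟨⟨⟨a, b⟩, c⟩, d⟩; exact ⟨⟨a, d⟩, b, c ▸ d⟩
    · rintro ⟨⟨a, d⟩, b, c⟩; exact ⟨⟨⟨a, b⟩, d.trans c.symm⟩, d⟩
  rw [h1, h2]; push_cast
  exact sq_sum_le_card_mul_sum_sq
theorem QKb : ∃ Y0 C : ℝ, 10 ≤ Y0 ∧ 1 ≤ C ∧ ∀ (Y X : ℝ) (L : ℕ) (ζ : ℕ → ℕ) (x : ℕ → ℝ) (I : Fin L° → Finset ℕ) (K : Finset (Fin L°))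
    (Q : Finset ((Fin L° → ℕ) × (Fin L° → ℕ))), Y0 ≤ Y → GS C Y L ζ x → x 0 = Y-2 → 1 < X → log X ≤ exp Y → I 0 = {0} →
    (∀ j, 1 ≤ ∑ q ∈ I j, 1/§q°) → (∀ s ∈ Fintype.piFinset I, 2*∏ j, ((s j:ℝ)+1) ≤ X ∧ log X ≤ 2*log (X/∏ j, ((s j:ℝ)+1))) →
    (∀ P ∈ Q, ∏ j, (P.1 j+1) = ∏ j, (P.2 j+1) ∧ (∀ j, P.1 j ≠ P.2 j ↔ j ∈ K) ∧ X/100 < ∏ j, ((P.1 j:ℝ)+1) ∧ ∏ j, ((P.1 j:ℝ)+1) ≤ X ∧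
      (∀ j, j ≠ 0 → P.1 j ∈ I j) ∧ ∀ j q, (q = P.1 j ∨ q = P.2 j) → CD Y ζ x j q) →
    ¢Q ≤ 12*(X/log X)*∏ j, ∑ q ∈ I j, 1/§q° := by
  classical
  obtain ⟨Y0, C, hY0, hC, hSK⟩ := SK
  refine ⟨Y0, C, hY0, hC, fun Y X L ζ x I K Q hY hG hx0 hX hXY hI0 hI hs hQ => ?_⟩
  have hlX : 0 < log X := log_pos hX
  obtain ⟨S, hS⟩ := exq (∏ j, ∑ q ∈ I j, 1/§q°)
  have hS0 : 0 ≤ S := hS ▸ prod_nonneg fun j _ => sum_nonneg fun q _ => po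
  have hKe : ∀ P ∈ Q, ∀ j, j ∉ K → P.1 j = P.2 j := fun P hP j hj => by
    by_contra h; exact hj (((hQ P hP).2.1 j).mp h)
  have hKp : ∀ P ∈ Q, ∏ j ∈ K, (P.1 j+1) = ∏ j ∈ K, (P.2 j+1) := fun P hP => by
    have := (hQ P hP).1
    rw [← prod_mul_prod_compl K, ← prod_mul_prod_compl K fun j => P.2 j+1,
      prod_congr (s₁ := Kᶜ) rfl fun j hj => by rw [hKe P hP j (mem_compl.mp hj)]] at this
    exact Nat.eq_of_mul_eq_mul_right (prod_pos fun j _ => om) this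
  rw [← hS]
  by_cases h0 : 0 ∈ K
  · have h1 : ¢Q ≤ X*∑ P ∈ Q, 1/∏ j, ((P.1 j:ℝ)+1) := by
      rw [card_eq_sum_ones, mul_sum]; push_cast
      refine sum_le_sum fun P hP => ?_
      rw [mul_one_div, le_div_iff₀ (prod_pos fun j _ => po), one_mul]; exact (hQ P hP).2.2.2.1
    have h2 := fibK K I Q (exp (-((1:ℕ)*x 0))) hI (fun P hP j hj => (hQ P hP).2.2.2.2.1 j fun h => hj (h ▸ h0)) fun u F hF => by
      refine hSK Y L ζ x K _ u 1 (X/∏ j ∈ Kᶜ, ((u j:ℝ)+1)) hY hG ⟨0, h0⟩ le_rfl (fun _ => ⟨h0, fun P hP => ?_⟩) fun P hP => ?_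
      · obtain ⟨hP, hu⟩ := hF P hP
        obtain ⟨-, -, a, b, -⟩ := hQ P hP
        rw [← prod_mul_prod_compl K, prod_congr (s₁ := Kᶜ) rfl fun j hj => by rw [hu j (mem_compl.mp hj)]] at a b
        have hc : 0 < ∏ j ∈ Kᶜ, ((u j:ℝ)+1) := prod_pos fun j _ => po
        exact ⟨by rw [div_right_comm, div_lt_iff₀ hc]; exact a, by rw [le_div_iff₀ hc]; exact b⟩
      · obtain ⟨hP, hu⟩ := hF P hP
        exact ⟨fun j hj => ⟨hu j hj, hKe P hP j hj ▸ hu j hj⟩, hKp P hP, fun j hj => ⟨((hQ P hP).2.1 j).mpr hj, (hQ P hP).2.2.2.2.2 j⟩⟩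
    rw [← hS] at h2
    have h3 : exp (-((1:ℕ)*x 0)) ≤ 12/log X := by
      rw [le_div_iff₀ hlX]
      calc _ ≤ exp (-((1:ℕ)*x 0))*exp Y := by gcongr
        _ = exp 1*exp 1 := by rw [← exp_add, ← exp_add, hx0]; congr 1; push_cast; ring
        _ ≤ 12 := by nlinarith only [exp_one_lt_d9, exp_one_gt_d9]
    calc ¢Q ≤ X*(S*(12/log X)) := h1.trans (by gcongr; exact h2.trans (by gcongr))
      _ = _ := by ring
  · obtain ⟨g, hg⟩ := exq (fun P => (Function.update P.1 0 0, Function.update P.2 0 0) : (Fin L° → ℕ) × (Fin L° → ℕ) → (Fin L° → ℕ) × (Fin L° → ℕ))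
    have hg1 : ∀ P j, j ≠ 0 → (g P).1 j = P.1 j ∧ (g P).2 j = P.2 j := fun P j hj => by rw [hg]; simp [hj]
    have hg0 : ∀ P, (g P).1 0 = 0 ∧ (g P).2 0 = 0 := fun P => by rw [hg]; simp
    have hpr : ∀ P, ∏ j, ((P.1 j:ℝ)+1) = (P.1 0+1)*∏ j, (((g P).1 j:ℝ)+1) := fun P => by
      rw [Fin.prod_univ_succ, Fin.prod_univ_succ (fun j => (((g P).1 j:ℝ)+1)), (hg0 P).1, Nat.cast_zero, zero_add, one_mul]
      congr 1
      exact prod_congr rfl fun j _ => by rw [(hg1 P _ (Fin.succ_ne_zero j)).1]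
    have h1 : ∀ P' ∈ Q.image g, ¢(Q.filter fun P => g P = P') ≤ 12*(X/log X)*(1/∏ j, ((P'.1 j:ℝ)+1)) := fun P' hP' => by
      obtain ⟨z, hz⟩ := exq (X/∏ j, ((P'.1 j:ℝ)+1))
      have hpp : 0 < ∏ j, ((P'.1 j:ℝ)+1) := prod_pos fun j _ => po
      have hm : P'.1 ∈ Fintype.piFinset I := by
        obtain ⟨P, hP, rfl⟩ := mem_image.mp hP'
        refine Fintype.mem_piFinset.mpr fun j => ?_
        by_cases hj : j = 0
        · rw [hj, (hg0 P).1, hI0]; simp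
        · rw [(hg1 P j hj).1]; exact (hQ P hP).2.2.2.2.1 j hj
      obtain ⟨z1, z2⟩ := hs _ hm
      rw [← hz] at z2
      have z3 : 2 ≤ z := by rw [hz, le_div_iff₀ hpp]; exact z1
      have hc : #(Q.filter fun P => g P = P') ≤ #(PR ⌊z⌋₊) := by
        refine card_le_card_of_injOn (fun P => P.1 0) (fun P hP => ?_) fun P hP P2 hP2 he => ?_
        · obtain ⟨hp, rfl⟩ := mem_filter.mp hP
          have := (hQ P hp).2.2.2.1
          rw [hpr P, ← le_div_iff₀ hpp, ← hz] at this
          refine mem_coe.mpr (mem_filter.mpr ⟨mem_range.mpr (Nat.lt_succ_of_le (Nat.le_floor li)), ((hQ P hp).2.2.2.2.2 0 _ (Or.inl rfl)).1⟩)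
        · obtain ⟨hP', e1⟩ := mem_filter.mp hP
          obtain ⟨hP2', e2⟩ := mem_filter.mp hP2
          refine Prod.ext (funext fun j => ?_) (funext fun j => ?_)
          · by_cases hj : j = 0
            · rw [hj]; exact he
            · rw [← (hg1 P j hj).1, ← (hg1 P2 j hj).1, e1, e2]
          · by_cases hj : j = 0
            · rw [hj, ← hKe P hP' 0 h0, ← hKe P2 hP2' 0 h0]; exact he
            · rw [← (hg1 P j hj).2, ← (hg1 P2 j hj).2, e1, e2]
      calc _ ≤ ¢(PR ⌊z⌋₊) := mod_cast hc
        _ ≤ 6*z/log z := cheb_up z3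
        _ ≤ 6*z/(log X/2) := by gcongr; linarith
        _ = _ := by rw [hz]; ring
    have h2 := fibK K I (Q.image g) 1 hI (fun P hP j hj => ?_) fun u F hF => ?_
    · rw [← hS, mul_one] at h2
      rw [card_eq_sum_card_image g Q]; push_cast
      refine (sum_le_sum h1).trans ?_
      rw [← mul_sum]; gcongr
    · obtain ⟨P, hp, rfl⟩ := mem_image.mp hP
      by_cases hj : j = 0
      · rw [hj, (hg0 P).1, hI0]; simp
      · rw [(hg1 P j hj).1]; exact (hQ P hp).2.2.2.2.1 j hj
    · have he : ∀ P ∈ F, (∀ j, j ∉ K → P.1 j = u j ∧ P.2 j = u j) ∧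
          ∃ P0 ∈ Q, ∀ j ∈ K, P.1 j = P0.1 j ∧ P.2 j = P0.2 j := fun P hP => by
        obtain ⟨hP, hu⟩ := hF P hP
        obtain ⟨P0, hP0, rfl⟩ := mem_image.mp hP
        refine ⟨fun j hj => ⟨hu j hj, hu j hj ▸ ?_⟩, P0, hP0, fun j hj => hg1 P0 j fun h => h0 (h ▸ hj)⟩
        by_cases hj0 : j = 0
        · rw [hj0, (hg0 P0).1, (hg0 P0).2]
        · rw [(hg1 P0 j hj0).1, (hg1 P0 j hj0).2, hKe P0 hP0 j hj]
      rcases K.eq_empty_or_nonempty with hK | hK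
      · simp only [hK, prod_empty, div_one, sum_const, nsmul_eq_mul, mul_one]
        rw [hK] at he
        have : #F ≤ 1 := card_le_one.mpr fun a ha b hb => by
          have a1 := (he a ha).1; have b1 := (he b hb).1
          refine Prod.ext (funext fun j => ?_) (funext fun j => ?_)
          · rw [(a1 j (notMem_empty j)).1, (b1 j (notMem_empty j)).1]
          · rw [(a1 j (notMem_empty j)).2, (b1 j (notMem_empty j)).2]
        exact_mod_cast this
      · have := hSK Y L ζ x K F u 0 0 hY hG hK zero_le_one (fun h => absurd h zero_ne_one) fun P hP => by
          obtain ⟨a, P0, hP0, b⟩ := he P hP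
          refine ⟨a, ?_, fun j hj => ?_⟩
          · rw [prod_congr rfl fun j hj => by rw [(b j hj).1], hKp P0 hP0]
            exact prod_congr rfl fun j hj => by rw [(b j hj).2]
          · rw [(b j hj).1, (b j hj).2]
            exact ⟨((hQ P0 hP0).2.1 j).mpr hj, (hQ P0 hP0).2.2.2.2.2 j⟩
        simpa using this
theorem Rb {ϱ A : ℝ} (h1 : ϱ < 1) (hA : 0 ≤ A) : ∃ Y0 : ℝ, 10 ≤ Y0 ∧ ∀ (Y X : ℝ) (L : ℕ) (s : Fin L° → ℕ), Y0 ≤ Y → 1 < X → exp Y ≤ 2*log X →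
    L ≤ A*log Y → s 0 = 0 → (∀ j, j ≠ 0 → (s j).Prime ∧ LL (s j) ≤ ϱ*Y+1) → 2*∏ j, ((s j:ℝ)+1) ≤ X ∧ log X ≤ 2*log (X/∏ j, ((s j:ℝ)+1)) := by
  have h1' : 0 < 1-ϱ := li
  obtain ⟨l0, -, hp⟩ := pow_le_exp_ev (24*A°/(1-ϱ)) 1
  refine ⟨10+|l0/(1-ϱ)|, by linarith [abs_nonneg (l0/(1-ϱ))], fun Y X L s hY hX hXY hL h0 hs => ?_⟩
  have hY1 : 10 ≤ Y := by linarith [abs_nonneg (l0/(1-ϱ))]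
  have e1 := hp ((1-ϱ)*Y) (by rw [mul_comm, ← div_le_iff₀ h1']; linarith [le_abs_self (l0/(1-ϱ))])
  rw [pow_one, ← mul_assoc, div_mul_cancel₀ _ h1'.ne'] at e1
  have hR : 0 < ∏ j, ((s j:ℝ)+1) := prod_pos fun j _ => po
  have e2 : log (∏ j, ((s j:ℝ)+1)) ≤ L°*(2*exp (ϱ*Y+1)) := by
    rw [log_prod fun j _ => po]
    refine (sum_le_card_nsmul _ _ (2*exp (ϱ*Y+1)) fun j _ => ?_).trans si
    by_cases hj : j = 0
    · rw [hj, h0]; simp; positivity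
    · obtain ⟨a, b⟩ := hs j hj
      have ha : §2 ≤ s j := mod_cast a.two_le
      calc log ((s j:ℝ)+1) ≤ log ((s j:ℝ)^2) := log_le_log po (by nlinarith only [ha])
        _ = 2*exp (LL (s j)) := by rw [log_pow, LL, exp_log (log_pos li)]; simp
        _ ≤ _ := by gcongr
  have hlY : log Y ≤ Y := log_le_self li
  have e3 : §L°*(2*exp (ϱ*Y+1)) ≤ exp Y/4 := by
    have : §L+1 ≤ A°*Y := by nlinarith only [hL, hA, hlY, hY1]
    have e4 : exp Y = exp ((1-ϱ)*Y)*exp (ϱ*Y) := by rw [← exp_add]; ring_nf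
    rw [exp_add, e4]
    have := exp_pos (ϱ*Y)
    calc §L°*(2*(exp (ϱ*Y)*exp 1)) ≤ (A°*Y)*(2*(exp (ϱ*Y)*3)) := by gcongr; linarith [exp_one_lt_d9]
      _ = (24*A°*Y)*exp (ϱ*Y)/4 := by ring
      _ ≤ _ := by gcongr
  have hlX : 4 ≤ log X := by linarith [add_one_le_exp Y]
  refine ⟨?_, by rw [log_div li hR.ne']; linarith⟩
  have : 2*∏ j, ((s j:ℝ)+1) ≤ exp (log X/2)*exp (log X/2) := by
    gcongr
    · linarith [add_one_le_exp (log X/2)]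
    · rw [← log_le_iff_le_exp hR]; linarith
  rwa [← exp_add, add_halves, exp_log li] at this
theorem fin1 {T S V A l Cc : ℝ} {b B L : ℕ} (hb : b = B) (hT : 0 < T) (hS : 0 < S) (h1 : T/16*S ≤ b) (h2 : §B^2 ≤ V*(2^L°*(12*T*S)))
    (h3 : exp (Cc - A*l) ≤ S) (hl : 1 ≤ l) (hL : L ≤ A*l) : T*exp (Cc - (2*A+10)*l) ≤ V := by
  rw [hb] at h1
  have h4 : (T/16*S)^2 ≤ §B^2 := pow_le_pow_left₀ po h1 2
  have h5 : T*S*(T*S) ≤ (6144*2^L*V)*(T*S) := by have := h4.trans h2; rw [pow_succ §2 L] at this; linarith only [this]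
  have h6 := le_of_mul_le_mul_right h5 po
  have h7 : §6144*2^L ≤ exp (10*l)*exp (A*l) := by
    gcongr
    · calc §6144 ≤ 2.7^10 := nu
        _ ≤ (exp 1)^10 := by gcongr; linarith [exp_one_gt_d9]
        _ = exp 10 := by rw [← exp_nat_mul]; norm_num
        _ ≤ _ := exp_le_exp.mpr li
    · calc §2^L ≤ (exp 1)^L := by gcongr; linarith [exp_one_gt_d9]
        _ = exp L := by rw [← exp_nat_mul, mul_one]
        _ ≤ _ := exp_le_exp.mpr hL
  have hV : 0 ≤ V := by
    by_contra h
    have : 0 < T*S := po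
    nlinarith only [h6, this, h, mul_pos (show §0 < 6144*2^L by positivity) (show 0 < -V by linarith)]
  have h8 : T*exp (Cc - A*l) ≤ exp (10*l)*exp (A*l)*V := (mul_le_mul_of_nonneg_left h3 hT.le).trans (h6.trans (by gcongr))
  rw [show Cc - (2*A+10)*l = (Cc-A*l) - (10*l+A*l) by ring, exp_sub, exp_add, ← mul_div_assoc, div_le_iff₀ po]
  linarith
theorem lowerV (ϱ : ℝ) (h0 : 0 < ϱ) (h1 : ϱ < 1) (hs : ∑' n, fordA n° * ϱ^n° = 1) :
    ∃ Y0 A : ℝ, 10 ≤ Y0 ∧ 1 ≤ A ∧ ∀ Y X : ℝ, Y0 ≤ Y → 1 < X → log X ≤ exp Y → exp Y ≤ 2*log X → ∃ (L : ℕ) (VV : Finset ℕ),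
    (∀ v ∈ VV, §v ≤ X ∧ ∃ S : Finset ℕ, #S = L ∧ (∀ q ∈ S, q.Prime ∧ 11 < q) ∧ ∏ q ∈ S, q° = v) ∧
    X/log X*exp (1/(2*log (1/ϱ))*log (Y/log Y)^2 - A*log Y) ≤ #VV := by
  classical
  obtain ⟨Y1, C1, hY1, hC1, hQK⟩ := QKb
  obtain ⟨Y2, C2, hY2, hC2, hsig⟩ := sig
  obtain ⟨Y3, hY3, hq0⟩ := q0
  obtain ⟨Y4, A, hY4, hA, hseq⟩ := seqs ϱ h0 h1 hs (max C1 C2) (hC1.trans (le_max_left _ _))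
  obtain ⟨Y5, hY5, hRb⟩ := Rb h1 (zero_le_one.trans hA)
  refine ⟨Y1+Y2+Y3+Y4+Y5, 2*A+10, li, li, fun Y X hY hX hXY hXY2 => ?_⟩
  obtain ⟨L, ζ, x, hL1, hL, hζ, hζ0, hζ1, hx0, hζϱ, hx, hgap, h5, hw, hprod⟩ := hseq Y li
  have hl2 : 2 ≤ log Y := by
    rw [le_log_iff_exp_le li, show §2 = 1+1 by norm_num, exp_add]
    nlinarith only [exp_one_lt_d9, exp_one_gt_d9, hY, hY1, hY2, hY3, hY4, hY5]
  have hl20 : 2 ≤ log Y^20+1 := by linarith [one_le_pow₀ (show 1 ≤ log Y by linarith) (n := 20)]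
  have hlX : 0 < log X := log_pos hX
  have hG : GS C1 Y L ζ x := by
    refine ⟨hζ, hζ1, hx, hgap, fun i M hi => le_trans ?_ (h5 i M hi), fun j k a b c => ⟨(le_max_left _ _).trans (hw j k a b c).1, (hw j k a b c).2⟩, fun j hj => ?_⟩
    · gcongr; exact le_max_left _ _
    · rcases Nat.eq_zero_or_pos j with rfl | h
      · linarith
      · linarith [(hw j j h le_rfl hj).1, le_max_left C1 C2]
  obtain ⟨I, hI⟩ := exq (fun j : Fin L° => if j = 0 then {0} else (II (x j) (ζ j)).filter (Nrm Y) : Fin L° → Finset ℕ)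
  have hI0 : I 0 = {0} := by rw [hI]; simp
  have hIj : ∀ j, j ≠ 0 → I j = (II (x j) (ζ j)).filter (Nrm Y) := fun j hj => by rw [hI]; simp [hj]
  have hp1 : ∀ j : Fin L°, j ≠ 0 → 1 ≤ (j:ℕ) := fun j hj => Nat.pos_of_ne_zero fun h => hj (Fin.ext h)
  have hle : ∀ j : Fin L°, (j:ℕ) ≤ L := fun j => om
  have hζY : ∀ j : Fin L°, j ≠ 0 → (ζ j:ℝ) ≤ Y := fun j hj => by linarith [hgap 0 j (hp1 j hj) (hle j)]
  have hCD : ∀ j : Fin L°, j ≠ 0 → ∀ q ∈ I j, CD Y ζ x j q := fun j hj q hq => by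
    rw [hIj j hj, mem_filter, mem_II] at hq
    exact ⟨hq.1.1, hq.1.2.1.le, hq.1.2.2, hq.1.2.2.trans (hζY j hj), hq.2⟩
  have hsg : ∀ j : Fin L°, j ≠ 0 → 1 ≤ (ζ j - x j)/4 ∧ (ζ j - x j)/4 ≤ ∑ q ∈ I j, 1/§q° := fun j hj => by
    have := (hw j j (hp1 j hj) le_rfl (hle j)).1.trans' (le_max_right C1 C2)
    exact ⟨li, hsig Y _ _ li (hx j (hle j)) li (hζY j hj) _ fun q a b => by rw [hIj j hj]; exact mem_filter.mpr ⟨a, b⟩⟩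
  have hI1 : ∀ j, 1 ≤ ∑ q ∈ I j, 1/§q° := fun j => by
    by_cases hj : j = 0
    · rw [hj, hI0]; simp
    · exact (hsg j hj).1.trans (hsg j hj).2
  obtain ⟨S, hS⟩ := exq (∏ j, ∑ q ∈ I j, 1/§q°)
  have hSl : exp (1/(2*log (1/ϱ))*log (Y/log Y)^2 - A*log Y) ≤ S := by
    refine hprod.trans ?_
    rw [hS, Fin.prod_univ_succ, hI0, ← Fin.prod_univ_eq_prod_range (fun j => ((ζ j°:ℝ) - x j°)/4) L]
    simp only [sum_singleton, Nat.cast_zero, zero_add, div_one, one_mul]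
    refine prod_le_prod (fun j _ => ?_) fun j _ => ?_
    · have := (hsg j.succ (Fin.succ_ne_zero j)).1; rw [Fin.val_succ] at this; linarith
    · have := (hsg j.succ (Fin.succ_ne_zero j)).2; rwa [Fin.val_succ] at this
  have hR : ∀ s ∈ Fintype.piFinset I, s 0 = 0 ∧ 2*∏ j, ((s j:ℝ)+1) ≤ X ∧ log X ≤ 2*log (X/∏ j, ((s j:ℝ)+1)) := fun s hs => by
    have hm := Fintype.mem_piFinset.mp hs
    have hs0 : s 0 = 0 := by have := hm 0; rw [hI0] at this; simpa using this
    refine ⟨hs0, hRb Y X L s li hX hXY2 hL hs0 fun j hj => ?_⟩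
    have := hCD j hj _ (hm j)
    exact ⟨this.1, this.2.2.1.trans (hζϱ j (hp1 j hj) (hle j))⟩
  obtain ⟨U, hU⟩ := exq ((Fintype.piFinset I).sigma fun s => QQ Y (X/∏ j, ((s j:ℝ)+1)) : Finset ((_ : Fin L° → ℕ) × ℕ))
  obtain ⟨g, hg⟩ := exq (fun p => Function.update p.1 0 p.2 : ((_ : Fin L° → ℕ) × ℕ) → Fin L° → ℕ)
  have hg0 : ∀ p, g p 0 = p.2 := fun p => by rw [hg]; simp
  have hgj : ∀ p j, j ≠ 0 → g p j = p.1 j := fun p j hj => by rw [hg]; simp [hj]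
  have hUm : ∀ p ∈ U, p.1 ∈ Fintype.piFinset I ∧ p.2 ∈ QQ Y (X/∏ j, ((p.1 j:ℝ)+1)) := fun p hp => by rw [hU] at hp; exact mem_sigma.mp hp
  have hinj : Set.InjOn g U := fun p hp p' hp' e => by
    obtain ⟨s, q⟩ := p; obtain ⟨s', q'⟩ := p'
    have a := hg0 ⟨s, q⟩; have b := hg0 ⟨s', q'⟩
    rw [e, b] at a
    have : s = s' := funext fun j => by
      by_cases hj : j = 0
      · rw [hj, (hR s (hUm _ hp).1).1, (hR s' (hUm _ hp').1).1]
      · have a := hgj ⟨s, q⟩ j hj; have b := hgj ⟨s', q'⟩ j hj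
        rw [e, b] at a; exact a.symm
    dsimp only at a
    rw [a, this]
  obtain ⟨B, hB⟩ := exq (U.image g)
  have hBc : X/log X/16*S ≤ #U := by
    rw [hU, card_sigma, hS, prod_univ_sum I fun _ q => 1/§q°, mul_sum]; push_cast
    refine sum_le_sum fun s hs => ?_
    obtain ⟨-, a, b⟩ := hR s hs
    have hp : 1 ≤ ∏ j, ((s j:ℝ)+1) := one_le_prod fun j => si
    have := (hq0 Y X (X/∏ j, ((s j:ℝ)+1)) li hXY hXY2 po (div_le_self li hp) b).1
    refine le_trans (le_of_eq ?_) this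
    rw [prod_div_distrib, prod_const_one]; field_simp
  have hBm : ∀ t ∈ B, (∀ j : Fin L°, CD Y ζ x j (t j)) ∧ (∀ j, j ≠ 0 → t j ∈ I j) ∧ X/100 < ∏ j, ((t j:ℝ)+1) ∧ ∏ j, ((t j:ℝ)+1) ≤ X := fun t ht => by
    rw [hB] at ht
    obtain ⟨p, hp, rfl⟩ := mem_image.mp ht
    obtain ⟨hs, hq⟩ := hUm p hp
    obtain ⟨hs0, a, b⟩ := hR _ hs
    have hp : 1 ≤ ∏ j, ((p.1 j:ℝ)+1) := one_le_prod fun j => si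
    have hp0 : 0 < ∏ j, ((p.1 j:ℝ)+1) := (by linarith only [h0, h1, hp])
    rw [QQ, mem_filter, mem_range, Nat.lt_iff_add_one_le, Nat.le_floor_iff po] at hq
    obtain ⟨q1, q2, q3, q4⟩ := hq
    push_cast at q1
    have e : ∏ j, ((g p j:ℝ)+1) = (p.2+1)*∏ j, ((p.1 j:ℝ)+1) := by
      rw [Fin.prod_univ_succ, Fin.prod_univ_succ (fun j => ((p.1 j:ℝ)+1)), hs0, hg0, Nat.cast_zero, zero_add, one_mul]
      congr 1
      exact prod_congr rfl fun j _ => by rw [hgj p _ (Fin.succ_ne_zero j)]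
    have hj : ∀ j, j ≠ 0 → g p j ∈ I j := fun j hj => by rw [hgj p j hj]; exact Fintype.mem_piFinset.mp hs j
    refine ⟨fun j => ?_, hj, ?_, ?_⟩
    · by_cases h : j = 0
      · have := (hq0 Y X _ li hXY hXY2 po (div_le_self li hp) b).2 p.2 q2 q4 q1
        rw [h, hg0]; exact ⟨q2, by rw [Fin.val_zero, hx0]; exact this.1, by rw [Fin.val_zero]; linarith, this.2, q3⟩
      · exact hCD j h _ (hj j h)
    · rw [e, ← div_lt_iff₀ hp0, div_right_comm]; exact q4
    · rw [e, ← le_div_iff₀ hp0]; exact q1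
  obtain ⟨f, hf⟩ := exq (fun t => ∏ j, (t j+1) : (Fin L° → ℕ) → ℕ)
  have hfc : ∀ t, (f t:ℝ) = ∏ j, ((t j:ℝ)+1) := fun t => by rw [hf]; push_cast; rfl
  refine ⟨L+1, B.image f, fun v hv => ?_, ?_⟩
  · obtain ⟨t, ht, rfl⟩ := mem_image.mp hv
    obtain ⟨c, -, -, d⟩ := hBm t ht
    have hne : ∀ i j : Fin L°, i < j → t i ≠ t j := fun i j hij e => by
      have := hgap i j hij (hle j); have a := (c i).2.1; have b := (c j).2.2.1
      rw [e] at a; linarith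
    have hti : Function.Injective t := fun i j e => by
      rcases lt_trichotomy i j with h | h | h
      · exact absurd e (hne i j h)
      · exact h
      · exact absurd e.symm (hne j i h)
    refine ⟨by rw [hfc]; exact d, univ.image t, by rw [card_image_of_injective _ hti]; simp, fun q hq => ?_, by rw [prod_image fun i _ j _ h => hti h, hf]⟩
    obtain ⟨j, -, rfl⟩ := mem_image.mp hq
    refine ⟨(c j).1, ?_⟩
    by_contra h
    have a := (c j).2.1.trans' (hx j (hle j))
    have e1 : log (t j) ≤ log (§2^4) := log_le_log (mod_cast (c j).1.pos) (by
      have : (t j:ℝ) ≤ 11 := mod_cast not_lt.mp h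
      linarith)
    have e2 : LL (t j) ≤ log (t j) - 1 := log_le_sub_one_of_pos (log_pos (mod_cast (c j).1.one_lt))
    rw [log_pow] at e1; push_cast at e1
    linarith [log_two_lt_d9]
  · refine fin1 (card_image_of_injOn hinj).symm (show 0 < X/log X by positivity) ((exp_pos _).trans_le hSl) hBc ?_ hSl li hL
    rw [← hB]
    refine (csl B f).trans (mul_le_mul_of_nonneg_left ?_ (Nat.cast_nonneg _))
    rw [card_eq_sum_card_fiberwise (f := fun P : (Fin L° → ℕ) × (Fin L° → ℕ) => univ.filter fun j => P.1 j ≠ P.2 j) (t := (univ : Finset (Finset (Fin L°))))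
      fun _ _ => mem_coe.mpr (mem_univ _)]
    push_cast
    refine (sum_le_card_nsmul _ _ (12*(X/log X)*S) fun K _ => ?_).trans si
    rw [hS]
    refine hQK Y X L ζ x I K _ li hG hx0 hX hXY hI0 hI1 (fun s hs => (hR s hs).2) fun P hP => ?_
    obtain ⟨hP, hK⟩ := mem_filter.mp hP
    obtain ⟨hP, he⟩ := mem_filter.mp hP
    obtain ⟨p1, p2⟩ := mem_product.mp hP
    have b1 := hBm _ p1; have b2 := hBm _ p2
    refine ⟨by rw [hf] at he; exact he, fun j => by rw [← hK]; simp, b1.2.2.1, b1.2.2.2, b1.2.1, fun j q hq => ?_⟩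
    rcases hq with rfl | rfl
    · exact b1.1 j
    · exact b2.1 j
theorem psi_ge {N : ℕ} (hN : N ≠ 0) : §N ≤ psiFull N := by
  conv_lhs => rw [← Nat.prod_factorization_pow_eq_self hN]
  rw [Finsupp.prod, Nat.support_factorization, psiFull, mval]; push_cast
  exact prod_le_prod (fun p _ => po) fun p _ => le_add_of_nonneg_right po
theorem nu4 (N : ℕ) : 0 ≤ nuInfFull N ∧ nuInfFull N^4 ≤ psiFull N^3 := by
  refine ⟨by rw [nuInfFull, mval]; exact prod_nonneg fun p _ => by split_ifs <;> positivity, ?_⟩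
  rw [nuInfFull, psiFull, mval, mval, ← prod_pow, ← prod_pow]
  refine prod_le_prod (fun p _ => po) fun p hp => ?_
  have hp2 : §2 ≤ p := mod_cast (Nat.prime_of_mem_primeFactors hp).two_le
  obtain ⟨e, he⟩ : ∃ e, N.factorization p = e+1 := ⟨N.factorization p - 1, by
    have := (Nat.prime_of_mem_primeFactors hp).factorization_pos_of_dvd (Nat.mem_primeFactors.mp hp).2.2 (Nat.dvd_of_mem_primeFactors hp); omega⟩
  rw [he, Nat.add_sub_cancel, show §p^e° + §p^e = §p^e*p° by ring, mul_pow]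
  split_ifs with h
  · obtain ⟨r, hr⟩ : ∃ r, e = 2*r := by obtain ⟨r, hr⟩ := h; exact ⟨r, om⟩
    rw [hr, show 2*r/2 = r by omega, mul_pow, ← pow_mul, ← pow_mul]
    have a : §p^(r*4) ≤ §p^(2*r*3) := pow_le_pow_right₀ li om
    have b : §2^4 ≤ p°^3 := le_trans nu (pow_le_pow_left₀ nu (show §3 ≤ p+1 by linarith) 3)
    rw [mul_comm]; gcongr
  · obtain ⟨r, hr⟩ : ∃ r, e = 2*r+1 := by rw [Nat.not_odd_iff_even] at h; obtain ⟨r, hr⟩ := h; exact ⟨r-1, om⟩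
    rw [hr, show (2*r+1+1)/2 = r+1 by omega, Nat.add_sub_cancel, show §p^r°+§p^r = §p^r*p° by ring, mul_pow, ← pow_mul, ← pow_mul]
    have a : §p^(r*4) ≤ §p^(2*r*3) := pow_le_pow_right₀ li om
    have b : §p+1 ≤ p^3 := by
      have : §4 ≤ p*p := by nlinarith only [hp2]
      nlinarith only [this, hp2]
    calc §p^(r*4)*p°^4 = §p^(r*4)*(p°*p°^3) := by ring
      _ ≤ §p^(2*r*3)*(p^3*p°^3) := by gcongr
      _ = _ := by ring
theorem nu_le {g : ℕ → ℕ → ℝ} (hg : ∀ p e, 0 ≤ g p e ∧ g p e ≤ 2) (N : ℕ) : 0 ≤ mval g N ∧ mval g N ≤ nuInfFull N := by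
  refine ⟨prod_nonneg fun p _ => (hg _ _).1, prod_le_prod (fun p _ => (hg _ _).1) fun p hp => (hg _ _).2.trans ?_⟩
  have hp2 : §2 ≤ p := mod_cast (Nat.prime_of_mem_primeFactors hp).two_le
  have h1 : ∀ n, 1 ≤ §p^n := fun n => one_le_pow₀ li
  dsimp only; split_ifs <;> linarith [h1 ((N.factorization p-1)/2), h1 (N.factorization p/2), h1 (N.factorization p/2-1)]
theorem ch (n : ℕ) : |chi4 n| ≤ 1 ∧ |chi3 n| ≤ 1 := by
  constructor
  · rw [chi4]; split_ifs <;> simp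
  · rw [chi3]; split_ifs <;> simp
theorem psi_bd {k N : ℕ} (hk : 2 ≤ k) {x : ℝ} (h : dFull k N ≤ (§k-1)/12*x) : psiFull N ≤ 2*x + 26^4 ∨ psiFull N ≤ 26^4 := by
  obtain ⟨h0, h4⟩ := nu4 N
  have h2 := nu_le (g := fun p e => if p^e = 2 then 1 else if p % 4 = 1 then 2 else 0) (fun p e => by split_ifs <;> norm_num) N
  have h3 := nu_le (g := fun p e => if p^e = 3 then 1 else if p % 3 = 1 then 2 else 0) (fun p e => by split_ifs <;> norm_num) N
  change 0 ≤ nu2Full N ∧ nu2Full N ≤ _ at h2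
  change 0 ≤ nu3Full N ∧ nu3Full N ≤ _ at h3
  have hk1 : §1 ≤ k-1 := by have : §2 ≤ k := mod_cast hk
                            linarith
  have hd : 0 ≤ delta2 k := by rw [delta2]; split_ifs <;> norm_num
  have a2 : -nuInfFull N ≤ chi4 (k-1)*(-nu2Full N) := by nlinarith only [abs_le.mp (ch (k-1)).1, h2.1, h2.2]
  have a3 : -nuInfFull N ≤ chi3 (k-1)*(-nu3Full N) := by nlinarith only [abs_le.mp (ch (k-1)).2, h3.1, h3.2]
  rw [dFull, c2, c3] at h
  have h5 : (§k-1)*(psiFull N - x) ≤ 13*nuInfFull N := li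
  have h6 : psiFull N - x ≤ 13*nuInfFull N := by
    rcases le_or_gt (psiFull N) x with h | h
    · linarith
    · nlinarith only [h, hk1, h5]
  by_contra hc; push Not at hc
  have h7 : psiFull N < 26*nuInfFull N := li
  have h8 : psiFull N^4 < (26*nuInfFull N)^4 := pow_lt_pow_left₀ h7 li nu
  have h9 : 0 < psiFull N := li
  have h10 : psiFull N*psiFull N^3 < 26^4*psiFull N^3 := by
    calc psiFull N*psiFull N^3 = psiFull N^4 := by ring
      _ < 26^4*nuInfFull N^4 := by rw [← mul_pow]; exact h8
      _ ≤ _ := by gcongr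
  have := lt_of_mul_lt_mul_right h10 po
  linarith
def DS (k : ℕ) (x : ℝ) : Set ℝ := {y : ℝ | ∃ N : ℕ, 1 ≤ N ∧ dFull k N = y ∧ dFull k N ≤ (§k-1)/12 * x}
theorem DS_sub {k : ℕ} (hk : 2 ≤ k) {x : ℝ} (hx : 0 ≤ x) : DS k x ⊆ ((Icc 1 ⌊2*x+26^4⌋₊).image (dFull k) : Finset ℝ) := by
  rintro y ⟨N, hN, rfl, h⟩
  refine mem_coe.mpr (mem_image_of_mem _ (mem_Icc.mpr ⟨hN, Nat.le_floor ?_⟩))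
  refine (psi_ge om).trans ?_
  rcases psi_bd hk h with h | h <;> linarith
theorem DS_fin {k : ℕ} (hk : 2 ≤ k) {x : ℝ} (hx : 0 ≤ x) : (DS k x).Finite := (Finset.finite_toSet _).subset (DS_sub hk hx)
theorem DS_triv {k : ℕ} (hk : 2 ≤ k) {x : ℝ} (hx : 16 ≤ x) : 1 ≤ ((DS k x).ncard:ℝ) ∧ ((DS k x).ncard:ℝ) ≤ 2*x+26^4 := by
  constructor
  · have : dFull k 1 ∈ DS k x := by
      refine ⟨1, le_rfl, rfl, ?_⟩
      have hk1 : §1 ≤ k-1 := by have : §2 ≤ k := mod_cast hk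
                                linarith
      have hd : delta2 k ≤ 1 := by rw [delta2]; split_ifs <;> norm_num
      have := abs_le.mp (ch (k-1)).1; have := abs_le.mp (ch (k-1)).2
      simp only [dFull, psiFull, nuInfFull, nu2Full, nu3Full, mval, Nat.primeFactors_one, prod_empty, c2, c3]
      nlinarith only [mul_le_mul_of_nonneg_left hx (show 0 ≤ (§k-1)/12 by linarith), abs_le.mp (ch (k-1)).1, abs_le.mp (ch (k-1)).2, hd, hk1]
    have := (Set.ncard_pos (DS_fin hk li)).mpr ⟨_, this⟩
    exact_mod_cast this
  · have h1 := Set.ncard_le_ncard (DS_sub hk (show 0 ≤ x by linarith)) (Finset.finite_toSet _)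
    rw [Set.ncard_coe_finset] at h1
    have h2 := h1.trans card_image_le
    rw [Nat.card_Icc, Nat.add_sub_cancel] at h2
    exact (Nat.cast_le.mpr h2).trans (Nat.floor_le li)
theorem mval_sq (f : ℕ → ℕ → ℝ) {S : Finset ℕ} (hS : ∀ p ∈ S, p.Prime) : mval f (∏ p ∈ S, p) = ∏ p ∈ S, f p 1 := by
  have h0 : ∏ p ∈ S, p ≠ 0 := prod_ne_zero_iff.mpr fun p hp => (hS p hp).ne_zero
  rw [mval, Nat.primeFactors_prod hS]
  refine prod_congr rfl fun p hp => ?_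
  rw [Nat.factorization_prod fun q hq => (hS q hq).ne_zero, Finsupp.finset_sum_apply, sum_eq_single_of_mem p hp fun q hq hne => ?_, (hS p hp).factorization_self]
  rw [(hS q hq).factorization, Finsupp.single_apply, if_neg hne]
theorem low_plug {k L : ℕ} (hk : 2 ≤ k) {x : ℝ} (hx : 0 ≤ x) (VV : Finset ℕ)
    (hV : ∀ v ∈ VV, §v ≤ x/12 ∧ ∃ S : Finset ℕ, #S = L ∧ (∀ q ∈ S, q.Prime ∧ 11 < q) ∧ ∏ q ∈ S, q° = v) : #VV ≤ (DS k x).ncard := by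
  classical
  have hk1 : §1 ≤ k-1 := by have : §2 ≤ k := mod_cast hk
                            linarith
  obtain ⟨g, hg⟩ := exq (fun v : ℕ => (§k-1)*v - 2^L + delta2 k : ℕ → ℝ)
  have hinj : Function.Injective g := fun a b h => by
    rw [hg] at h; dsimp only at h
    have : (§k-1)*a = (k-1)*b := li
    exact_mod_cast mul_left_cancel₀ (show §k-1 ≠ 0 by linarith) this
  rw [← card_image_of_injective VV hinj, ← Set.ncard_coe_finset]
  refine Set.ncard_le_ncard (fun y hy => ?_) (DS_fin hk hx)
  obtain ⟨v, hv, rfl⟩ := mem_image.mp (mem_coe.mp hy)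
  obtain ⟨hvx, S, hL, hS, hSv⟩ := hV v hv
  have h11 : 11 ∉ S := fun h => lt_irrefl _ (hS 11 h).2
  have hp : ∀ p ∈ insert 11 S, p.Prime := fun p hp => by
    rcases mem_insert.mp hp with rfl | h
    · norm_num
    · exact (hS p h).1
  have e : dFull k (∏ p ∈ insert 11 S, p) = g v := by
    have hd : §v = ∏ q ∈ S, §q° := by rw [← hSv]; push_cast; rfl
    rw [dFull, psiFull, nuInfFull, nu2Full, nu3Full, mval_sq _ hp, mval_sq _ hp, mval_sq _ hp, mval_sq _ hp, hg]
    simp only [prod_insert h11, hd]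
    norm_num [prod_const, hL]
    ring
  refine ⟨_, Nat.one_le_iff_ne_zero.mpr (prod_ne_zero_iff.mpr fun p h => (hp p h).ne_zero), e, ?_⟩
  rw [e, hg]
  have hd : delta2 k ≤ 1 := by rw [delta2]; split_ifs <;> norm_num
  have : §1 ≤ 2^L := one_le_pow₀ nu
  have := mul_le_mul_of_nonneg_left hvx (show 0 ≤ §k-1 by linarith)
  dsimp only; linarith
theorem omc (n t : ℕ) : ¢((Ioc 0 n).filter fun N => t ≤ #N.primeFactors)*2^t ≤ n*(1+log n) := by
  have h1 : #((Ioc 0 n).filter fun N => t ≤ #N.primeFactors)*2^t ≤ ∑ N ∈ Ioc 0 n, #N.divisors := by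
    rw [← smul_eq_mul]
    refine (card_nsmul_le_sum _ (fun N => #N.divisors) (2^t) fun N hN => ?_).trans (sum_le_sum_of_subset (filter_subset _ _))
    obtain ⟨hN, ht⟩ := mem_filter.mp hN
    have h0 : N ≠ 0 := (mem_Ioc.mp hN).1.ne'
    rw [Nat.card_divisors h0]
    calc 2^t ≤ 2^#N.primeFactors := Nat.pow_le_pow_right nu ht
      _ = ∏ p ∈ N.primeFactors, 2 := by rw [prod_const]
      _ ≤ _ := prod_le_prod' fun p hp => by
        have := (Nat.prime_of_mem_primeFactors hp).factorization_pos_of_dvd h0 (Nat.dvd_of_mem_primeFactors hp); omega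
  have h2 : ∑ N ∈ Ioc 0 n, #N.divisors = ∑ d ∈ Ioc 0 n, n/d := by
    have : ∀ N ∈ Ioc 0 n, #N.divisors = ∑ d ∈ Ioc 0 n, if d ∣ N then 1 else 0 := fun N hN => by
      have hN := mem_Ioc.mp hN
      rw [← card_filter]; congr 1; ext d
      rw [Nat.mem_divisors, mem_filter, mem_Ioc]
      exact ⟨fun h => ⟨⟨Nat.pos_of_dvd_of_pos h.1 hN.1, (Nat.le_of_dvd hN.1 h.1).trans hN.2⟩, h.1⟩, fun h => ⟨h.2, om⟩⟩
    rw [sum_congr rfl this, sum_comm]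
    refine sum_congr rfl fun d _ => ?_
    rw [← card_filter, Nat.Ioc_filter_dvd_card_eq_div]
  have h3 : ((∑ d ∈ Ioc 0 n, n/d : ℕ):ℝ) ≤ n*(1+log n) := by
    push_cast
    refine (sum_le_sum fun d _ => Nat.cast_div_le).trans ?_
    have := harmonic_le_one_add_log n
    rw [harmonic_eq_sum_Icc] at this; push_cast at this
    simp only [div_eq_mul_inv]; rw [← mul_sum]
    exact mul_le_mul_of_nonneg_left this (Nat.cast_nonneg _)
  refine le_trans ?_ h3
  rw [← h2]; exact_mod_cast h1
theorem sfs : ∃ G : ℝ, 1 ≤ G ∧ ∀ F : Finset ℕ, (∀ s ∈ F, s ≠ 0 ∧ ∀ p, s.factorization p ≠ 1) → ∑ s ∈ F, §s^(-(3/4):ℝ) ≤ G := by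
  classical
  have hS : Summable fun P : ℕ × ℕ => (P.1:ℝ)^(-(3/2):ℝ)*(P.2:ℝ)^(-(9/4):ℝ) :=
    (summable_nat_rpow.mpr nu).mul_of_nonneg (summable_nat_rpow.mpr nu) (fun _ => po) fun _ => po
  refine ⟨1 + ∑' P : ℕ × ℕ, (P.1:ℝ)^(-(3/2):ℝ)*(P.2:ℝ)^(-(9/4):ℝ), by linarith [show 0 ≤ ∑' P : ℕ × ℕ, (P.1:ℝ)^(-(3/2):ℝ)*(P.2:ℝ)^(-(9/4):ℝ) from tsum_nonneg fun _ => po], fun F hF => ?_⟩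
  have hc : ∀ s : ℕ, ∃ P : ℕ × ℕ, s ∈ F → P.1^2*P.2^3 = s := fun s => by
    by_cases hs : s ∈ F
    · obtain ⟨h0, h1⟩ := hF s hs
      obtain ⟨b, a, hb, ha, e, hsq⟩ := Nat.sq_mul_squarefree_of_pos (Nat.pos_of_ne_zero h0)
      have hd : b ∣ a := (Nat.factorization_prime_le_iff_dvd hb.ne' ha.ne').mp fun p _ => by
        have a1 := hsq.natFactorization_le_one p
        have a2 := h1 p
        rw [← e, Nat.factorization_mul (pow_ne_zero 2 ha.ne') hb.ne', Nat.factorization_pow] at a2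
        simp only [Finsupp.add_apply, Finsupp.smul_apply, smul_eq_mul] at a2; omega
      obtain ⟨c, rfl⟩ := hd
      exact ⟨(c, b), fun _ => by rw [← e]; ring⟩
    · exact ⟨(0, 0), fun h => absurd h hs⟩
  choose f hf using hc
  have hi : Set.InjOn f F := fun a ha b hb e => by rw [← hf a ha, ← hf b hb, e]
  calc ∑ s ∈ F, §s^(-(3/4):ℝ) = ∑ s ∈ F, ((f s).1:ℝ)^(-(3/2):ℝ)*((f s).2:ℝ)^(-(9/4):ℝ) := sum_congr rfl fun s hs => by
        conv_lhs => rw [← hf s hs]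
        push_cast
        rw [mul_rpow po po, ← rpow_natCast_mul po, ← rpow_natCast_mul po]
        norm_num
    _ = ∑ P ∈ F.image f, (P.1:ℝ)^(-(3/2):ℝ)*(P.2:ℝ)^(-(9/4):ℝ) := (sum_image (f := fun P : ℕ × ℕ => (P.1:ℝ)^(-(3/2):ℝ)*(P.2:ℝ)^(-(9/4):ℝ)) hi).symm
    _ ≤ _ := (hS.sum_le_tsum _ fun _ _ => po).trans li
theorem dec {N : ℕ} (hN : N ≠ 0) : ∃ (s : ℕ) (T : Finset ℕ), s ≠ 0 ∧ (∀ p, s.factorization p ≠ 1) ∧ (∀ q ∈ T, q.Prime) ∧ #T ≤ #N.primeFactors ∧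
    ∀ g : ℕ → ℕ → ℝ, mval g N = mval g s*∏ p ∈ T, g p 1 := by
  classical
  obtain ⟨f, hf⟩ := exq (N.factorization.filter fun p => N.factorization p ≠ 1)
  have hsup : f.support = N.primeFactors.filter fun p => N.factorization p ≠ 1 := by rw [hf, Finsupp.support_filter, Nat.support_factorization]
  have hp : ∀ p ∈ f.support, p.Prime := fun p hp => by rw [hsup] at hp; exact Nat.prime_of_mem_primeFactors (mem_filter.mp hp).1
  have hsf := Nat.prod_pow_factorization_eq_self hp
  refine ⟨f.prod (· ^ ·), N.primeFactors.filter fun p => N.factorization p = 1, ?_, fun p => ?_, fun q hq => Nat.prime_of_mem_primeFactors (mem_filter.mp hq).1,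
    card_le_card (filter_subset _ _), fun g => ?_⟩
  · exact prod_ne_zero_iff.mpr fun p h => pow_ne_zero _ (hp p h).ne_zero
  · rw [hsf, hf, Finsupp.filter_apply]; split_ifs with h
    · exact h
    · simp
  · rw [mval, mval, ← Nat.support_factorization (f.prod _), hsf, hsup, mul_comm, ← prod_filter_mul_prod_filter_not N.primeFactors fun p => N.factorization p = 1]
    congr 1
    · exact prod_congr rfl fun p hp => by rw [(mem_filter.mp hp).2]
    · exact prod_congr rfl fun p hp => by rw [hf, Finsupp.filter_apply, if_pos (mem_filter.mp hp).2]
theorem flag (r : ℕ) (g : ℕ → ℝ) (h1 : g r = 1) (h2 : ∀ p, p ≠ r → g p = 0 ∨ g p = 2) (T : Finset ℕ) :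
    ∃ a ∈ ({0, 1, 1/2} : Finset ℝ), ∏ p ∈ T, g p = a*2^#T := by
  classical
  have key : ∀ T : Finset ℕ, r ∉ T → ∏ p ∈ T, g p = 0 ∨ ∏ p ∈ T, g p = 2^#T := fun T hr => by
    by_cases h : ∃ p ∈ T, g p = 0
    · obtain ⟨p, a, b⟩ := h; exact Or.inl (prod_eq_zero a b)
    · push Not at h
      refine Or.inr ((prod_congr rfl fun p hp => ((h2 p fun e => hr (e ▸ hp)).resolve_left (h p hp))).trans si)
  by_cases hr : r ∈ T
  · rw [← mul_prod_erase T g hr, h1, one_mul, ← card_erase_add_one hr]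
    rcases key (T.erase r) (notMem_erase _ _) with h | h <;> rw [h]
    · exact ⟨0, si, si⟩
    · exact ⟨1/2, si, by ring⟩
  · rcases key T hr with h | h <;> rw [h]
    · exact ⟨0, si, si⟩
    · exact ⟨1, si, si⟩
open Classical in
noncomputable def SF (n : ℕ) : Finset ℕ := (Ioc 0 n).filter fun s => ∀ p, s.factorization p ≠ 1
theorem up_plug {k t : ℕ} (hk : 2 ≤ k) {x W : ℝ} (hx : 0 ≤ x) (hW : 2*x+26^4 ≤ W) :
    ((DS k x).ncard:ℝ) ≤ W*(1+log W)/2^t + ∑ s ∈ SF ⌊W⌋₊, ¢(VS (W/s))*(9*t) := by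
  classical
  obtain ⟨F3, hF3⟩ := exq ({0, 1, 1/2} : Finset ℝ)
  have hF3c : #F3 ≤ 3 := hF3 ▸ card_le_three
  obtain ⟨G, hG⟩ : ∃ G : ℕ → ℕ × ℕ × ℝ × ℝ → ℝ, G = fun s P => (§k-1)/12*(psiFull s*P.1) - 1/2*(nuInfFull s*2^P.2.1) + c2 k*(nu2Full s*(P.2.2.1*2^P.2.1))
    + c3 k*(nu3Full s*(P.2.2.2*2^P.2.1)) + delta2 k := ⟨_, rfl⟩
  obtain ⟨E, hE⟩ := exq ((Ioc 0 ⌊W⌋₊).filter fun N => t ≤ #N.primeFactors)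
  have hW1 : 1 ≤ W := li
  have sub : DS k x ⊆ (E.image (dFull k) ∪ (SF ⌊W⌋₊).biUnion fun s => (VS (W/s) ×ˢ range t ×ˢ F3 ×ˢ F3).image (G s) : Finset ℝ) := by
    rintro y ⟨N, hN, rfl, h⟩
    have hψ : psiFull N ≤ W := by rcases psi_bd hk h with h | h <;> linarith
    have hNW : N ∈ Ioc 0 ⌊W⌋₊ := mem_Ioc.mpr ⟨hN, Nat.le_floor ((psi_ge om).trans hψ)⟩
    rw [mem_coe, mem_union]
    by_cases ht : t ≤ #N.primeFactors
    · exact Or.inl (mem_image_of_mem _ (hE ▸ mem_filter.mpr ⟨hNW, ht⟩))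
    right
    obtain ⟨s, T, hs0, hs, hT, hTc, hm⟩ := dec (show N ≠ 0 by omega)
    have e1 : psiFull N = psiFull s*((∏ p ∈ T, p° : ℕ):ℝ) := by rw [psiFull, hm]; push_cast; simp
    have e2 : nuInfFull N = nuInfFull s*2^#T := by rw [nuInfFull, hm]; simp
    obtain ⟨a, ha, ha'⟩ := flag 2 (fun p => if p^1 = 2 then 1 else if p % 4 = 1 then 2 else 0) nu (fun p hp => by
      rw [pow_one, if_neg hp]; split_ifs <;> simp) T
    obtain ⟨b, hb, hb'⟩ := flag 3 (fun p => if p^1 = 3 then 1 else if p % 3 = 1 then 2 else 0) nu (fun p hp => by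
      rw [pow_one, if_neg hp]; split_ifs <;> simp) T
    have e3 : nu2Full N = nu2Full s*(a*2^#T) := by rw [nu2Full, hm, ← ha']
    have e4 : nu3Full N = nu3Full s*(b*2^#T) := by rw [nu3Full, hm, ← hb']
    have hsp : §0 < s := mod_cast Nat.pos_of_ne_zero hs0
    have hv1 : §1 ≤ (∏ p ∈ T, p° : ℕ) := mod_cast Nat.one_le_iff_ne_zero.mpr (prod_ne_zero_iff.mpr fun p _ => om)
    have hsv : §s*(∏ p ∈ T, p° : ℕ) ≤ W := by
      refine le_trans ?_ hψ; rw [e1]; gcongr; exact psi_ge hs0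
    refine mem_biUnion.mpr ⟨s, mem_filter.mpr ⟨mem_Ioc.mpr ⟨Nat.pos_of_ne_zero hs0, Nat.le_floor (by nlinarith only [hsv, hv1, hsp])⟩, hs⟩,
      mem_image.mpr ⟨(∏ p ∈ T, p°, #T, a, b), ?_, ?_⟩⟩
    · simp only [mem_product, mem_range, hF3]
      refine ⟨(mem_VS po).mpr ⟨⟨T, hT, rfl⟩, ?_⟩, om, ha, hb⟩
      rw [le_div_iff₀ hsp]; linarith
    · rw [hG, dFull, e1, e2, e3, e4]
  have h1 := Set.ncard_le_ncard sub (Finset.finite_toSet _)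
  rw [Set.ncard_coe_finset] at h1
  have h2 := (h1.trans (card_union_le _ _)).trans (Nat.add_le_add card_image_le card_biUnion_le)
  have h3 : ((DS k x).ncard:ℝ) ≤ #E + ∑ s ∈ SF ⌊W⌋₊, ¢((VS (W/s) ×ˢ range t ×ˢ F3 ×ˢ F3).image (G s)) := mod_cast h2
  refine h3.trans (add_le_add ?_ (sum_le_sum fun s _ => ?_))
  · rw [le_div_iff₀ po, hE]
    refine (omc _ _).trans ?_
    have : 1 ≤ ⌊W⌋₊ := Nat.le_floor (by simpa using hW1)
    have h5 := Nat.floor_le (show 0 ≤ W by linarith)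
    have h6 : §1 ≤ ⌊W⌋₊ := mod_cast this
    have := log_nonneg h6
    gcongr
  · refine (Nat.cast_le.mpr card_image_le).trans ?_
    rw [card_product, card_product, card_product, card_range]
    have : #(VS (W/s))*(t*(#F3*#F3)) ≤ #(VS (W/s))*(t*(3*3)) := by gcongr
    calc ((#(VS (W/s))*(t*(#F3*#F3)) : ℕ):ℝ) ≤ ((#(VS (W/s))*(t*(3*3)) : ℕ):ℝ) := mod_cast this
      _ = _ := by push_cast; ring
theorem shiftY {Y Y' c A : ℝ} (hY : 10 ≤ Y) (h1 : Y ≤ Y') (h2 : Y' ≤ Y+1/Y) (hc : 0 ≤ c) (hA : 0 ≤ A) :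
    c*log (Y'/log Y')^2 + A*log Y' ≤ c*log (Y/log Y)^2 + A*log Y + (3*c+A) := by
  have hY0 : 0 < Y := li
  have hl : 1 ≤ log Y := by rw [le_log_iff_exp_le hY0]; linarith [exp_one_lt_d9]
  have hll : log Y ≤ log Y' := log_le_log hY0 h1
  have e1 : log Y' ≤ log Y + 1/Y^2 := by
    have : log (Y'/Y) ≤ Y'/Y - 1 := log_le_sub_one_of_pos (div_pos li hY0)
    rw [log_div li hY0.ne'] at this
    have h3 : Y'/Y ≤ 1+1/Y^2 := by rw [div_le_iff₀ hY0]; refine h2.trans (le_of_eq ?_); field_simp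
    linarith
  have hi : 1/Y^2 ≤ 1 := by rw [div_le_one po]; nlinarith only [hY]
  have e2 : 0 ≤ log (Y'/log Y') := log_nonneg (by rw [one_le_div li]; exact log_le_self li)
  have e3 : log (Y'/log Y') ≤ log (Y/log Y) + 1/Y^2 := by
    rw [log_div li li, log_div li li]
    linarith [log_le_log li hll]
  have e4 : log (Y/log Y) ≤ Y := (log_le_log po (div_le_self hY0.le hl)).trans (log_le_self hY0.le)
  have e5 : log (Y/log Y)*(1/Y^2) ≤ 1 := by
    calc _ ≤ Y*(1/Y^2) := by gcongr
      _ = 1/Y := by field_simp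
      _ ≤ 1 := by rw [div_le_one hY0]; linarith
  have e6 : log (Y'/log Y')^2 ≤ log (Y/log Y)^2+3 := by
    have := pow_le_pow_left₀ e2 e3 2
    have h7 : (1/Y^2)*(1/Y^2) ≤ 1 := mul_le_one₀ hi po hi
    nlinarith only [this, e5, h7]
  nlinarith only [mul_le_mul_of_nonneg_left e6 hc, mul_le_mul_of_nonneg_left (e1.trans (add_le_add le_rfl hi)) hA]
theorem VSb {W E : ℝ} {s : ℕ} (hW : 10 ≤ W) (hE : 1 ≤ E) (hs : 1 ≤ s)
    (hu : ∀ y, 2 ≤ y → y ≤ W → ¢(VS y) ≤ E*(y/log y)) : ¢(VS (W/s)) ≤ 8*E*(W/log W)*§s^(-(3/4):ℝ) := by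
  have hs1 : §1 ≤ s := mod_cast hs
  have hl : 0 < log W := log_pos li
  have hp : 0 < §s^(-(3/4):ℝ) := po
  rcases le_or_gt (§s^2) W with h | h
  · have h2 : W ≤ (W/s)^2 := by rw [div_pow, le_div_iff₀ po]; nlinarith only [h, hW]
    have h3 : 2 ≤ W/s := by by_contra h4; nlinarith only [h2, h4, hW, show 0 ≤ W/s by positivity]
    have h4 : log W ≤ 2*log (W/s) := by have := log_le_log li h2; rw [log_pow] at this; exact_mod_cast this
    have h5 : §s⁻¹ ≤ §s^(-(3/4):ℝ) := by rw [← rpow_neg_one]; exact rpow_le_rpow_of_exponent_le hs1 nu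
    calc _ ≤ E*((W/s)/log (W/s)) := hu _ h3 (div_le_self li hs1)
      _ ≤ E*((W/s)/(log W/2)) := by gcongr; linarith
      _ = 2*E*(W/log W)*§s⁻¹ := by field_simp
      _ ≤ _ := by gcongr; norm_num
  · have h5 : log W ≤ 8*§s^(1/4:ℝ) := by
      have a : log W ≤ 2*log s := by have := log_le_log li h.le; rw [log_pow] at this; exact_mod_cast this
      have b := log_le_self (show 0 ≤ §s^(1/4:ℝ) by positivity)
      rw [log_rpow li] at b; linarith
    have h6 : §s*(§s^(-(3/4):ℝ)) = §s^(1/4:ℝ) := by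
      nth_rewrite 1 [← rpow_one §s]; rw [← rpow_add li]; norm_num
    refine (VS_triv _ po).trans ?_
    rw [div_le_iff₀ li, mul_assoc, mul_comm _ §s, h6]
    calc W = W/log W*log W := by field_simp
      _ ≤ W/log W*(8*§s^(1/4:ℝ)) := by gcongr
      _ = 8*1*(W/log W)*§s^(1/4:ℝ) := by ring
      _ ≤ _ := by gcongr
theorem exp14 : §26^4 ≤ exp 14 := by
  have : exp §14 = exp 1^14 := by rw [← exp_nat_mul]; norm_num
  rw [this]
  calc §26^4 ≤ 2.7^14 := nu
    _ ≤ _ := pow_le_pow_left₀ nu (by linarith [exp_one_gt_d9]) _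
theorem upX (ϱ : ℝ) (h0 : 0 < ϱ) (h1 : ϱ < 1) (hs : ∑' n, fordA n° * ϱ^n° = 1) : ∃ Y0 A : ℝ, 10 ≤ Y0 ∧ 0 ≤ A ∧ ∀ (k : ℕ) (x Y : ℝ), 2 ≤ k →
    Y0 ≤ Y → 0 < x → 1 < log x → Y = log (log x) → ((DS k x).ncard:ℝ) ≤ x/log x*exp (1/(2*log (1/ϱ))*log (Y/log Y)^2 + A*log Y) := by
  obtain ⟨Y0, A, hY0, hA, hU⟩ := upperV ϱ h0 h1 hs
  obtain ⟨G, hG, hsf⟩ := sfs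
  obtain ⟨c, hc⟩ := exq (1/(2*log (1/ϱ)))
  have hc0 : 0 ≤ c := by
    have : 0 < log (1/ϱ) := log_pos (by rw [lt_div_iff₀ h0]; linarith)
    rw [hc]; positivity
  rw [← hc] at hU ⊢
  have hK := log_nonneg (show 1 ≤ 2000*G by linarith)
  refine ⟨Y0+14, A° + (3*c+A°) + log (2000*G), li, li, fun k x Y hk hY hx hx1 hYx => ?_⟩
  have hY1 : 14 ≤ Y := li
  have hlx : Y ≤ log x := hYx ▸ log_le_self li
  have heY : exp Y = log x := by rw [hYx, exp_log li]
  have hx2 : §26^4 ≤ x := by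
    rw [← exp_log hx]; exact exp14.trans (exp_le_exp.mpr li)
  obtain ⟨W, hW⟩ := exq (3*x)
  have hlW : log W = log x + log 3 := by rw [hW, log_mul nu hx.ne']; ring
  have hl3 : 0 ≤ log §3 ∧ log §3 ≤ 2 := ⟨log_nonneg nu, by have := log_le_sub_one_of_pos (show §0 < 3 by norm_num); linarith⟩
  have hW0 : 10 ≤ W := by rw [hW]; linarith
  obtain ⟨Z, hZ⟩ := exq (log (log W))
  have heZ : exp Z = log W := by rw [hZ, exp_log li]
  have hYZ : Y ≤ Z := by rw [hYx, hZ]; exact log_le_log li li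
  have hZY : Z ≤ Y+1/Y := by
    have a : log (log W/log x) ≤ log W/log x - 1 := log_le_sub_one_of_pos (div_pos li li)
    rw [log_div li li, ← hZ, ← hYx] at a
    have b : log W/log x - 1 ≤ 1/Y := by
      rw [hlW, div_sub_one li, div_le_div_iff₀ li li, ← heY]
      have := quadratic_le_exp_of_nonneg (show 0 ≤ Y by linarith)
      nlinarith only [this, hl3.1, hl3.2, hY1]
    linarith
  have heeZ : ee Z = W := by unfold ee; rw [heZ, exp_log li]
  obtain ⟨E, hE⟩ := exq (exp (c*log (Z/log Z)^2+A*log Z))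
  have hlZ : 0 ≤ log Z := log_nonneg li
  have hE1 : 1 ≤ E := by rw [hE]; exact one_le_exp po
  have hu : ∀ y, 2 ≤ y → y ≤ W → ¢(VS y) ≤ E*(y/log y) := fun y h2 h3 => by
    rw [hE]; exact hU Z y li h2 (by rwa [heeZ])
  have hm := up_plug (k := k) (t := ⌈5*Z⌉₊) (W := W) hk hx.le (by rw [hW]; linarith)
  have ht1 : 5*Z ≤ (⌈5*Z⌉₊:ℝ) := Nat.le_ceil _
  have ht2 : (⌈5*Z⌉₊:ℝ) ≤ 6*Z := by linarith [Nat.ceil_lt_add_one (show 0 ≤ 5*Z by linarith)]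
  have hlW1 : 1 ≤ log W := li
  have hQ : 0 ≤ W/log W := po
  have T1 : W*(1+log W)/2^⌈5*Z⌉₊ ≤ W/log W := by
    have a : exp (3*Z) ≤ 2^⌈5*Z⌉₊ := by
      rw [← rpow_natCast, rpow_def_of_pos nu]
      apply exp_le_exp.mpr
      nlinarith only [log_two_gt_d9, ht1, hYZ, hY1]
    have b : exp (3*Z) = log W^3 := by rw [← heZ, ← exp_nat_mul]; norm_num
    rw [div_le_div_iff₀ po li, mul_assoc]
    refine mul_le_mul_of_nonneg_left (le_trans ?_ a) li
    rw [b]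
    have : 2 ≤ log W := li
    have h3 : 1+log W ≤ log W^2 := by nlinarith only [this]
    calc _ ≤ log W^2*log W := by gcongr
      _ = _ := by ring
  have T2 : ∑ s ∈ SF ⌊W⌋₊, ¢(VS (W/s))*(9*⌈5*Z⌉₊) ≤ 432*G*(W/log W)*(E*Z) := by
    rw [← sum_mul]
    have a : ∑ s ∈ SF ⌊W⌋₊, ¢(VS (W/s)) ≤ 8*E*(W/log W)*G := by
      calc _ ≤ ∑ s ∈ SF ⌊W⌋₊, 8*E*(W/log W)*§s^(-(3/4):ℝ) := sum_le_sum fun s hs => VSb hW0 hE1 (by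
              simp only [SF, mem_filter, mem_Ioc] at hs; exact hs.1.1) hu
        _ = 8*E*(W/log W)*∑ s ∈ SF ⌊W⌋₊, §s^(-(3/4):ℝ) := by rw [mul_sum]
        _ ≤ _ := by
          refine mul_le_mul_of_nonneg_left (hsf _ fun s hs => ?_) po
          simp only [SF, mem_filter, mem_Ioc] at hs; exact ⟨om, hs.2⟩
    calc _ ≤ 8*E*(W/log W)*G*(9*(6*Z)) := mul_le_mul a li po po
      _ = _ := by ring
  have hEZ : E*Z = exp (c*log (Z/log Z)^2+A°*log Z) := by
    rw [hE]; nth_rewrite 4 [← exp_log (show 0 < Z by linarith)]; rw [← exp_add]; ring_nf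
  have hEZ1 : 1 ≤ E*Z := by nlinarith only [hE1, hYZ, hY1]
  have hWx : W/log W ≤ 3*(x/log x) := by
    rw [hW, mul_div_assoc, ← hW]; gcongr; linarith
  have hxl : 0 ≤ x/log x := div_nonneg hx.le li
  have hsh := shiftY li hYZ hZY hc0 (show 0 ≤ A+1 by linarith)
  have hlY : 1 ≤ log Y := by rw [le_log_iff_exp_le li]; linarith [exp_one_lt_d9]
  calc ((DS k x).ncard:ℝ) ≤ W/log W + 432*G*(W/log W)*(E*Z) := hm.trans (add_le_add T1 T2)
    _ ≤ (W/log W)*(1*(G*(E*Z))) + 432*G*(W/log W)*(E*Z) := by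
        refine add_le_add (le_mul_of_one_le_right hQ ?_) le_rfl
        nlinarith only [hG, hEZ1]
    _ = (433*G*(E*Z))*(W/log W) := by ring
    _ ≤ (433*G*(E*Z))*(3*(x/log x)) := by gcongr
    _ = (x/log x)*((1299*G)*(E*Z)) := by ring
    _ ≤ (x/log x)*((2000*G)*(E*Z)) := by gcongr; norm_num
    _ ≤ _ := by
        rw [hEZ, ← exp_log (show 0 < 2000*G by linarith), ← exp_add, exp_log (show 0 < 2000*G by linarith)]
        refine mul_le_mul_of_nonneg_left (exp_le_exp.mpr ?_) hxl
        have := mul_le_mul_of_nonneg_left hlY (show 0 ≤ 3*c+A°+log (2000*G) by linarith)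
        linarith only [this, hsh]
theorem lowX (ϱ : ℝ) (h0 : 0 < ϱ) (h1 : ϱ < 1) (hs : ∑' n, fordA n° * ϱ^n° = 1) : ∃ Y0 A : ℝ, 10 ≤ Y0 ∧ 0 ≤ A ∧ ∀ (k : ℕ) (x Y : ℝ), 2 ≤ k →
    Y0 ≤ Y → 0 < x → 1 < log x → Y = log (log x) → x/log x*exp (1/(2*log (1/ϱ))*log (Y/log Y)^2 - A*log Y) ≤ ((DS k x).ncard:ℝ) := by
  obtain ⟨Y0, A, hY0, hA, hU⟩ := lowerV ϱ h0 h1 hs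
  refine ⟨Y0+14, A+3, li, li, fun k x Y hk hY hx hx1 hYx => ?_⟩
  have hY1 : 14 ≤ Y := li
  have hlx : Y ≤ log x := hYx ▸ log_le_self li
  have heY : exp Y = log x := by rw [hYx, exp_log li]
  have h12 : log §12 ≤ 3 := by
    rw [log_le_iff_le_exp nu]
    have : exp §3 = exp 1^3 := by rw [← exp_nat_mul]; norm_num
    rw [this]
    calc §12 ≤ 2.7^3 := nu
      _ ≤ _ := pow_le_pow_left₀ nu (by linarith [exp_one_gt_d9]) _
  have h12' : 0 ≤ log §12 := log_nonneg nu
  have hlX : log (x/12) = log x - log 12 := log_div hx.ne' nu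
  have hX1 : 1 < x/12 := by
    by_contra h
    have := log_nonpos (show 0 ≤ x/12 by positivity) (not_lt.mp h)
    linarith
  obtain ⟨L, VV, hV, hc⟩ := hU Y (x/12) li hX1 li li
  refine le_trans (le_trans ?_ hc) (mod_cast low_plug hk hx.le VV hV)
  have hlY : 1 ≤ log Y := by rw [le_log_iff_exp_le li]; linarith [exp_one_lt_d9]
  have hp : 0 < log (x/12) := li
  calc _ ≤ x/log x*exp (-log 12+(1/(2*log (1/ϱ))*log (Y/log Y)^2 - A*log Y)) := by
        refine mul_le_mul_of_nonneg_left (exp_le_exp.mpr ?_) (div_nonneg hx.le li)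
        linarith
    _ = x/12/log x*exp (1/(2*log (1/ϱ))*log (Y/log Y)^2 - A*log Y) := by
        rw [exp_add, exp_neg, exp_log nu]; ring
    _ ≤ _ := by gcongr; linarith
theorem fin (ϱ : ℝ) (h0 : 0 < ϱ) (h1 : ϱ < 1) (hs : ∑' n, fordA n° * ϱ^n° = 1) :
    ∃ A : ℝ, 0 < A ∧ ∀ k : ℕ, Even k → 2 ≤ k → ∀ x : ℝ, 16 ≤ x →
      x/log x*exp ((1/(2*log (1/ϱ)))*(log (loglog x/logloglog x))^2 - A*logloglog x) ≤ ((DS k x).ncard:ℝ) ∧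
      ((DS k x).ncard:ℝ) ≤ x/log x*exp ((1/(2*log (1/ϱ)))*(log (loglog x/logloglog x))^2 + A*logloglog x) := by
  obtain ⟨Y1, A1, hY1, hA1, hU⟩ := upX ϱ h0 h1 hs
  obtain ⟨Y2, A2, hY2, hA2, hL⟩ := lowX ϱ h0 h1 hs
  obtain ⟨c, hc⟩ := exq (1/(2*log (1/ϱ)))
  have hc0 : 0 ≤ c := by
    have : 0 < log (1/ϱ) := log_pos (by rw [lt_div_iff₀ h0]; linarith)
    rw [hc]; positivity
  rw [← hc] at hU hL ⊢
  obtain ⟨z, hz⟩ := exq (log (log (log 16)))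
  have h16 : exp 1 < log 16 := by
    rw [show §16 = 2^4 by norm_num, log_pow]; push_cast; linarith [log_two_gt_d9, exp_one_lt_d9]
  have hz1 : 1 < log (log 16) := by rwa [lt_log_iff_exp_lt (by linarith [exp_pos 1])]
  have hz0 : 0 < z := by rw [hz]; exact log_pos hz1
  obtain ⟨M, hM⟩ := exq (ee (Y1+Y2))
  have hM0 : 0 < M := by rw [hM]; exact exp_pos _
  obtain ⟨B, hB⟩ := exq ((2*M+26^4+M+c*(M/z)^2)/z)
  have hB0 : 0 < B := by rw [hB]; positivity
  have hBz : B*z = 2*M+26^4+M+c*(M/z)^2 := by rw [hB]; field_simp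
  refine ⟨A1+A2+B, li, fun k _ hk x hx => ?_⟩
  have hlx : log 16 ≤ log x := log_le_log nu hx
  have he1 : 1 < exp §1 := by linarith [exp_one_gt_d9]
  have hY : log (log 16) ≤ log (log x) := log_le_log li hlx
  have hl : z ≤ log (log (log x)) := by rw [hz]; exact log_le_log li hY
  unfold loglog logloglog
  obtain ⟨Y, hYd⟩ := exq (log (log x))
  rw [← hYd] at hY hl ⊢
  have hx0 : 0 < x := li
  have hq : 0 ≤ x/log x := div_nonneg hx0.le li
  have hBl : B*z ≤ B*log Y := mul_le_mul_of_nonneg_left hl hB0.le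
  have a1 : 0 ≤ A1*log Y := mul_nonneg hA1 li
  have a2 : 0 ≤ A2*log Y := mul_nonneg hA2 li
  have hBp : 0 ≤ B*z := po
  rcases le_or_gt (Y1+Y2) Y with h | h
  · constructor
    · refine le_trans (mul_le_mul_of_nonneg_left (exp_le_exp.mpr ?_) hq) (hL k x Y hk li hx0 li hYd)
      linarith
    · refine (hU k x Y hk li hx0 li hYd).trans (mul_le_mul_of_nonneg_left (exp_le_exp.mpr ?_) hq)
      linarith
  · have hxM : x ≤ M := by
      rw [hM, ee, ← log_le_iff_le_exp hx0, ← log_le_iff_le_exp li, ← hYd]; exact h.le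
    obtain ⟨d1, d2⟩ := DS_triv hk hx
    have hq1 : 1 ≤ x/log x := by rw [one_le_div li]; exact log_le_self hx0.le
    have hq2 : x/log x ≤ exp M := by
      refine (div_le_self hx0.le li).trans (hxM.trans ?_); linarith [add_one_le_exp M]
    have hYx : Y ≤ x := hYd ▸ (log_le_self li).trans (log_le_self hx0.le)
    have hY0 : 0 < Y := li
    have hr : log (Y/log Y) ≤ M/z := (log_le_self (div_pos hY0 li).le).trans (by gcongr; linarith)
    have hr0 : 0 ≤ log (Y/log Y) := log_nonneg (by rw [one_le_div li]; exact log_le_self hY0.le)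
    have hr2 : c*log (Y/log Y)^2 ≤ c*(M/z)^2 := by gcongr
    have hr3 : 0 ≤ c*log (Y/log Y)^2 := po
    have hr4 : 0 ≤ c*(M/z)^2 := hr3.trans hr2
    constructor
    · refine le_trans ?_ d1
      calc _ ≤ exp M*exp (-M) := by
            refine mul_le_mul hq2 (exp_le_exp.mpr ?_) (exp_pos _).le (exp_pos _).le
            linarith
        _ = 1 := by rw [← exp_add]; simp
    · refine d2.trans ?_
      calc 2*x+26^4 ≤ 1*exp (2*M+26^4) := by linarith [add_one_le_exp (2*M+26^4)]
        _ ≤ _ := by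
            refine mul_le_mul hq1 (exp_le_exp.mpr ?_) (exp_pos _).le hq
            linarith
end FT

/-- STATEMENT: value distribution of dim S_k^full(Γ₀(N)). -/
theorem dimension_count_full
    (ϱ : ℝ) (hϱ₀ : 0 < ϱ) (hϱ₁ : ϱ < 1)
    (hϱ : ∑' n : ℕ, fordA (n+1) * ϱ^(n+1) = 1) :
    ∃ A : ℝ, 0 < A ∧ ∀ k : ℕ, Even k → 2 ≤ k → ∀ x : ℝ, 16 ≤ x →
      x / Real.log x *
          Real.exp ((1/(2*Real.log (1/ϱ))) * (Real.log (loglog x / logloglog x))^2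
            - A * logloglog x)
        ≤ (Set.ncard {y : ℝ | ∃ N : ℕ, 1 ≤ N ∧ dFull k N = y ∧
            dFull k N ≤ ((k:ℝ)-1)/12 * x} : ℝ) ∧
      (Set.ncard {y : ℝ | ∃ N : ℕ, 1 ≤ N ∧ dFull k N = y ∧
            dFull k N ≤ ((k:ℝ)-1)/12 * x} : ℝ)
        ≤ x / Real.log x *
          Real.exp ((1/(2*Real.log (1/ϱ))) * (Real.log (loglog x / logloglog x))^2
            + A * logloglog x) := FT.fin ϱ hϱ₀ hϱ₁ hϱ
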